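/- Let Ω be a bounded domain in ℝ^N (N ≥ 2) which is of class C^{1,α} for some 0 < α ≤ 1 in a neighborhood of a boundary point y ∈ ∂Ω, let x₀ ∈ Ω, a > 0 and V ∈ 𝒱(Ω,a). Then y is finely regular with respect to V if and only if ∫_Ω (δ_Ω(x)² / |x − y|^N) V(x) dx < ∞. -/

import Mathlib

open MeasureTheory Metric Set Filter Topology
open scoped ENNReal NNReal

noncomputable section

namespace Anc

abbrev ES (N : ℕ) := EuclideanSpace ℝ (Fin N)

/-- `δ_Ω(x)`: the distance from `x` to the complement of `Ω`. -/
def dista {N : ℕ} (Ω : Set (ES N)) (x : ES N) : ℝ := infDist x Ωᶜ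

/-- Pointwise Laplacian (junk values where the derivatives do not exist). -/
def lap {N : ℕ} (u : ES N → ℝ) (x : ES N) : ℝ :=
  ∑ i : Fin N,
    fderiv ℝ (fun y => fderiv ℝ u y (EuclideanSpace.single i 1)) x (EuclideanSpace.single i 1)

/-- Smooth compactly supported test functions in `Ω`. -/
def IsTestFun {N : ℕ} (Ω : Set (ES N)) (φ : ES N → ℝ) : Prop :=
  ContDiff ℝ (⊤ : ℕ∞) φ ∧ IsCompact (tsupport φ) ∧ tsupport φ ⊆ Ω

/-- `u` is a continuous weak solution of `Δu - V·u = 0` in `Ω` (i.e. `L_V`-harmonic). -/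
def LVHarmonic {N : ℕ} (Ω : Set (ES N)) (V u : ES N → ℝ) : Prop :=
  ContinuousOn u Ω ∧ LocallyIntegrableOn u Ω ∧
    LocallyIntegrableOn (fun x => V x * u x) Ω ∧
    ∀ φ, IsTestFun Ω φ → ∫ x in Ω, u x * lap φ x = ∫ x in Ω, V x * u x * φ x

/-- `s` is `L_V`-superharmonic in `Ω` (weakly, `Δs - V·s ≤ 0`, `s` l.s.c.). -/
def LVSuperharmonic {N : ℕ} (Ω : Set (ES N)) (V s : ES N → ℝ) : Prop :=
  LowerSemicontinuousOn s Ω ∧ LocallyIntegrableOn s Ω ∧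
    LocallyIntegrableOn (fun x => V x * s x) Ω ∧
    ∀ φ, IsTestFun Ω φ → (∀ x, 0 ≤ φ x) →
      ∫ x in Ω, s x * lap φ x ≤ ∫ x in Ω, V x * s x * φ x

/-- The class `𝒱(Ω,a)` of nonnegative Borel potentials with `V(x) ≤ a/δ_Ω(x)²`. -/
def VClass {N : ℕ} (Ω : Set (ES N)) (a : ℝ) (V : ES N → ℝ) : Prop :=
  Measurable V ∧ ∀ x ∈ Ω, 0 ≤ V x ∧ V x * dista Ω x ^ 2 ≤ a

/-- Lipschitz domain: open, connected, and near every boundary point, after an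
orthogonal change of coordinates, the domain is the region above the graph of a
Lipschitz function. -/
def IsLipschitzDomain {N : ℕ} (Ω : Set (ES N)) : Prop :=
  IsOpen Ω ∧ IsConnected Ω ∧
    ∀ z ∈ frontier Ω, ∃ (g : ES N ≃ₗᵢ[ℝ] ES N) (i : Fin N) (f : ES N → ℝ)
      (L : ℝ≥0) (ε : ℝ), 0 < ε ∧ LipschitzWith L f ∧
      (∀ x w : ES N, (∀ j, j ≠ i → x j = w j) → f x = f w) ∧
      ∀ x ∈ ball z ε, (x ∈ Ω ↔ f (g x) < g x i)

/-- `Ω` has a `C^{1,α}` boundary near `y`. -/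
def IsC1AlphaNear {N : ℕ} (Ω : Set (ES N)) (α : ℝ) (y : ES N) : Prop :=
  ∃ (g : ES N ≃ₗᵢ[ℝ] ES N) (i : Fin N) (f : ES N → ℝ) (C : ℝ≥0) (ε : ℝ),
    0 < ε ∧ ContDiff ℝ 1 f ∧ HolderWith C α.toNNReal (fderiv ℝ f) ∧
    (∀ x w : ES N, (∀ j, j ≠ i → x j = w j) → f x = f w) ∧
    ∀ x ∈ ball y ε, (x ∈ Ω ↔ f (g x) < g x i)

/-- `K` is the `L_V`-Martin kernel of `Ω` with pole `y ∈ ∂Ω`, normalized at `x₀`: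
the unique positive `L_V`-harmonic function vanishing on `∂Ω ∖ {y}` with `K x₀ = 1`. -/
def IsMartinKernel {N : ℕ} (Ω : Set (ES N)) (V : ES N → ℝ) (x₀ y : ES N)
    (K : ES N → ℝ) : Prop :=
  LVHarmonic Ω V K ∧ (∀ x ∈ Ω, 0 < K x) ∧ K x₀ = 1 ∧
    ∀ z ∈ frontier Ω, z ≠ y → Tendsto K (𝓝[Ω] z) (𝓝 0)

/-- `G` is the `L_V`-Green function of `Ω` with pole `y ∈ Ω`:
positive, vanishing at the boundary, and `L_V G = -δ_y` weakly. -/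
def IsGreenFunction {N : ℕ} (Ω : Set (ES N)) (V : ES N → ℝ) (y : ES N)
    (G : ES N → ℝ) : Prop :=
  ContinuousOn G (Ω \ {y}) ∧ (∀ x ∈ Ω \ {y}, 0 < G x) ∧ LocallyIntegrableOn G Ω ∧
    (∀ z ∈ frontier Ω, Tendsto G (𝓝[Ω \ {y}] z) (𝓝 0)) ∧
    ∀ φ, IsTestFun Ω φ → ∫ x in Ω, G x * (lap φ x - V x * φ x) = -φ y

/-- `y ∈ ∂Ω` is finely regular w.r.t. `V`, `Ky` being the classical Martin kernel at
`y`: the greatest `L_V`-harmonic minorant of `Ky` is positive, equivalently `Ky`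
admits a positive `L_V`-harmonic minorant. -/
def FinelyRegular {N : ℕ} (Ω : Set (ES N)) (V Ky : ES N → ℝ) : Prop :=
  ∃ h, LVHarmonic Ω V h ∧ (∀ x ∈ Ω, 0 < h x) ∧ ∀ x ∈ Ω, h x ≤ Ky x

/-- `h` is the greatest nonnegative `L_V`-harmonic minorant of `w` in `Ω`. -/
def IsGreatestLVHarmMinorant {N : ℕ} (Ω : Set (ES N)) (V w h : ES N → ℝ) : Prop :=
  LVHarmonic Ω V h ∧ (∀ x ∈ Ω, 0 ≤ h x ∧ h x ≤ w x) ∧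
    ∀ g, LVHarmonic Ω V g → (∀ x ∈ Ω, 0 ≤ g x ∧ g x ≤ w x) → ∀ x ∈ Ω, g x ≤ h x

/-- Classical superharmonicity via the sub-mean value property. -/
def IsSuperharmonicOn {N : ℕ} (W : Set (ES N)) (s : ES N → ℝ) : Prop :=
  LowerSemicontinuousOn s W ∧ LocallyIntegrableOn s W ∧
    ∀ x ∈ W, ∀ t > (0:ℝ), closedBall x t ⊆ W → ⨍ z in ball x t, s z ≤ s x

/-- The réduite of `w` over `A` in `W`: infimum of the nonnegative superharmonic
functions in `W` dominating `w` on `A`. -/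
def reduite {N : ℕ} (W : Set (ES N)) (w : ES N → ℝ) (A : Set (ES N)) (x : ES N) : ℝ :=
  sInf {v | ∃ s : ES N → ℝ, IsSuperharmonicOn W s ∧ (∀ z ∈ W, 0 ≤ s z) ∧
    (∀ z ∈ A, w z ≤ s z) ∧ v = s x}

/-- The lower semicontinuous regularization `R̂` of the réduite. -/
def reduiteReg {N : ℕ} (W : Set (ES N)) (w : ES N → ℝ) (A : Set (ES N)) (x : ES N) : ℝ :=
  liminf (reduite W w A) (𝓝[W] x)

/-- Nontangential approach region at `y` with aperture `κ`. -/
def ntRegion {N : ℕ} (Ω : Set (ES N)) (y : ES N) (κ : ℝ) : Set (ES N) :=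
  {x | x ∈ Ω ∧ dist x y ≤ κ * dista Ω x}

/-- `g` tends to `l` nontangentially at `y`. -/
def TendstoNT {N : ℕ} (Ω : Set (ES N)) (g : ES N → ℝ) (y : ES N) (l : Filter ℝ) : Prop :=
  ∀ κ > (0:ℝ), Tendsto g (𝓝[ntRegion Ω y κ] y) l

/-- Truncated cone `{y + t(ν+v) : 0 < t ≤ η, ‖v‖ ≤ η}` with vertex `y`. -/
def truncCone {N : ℕ} (y ν : ES N) (η : ℝ) : Set (ES N) :=
  {x | ∃ (t : ℝ) (v : ES N), 0 < t ∧ t ≤ η ∧ ‖v‖ ≤ η ∧ x = y + t • (ν + v)}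

/-- Last coordinate of a point of `ℝ^{n+1}`. -/
def lastC {n : ℕ} (x : ES (n + 1)) : ℝ := x (Fin.last n)

/-- First `n` coordinates of a point of `ℝ^{n+1}`. -/
def firstC {n : ℕ} (x : ES (n + 1)) : ES n :=
  (EuclideanSpace.equiv (Fin n) ℝ).symm fun i => x i.castSucc

/-- The region `U_f(r,ρ) = {(x',x_N) : |x'| < r, f(x') < x_N < ρ}`. -/
def Ucyl {n : ℕ} (f : ES n → ℝ) (r ρ : ℝ) : Set (ES (n + 1)) :=
  {x | ‖firstC x‖ < r ∧ f (firstC x) < lastC x ∧ lastC x < ρ}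

/-- The cylinder `T(t) = B_{N-1}(0,tr) × (-tρ, tρ)`. -/
def Tcyl (n : ℕ) (r ρ t : ℝ) : Set (ES (n + 1)) :=
  {x | ‖firstC x‖ < t * r ∧ |lastC x| < t * ρ}

/-- The graph part `∂_#U` of the boundary of `U_f(r,ρ)`. -/
def graphBdry {n : ℕ} (f : ES n → ℝ) (r ρ : ℝ) : Set (ES (n + 1)) :=
  frontier (Ucyl f r ρ) ∩ {x | ‖firstC x‖ < r ∧ lastC x = f (firstC x)}

section
/-! ### Jets -/

lemma two_le_top : (2 : WithTop ℕ∞) ≤ ((⊤ : ℕ∞) : WithTop ℕ∞) := by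
  have h : (2 : ℕ∞) ≤ ⊤ := le_top
  exact WithTop.coe_le_coe.2 h


def ee {N : ℕ} (i : Fin N) : ES N := EuclideanSpace.single i 1

lemma lap_def' {N : ℕ} (u : ES N → ℝ) (x : ES N) :
    lap u x = ∑ i : Fin N, fderiv ℝ (fun y => fderiv ℝ u y (ee i)) x (ee i) := rfl

lemma inner_ee {N : ℕ} (g : ES N) (i : Fin N) : inner ℝ g (ee i) = g i := by
  simp [ee, EuclideanSpace.inner_single_right]

lemma sum_inner_ee {N : ℕ} (g k : ES N) :
    ∑ i : Fin N, inner ℝ g (ee i) * inner ℝ k (ee i) = inner ℝ g k := by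
  simp only [inner_ee]
  rw [PiLp.inner_apply]
  refine Finset.sum_congr rfl fun i _ => ?_
  simp [mul_comm]

lemma lap_congr {N : ℕ} {u v : ES N → ℝ} {x : ES N} (h : u =ᶠ[𝓝 x] v) : lap u x = lap v x := by
  rw [lap_def', lap_def']
  refine Finset.sum_congr rfl fun i _ => ?_
  have : (fun y => fderiv ℝ u y (ee i)) =ᶠ[𝓝 x] (fun y => fderiv ℝ v y (ee i)) := by
    filter_upwards [h.eventuallyEq_nhds] with y hy
    rw [hy.fderiv_eq]
  rw [this.fderiv_eq]

def J {N : ℕ} (u : ES N → ℝ) (x : ES N) (g : ES N) (l : ℝ) : Prop :=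
  ContDiffAt ℝ 2 u x ∧ (∀ v, fderiv ℝ u x v = inner ℝ g v) ∧ lap u x = l

lemma J.congr {N : ℕ} {u v : ES N → ℝ} {x g : ES N} {l : ℝ} (h : J u x g l) (e : v =ᶠ[𝓝 x] u) :
    J v x g l :=
  ⟨h.1.congr_of_eventuallyEq e, fun w => by rw [e.fderiv_eq, h.2.1], by rw [lap_congr e, h.2.2]⟩

lemma J.of_eq {N : ℕ} {u : ES N → ℝ} {x g g' : ES N} {l l' : ℝ} (h : J u x g l) (hg : g = g')
    (hl : l = l') : J u x g' l' := by subst hg hl; exact h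

lemma ev_diff {N : ℕ} {u : ES N → ℝ} {x : ES N} (h : ContDiffAt ℝ 2 u x) :
    ∀ᶠ y in 𝓝 x, DifferentiableAt ℝ u y := by
  filter_upwards [h.eventually (by simp)] with y hy
  exact hy.differentiableAt (by norm_num)

lemma diff_fderiv {N : ℕ} {u : ES N → ℝ} {x : ES N} (h : ContDiffAt ℝ 2 u x) (v : ES N) :
    DifferentiableAt ℝ (fun y => fderiv ℝ u y v) x := by
  have h1 : ContDiffAt ℝ 1 (fderiv ℝ u) x := h.fderiv_right (by norm_num)
  exact (h1.differentiableAt (by norm_num)).clm_apply (differentiableAt_const v)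

lemma exists_J {N : ℕ} {u : ES N → ℝ} {x : ES N} (h : ContDiffAt ℝ 2 u x) :
    J u x (gradient u x) (lap u x) := by
  refine ⟨h, fun v => ?_, rfl⟩
  simp [gradient]

lemma J_const {N : ℕ} (c : ℝ) (x : ES N) : J (fun _ => c) x 0 0 := by
  refine ⟨contDiffAt_const, fun v => by simp, by simp [lap_def']⟩

lemma J_lin {N : ℕ} (ν p x : ES N) : J (fun z => inner ℝ ν (z - p)) x ν 0 := by
  have h1 : ∀ y, HasFDerivAt (fun z => inner ℝ ν (z - p)) (innerSL ℝ ν) y := by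
    intro y
    have := ((innerSL ℝ ν).hasFDerivAt (x := y - p)).comp y ((hasFDerivAt_id y).sub_const p)
    simpa [Function.comp_def] using this
  refine ⟨?_, fun v => by rw [(h1 x).fderiv]; rfl, ?_⟩
  · exact contDiffAt_const.inner ℝ (contDiffAt_id.sub contDiffAt_const)
  · rw [lap_def']
    refine Finset.sum_eq_zero fun i _ => ?_
    have : (fun y => fderiv ℝ (fun z => inner ℝ ν (z - p)) y (ee i)) = fun _ => inner ℝ ν (ee i) := by
      funext y; rw [(h1 y).fderiv]; rfl
    rw [this]; simp

lemma J_sq {N : ℕ} (p x : ES N) : J (fun z => ‖z - p‖ ^ 2) x ((2:ℝ) • (x - p)) (2 * N) := by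
  have h1 : ∀ y, HasFDerivAt (fun z : ES N => ‖z - p‖ ^ 2) ((2:ℝ) • innerSL ℝ (y - p)) y := by
    intro y
    have := ((hasFDerivAt_id y).sub_const p).norm_sq
    have e : (2:ℝ) • innerSL ℝ (y - p) = 2 • (innerSL ℝ (id y - p)).comp (ContinuousLinearMap.id ℝ (ES N)) := by
      ext w; simp
    rw [e]; exact this
  refine ⟨?_, fun v => ?_, ?_⟩
  · exact (contDiffAt_id.sub contDiffAt_const).norm_sq ℝ
  · rw [(h1 x).fderiv]; simp [inner_smul_left, inner_sub_left]
  · rw [lap_def']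
    have : ∀ i : Fin N, fderiv ℝ (fun y => fderiv ℝ (fun z : ES N => ‖z - p‖ ^ 2) y (ee i)) x (ee i) = 2 := by
      intro i
      have : (fun y => fderiv ℝ (fun z : ES N => ‖z - p‖ ^ 2) y (ee i)) =
          fun y => 2 * inner ℝ (ee i) (y - p) := by
        funext y; rw [(h1 y).fderiv]; simp [inner_sub_right, real_inner_comm]
      rw [this, fderiv_const_mul, ]
      · have := (J_lin (ee i) p x).2.1 (ee i)
        simp only [_root_.smul_apply, smul_eq_mul, this]
        simp [ee]
      · exact (J_lin (ee i) p x).1.differentiableAt (by norm_num)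
    simp [this, mul_comm]

lemma J.add {N : ℕ} {u v : ES N → ℝ} {x g k : ES N} {l m : ℝ} (hu : J u x g l) (hv : J v x k m) :
    J (fun z => u z + v z) x (g + k) (l + m) := by
  refine ⟨hu.1.add hv.1, fun w => ?_, ?_⟩
  · rw [fderiv_fun_add (hu.1.differentiableAt (by norm_num)) (hv.1.differentiableAt (by norm_num))]
    simp [hu.2.1, hv.2.1, inner_add_left]
  · rw [← hu.2.2, ← hv.2.2, lap_def', lap_def', lap_def', ← Finset.sum_add_distrib]
    refine Finset.sum_congr rfl fun i _ => ?_
    have : (fun y => fderiv ℝ (fun z => u z + v z) y (ee i)) =ᶠ[𝓝 x]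
        fun y => fderiv ℝ u y (ee i) + fderiv ℝ v y (ee i) := by
      filter_upwards [ev_diff hu.1, ev_diff hv.1] with y h1 h2
      rw [fderiv_fun_add h1 h2]; rfl
    rw [this.fderiv_eq, fderiv_fun_add (diff_fderiv hu.1 _) (diff_fderiv hv.1 _)]; rfl

lemma J.mul {N : ℕ} {u v : ES N → ℝ} {x g k : ES N} {l m : ℝ} (hu : J u x g l) (hv : J v x k m) :
    J (fun z => u z * v z) x (u x • k + v x • g) (u x * m + v x * l + 2 * inner ℝ g k) := by
  have du := hu.1.differentiableAt (by norm_num)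
  have dv := hv.1.differentiableAt (by norm_num)
  refine ⟨hu.1.mul hv.1, fun w => ?_, ?_⟩
  · rw [fderiv_fun_mul du dv]
    simp [hu.2.1, hv.2.1, inner_add_left, inner_smul_left]
  · rw [← hu.2.2, ← hv.2.2, ← sum_inner_ee, lap_def', lap_def', lap_def', Finset.mul_sum,
      Finset.mul_sum, Finset.mul_sum, ← Finset.sum_add_distrib, ← Finset.sum_add_distrib]
    refine Finset.sum_congr rfl fun i _ => ?_
    have : (fun y => fderiv ℝ (fun z => u z * v z) y (ee i)) =ᶠ[𝓝 x]
        fun y => u y * fderiv ℝ v y (ee i) + v y * fderiv ℝ u y (ee i) := by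
      filter_upwards [ev_diff hu.1, ev_diff hv.1] with y h1 h2
      rw [fderiv_fun_mul h1 h2]; simp
    rw [this.fderiv_eq, fderiv_fun_add (du.fun_mul (diff_fderiv hv.1 _)) (dv.fun_mul (diff_fderiv hu.1 _)),
      fderiv_fun_mul du (diff_fderiv hv.1 _), fderiv_fun_mul dv (diff_fderiv hu.1 _)]
    simp only [_root_.add_apply, _root_.smul_apply, smul_eq_mul,
      hu.2.1, hv.2.1]
    ring

lemma J.cmul {N : ℕ} {u : ES N → ℝ} {x g : ES N} {l : ℝ} (c : ℝ) (hu : J u x g l) :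
    J (fun z => c * u z) x (c • g) (c * l) :=
  ((J_const c x).mul hu).of_eq (by simp) (by simp)

lemma J.neg {N : ℕ} {u : ES N → ℝ} {x g : ES N} {l : ℝ} (hu : J u x g l) :
    J (fun z => - u z) x (- g) (- l) :=
  ((hu.cmul (-1)).of_eq (by simp) (by simp)).congr (Eventually.of_forall fun z => by simp)

lemma J.sub {N : ℕ} {u v : ES N → ℝ} {x g k : ES N} {l m : ℝ} (hu : J u x g l) (hv : J v x k m) :
    J (fun z => u z - v z) x (g - k) (l - m) :=
  ((hu.add hv.neg).of_eq (by rw [sub_eq_add_neg]) (by ring)).congr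
    (Eventually.of_forall fun z => by simp [sub_eq_add_neg])

lemma J.comp {N : ℕ} {u : ES N → ℝ} {x g : ES N} {l : ℝ} {φ : ℝ → ℝ} {a b : ℝ}
    (hu : J u x g l) (hφ : ContDiffAt ℝ 2 φ (u x)) (ha : deriv φ (u x) = a)
    (hb : deriv (deriv φ) (u x) = b) :
    J (fun z => φ (u z)) x (a • g) (a * l + b * ‖g‖ ^ 2) := by
  have du := hu.1.differentiableAt (by norm_num)
  have key : ∀ y, DifferentiableAt ℝ u y → DifferentiableAt ℝ φ (u y) → ∀ w,
      fderiv ℝ (fun z => φ (u z)) y w = deriv φ (u y) * fderiv ℝ u y w := by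
    intro y h1 h2 w
    have := (h2.hasDerivAt.comp_hasFDerivAt y h1.hasFDerivAt).fderiv
    have e : (φ ∘ u) = fun z => φ (u z) := rfl
    rw [e] at this
    rw [this]; simp
  have hd2 : DifferentiableAt ℝ (deriv φ) (u x) := by
    have h1 : ContDiffAt ℝ 1 (fderiv ℝ φ) (u x) := hφ.fderiv_right (by norm_num)
    exact (h1.differentiableAt (by norm_num)).clm_apply (differentiableAt_const (1:ℝ))
  refine ⟨hφ.comp x hu.1, fun w => ?_, ?_⟩
  · rw [key x du (hφ.differentiableAt (by norm_num)), ha, hu.2.1, inner_smul_left]; simp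
  · rw [← hu.2.2, ← real_inner_self_eq_norm_sq, ← sum_inner_ee, lap_def', lap_def', Finset.mul_sum,
      Finset.mul_sum, ← Finset.sum_add_distrib]
    refine Finset.sum_congr rfl fun i _ => ?_
    have hev : ∀ᶠ y in 𝓝 x, DifferentiableAt ℝ φ (u y) := by
      have h3 : ∀ᶠ t in 𝓝 (u x), DifferentiableAt ℝ φ t := by
        filter_upwards [hφ.eventually (by simp)] with t ht
        exact ht.differentiableAt (by norm_num)
      exact hu.1.continuousAt.eventually h3
    have : (fun y => fderiv ℝ (fun z => φ (u z)) y (ee i)) =ᶠ[𝓝 x]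
        fun y => deriv φ (u y) * fderiv ℝ u y (ee i) := by
      filter_upwards [ev_diff hu.1, hev] with y h1 h2
      exact key y h1 h2 _
    have hc : DifferentiableAt ℝ (fun y => deriv φ (u y)) x := hd2.comp x du
    rw [this.fderiv_eq, fderiv_fun_mul hc (diff_fderiv hu.1 _)]
    have h4 : fderiv ℝ (fun y => deriv φ (u y)) x (ee i) = deriv (deriv φ) (u x) * fderiv ℝ u x (ee i) := by
      have := (hd2.hasDerivAt.comp_hasFDerivAt x du.hasFDerivAt).fderiv
      have e : (deriv φ ∘ u) = fun z => deriv φ (u z) := rfl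
      rw [e] at this
      rw [this]; simp
    simp only [_root_.add_apply, _root_.smul_apply, smul_eq_mul, h4, ha, hb,
      hu.2.1]
    ring

/-! ### lap regularity -/

lemma lap_contDiff {N : ℕ} {u : ES N → ℝ} (hu : ContDiff ℝ (⊤ : ℕ∞) u) :
    ContDiff ℝ (⊤ : ℕ∞) (lap u) := by
  have : lap u = fun x => ∑ i : Fin N, fderiv ℝ (fun y => fderiv ℝ u y (ee i)) x (ee i) := by
    funext x; rfl
  rw [this]
  refine ContDiff.sum fun i _ => ?_
  have h1 : ContDiff ℝ (⊤ : ℕ∞) (fun y => fderiv ℝ u y (ee i)) :=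
    (hu.fderiv_right (m := (⊤ : ℕ∞)) (by simp)).clm_apply contDiff_const
  exact (h1.fderiv_right (m := (⊤ : ℕ∞)) (by simp)).clm_apply contDiff_const

lemma lap_continuousAt {N : ℕ} {u : ES N → ℝ} {x : ES N} (hu : ContDiffAt ℝ 2 u x) :
    ContinuousAt (lap u) x := by
  have : lap u = fun x => ∑ i : Fin N, fderiv ℝ (fun y => fderiv ℝ u y (ee i)) x (ee i) := by
    funext x; rfl
  rw [this]
  refine tendsto_finsetSum _ fun i _ => ?_
  have h1 : ContDiffAt ℝ 1 (fun y => fderiv ℝ u y (ee i)) x :=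
    (hu.fderiv_right (m := 1) (by norm_num)).clm_apply contDiffAt_const
  exact ((h1.fderiv_right (m := 0) (by norm_num)).clm_apply contDiffAt_const).continuousAt

lemma lap_continuous {N : ℕ} {u : ES N → ℝ} (hu : ContDiff ℝ 2 u) : Continuous (lap u) :=
  continuous_iff_continuousAt.2 fun _ => lap_continuousAt hu.contDiffAt

lemma lap_eq_zero_of_notMem {N : ℕ} {u : ES N → ℝ} {x : ES N} (hx : x ∉ tsupport u) :
    lap u x = 0 := by
  have : u =ᶠ[𝓝 x] fun _ => 0 := notMem_tsupport_iff_eventuallyEq.1 hx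
  rw [lap_congr this]; exact (J_const 0 x).2.2

lemma tsupport_lap_subset {N : ℕ} (u : ES N → ℝ) : tsupport (lap u) ⊆ tsupport u := by
  refine closure_minimal (fun x hx => ?_) (isClosed_tsupport u)
  by_contra h
  exact hx (lap_eq_zero_of_notMem h)

/-! ### Green -/

lemma int_fderiv_zero {N : ℕ} {u : ES N → ℝ} (hu : ContDiff ℝ 1 u) (hc : HasCompactSupport u)
    (v : ES N) : ∫ x, fderiv ℝ u x v = 0 := by
  have := integral_mul_fderiv_eq_neg_fderiv_mul_of_integrable (𝕜 := ℝ) (μ := (volume : Measure (ES N)))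
    (f := fun _ => (1:ℝ)) (g := u) (v := v) (by simp) ?_ ?_ (by fun_prop)
    (fun x _ => hu.differentiable (by norm_num) x)
  · simpa using this
  · simp only [one_mul]
    refine Continuous.integrable_of_hasCompactSupport ?_ ?_
    · exact (hu.continuous_fderiv (by norm_num)).clm_apply continuous_const
    · exact (hc.fderiv ℝ).comp_left (g := fun (L : ES N →L[ℝ] ℝ) => L v) (by simp)
  · simpa using hu.continuous.integrable_of_hasCompactSupport hc

lemma green_half {N : ℕ} {u v : ES N → ℝ} (hu : ContDiff ℝ 2 u) (hv : ContDiff ℝ 2 v)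
    (hc : HasCompactSupport v) :
    ∫ x, (u x * lap v x - v x * lap u x) = 0 := by
  have e : ∀ x, u x * lap v x - v x * lap u x = ∑ i : Fin N,
      fderiv ℝ (fun y => u y * fderiv ℝ v y (ee i) - v y * fderiv ℝ u y (ee i)) x (ee i) := by
    intro x
    rw [lap_def', lap_def', Finset.mul_sum, Finset.mul_sum, ← Finset.sum_sub_distrib]
    refine Finset.sum_congr rfl fun i _ => ?_
    have du := (hu.differentiable (by norm_num)) x
    have dv := (hv.differentiable (by norm_num)) x
    have d2u := diff_fderiv hu.contDiffAt (x := x) (ee i)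
    have d2v := diff_fderiv hv.contDiffAt (x := x) (ee i)
    rw [fderiv_fun_sub (du.fun_mul d2v) (dv.fun_mul d2u), fderiv_fun_mul du d2v, fderiv_fun_mul dv d2u]
    simp only [_root_.add_apply, _root_.smul_apply, smul_eq_mul,
      _root_.sub_apply]
    ring
  have hu1 : ∀ i : Fin N, ContDiff ℝ 1 (fun y => fderiv ℝ u y (ee i)) := fun i =>
    (hu.fderiv_right (m := 1) (by norm_num)).clm_apply contDiff_const
  have hv1 : ∀ i : Fin N, ContDiff ℝ 1 (fun y => fderiv ℝ v y (ee i)) := fun i =>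
    (hv.fderiv_right (m := 1) (by norm_num)).clm_apply contDiff_const
  have h1 : ∀ i : Fin N, ContDiff ℝ 1
      (fun y => u y * fderiv ℝ v y (ee i) - v y * fderiv ℝ u y (ee i)) := fun i =>
    ((hu.of_le (by norm_num)).mul (hv1 i)).sub ((hv.of_le (by norm_num)).mul (hu1 i))
  have h2 : ∀ i : Fin N, HasCompactSupport
      (fun y => u y * fderiv ℝ v y (ee i) - v y * fderiv ℝ u y (ee i)) := by
    intro i
    have a1 : HasCompactSupport (fun y => fderiv ℝ v y (ee i)) :=
      (hc.fderiv ℝ).comp_left (g := fun (L : ES N →L[ℝ] ℝ) => L (ee i)) (by simp)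
    have a2 : HasCompactSupport (fun y => u y * fderiv ℝ v y (ee i)) := a1.mul_left
    have a3 : HasCompactSupport (fun y => v y * fderiv ℝ u y (ee i)) := hc.mul_right
    exact a2.sub a3
  simp_rw [e]
  rw [integral_finsetSum]
  · exact Finset.sum_eq_zero fun i _ => int_fderiv_zero (h1 i) (h2 i) _
  · intro i _
    refine Continuous.integrable_of_hasCompactSupport ?_ ?_
    · exact ((h1 i).continuous_fderiv (by norm_num)).clm_apply continuous_const
    · exact ((h2 i).fderiv ℝ).comp_left (g := fun (L : ES N →L[ℝ] ℝ) => L (ee i)) (by simp)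

lemma hcs_lap {N : ℕ} {v : ES N → ℝ} (hc : HasCompactSupport v) : HasCompactSupport (lap v) :=
  hc.of_isClosed_subset (isClosed_tsupport _) (tsupport_lap_subset v)

lemma green {N : ℕ} {u v : ES N → ℝ} (hu : ContDiff ℝ 2 u) (hv : ContDiff ℝ 2 v)
    (hc : HasCompactSupport v) :
    ∫ x, u x * lap v x = ∫ x, v x * lap u x := by
  have := green_half hu hv hc
  rw [integral_sub] at this
  · linarith
  · exact (hu.continuous.mul (lap_continuous hv)).integrable_of_hasCompactSupport (hcs_lap hc).mul_left
  · exact (hv.continuous.mul (lap_continuous hu)).integrable_of_hasCompactSupport hc.mul_right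

/-- cutoff: 1 near a compact set, supported in an open set -/
lemma exists_cutoff {N : ℕ} {S U : Set (ES N)} (hS : IsCompact S) (hU : IsOpen U) (h : S ⊆ U) :
    ∃ η : ES N → ℝ, ContDiff ℝ (⊤ : ℕ∞) η ∧ HasCompactSupport η ∧ tsupport η ⊆ U ∧
      (∀ x, 0 ≤ η x ∧ η x ≤ 1) ∧ ∀ᶠ x in 𝓝ˢ S, η x = 1 := by
  obtain ⟨S1, hS1, h1, h2⟩ := exists_compact_between hS hU h
  obtain ⟨S2, hS2, h3, h4⟩ := exists_compact_between hS1 hU h2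
  obtain ⟨f, hf, hr, hz, ho⟩ := exists_contMDiff_zero_iff_one_iff_of_isClosed
    (modelWithCornersSelf ℝ (ES N)) (n := (⊤ : ℕ∞)) (s := (interior S2)ᶜ) (t := S1)
    isOpen_interior.isClosed_compl hS1.isClosed
    (Set.disjoint_left.2 fun x hx hx1 => hx (h3 hx1))
  have hsub : tsupport f ⊆ S2 := by
    refine closure_minimal (fun x hx => ?_) hS2.isClosed
    by_contra hc
    exact hx ((hz x).1 fun hi => hc (interior_subset hi))
  refine ⟨f, contMDiff_iff_contDiff.1 hf, hS2.of_isClosed_subset (isClosed_tsupport _) hsub,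
    hsub.trans h4, fun x => ?_, ?_⟩
  · have := hr ⟨x, rfl⟩
    exact this
  · have : interior S1 ∈ 𝓝ˢ S := isOpen_interior.mem_nhdsSet.2 h1
    filter_upwards [this] with x hx
    exact (ho x).1 (interior_subset hx)

lemma green_loc {N : ℕ} {u v : ES N → ℝ} (hv : ContDiff ℝ 2 v)
    (hc : HasCompactSupport v) (hu : ∀ x ∈ tsupport v, ContDiffAt ℝ 2 u x) :
    ∫ x, u x * lap v x = ∫ x, v x * lap u x := by
  have hU : IsOpen {x | ContDiffAt ℝ 2 u x} := by
    rw [isOpen_iff_mem_nhds]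
    intro x hx
    exact ContDiffAt.eventually (n := 2) hx (by simp)
  obtain ⟨η, h1, h2, h3, h4, h5⟩ := exists_cutoff (S := tsupport v) hc hU hu
  have hηu : ContDiff ℝ 2 (fun x => η x * u x) := by
    rw [contDiff_iff_contDiffAt]
    intro x
    by_cases hx : x ∈ tsupport η
    · exact (h1.of_le two_le_top).contDiffAt.mul (h3 hx)
    · have : (fun x => η x * u x) =ᶠ[𝓝 x] fun _ => 0 := by
        filter_upwards [notMem_tsupport_iff_eventuallyEq.1 hx] with z hz
        simp [hz]
      exact contDiffAt_const.congr_of_eventuallyEq this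
  have := green hηu hv hc
  have e1 : ∀ x, η x * u x * lap v x = u x * lap v x := by
    intro x
    by_cases hx : x ∈ tsupport v
    · rw [h5.self_of_nhdsSet x hx]; ring
    · rw [lap_eq_zero_of_notMem hx]; ring
  have e2 : ∀ x, v x * lap (fun x => η x * u x) x = v x * lap u x := by
    intro x
    by_cases hx : x ∈ tsupport v
    · have : (fun x => η x * u x) =ᶠ[𝓝 x] u := by
        have : ∀ᶠ z in 𝓝 x, η z = 1 := h5.filter_mono (nhds_le_nhdsSet hx)
        filter_upwards [this] with z hz
        simp [hz]
      rw [lap_congr this]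
    · rw [image_eq_zero_of_notMem_tsupport hx]; ring
  simp_rw [e1, e2] at this
  exact this
end

section
/-! ### Mollifier -/

def Q0 (u : ℝ) : ℝ := expNegInvGlue (1 - u)
def F0 (u : ℝ) : ℝ := 2 * ((1 - u)⁻¹) ^ 2 * expNegInvGlue (1 - u)

lemma Q0_contDiff : ContDiff ℝ (⊤ : ℕ∞) Q0 :=
  expNegInvGlue.contDiff.comp (contDiff_const.sub contDiff_id)

lemma F0_contDiff : ContDiff ℝ (⊤ : ℕ∞) F0 := by
  have h := expNegInvGlue.contDiff_polynomial_eval_inv_mul (n := (⊤ : ℕ∞))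
    (Polynomial.C 2 * Polynomial.X ^ 2)
  have := h.comp (contDiff_const.sub contDiff_id : ContDiff ℝ (⊤ : ℕ∞) (fun u : ℝ => 1 - u))
  have e : F0 = (fun x => Polynomial.eval x⁻¹ (Polynomial.C 2 * Polynomial.X ^ 2) * expNegInvGlue x) ∘
      fun u : ℝ => 1 - u := by
    funext u; simp [F0]
  rw [e]; exact this

lemma Q0_deriv (u : ℝ) : HasDerivAt Q0 (-(F0 u / 2)) u := by
  have h := expNegInvGlue.hasDerivAt_polynomial_eval_inv_mul 1 (1 - u)
  simp only [Polynomial.eval_one, one_mul, Polynomial.derivative_one, sub_zero, mul_one,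
    Polynomial.eval_pow, Polynomial.eval_X] at h
  have := h.comp u ((hasDerivAt_const u (1:ℝ)).sub (hasDerivAt_id u))
  refine this.congr_deriv ?_
  unfold F0; ring

lemma Q0_nonneg (u : ℝ) : 0 ≤ Q0 u := expNegInvGlue.nonneg _
lemma F0_nonneg (u : ℝ) : 0 ≤ F0 u := by
  have := expNegInvGlue.nonneg (1 - u); unfold F0; positivity
lemma Q0_zero {u : ℝ} (h : 1 ≤ u) : Q0 u = 0 := expNegInvGlue.zero_of_nonpos (by linarith)
lemma F0_zero {u : ℝ} (h : 1 ≤ u) : F0 u = 0 := by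
  unfold F0; rw [expNegInvGlue.zero_of_nonpos (by linarith)]; simp
lemma F0_pos {u : ℝ} (h : u < 1) : 0 < F0 u := by
  have := expNegInvGlue.pos_of_pos (show 0 < 1 - u by linarith)
  have h2 : 0 < (1 - u)⁻¹ := inv_pos.2 (by linarith)
  unfold F0; positivity
lemma Q0_le {u : ℝ} (h : 0 ≤ u) : Q0 u ≤ F0 u / 2 := by
  rcases le_or_gt 1 u with h1 | h1
  · rw [Q0_zero h1, F0_zero h1]; simp
  · unfold Q0 F0
    have := expNegInvGlue.nonneg (1 - u)
    have h2 : 1 ≤ (1 - u)⁻¹ := (one_le_inv₀ (by linarith)).2 (by linarith)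
    have h3 : 1 ≤ ((1 - u)⁻¹) ^ 2 := one_le_pow₀ h2
    nlinarith

lemma exists_F0_max : ∃ C : ℝ, 0 < C ∧ ∀ u, 0 ≤ u → F0 u ≤ C := by
  obtain ⟨C, hC⟩ := (isCompact_Icc (a := (0:ℝ)) (b := 1)).exists_bound_of_continuousOn
    F0_contDiff.continuous.continuousOn
  refine ⟨max C 1, by positivity, fun u hu => ?_⟩
  rcases le_or_gt u 1 with h | h
  · exact ((le_abs_self _).trans (hC u ⟨hu, h⟩)).trans (le_max_left _ _)
  · rw [F0_zero h.le]; positivity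

lemma exists_F0_min {θ : ℝ} (h0 : 0 ≤ θ) (hθ : θ < 1) : ∃ c : ℝ, 0 < c ∧ ∀ u, 0 ≤ u → u ≤ θ → c ≤ F0 u := by
  obtain ⟨v, hv, hm⟩ := (isCompact_Icc (a := (0:ℝ)) (b := θ)).exists_isMinOn
    ⟨0, by simp [h0]⟩ F0_contDiff.continuous.continuousOn
  exact ⟨F0 v, F0_pos (by linarith [hv.2]), fun u h1 h2 => hm ⟨h1, h2⟩⟩

def Zc (N : ℕ) : ℝ := ∫ w : ES N, F0 (‖w‖ ^ 2)

def psi {N : ℕ} (s : ℝ) (x z : ES N) : ℝ := (s ^ N)⁻¹ * (Zc N)⁻¹ * F0 (‖z - x‖ ^ 2 / s ^ 2)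
def qs {N : ℕ} (s : ℝ) (x z : ES N) : ℝ := (s ^ N)⁻¹ * (Zc N)⁻¹ * Q0 (‖z - x‖ ^ 2 / s ^ 2)

lemma F0sq_cont (N : ℕ) : Continuous fun w : ES N => F0 (‖w‖ ^ 2) :=
  F0_contDiff.continuous.comp (continuous_norm.pow 2)

lemma F0sq_supp (N : ℕ) : HasCompactSupport fun w : ES N => F0 (‖w‖ ^ 2) := by
  refine HasCompactSupport.intro (isCompact_closedBall (0 : ES N) 1) fun w hw => ?_
  refine F0_zero ?_
  have : 1 < ‖w‖ := by simpa using hw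
  nlinarith

lemma Zc_pos (N : ℕ) : 0 < Zc N := by
  refine Continuous.integral_pos_of_hasCompactSupport_nonneg_nonzero (x := 0) (F0sq_cont N) (F0sq_supp N)
    (fun w => F0_nonneg _) ?_
  exact (F0_pos (by simp)).ne'

lemma psi_contDiff {N : ℕ} (s : ℝ) (x : ES N) : ContDiff ℝ (⊤ : ℕ∞) (psi s x) :=
  contDiff_const.mul (F0_contDiff.comp (((contDiff_id.sub contDiff_const).norm_sq ℝ).div_const _))
lemma qs_contDiff {N : ℕ} (s : ℝ) (x : ES N) : ContDiff ℝ (⊤ : ℕ∞) (qs s x) :=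
  contDiff_const.mul (Q0_contDiff.comp (((contDiff_id.sub contDiff_const).norm_sq ℝ).div_const _))

lemma psi_nonneg {N : ℕ} {s : ℝ} (hs : 0 < s) (x z : ES N) : 0 ≤ psi s x z := by
  have := Zc_pos N; have := F0_nonneg (‖z - x‖ ^ 2 / s ^ 2); unfold psi; positivity
lemma qs_nonneg {N : ℕ} {s : ℝ} (hs : 0 < s) (x z : ES N) : 0 ≤ qs s x z := by
  have := Zc_pos N; have := Q0_nonneg (‖z - x‖ ^ 2 / s ^ 2); unfold qs; positivity
lemma qs_le {N : ℕ} {s : ℝ} (hs : 0 < s) (x z : ES N) : qs s x z ≤ psi s x z / 2 := by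
  have := Zc_pos N
  have h := Q0_le (u := ‖z - x‖ ^ 2 / s ^ 2) (by positivity)
  unfold qs psi
  rw [mul_div_assoc]
  exact mul_le_mul_of_nonneg_left h (by positivity)

lemma one_le_of_far {N : ℕ} {s : ℝ} (hs : 0 < s) {x z : ES N} (h : s ≤ dist z x) :
    1 ≤ ‖z - x‖ ^ 2 / s ^ 2 := by
  rw [one_le_div (by positivity), ← dist_eq_norm]
  exact pow_le_pow_left₀ hs.le h 2
lemma psi_zero {N : ℕ} {s : ℝ} (hs : 0 < s) {x z : ES N} (h : s ≤ dist z x) : psi s x z = 0 := by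
  unfold psi; rw [F0_zero (one_le_of_far hs h), mul_zero]
lemma qs_zero {N : ℕ} {s : ℝ} (hs : 0 < s) {x z : ES N} (h : s ≤ dist z x) : qs s x z = 0 := by
  unfold qs; rw [Q0_zero (one_le_of_far hs h), mul_zero]
lemma psi_tsupport {N : ℕ} {s : ℝ} (hs : 0 < s) (x : ES N) : tsupport (psi s x) ⊆ closedBall x s := by
  refine closure_minimal (fun z hz => ?_) isClosed_closedBall
  by_contra hc
  exact hz (psi_zero hs (not_le.1 hc).le)
lemma qs_tsupport {N : ℕ} {s : ℝ} (hs : 0 < s) (x : ES N) : tsupport (qs s x) ⊆ closedBall x s := by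
  refine closure_minimal (fun z hz => ?_) isClosed_closedBall
  by_contra hc
  exact hz (qs_zero hs (not_le.1 hc).le)
lemma psi_hcs {N : ℕ} {s : ℝ} (hs : 0 < s) (x : ES N) : HasCompactSupport (psi s x) :=
  (isCompact_closedBall x s).of_isClosed_subset (isClosed_tsupport _) (psi_tsupport hs x)
lemma qs_hcs {N : ℕ} {s : ℝ} (hs : 0 < s) (x : ES N) : HasCompactSupport (qs s x) :=
  (isCompact_closedBall x s).of_isClosed_subset (isClosed_tsupport _) (qs_tsupport hs x)
lemma psi_comm {N : ℕ} (s : ℝ) (x z : ES N) : psi s x z = psi s z x := by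
  unfold psi; rw [norm_sub_rev]

lemma psi_integral {N : ℕ} {s : ℝ} (hs : 0 < s) (x : ES N) : ∫ z, psi s x z = 1 := by
  have e : ∀ z, psi s x z = (fun w : ES N => (s ^ N)⁻¹ * (Zc N)⁻¹ * F0 (‖s⁻¹ • w‖ ^ 2)) (z - x) := by
    intro z
    simp only [psi, norm_smul, mul_pow, Real.norm_eq_abs, sq_abs]
    congr 2
    rw [inv_pow, div_eq_inv_mul]
  simp_rw [e]
  rw [integral_sub_right_eq_self (fun w : ES N => (s ^ N)⁻¹ * (Zc N)⁻¹ * F0 (‖s⁻¹ • w‖ ^ 2)) x,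
    integral_const_mul]
  have := Measure.integral_comp_inv_smul (volume : Measure (ES N)) (fun w => F0 (‖w‖ ^ 2)) s
  rw [this]
  have hZ := Zc_pos N
  have : (∫ w : ES N, F0 (‖w‖ ^ 2)) = Zc N := rfl
  rw [this]
  simp only [finrank_euclideanSpace, Fintype.card_fin, smul_eq_mul]
  rw [abs_of_pos (by positivity)]
  field_simp

lemma exists_psi_le (N : ℕ) : ∃ C : ℝ, 0 < C ∧ ∀ (s : ℝ) (_ : 0 < s) (x z : ES N),
    psi s x z ≤ C * (s ^ N)⁻¹ := by
  obtain ⟨C, hC, h⟩ := exists_F0_max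
  have hZ := Zc_pos N
  refine ⟨C * (Zc N)⁻¹, by positivity, fun s hs x z => ?_⟩
  unfold psi
  have := h (‖z - x‖ ^ 2 / s ^ 2) (by positivity)
  calc _ ≤ (s ^ N)⁻¹ * (Zc N)⁻¹ * C := mul_le_mul_of_nonneg_left this (by positivity)
    _ = _ := by ring

lemma exists_le_psi (N : ℕ) {θ : ℝ} (h0 : 0 ≤ θ) (h1 : θ < 1) :
    ∃ c : ℝ, 0 < c ∧ ∀ (s : ℝ) (_ : 0 < s) (x z : ES N), dist z x ≤ θ * s →
    c * (s ^ N)⁻¹ ≤ psi s x z := by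
  obtain ⟨c, hc, h⟩ := exists_F0_min (θ := θ ^ 2) (by positivity) (by nlinarith)
  have hZ := Zc_pos N
  refine ⟨c * (Zc N)⁻¹, by positivity, fun s hs x z hz => ?_⟩
  unfold psi
  have := h (‖z - x‖ ^ 2 / s ^ 2) (by positivity) (by
    rw [div_le_iff₀ (by positivity), ← mul_pow, ← dist_eq_norm]
    exact pow_le_pow_left₀ dist_nonneg hz 2)
  calc _ = (s ^ N)⁻¹ * (Zc N)⁻¹ * c := by ring
    _ ≤ _ := mul_le_mul_of_nonneg_left this (by positivity)

/-- formula for the Laplacian of `qs` -/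
lemma qs_lap {N : ℕ} (s : ℝ) (x z : ES N) :
    lap (qs s x) z = (s ^ N)⁻¹ * (Zc N)⁻¹ * (-(F0 (‖z - x‖ ^ 2 / s ^ 2) / 2) * ((s ^ 2)⁻¹ * (2 * N))
      + -(deriv F0 (‖z - x‖ ^ 2 / s ^ 2) / 2) * (4 * ‖z - x‖ ^ 2 * ((s ^ 2)⁻¹) ^ 2)) := by
  have h1 : J (fun z => ‖z - x‖ ^ 2 / s ^ 2) z ((s ^ 2)⁻¹ • (2:ℝ) • (z - x)) ((s ^ 2)⁻¹ * (2 * N)) :=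
    ((J_sq x z).cmul ((s ^ 2)⁻¹)).congr (Eventually.of_forall fun w => by
      simp only [div_eq_inv_mul])
  have d1 : deriv Q0 = fun u => -(F0 u / 2) := by funext u; exact (Q0_deriv u).deriv
  have h2 := (h1.comp (φ := Q0) (a := -(F0 (‖z - x‖ ^ 2 / s ^ 2) / 2))
    (b := -(deriv F0 (‖z - x‖ ^ 2 / s ^ 2) / 2)) (Q0_contDiff.of_le two_le_top).contDiffAt
    (Q0_deriv _).deriv (by
      rw [d1]
      have : HasDerivAt F0 (deriv F0 (‖z - x‖ ^ 2 / s ^ 2)) (‖z - x‖ ^ 2 / s ^ 2) :=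
        (F0_contDiff.differentiable (by simp) _).hasDerivAt
      exact (this.div_const 2).neg.deriv)).cmul ((s ^ N)⁻¹ * (Zc N)⁻¹)
  have h3 := h2.2.2
  have e : lap (qs s x) z = _ := h3
  rw [e]
  simp only [norm_smul, norm_inv, norm_pow, Real.norm_eq_abs, abs_two]
  rw [sq_abs]; ring

lemma psi_hasDerivAt {N : ℕ} {s : ℝ} (hs : 0 < s) (x z : ES N) :
    HasDerivAt (fun s => psi s x z) (s * lap (qs s x) z) s := by
  have hF : HasDerivAt F0 (deriv F0 (‖z - x‖ ^ 2 / s ^ 2)) (‖z - x‖ ^ 2 / s ^ 2) :=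
    (F0_contDiff.differentiable (by simp) _).hasDerivAt
  have h1 : HasDerivAt (fun s : ℝ => ‖z - x‖ ^ 2 / s ^ 2)
      ((0 * s ^ 2 - ‖z - x‖ ^ 2 * (2 * s)) / (s ^ 2) ^ 2) s := by
    have h2 : HasDerivAt (fun s : ℝ => s ^ 2) (2 * s) s := by simpa using hasDerivAt_pow 2 s
    exact (hasDerivAt_const s _).div h2 (by positivity)
  have h3 : HasDerivAt (fun s : ℝ => (s ^ N)⁻¹ * (Zc N)⁻¹) (-(N * s ^ (N - 1)) / (s ^ N) ^ 2 * (Zc N)⁻¹) s :=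
    ((hasDerivAt_pow N s).inv (by positivity)).mul_const _
  have h4 := h3.mul (hF.comp s h1)
  refine h4.congr_deriv ?_
  rw [qs_lap]
  have hZ := Zc_pos N
  have : (N:ℝ) * s ^ (N - 1) = N * s ^ N / s := by
    rcases N with _ | n
    · simp
    · simp only [Nat.add_sub_cancel, pow_succ]; field_simp
  rw [this]
  simp only [Function.comp]
  field_simp
  ring
end

section
/-! ### Weighted means -/

def mm {N : ℕ} (u : ES N → ℝ) (x : ES N) (s : ℝ) : ℝ := ∫ z, psi s x z * u z

lemma integrable_mul_of_supp {N : ℕ} {g u : ES N → ℝ} {S : Set (ES N)} (hg : Continuous g)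
    (hc : HasCompactSupport g) (hsub : tsupport g ⊆ S) (hu : IntegrableOn u S) :
    Integrable (fun z => g z * u z) := by
  have h1 : IntegrableOn (fun z => g z * u z) (tsupport g) :=
    (hu.mono_set hsub).continuousOn_mul hg.continuousOn hc
  refine (integrableOn_iff_integrable_of_support_subset ?_).1 h1
  intro z hz
  refine subset_tsupport g ?_
  intro h0
  exact hz (by simp [h0])

lemma qs_lap_zero {N : ℕ} {s : ℝ} (hs : 0 < s) {x z : ES N} (h : s < dist z x) : lap (qs s x) z = 0 :=
  lap_eq_zero_of_notMem fun hz => by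
    have := qs_tsupport hs x hz
    rw [mem_closedBall] at this; linarith

lemma qs_lap_cont {N : ℕ} (s : ℝ) (x : ES N) : Continuous (lap (qs s x)) :=
  (lap_contDiff (qs_contDiff s x)).continuous

lemma qs_lap_integrable {N : ℕ} {u : ES N → ℝ} {x : ES N} {s : ℝ} (hs : 0 < s)
    (hu : IntegrableOn u (closedBall x s)) : Integrable (fun z => lap (qs s x) z * u z) :=
  integrable_mul_of_supp (qs_lap_cont s x) (hcs_lap (qs_hcs hs x))
    ((tsupport_lap_subset _).trans (qs_tsupport hs x)) hu

lemma psi_mul_integrable {N : ℕ} {u : ES N → ℝ} {x : ES N} {s : ℝ} (hs : 0 < s)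
    (hu : IntegrableOn u (closedBall x s)) : Integrable (fun z => psi s x z * u z) :=
  integrable_mul_of_supp (psi_contDiff s x).continuous (psi_hcs hs x) (psi_tsupport hs x) hu

lemma qs_mul_integrable {N : ℕ} {u : ES N → ℝ} {x : ES N} {s : ℝ} (hs : 0 < s)
    (hu : IntegrableOn u (closedBall x s)) : Integrable (fun z => qs s x z * u z) :=
  integrable_mul_of_supp (qs_contDiff s x).continuous (qs_hcs hs x) (qs_tsupport hs x) hu

lemma psi_integrable {N : ℕ} {x : ES N} {s : ℝ} (hs : 0 < s) : Integrable (psi s x) :=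
  (psi_contDiff s x).continuous.integrable_of_hasCompactSupport (psi_hcs hs x)

lemma mm_hasDerivAt {N : ℕ} {u : ES N → ℝ} {x : ES N} {s s0 : ℝ} (hs : 0 < s) (hs0 : s < s0)
    (hu : IntegrableOn u (closedBall x s0)) :
    HasDerivAt (mm u x) (s * ∫ z, lap (qs s x) z * u z) s := by
  have hcont : ContinuousOn (fun p : ℝ × ES N => p.1 * lap (qs p.1 x) p.2)
      (Icc (s / 2) s0 ×ˢ closedBall x s0) := by
    have e : (fun p : ℝ × ES N => p.1 * lap (qs p.1 x) p.2) = fun p : ℝ × ES N =>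
      p.1 * ((p.1 ^ N)⁻¹ * (Zc N)⁻¹ * (-(F0 (‖p.2 - x‖ ^ 2 / p.1 ^ 2) / 2) * ((p.1 ^ 2)⁻¹ * (2 * N))
      + -(deriv F0 (‖p.2 - x‖ ^ 2 / p.1 ^ 2) / 2) * (4 * ‖p.2 - x‖ ^ 2 * ((p.1 ^ 2)⁻¹) ^ 2))) := by
      funext p; rw [qs_lap]
    rw [e]
    have hne : ∀ p ∈ Icc (s / 2) s0 ×ˢ closedBall x s0, p.1 ≠ 0 := by
      intro p hp
      have := hp.1.1
      exact (by linarith : 0 < p.1).ne'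
    have c1 : ContinuousOn (fun p : ℝ × ES N => ‖p.2 - x‖ ^ 2 / p.1 ^ 2)
        (Icc (s / 2) s0 ×ˢ closedBall x s0) :=
      ContinuousOn.div (by fun_prop) (by fun_prop) fun p hp => pow_ne_zero _ (hne p hp)
    have c2 : ∀ n : ℕ, ContinuousOn (fun p : ℝ × ES N => (p.1 ^ n)⁻¹)
        (Icc (s / 2) s0 ×ˢ closedBall x s0) := fun n =>
      ContinuousOn.inv₀ (by fun_prop) fun p hp => pow_ne_zero _ (hne p hp)
    have c3 := F0_contDiff.continuous.comp_continuousOn c1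
    have c4 := (F0_contDiff.continuous_deriv (by simp)).comp_continuousOn c1
    refine continuousOn_fst.mul (((c2 N).mul continuousOn_const).mul (((c3.div_const _).neg.mul
      ((c2 2).mul continuousOn_const)).add ((c4.div_const _).neg.mul (ContinuousOn.mul (by fun_prop) ((c2 2).pow 2)))))
  obtain ⟨C, hC⟩ := ((isCompact_Icc.prod (isCompact_closedBall x s0)).exists_bound_of_continuousOn hcont)
  have hC0 : 0 ≤ C := (norm_nonneg _).trans (hC (s, x) ⟨⟨by linarith, hs0.le⟩, by simp; linarith⟩)
  have key := hasDerivAt_integral_of_dominated_loc_of_deriv_le (μ := (volume : Measure (ES N)))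
    (F := fun r z => psi r x z * u z) (F' := fun r z => (r * lap (qs r x) z) * u z) (x₀ := s)
    (s := Ioo (s / 2) s0) (bound := (closedBall x s0).indicator fun z => C * |u z|)
    (Ioo_mem_nhds (by linarith) hs0) ?_ ?_ ?_ ?_ ?_ ?_
  · have h2 := key.2
    have e : (∫ z, (s * lap (qs s x) z) * u z) = s * ∫ z, lap (qs s x) z * u z := by
      rw [← integral_const_mul]; simp only [mul_assoc]
    rw [e] at h2
    exact h2
  · filter_upwards [Ioo_mem_nhds (show s / 2 < s by linarith) hs0] with r hr
    exact (psi_mul_integrable (by linarith [hr.1]) (hu.mono_set (closedBall_subset_closedBall hr.2.le))).1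
  · exact psi_mul_integrable hs (hu.mono_set (closedBall_subset_closedBall hs0.le))
  · have := (qs_lap_integrable hs (hu.mono_set (closedBall_subset_closedBall hs0.le))).const_mul s
    simp only [← mul_assoc] at this
    exact this.1
  · refine Eventually.of_forall fun z r hr => ?_
    by_cases hz : z ∈ closedBall x s0
    · rw [indicator_of_mem hz, norm_mul, Real.norm_eq_abs (u z)]
      exact mul_le_mul_of_nonneg_right (hC (r, z) ⟨⟨hr.1.le, hr.2.le⟩, hz⟩) (abs_nonneg _)
    · rw [indicator_of_notMem hz]
      rw [mem_closedBall, not_le] at hz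
      rw [qs_lap_zero (by linarith [hr.1]) (hr.2.trans hz)]; simp
  · exact (integrable_indicator_iff measurableSet_closedBall).2 (hu.abs.const_mul C)
  · refine Eventually.of_forall fun z r hr => ?_
    exact (psi_hasDerivAt (by linarith [hr.1]) x z).mul_const _

lemma mm_const {N : ℕ} (c : ℝ) (x : ES N) {s : ℝ} (hs : 0 < s) : mm (fun _ => c) x s = c := by
  unfold mm; rw [integral_mul_const, psi_integral hs, one_mul]

lemma mm_mono {N : ℕ} {u v : ES N → ℝ} {x : ES N} {s : ℝ} (hs : 0 < s)
    (hu : IntegrableOn u (closedBall x s)) (hv : IntegrableOn v (closedBall x s))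
    (h : ∀ z ∈ closedBall x s, u z ≤ v z) : mm u x s ≤ mm v x s := by
  refine integral_mono (psi_mul_integrable hs hu) (psi_mul_integrable hs hv) fun z => ?_
  by_cases hz : z ∈ closedBall x s
  · exact mul_le_mul_of_nonneg_left (h z hz) (psi_nonneg hs x z)
  · rw [mem_closedBall, not_le] at hz
    simp [psi_zero hs hz.le]

lemma mm_tendsto {N : ℕ} {u : ES N → ℝ} {x : ES N} {s0 : ℝ} (h0 : 0 < s0)
    (hu : IntegrableOn u (closedBall x s0)) (hc : ContinuousAt u x) :
    Tendsto (mm u x) (𝓝[>] 0) (𝓝 (u x)) := by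
  rw [Metric.tendsto_nhds]
  intro ε hε
  obtain ⟨δ, hδ, h⟩ := Metric.continuousAt_iff.1 hc (ε / 2) (by linarith)
  have : Ioo 0 (min δ s0) ∈ 𝓝[>] (0:ℝ) := Ioo_mem_nhdsGT (lt_min hδ h0)
  filter_upwards [this] with s hs
  have hs0 : s ≤ s0 := hs.2.le.trans (min_le_right _ _)
  have hu' := hu.mono_set (closedBall_subset_closedBall (x := x) hs0)
  have hfin : ∀ c : ℝ, IntegrableOn (fun _ : ES N => c) (closedBall x s) := fun c =>
    integrableOn_const (isCompact_closedBall x s).measure_lt_top.ne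
  have hb : ∀ z ∈ closedBall x s, |u z - u x| < ε / 2 := fun z hz => h (lt_of_le_of_lt hz (hs.2.trans_le (min_le_left _ _)))
  have a1 := mm_mono hs.1 hu' (hfin (u x + ε / 2)) fun z hz => by linarith [(abs_lt.1 (hb z hz)).2]
  have a2 := mm_mono hs.1 (hfin (u x - ε / 2)) hu' fun z hz => by linarith [(abs_lt.1 (hb z hz)).1]
  rw [mm_const _ _ hs.1] at a1 a2
  rw [Real.dist_eq, abs_lt]
  constructor <;> linarith

lemma tend_of_monotoneOn {f : ℝ → ℝ} {s0 l : ℝ} (hf : MonotoneOn f (Ioo 0 s0))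
    (ht : Tendsto f (𝓝[>] 0) (𝓝 l)) {s : ℝ} (hs : s ∈ Ioo 0 s0) : l ≤ f s := by
  refine le_of_tendsto ht ?_
  filter_upwards [Ioo_mem_nhdsGT hs.1] with r hr
  exact hf ⟨hr.1, hr.2.trans hs.2⟩ hs hr.2.le

lemma mm_ge {N : ℕ} {u : ES N → ℝ} {x : ES N} {s0 : ℝ}
    (hu : IntegrableOn u (closedBall x s0)) (hc : ContinuousAt u x)
    (h : ∀ r ∈ Ioo 0 s0, 0 ≤ ∫ z, lap (qs r x) z * u z) {s : ℝ} (hs : s ∈ Ioo 0 s0) :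
    u x ≤ mm u x s := by
  refine tend_of_monotoneOn (s0 := s0) ?_ (mm_tendsto (hs.1.trans hs.2) hu hc) hs
  refine monotoneOn_of_deriv_nonneg (convex_Ioo _ _) (fun r hr => (mm_hasDerivAt hr.1 hr.2 hu).continuousAt.continuousWithinAt) ?_ ?_
  · intro r hr
    rw [interior_Ioo] at hr
    exact (mm_hasDerivAt hr.1 hr.2 hu).differentiableAt.differentiableWithinAt
  · intro r hr
    rw [interior_Ioo] at hr
    rw [(mm_hasDerivAt hr.1 hr.2 hu).deriv]
    exact mul_nonneg hr.1.le (h r hr)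

lemma mm_gt {N : ℕ} {u : ES N → ℝ} {x : ES N} {s0 : ℝ}
    (hu : IntegrableOn u (closedBall x s0)) (hc : ContinuousAt u x)
    (h : ∀ r ∈ Ioo 0 s0, 0 < ∫ z, lap (qs r x) z * u z) {s : ℝ} (hs : s ∈ Ioo 0 s0) :
    u x < mm u x s := by
  have hm : StrictMonoOn (mm u x) (Ioo 0 s0) := by
    refine strictMonoOn_of_deriv_pos (convex_Ioo _ _) (fun r hr => (mm_hasDerivAt hr.1 hr.2 hu).continuousAt.continuousWithinAt) ?_
    intro r hr
    rw [interior_Ioo] at hr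
    rw [(mm_hasDerivAt hr.1 hr.2 hu).deriv]
    exact mul_pos hr.1 (h r hr)
  have h1 : s / 2 ∈ Ioo 0 s0 := ⟨by linarith [hs.1], by linarith [hs.1, hs.2]⟩
  exact lt_of_le_of_lt (mm_ge hu hc (fun r hr => (h r hr).le) h1) (hm h1 hs (by linarith [hs.1]))

lemma mm_le_exp {N : ℕ} {u : ES N → ℝ} {x : ES N} {s0 Λ : ℝ}
    (hu : IntegrableOn u (closedBall x s0)) (hc : ContinuousAt u x)
    (h : ∀ r ∈ Ioo 0 s0, ∫ z, lap (qs r x) z * u z ≤ Λ / 2 * mm u x r) {s : ℝ} (hs : s ∈ Ioo 0 s0) :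
    mm u x s ≤ Real.exp (Λ * s ^ 2 / 4) * u x := by
  have hd : ∀ r ∈ Ioo 0 s0, HasDerivAt (fun r => -(Real.exp (-(Λ * r ^ 2 / 4)) * mm u x r))
      (-(Real.exp (-(Λ * r ^ 2 / 4)) * (-(Λ * (2 * r) / 4)) * mm u x r
        + Real.exp (-(Λ * r ^ 2 / 4)) * (r * ∫ z, lap (qs r x) z * u z))) r := by
    intro r hr
    have h2 : HasDerivAt (fun s : ℝ => s ^ 2) (2 * r) r := by simpa using hasDerivAt_pow 2 r
    have h3 : HasDerivAt (fun r => -(Λ * r ^ 2 / 4)) (-(Λ * (2 * r) / 4)) r :=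
      ((h2.const_mul Λ).div_const 4).neg
    exact (h3.exp.mul (mm_hasDerivAt hr.1 hr.2 hu)).neg
  have hm : MonotoneOn (fun r => -(Real.exp (-(Λ * r ^ 2 / 4)) * mm u x r)) (Ioo 0 s0) := by
    refine monotoneOn_of_deriv_nonneg (convex_Ioo _ _) (fun r hr => (hd r hr).continuousAt.continuousWithinAt) ?_ ?_
    · intro r hr
      rw [interior_Ioo] at hr
      exact (hd r hr).differentiableAt.differentiableWithinAt
    · intro r hr
      rw [interior_Ioo] at hr
      rw [(hd r hr).deriv]
      have h1 := h r hr
      have h2 := Real.exp_pos (-(Λ * r ^ 2 / 4))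
      have h3 : r * ∫ z, lap (qs r x) z * u z ≤ r * (Λ / 2 * mm u x r) := mul_le_mul_of_nonneg_left h1 hr.1.le
      have h4 : Real.exp (-(Λ * r ^ 2 / 4)) * (-(Λ * (2 * r) / 4)) * mm u x r
        + Real.exp (-(Λ * r ^ 2 / 4)) * (r * ∫ z, lap (qs r x) z * u z) =
        Real.exp (-(Λ * r ^ 2 / 4)) * ((r * ∫ z, lap (qs r x) z * u z) - r * (Λ / 2 * mm u x r)) := by ring
      rw [h4]
      have := mul_nonneg h2.le (sub_nonneg.2 h3)
      linarith
  have ht : Tendsto (fun r => -(Real.exp (-(Λ * r ^ 2 / 4)) * mm u x r)) (𝓝[>] 0) (𝓝 (-(u x))) := by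
    have h1 : Tendsto (fun r : ℝ => Real.exp (-(Λ * r ^ 2 / 4))) (𝓝[>] 0) (𝓝 1) := by
      have : Continuous (fun r : ℝ => Real.exp (-(Λ * r ^ 2 / 4))) := by fun_prop
      have := this.tendsto 0
      simp only [ne_eq, OfNat.ofNat_ne_zero, not_false_eq_true, zero_pow, mul_zero, zero_div, neg_zero,
        Real.exp_zero] at this
      exact this.mono_left nhdsWithin_le_nhds
    have := (h1.mul (mm_tendsto (hs.1.trans hs.2) hu hc)).neg
    simpa using this
  have := tend_of_monotoneOn hm ht hs
  simp only [neg_le_neg_iff] at this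
  rw [Real.exp_neg] at this
  have hp := Real.exp_pos (Λ * s ^ 2 / 4)
  calc mm u x s = Real.exp (Λ * s ^ 2 / 4) * ((Real.exp (Λ * s ^ 2 / 4))⁻¹ * mm u x s) := by
        field_simp
    _ ≤ _ := mul_le_mul_of_nonneg_left this hp.le

/-- no local max for sub-mean minus strictly superharmonic -/
lemma no_local_max {N : ℕ} {h W : ES N → ℝ} {x : ES N} {s0 : ℝ} (h0 : 0 < s0)
    (hW : ContDiffAt ℝ 2 W x) (hlap : lap W x < 0) (hh : IntegrableOn h (closedBall x s0))
    (hsub : ∀ s ∈ Ioo 0 s0, h x ≤ mm h x s) (hmax : IsLocalMax (fun z => h z - W z) x) : False := by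
  have e1 : ∀ᶠ z in 𝓝 x, ContDiffAt ℝ 2 W z := hW.eventually (by simp)
  have e2 : ∀ᶠ z in 𝓝 x, lap W z < 0 := (lap_continuousAt hW).eventually (gt_mem_nhds hlap)
  obtain ⟨r, hr, hball⟩ := Metric.nhds_basis_closedBall.mem_iff.1 ((e1.and e2).and hmax)
  set t := min r s0 with ht
  have ht0 : 0 < t := lt_min hr h0
  have hsubset : closedBall x t ⊆ closedBall x r := closedBall_subset_closedBall (min_le_left _ _)
  have hWc : ContinuousOn W (closedBall x t) := fun z hz => (hball (hsubset hz)).1.1.continuousAt.continuousWithinAt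
  have hWi : IntegrableOn W (closedBall x t) := hWc.integrableOn_compact (isCompact_closedBall x t)
  have hhi : IntegrableOn h (closedBall x t) := hh.mono_set (closedBall_subset_closedBall (min_le_right _ _))
  have key : ∀ ρ ∈ Ioo 0 t, 0 < ∫ z, lap (qs ρ x) z * (-W z) := by
    intro ρ hρ
    have hsub2 : closedBall x ρ ⊆ closedBall x r := closedBall_subset_closedBall (hρ.2.le.trans (min_le_left _ _))
    have g := green_loc (u := W) (v := qs ρ x) ((qs_contDiff ρ x).of_le two_le_top) (qs_hcs hρ.1 x)
      (fun z hz => (hball (hsub2 (qs_tsupport hρ.1 x hz))).1.1)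
    have : ∫ z, lap (qs ρ x) z * (-W z) = ∫ z, qs ρ x z * (- lap W z) := by
      simp only [mul_neg]
      rw [integral_neg, integral_neg, ← g]
      simp only [mul_comm]
    rw [this]
    have hcl : ContinuousOn (fun z => - lap W z) (closedBall x ρ) := fun z hz =>
      (lap_continuousAt (hball (hsub2 hz)).1.1).neg.continuousWithinAt
    have hInt := qs_mul_integrable hρ.1 (hcl.integrableOn_compact (isCompact_closedBall x ρ))
    have hnn : 0 ≤ fun z => qs ρ x z * (- lap W z) := by
      intro z
      by_cases hz : z ∈ closedBall x ρ
      · exact mul_nonneg (qs_nonneg hρ.1 x z) (by linarith [(hball (hsub2 hz)).1.2])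
      · rw [mem_closedBall, not_le] at hz
        simp [qs_zero hρ.1 hz.le]
    rw [integral_pos_iff_support_of_nonneg hnn hInt]
    refine lt_of_lt_of_le (measure_ball_pos volume x hρ.1) (measure_mono fun z hz => ?_)
    have hz' : z ∈ closedBall x ρ := ball_subset_closedBall hz
    have h1 : 0 < qs ρ x z := by
      unfold qs
      have := Zc_pos N
      have h2 : 0 < Q0 (‖z - x‖ ^ 2 / ρ ^ 2) := by
        refine expNegInvGlue.pos_of_pos ?_
        rw [sub_pos, div_lt_one (by have := hρ.1; positivity), ← dist_eq_norm]
        exact pow_lt_pow_left₀ hz dist_nonneg (by norm_num)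
      have := hρ.1
      positivity
    exact (mul_pos h1 (by linarith [(hball (hsub2 hz')).1.2])).ne'
  have hρ : t / 2 ∈ Ioo 0 t := ⟨by linarith, by linarith⟩
  have a1 := mm_gt (u := fun z => -W z) hWi.neg hW.continuousAt.neg key hρ
  have a2 := hsub (t / 2) ⟨hρ.1, hρ.2.trans_le (min_le_right _ _)⟩
  have hs2 : closedBall x (t / 2) ⊆ closedBall x t := closedBall_subset_closedBall hρ.2.le
  have a3 : mm h x (t / 2) ≤ mm (fun z => W z + (h x - W x)) x (t / 2) := by
    refine mm_mono hρ.1 (hhi.mono_set hs2) ((hWi.mono_set hs2).add (integrableOn_const (isCompact_closedBall x _).measure_lt_top.ne)) ?_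
    intro z hz
    have := (hball (hsubset (hs2 hz))).2
    simp only at this
    linarith
  have a4 : mm (fun z => W z + (h x - W x)) x (t / 2) = mm W x (t / 2) + (h x - W x) := by
    unfold mm
    simp only [mul_add]
    rw [integral_add (psi_mul_integrable hρ.1 (hWi.mono_set hs2)) ((psi_integrable hρ.1).mul_const _),
      integral_mul_const, psi_integral hρ.1, one_mul]
  have a5 : mm (fun z => -W z) x (t / 2) = - mm W x (t / 2) := by
    unfold mm; simp only [mul_neg]; rw [integral_neg]
  rw [a5] at a1
  linarith
end

section
/-! ### Mollification -/

open scoped Convolution in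
lemma mm_eq_conv {N : ℕ} (u : ES N → ℝ) (s : ℝ) :
    (fun x => mm u x s) = (u ⋆[ContinuousLinearMap.lsmul ℝ ℝ, volume] psi s (0 : ES N)) := by
  funext x
  rw [convolution_def]
  unfold mm
  refine integral_congr_ae (Eventually.of_forall fun z => ?_)
  simp only [ContinuousLinearMap.lsmul_apply, smul_eq_mul]
  rw [mul_comm]; congr 1
  unfold psi; rw [norm_sub_rev]; simp

open scoped Convolution in
lemma mm_eq_conv' {N : ℕ} (u : ES N → ℝ) (s : ℝ) :
    (fun x => mm u x s) = (psi s (0 : ES N) ⋆[ContinuousLinearMap.lsmul ℝ ℝ, volume] u) := by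
  rw [mm_eq_conv]
  have := convolution_flip (f := u) (g := psi s (0 : ES N)) (L := ContinuousLinearMap.lsmul ℝ ℝ) (μ := (volume : Measure (ES N)))
  rw [← this]
  congr 1
  ext; simp

lemma mm_contDiff {N : ℕ} {u : ES N → ℝ} (hu : LocallyIntegrable u) {s : ℝ} (hs : 0 < s) :
    ContDiff ℝ (⊤ : ℕ∞) (fun x => mm u x s) := by
  rw [mm_eq_conv]
  exact (psi_hcs hs 0).contDiff_convolution_right _ hu (psi_contDiff s 0)

lemma fderiv_mm {N : ℕ} {w : ES N → ℝ} (hw : ContDiff ℝ 1 w) (hc : HasCompactSupport w) {s : ℝ}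
    (v x : ES N) (hs : 0 < s) :
    fderiv ℝ (fun x => mm w x s) x v = mm (fun z => fderiv ℝ w z v) x s := by
  have hl : LocallyIntegrable (psi s (0 : ES N)) := (psi_integrable hs).locallyIntegrable
  have h1 := hc.hasFDerivAt_convolution_right (ContinuousLinearMap.lsmul ℝ ℝ) hl hw x
  have e := mm_eq_conv' w s
  have e2 := congrFun (mm_eq_conv' (fun z => fderiv ℝ w z v) s) x
  rw [e, h1.fderiv, e2, convolution_precompR_apply]
  · exact hl
  · exact hc.fderiv (𝕜 := ℝ)
  · exact hw.continuous_fderiv (by norm_num)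

lemma lap_mm {N : ℕ} {w : ES N → ℝ} (hw : ContDiff ℝ (⊤ : ℕ∞) w) (hc : HasCompactSupport w) {s : ℝ}
    (x : ES N) (hs : 0 < s) : lap (fun x => mm w x s) x = mm (lap w) x s := by
  rw [lap_def']
  have h1 : ∀ v : ES N, ContDiff ℝ (⊤ : ℕ∞) (fun z => fderiv ℝ w z v) := fun v =>
    (hw.fderiv_right (m := ((⊤ : ℕ∞) : WithTop ℕ∞)) (by simp)).clm_apply contDiff_const
  have h3 : ∀ v : ES N, HasCompactSupport (fun z => fderiv ℝ w z v) := fun v => hc.fderiv_apply (𝕜 := ℝ) v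
  have h2 : ∀ i : Fin N, fderiv ℝ (fun y => fderiv ℝ (fun x => mm w x s) y (ee i)) x (ee i)
      = mm (fun z => fderiv ℝ (fun y => fderiv ℝ w y (ee i)) z (ee i)) x s := by
    intro i
    have : (fun y => fderiv ℝ (fun x => mm w x s) y (ee i)) = fun y => mm (fun z => fderiv ℝ w z (ee i)) y s := by
      funext y
      exact fderiv_mm (hw.of_le (by exact_mod_cast le_top)) hc _ _ hs
    rw [this]
    exact fderiv_mm ((h1 _).of_le (by exact_mod_cast le_top)) (h3 _) _ _ hs
  simp_rw [h2]
  unfold mm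
  rw [← integral_finsetSum]
  · refine integral_congr_ae (Eventually.of_forall fun z => ?_)
    simp only [lap_def', Finset.mul_sum]
  · intro i _
    refine psi_mul_integrable hs ?_
    refine (Continuous.integrable_of_hasCompactSupport ?_ ?_).integrableOn
    · exact (((h1 (ee i)).fderiv_right (m := ((⊤ : ℕ∞) : WithTop ℕ∞)) (by simp)).clm_apply contDiff_const).continuous
    · exact (h3 _).fderiv_apply (𝕜 := ℝ) _

lemma mm_swap {N : ℕ} {h g : ES N → ℝ} (hh : Integrable h) (hg : Integrable g) {s : ℝ} (hs : 0 < s) :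
    ∫ x, mm h x s * g x = ∫ z, h z * mm g z s := by
  unfold mm
  have e1 : ∀ x, (∫ z, psi s x z * h z) * g x = ∫ z, psi s x z * (g x * h z) := by
    intro x; rw [← integral_mul_const]; congr 1; ext z; ring
  have e2 : ∀ z, h z * (∫ x, psi s z x * g x) = ∫ x, psi s x z * (g x * h z) := by
    intro z; rw [← integral_const_mul]; congr 1; ext x; rw [psi_comm]; ring
  simp_rw [e1, e2]
  refine integral_integral_swap ?_
  obtain ⟨C, hC, h⟩ := exists_psi_le N
  have := Integrable.bdd_mul (hg.mul_prod hh) (f := fun p : ES N × ES N => psi s p.1 p.2) (c := C * (s ^ N)⁻¹) ?_ ?_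
  · exact this
  · refine Continuous.aestronglyMeasurable ?_
    unfold psi
    have := F0_contDiff.continuous
    fun_prop
  · refine Eventually.of_forall fun p => ?_
    rw [Real.norm_of_nonneg (psi_nonneg hs _ _)]
    exact h s hs _ _

lemma mm_tsupport {N : ℕ} {w : ES N → ℝ} {s : ℝ} (hs : 0 < s) :
    tsupport (fun x => mm w x s) ⊆ cthickening s (tsupport w) := by
  refine closure_minimal (fun x hx => ?_) isClosed_cthickening
  by_contra hc
  apply hx
  unfold mm
  have : ∀ z, psi s x z * w z = 0 := by
    intro z
    by_cases hz : s ≤ dist z x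
    · rw [psi_zero hs hz, zero_mul]
    · have : z ∉ tsupport w := fun hz2 => hc (mem_cthickening_of_dist_le x z s _ hz2 (by rw [dist_comm]; linarith [not_le.1 hz]))
      rw [image_eq_zero_of_notMem_tsupport this, mul_zero]
  simp [this]

lemma mm_nonneg {N : ℕ} {w : ES N → ℝ} {s : ℝ} (hs : 0 < s) (x : ES N) (h : ∀ z, 0 ≤ w z) : 0 ≤ mm w x s :=
  integral_nonneg fun z => mul_nonneg (psi_nonneg hs x z) (h z)

lemma mm_close {N : ℕ} {u : ES N → ℝ} {x : ES N} {s c η : ℝ} (hs : 0 < s)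
    (hu : IntegrableOn u (closedBall x s)) (h : ∀ z ∈ closedBall x s, |u z - c| ≤ η) :
    |mm u x s - c| ≤ η := by
  have hc : ∀ k : ℝ, IntegrableOn (fun _ : ES N => k) (closedBall x s) := fun k =>
    integrableOn_const (isCompact_closedBall x s).measure_lt_top.ne
  have h1 := mm_mono hs hu (hc (c + η)) fun z hz => by linarith [(abs_le.1 (h z hz)).2]
  have h2 := mm_mono hs (hc (c - η)) hu fun z hz => by linarith [(abs_le.1 (h z hz)).1]
  rw [mm_const _ _ hs] at h1 h2
  exact abs_le.2 ⟨by linarith, by linarith⟩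

/-! ### The convex cutoff -/

def jj (ε u : ℝ) : ℝ := ∫ t in (0:ℝ)..u, Real.smoothTransition (t / ε - 1)

lemma st_cont : Continuous Real.smoothTransition := Real.smoothTransition.continuous

lemma jj_hasDerivAt (ε u : ℝ) : HasDerivAt (jj ε) (Real.smoothTransition (u / ε - 1)) u := by
  have hc : Continuous fun t : ℝ => Real.smoothTransition (t / ε - 1) := st_cont.comp (by fun_prop)
  exact intervalIntegral.integral_hasDerivAt_right (hc.intervalIntegrable _ _)
    hc.aestronglyMeasurable.stronglyMeasurableAtFilter hc.continuousAt

lemma jj_deriv (ε : ℝ) : deriv (jj ε) = fun u => Real.smoothTransition (u / ε - 1) :=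
  funext fun u => (jj_hasDerivAt ε u).deriv

lemma st_contDiff : ContDiff ℝ (⊤ : ℕ∞) Real.smoothTransition := Real.smoothTransition.contDiff

lemma jj_contDiff (ε : ℝ) : ContDiff ℝ (⊤ : ℕ∞) (jj ε) := by
  rw [contDiff_infty_iff_deriv]
  refine ⟨fun u => (jj_hasDerivAt ε u).differentiableAt, ?_⟩
  rw [jj_deriv]
  exact st_contDiff.comp ((contDiff_id.div_const _).sub contDiff_const)

lemma st_mono : Monotone Real.smoothTransition := by
  intro a b hab
  by_cases ha : a ≤ 0
  · rw [Real.smoothTransition.zero_of_nonpos ha]; exact Real.smoothTransition.nonneg _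
  have ha := not_le.1 ha
  by_cases hb : 1 ≤ b
  · rw [Real.smoothTransition.one_of_one_le hb]; exact Real.smoothTransition.le_one _
  have hb := not_le.1 hb
  unfold Real.smoothTransition
  have e1 := expNegInvGlue.monotone hab
  have e2 : expNegInvGlue (1 - b) ≤ expNegInvGlue (1 - a) := expNegInvGlue.monotone (by linarith)
  have p1 := expNegInvGlue.pos_of_pos ha
  have p2 := expNegInvGlue.pos_of_pos (show 0 < 1 - b by linarith)
  rw [div_le_div_iff₀ (by linarith) (by linarith)]
  nlinarith

lemma jj_d2_nonneg {ε : ℝ} (hε : 0 < ε) (u : ℝ) : 0 ≤ deriv (deriv (jj ε)) u := by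
  rw [jj_deriv]
  apply Monotone.deriv_nonneg
  intro a b hab
  exact st_mono (by have := div_le_div_of_nonneg_right hab hε.le; linarith)

lemma jj_zero {ε u : ℝ} (hε : 0 < ε) (hu : u ≤ ε) : jj ε u = 0 := by
  unfold jj
  rw [intervalIntegral.integral_congr (g := fun _ => 0)]
  · simp
  · intro t ht
    have : t ≤ ε := by
      rcases le_total 0 u with h | h
      · rw [uIcc_of_le h] at ht; exact ht.2.trans hu
      · rw [uIcc_of_ge h] at ht; exact ht.2.trans hε.le
    exact Real.smoothTransition.zero_of_nonpos (by rw [sub_nonpos, div_le_one hε]; exact this)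

lemma jj_mono (ε : ℝ) : Monotone (jj ε) := by
  refine monotone_of_deriv_nonneg (fun u => (jj_hasDerivAt ε u).differentiableAt) fun u => ?_
  rw [jj_deriv]; exact Real.smoothTransition.nonneg _

lemma jj_nonneg {ε : ℝ} (hε : 0 < ε) (u : ℝ) : 0 ≤ jj ε u := by
  rcases le_total u ε with h | h
  · rw [jj_zero hε h]
  · rw [← jj_zero hε le_rfl]; exact jj_mono ε h

lemma jj_sub_hasDerivAt (ε u : ℝ) :
    HasDerivAt (fun u => jj ε u - u) (Real.smoothTransition (u / ε - 1) - 1) u :=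
  (jj_hasDerivAt ε u).sub (hasDerivAt_id u)

lemma jj_le {ε : ℝ} {u : ℝ} (hu : 0 ≤ u) : jj ε u ≤ u := by
  have h : Antitone fun u => jj ε u - u := by
    refine antitone_of_deriv_nonpos (fun u => (jj_sub_hasDerivAt ε u).differentiableAt) fun u => ?_
    rw [(jj_sub_hasDerivAt ε u).deriv]
    linarith [Real.smoothTransition.le_one (u / ε - 1)]
  have := h hu
  simp only [jj, intervalIntegral.integral_same] at this ⊢
  linarith

lemma jj_ge {ε : ℝ} (hε : 0 < ε) (u : ℝ) : u - 2 * ε ≤ jj ε u := by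
  rcases le_total u (2 * ε) with h | h
  · linarith [jj_nonneg hε u]
  · have hm : MonotoneOn (fun u => jj ε u - u) (Ici (2 * ε)) := by
      refine monotoneOn_of_deriv_nonneg (convex_Ici _) (fun u _ => (jj_sub_hasDerivAt ε u).continuousAt.continuousWithinAt)
        (fun u _ => (jj_sub_hasDerivAt ε u).differentiableAt.differentiableWithinAt) fun u hu => ?_
      rw [interior_Ici] at hu
      rw [(jj_sub_hasDerivAt ε u).deriv]
      rw [Real.smoothTransition.one_of_one_le]
      · norm_num
      · have : 2 ≤ u / ε := by rw [le_div_iff₀ hε]; exact (mem_Ioi.1 hu).le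
        linarith
    have := hm (mem_Ici.2 le_rfl) (mem_Ici.2 h) h
    simp only at this
    linarith [jj_nonneg hε (2 * ε)]

lemma jj_lip (ε : ℝ) (u v : ℝ) : |jj ε u - jj ε v| ≤ |u - v| := by
  have := Convex.norm_image_sub_le_of_norm_deriv_le (f := jj ε) (C := 1) (s := univ) (x := v) (y := u)
    (fun x _ => (jj_hasDerivAt ε x).differentiableAt) (fun x _ => by
      rw [jj_deriv, Real.norm_of_nonneg (Real.smoothTransition.nonneg _)]
      exact Real.smoothTransition.le_one _) convex_univ (mem_univ _) (mem_univ _)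
  simpa using this
end

section
lemma jj_d2_zero {ε u : ℝ} (hε : 0 < ε) (hu : u < ε) : deriv (deriv (jj ε)) u = 0 := by
  rw [jj_deriv]
  have : (fun u => Real.smoothTransition (u / ε - 1)) =ᶠ[𝓝 u] fun _ => 0 := by
    filter_upwards [gt_mem_nhds hu] with v hv
    exact Real.smoothTransition.zero_of_nonpos (by rw [sub_nonpos, div_le_one hε]; exact hv.le)
  rw [this.deriv_eq]; simp

/-- zero extended nonnegative solution -/
structure Sol {N : ℕ} (Ω : Set (ES N)) (y : ES N) (V h : ES N → ℝ) (a : ℝ) : Prop where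
  op : IsOpen Ω
  bdd : Bornology.IsBounded Ω
  yn : y ∉ Ω
  ca : 0 ≤ a
  hc : ContinuousOn h {y}ᶜ
  h0 : ∀ x, x ∉ Ω → h x = 0
  nn : ∀ x, 0 ≤ h x
  Vm : Measurable V
  V0 : ∀ x, 0 ≤ V x
  Va : ∀ x ∈ Ω, V x * dista Ω x ^ 2 ≤ a
  weak : ∀ φ, IsTestFun Ω φ → ∫ x, h x * lap φ x = ∫ x, V x * h x * φ x

variable {N : ℕ} {Ω : Set (ES N)} {y : ES N} {V h : ES N → ℝ} {a : ℝ}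

lemma Sol.meas (H : Sol Ω y V h a) : Measurable h := measurable_of_continuousOn_compl_singleton y H.hc

lemma Sol.intOn (H : Sol Ω y V h a) {S : Set (ES N)} (hS : IsCompact S) (hy : y ∉ S) : IntegrableOn h S :=
  (H.hc.mono fun x hx => by rintro rfl; exact hy hx).integrableOn_compact hS

lemma Sol.dista_pos (H : Sol Ω y V h a) {x : ES N} (hx : x ∈ Ω) : 0 < dista Ω x := by
  unfold dista
  rw [← (H.op.isClosed_compl).notMem_iff_infDist_pos ⟨y, H.yn⟩]
  exact fun h => h hx

lemma dista_cont (Ω : Set (ES N)) : Continuous (dista Ω) := continuous_infDist_pt _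

lemma ball_dista_subset {x : ES N} (Ω : Set (ES N)) : ball x (dista Ω x) ⊆ Ω := by
  have := ball_infDist_compl_subset (s := Ω) (x := x)
  exact this

lemma le_dista {x : ES N} {s : ℝ} (hy : y ∉ Ω) (hb : ball x s ⊆ Ω) : s ≤ dista Ω x := by
  unfold dista
  rw [le_infDist ⟨y, hy⟩]
  intro z hz
  by_contra hc
  exact hz (hb (by rw [mem_ball, dist_comm]; exact not_le.1 hc))

lemma Sol.Vh_int (H : Sol Ω y V h a) {g : ES N → ℝ} (hg : Continuous g) (hc : HasCompactSupport g)
    (hs : tsupport g ⊆ Ω) : Integrable (fun x => V x * h x * g x) := by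
  have hgi : Integrable (fun x => g x * h x) :=
    integrable_mul_of_supp hg hc subset_rfl (H.intOn hc fun hy => H.yn (hs hy))
  rcases (tsupport g).eq_empty_or_nonempty with he | hne
  · have : ∀ x, g x = 0 := fun x => image_eq_zero_of_notMem_tsupport (by rw [he]; simp)
    simp [this]
  obtain ⟨x1, hx1, hmin⟩ := hc.isCompact.exists_isMinOn hne (dista_cont Ω).continuousOn
  set d0 := dista Ω x1
  have hd0 : 0 < d0 := H.dista_pos (hs hx1)
  refine Integrable.mono' (hgi.norm.const_mul (a / d0 ^ 2)) ?_ (Eventually.of_forall fun x => ?_)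
  · exact ((H.Vm.mul H.meas).mul hg.measurable).aestronglyMeasurable
  · by_cases hx : x ∈ tsupport g
    · have h1 : d0 ≤ dista Ω x := hmin hx
      have h2 : V x ≤ a / d0 ^ 2 := by
        rw [le_div_iff₀ (by positivity)]
        refine le_trans ?_ (H.Va x (hs hx))
        exact mul_le_mul_of_nonneg_left (pow_le_pow_left₀ hd0.le h1 2) (H.V0 x)
      rw [show V x * h x * g x = V x * (g x * h x) by ring, norm_mul, Real.norm_of_nonneg (H.V0 x)]
      exact mul_le_mul_of_nonneg_right h2 (norm_nonneg _)
    · rw [image_eq_zero_of_notMem_tsupport hx]; simp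

lemma tsupport_subset_of {g : ES N → ℝ} {S : Set (ES N)} (hS : IsClosed S) (h : ∀ x, g x ≠ 0 → x ∈ S) :
    tsupport g ⊆ S := closure_minimal (fun x hx => h x hx) hS

lemma Sol.ext_aux (H : Sol Ω y V h a) {φ : ES N → ℝ} (hφ : ContDiff ℝ (⊤ : ℕ∞) φ)
    (hc : HasCompactSupport φ) (hy : y ∉ tsupport φ) (hpos : ∀ x ∈ Ω, 0 ≤ φ x) {ε : ℝ} (hε : 0 < ε) :
    ∃ w : ES N → ℝ, Continuous w ∧ (∀ x, 0 ≤ w x) ∧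
      0 ≤ ∫ x, h x * lap φ x + 3 * ε * |lap φ x| ∧
      ∫⁻ x, ENNReal.ofReal (V x * h x * w x) ≤ ENNReal.ofReal (∫ x, h x * lap φ x + 3 * ε * |lap φ x|) ∧
      ∀ x, 4 * ε < h x → φ x - ε ≤ w x := by
  set T := tsupport φ with hT
  have hTc : IsCompact T := hc
  obtain ⟨δ, hδ, hδT⟩ := hTc.exists_cthickening_subset_open (isOpen_compl_singleton (x := y))
    (fun x hx => by rintro rfl; exact hy hx)
  set T2 := cthickening δ T with hT2
  have hT2c : IsCompact T2 := hTc.cthickening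
  have hcT2 : ContinuousOn h T2 := H.hc.mono hδT
  have hyT2 : y ∉ T2 := fun hh => hδT hh rfl
  obtain ⟨δ1, hδ1, hu1⟩ := Metric.uniformContinuousOn_iff.1 (hT2c.uniformContinuousOn_of_continuous hcT2) (ε / 2) (by linarith)
  obtain ⟨δ2, hδ2, hu2⟩ := Metric.uniformContinuous_iff.1 (hc.uniformContinuous_of_continuous hφ.continuous) ε hε
  set S := T ∩ h ⁻¹' (Ici (ε / 2)) with hS
  have hTT2 : T ⊆ T2 := self_subset_cthickening T
  have hSc : IsCompact S := hTc.of_isClosed_subset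
    ((hcT2.mono hTT2).preimage_isClosed_of_isClosed (isClosed_tsupport φ) isClosed_Ici) inter_subset_left
  have hSΩ : S ⊆ Ω := by
    intro x hx
    by_contra hxΩ
    have := hx.2
    rw [mem_preimage, H.h0 x hxΩ, mem_Ici] at this
    linarith
  obtain ⟨δ3, hδ3, hδS⟩ := hSc.exists_cthickening_subset_open H.op hSΩ
  set s := min (min (δ / 2) (δ1 / 2)) (min (δ2 / 2) (δ3 / 2)) with hs_def
  have hs : 0 < s := by positivity
  have s1 : s ≤ δ / 2 := (min_le_left _ _).trans (min_le_left _ _)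
  have s2 : s ≤ δ1 / 2 := (min_le_left _ _).trans (min_le_right _ _)
  have s3 : s ≤ δ2 / 2 := (min_le_right _ _).trans (min_le_left _ _)
  have s4 : s ≤ δ3 / 2 := (min_le_right _ _).trans (min_le_right _ _)
  set h' := T2.indicator h with hh'
  have hh'i : Integrable h' := (H.intOn hT2c hyT2).integrable_indicator hT2c.measurableSet
  set Hs : ES N → ℝ := fun x => mm h' x s with hHs
  have hHsm : ContDiff ℝ (⊤ : ℕ∞) Hs := mm_contDiff hh'i.locallyIntegrable hs
  have hclose : ∀ x ∈ cthickening (δ / 2) T, |Hs x - h x| ≤ ε / 2 := by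
    intro x hx
    refine mm_close hs hh'i.integrableOn fun z hz => ?_
    have hx2 : x ∈ T2 := cthickening_mono (by linarith) _ hx
    have hz2 : z ∈ T2 := by
      have := cthickening_cthickening_subset (ε := δ / 2) (δ := δ / 2) (by linarith) (by linarith) T
      rw [add_halves] at this
      exact this (mem_cthickening_of_dist_le z x _ _ hx ((mem_closedBall.1 hz).trans s1))
    rw [hh', indicator_of_mem hz2]
    have := hu1 z hz2 x hx2 (by have := mem_closedBall.1 hz; linarith)
    rw [Real.dist_eq] at this; exact this.le
  have hTT1 : T ⊆ cthickening (δ / 2) T := self_subset_cthickening T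
  set jd : ℝ → ℝ := fun u => Real.smoothTransition (u / ε - 1) with hjd
  have hjdz : ∀ u, u ≤ ε → jd u = 0 := fun u hu =>
    Real.smoothTransition.zero_of_nonpos (by rw [sub_nonpos, div_le_one hε]; exact hu)
  have hjds : ContDiff ℝ (⊤ : ℕ∞) jd := st_contDiff.comp ((contDiff_id.div_const _).sub contDiff_const)
  set w0 : ES N → ℝ := fun x => φ x * jd (Hs x) with hw0
  have hw0s : ContDiff ℝ (⊤ : ℕ∞) w0 := hφ.mul (hjds.comp hHsm)
  have hw0c : HasCompactSupport w0 := hc.mul_right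
  have hw0S : tsupport w0 ⊆ S := by
    refine tsupport_subset_of hSc.isClosed fun x hx => ?_
    have hx1 : x ∈ T := by
      by_contra hxn; exact hx (by simp [hw0, image_eq_zero_of_notMem_tsupport hxn])
    refine ⟨hx1, ?_⟩
    have h1 : ε < Hs x := by
      by_contra hn; exact hx (by simp [hw0, hjdz _ (not_lt.1 hn)])
    have := (abs_le.1 (hclose x (hTT1 hx1))).2
    rw [mem_preimage, mem_Ici]; linarith
  have hw0nn : ∀ x, 0 ≤ w0 x := by
    intro x
    by_cases hx : x ∈ tsupport w0
    · exact mul_nonneg (hpos x (hSΩ (hw0S hx))) (Real.smoothTransition.nonneg _)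
    · rw [image_eq_zero_of_notMem_tsupport hx]
  set w : ES N → ℝ := fun x => mm w0 x s with hw
  have hw0i : Integrable w0 := hw0s.continuous.integrable_of_hasCompactSupport hw0c
  have hws : ContDiff ℝ (⊤ : ℕ∞) w := mm_contDiff hw0i.locallyIntegrable hs
  have hwsup : tsupport w ⊆ cthickening s S := (mm_tsupport hs).trans (cthickening_subset_of_subset s hw0S)
  have hwΩ : tsupport w ⊆ Ω := hwsup.trans ((cthickening_mono (by linarith) S).trans hδS)
  have hwc : HasCompactSupport w := hSc.cthickening.of_isClosed_subset (isClosed_tsupport _) hwsup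
  have hwT2 : tsupport w ⊆ T2 := hwsup.trans ((cthickening_mono (by linarith) S).trans
    (cthickening_subset_of_subset _ inter_subset_left))
  have hwnn : ∀ x, 0 ≤ w x := fun x => mm_nonneg hs x hw0nn
  -- identities
  have i3 : ∫ x, w0 x * lap Hs x = ∫ x, V x * h x * w x := by
    rw [← green (hHsm.of_le two_le_top) (hw0s.of_le two_le_top) hw0c, hHs]
    have hli : Integrable (lap w0) := (lap_contDiff hw0s).continuous.integrable_of_hasCompactSupport (hcs_lap hw0c)
    simp only
    rw [mm_swap hh'i hli hs, ← H.weak w ⟨hws, hwc, hwΩ⟩]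
    refine integral_congr_ae (Eventually.of_forall fun x => ?_)
    simp only
    rw [← lap_mm hw0s hw0c x hs]
    by_cases hx : x ∈ T2
    · rw [hh', indicator_of_mem hx]
    · have : lap w x = 0 := lap_eq_zero_of_notMem fun h => hx (hwT2 h)
      rw [show lap (fun x => mm w0 x s) x = 0 from this]; simp
  have hjH : ContDiff ℝ (⊤ : ℕ∞) (fun x => jj ε (Hs x)) := (jj_contDiff ε).comp hHsm
  have i1 : ∫ x, jj ε (Hs x) * lap φ x = ∫ x, φ x * lap (fun x => jj ε (Hs x)) x :=
    green (hjH.of_le two_le_top) (hφ.of_le two_le_top) hc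
  have i2 : ∫ x, w0 x * lap Hs x ≤ ∫ x, φ x * lap (fun x => jj ε (Hs x)) x := by
    refine integral_mono ?_ ?_ fun x => ?_
    · exact (hw0s.continuous.mul (lap_contDiff hHsm).continuous).integrable_of_hasCompactSupport hw0c.mul_right
    · exact (hφ.continuous.mul (lap_contDiff hjH).continuous).integrable_of_hasCompactSupport hc.mul_right
    · have hJ := (exists_J (hHsm.of_le two_le_top).contDiffAt (x := x)).comp
        (φ := jj ε) ((jj_contDiff ε).of_le two_le_top).contDiffAt rfl rfl
      simp only
      rw [hJ.2.2, jj_deriv, hw0]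
      have : 0 ≤ φ x * (deriv (deriv (jj ε)) (Hs x) * ‖gradient Hs x‖ ^ 2) := by
        by_cases hxΩ : x ∈ Ω
        · exact mul_nonneg (hpos x hxΩ) (mul_nonneg (jj_d2_nonneg hε _) (by positivity))
        · by_cases hxT : x ∈ T
          · have := (abs_le.1 (hclose x (hTT1 hxT))).2
            rw [H.h0 x hxΩ] at this
            rw [jj_d2_zero hε (by linarith)]; simp
          · rw [image_eq_zero_of_notMem_tsupport hxT]; simp
      rw [jj_deriv] at this
      simp only [hjd]
      nlinarith
  have hhlap : Integrable (fun x => h x * lap φ x) := by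
    have := integrable_mul_of_supp (lap_contDiff hφ).continuous (hcs_lap hc) (tsupport_lap_subset φ)
      (H.intOn hTc hy)
    simpa only [mul_comm] using this
  have hlapi : Integrable (lap φ) := (lap_contDiff hφ).continuous.integrable_of_hasCompactSupport (hcs_lap hc)
  have hRi : Integrable (fun x => h x * lap φ x + 3 * ε * |lap φ x|) := hhlap.add (hlapi.abs.const_mul _)
  have i4 : ∫ x, jj ε (Hs x) * lap φ x ≤ ∫ x, h x * lap φ x + 3 * ε * |lap φ x| := by
    refine integral_mono ?_ hRi fun x => ?_
    · exact (hjH.continuous.mul (lap_contDiff hφ).continuous).integrable_of_hasCompactSupport (hcs_lap hc).mul_left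
    · by_cases hx : x ∈ T
      · have b1 := hclose x (hTT1 hx)
        have b2 := jj_lip ε (Hs x) (h x)
        have b3 := jj_le (ε := ε) (H.nn x)
        have b4 := jj_ge hε (h x)
        have b5 : |jj ε (Hs x) - h x| ≤ 3 * ε := by
          rw [abs_le] at b1 b2 ⊢
          have := b2.1; have := b2.2
          have := abs_le.2 b1
          constructor <;> linarith
        have b6 : (jj ε (Hs x) - h x) * lap φ x ≤ 3 * ε * |lap φ x| := by
          refine (le_abs_self _).trans ?_
          rw [abs_mul]; exact mul_le_mul_of_nonneg_right b5 (abs_nonneg _)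
        simp only; linarith
      · have : lap φ x = 0 := lap_eq_zero_of_notMem hx
        simp [this]
  have hVw : 0 ≤ ∫ x, V x * h x * w x :=
    integral_nonneg fun x => mul_nonneg (mul_nonneg (H.V0 x) (H.nn x)) (hwnn x)
  have itot : ∫ x, V x * h x * w x ≤ ∫ x, h x * lap φ x + 3 * ε * |lap φ x| := by
    rw [← i3]; exact i2.trans (i1 ▸ i4)
  refine ⟨w, hws.continuous, hwnn, hVw.trans itot, ?_, ?_⟩
  · rw [← ofReal_integral_eq_lintegral_ofReal (H.Vh_int hws.continuous hwc hwΩ)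
      (Eventually.of_forall fun x => mul_nonneg (mul_nonneg (H.V0 x) (H.nn x)) (hwnn x))]
    exact ENNReal.ofReal_le_ofReal itot
  · intro x hx
    by_cases hxT : x ∈ T
    · have hcon : ∀ k : ℝ, IntegrableOn (fun _ : ES N => k) (closedBall x s) := fun k =>
        integrableOn_const (isCompact_closedBall x s).measure_lt_top.ne
      have := mm_mono hs (hcon (φ x - ε)) hw0i.integrableOn (x := x) fun z hz => by
        have hz1 : z ∈ cthickening (δ / 2) T := mem_cthickening_of_dist_le z x _ _ hxT ((mem_closedBall.1 hz).trans s1)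
        have hz2 := hclose z hz1
        have hz3 := hu1 z (cthickening_mono (by linarith) _ hz1) x (hTT2 hxT) (by have := mem_closedBall.1 hz; linarith)
        have hz4 := hu2 (a := z) (b := x) (by have := mem_closedBall.1 hz; linarith)
        rw [Real.dist_eq] at hz3 hz4
        have c1 := (abs_le.1 hz2).1
        have c2 := (abs_lt.1 hz3).1
        have c3 := (abs_lt.1 hz4).1
        have : jd (Hs z) = 1 := by
          refine Real.smoothTransition.one_of_one_le ?_
          have : 2 ≤ Hs z / ε := by rw [le_div_iff₀ hε]; linarith
          linarith
        rw [hw0]; simp only [this]; linarith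
      rwa [mm_const _ _ hs] at this
    · rw [image_eq_zero_of_notMem_tsupport hxT]
      linarith [hwnn x]

lemma Sol.ext (H : Sol Ω y V h a) {φ : ES N → ℝ} (hφ : ContDiff ℝ (⊤ : ℕ∞) φ)
    (hc : HasCompactSupport φ) (hy : y ∉ tsupport φ) (hpos : ∀ x ∈ Ω, 0 ≤ φ x) :
    0 ≤ ∫ x, h x * lap φ x ∧
      ∫⁻ x, ENNReal.ofReal (V x * h x * φ x) ≤ ENNReal.ofReal (∫ x, h x * lap φ x) := by
  have hhlap : Integrable (fun x => h x * lap φ x) := by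
    have := integrable_mul_of_supp (lap_contDiff hφ).continuous (hcs_lap hc) (tsupport_lap_subset φ)
      (H.intOn hc hy)
    simpa only [mul_comm] using this
  have hlapi : Integrable (lap φ) := (lap_contDiff hφ).continuous.integrable_of_hasCompactSupport (hcs_lap hc)
  have he : ∀ ε : ℝ, ∫ x, h x * lap φ x + 3 * ε * |lap φ x| = (∫ x, h x * lap φ x) + 3 * ε * ∫ x, |lap φ x| := by
    intro ε
    rw [integral_add hhlap (hlapi.abs.const_mul _), integral_const_mul]
  have hεt : Tendsto (fun n : ℕ => 1 / ((n : ℝ) + 1)) atTop (𝓝 0) := tendsto_one_div_add_atTop_nhds_zero_nat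
  have ht : Tendsto (fun n : ℕ => ∫ x, h x * lap φ x + 3 * (1 / ((n : ℝ) + 1)) * |lap φ x|) atTop (𝓝 (∫ x, h x * lap φ x)) := by
    simp_rw [he]
    have := ((hεt.const_mul 3).mul_const (∫ x, |lap φ x|)).const_add (∫ x, h x * lap φ x)
    simpa using this
  have hch := fun n : ℕ => H.ext_aux hφ hc hy hpos (ε := 1 / ((n : ℝ) + 1)) (by positivity)
  choose w hw1 hw2 hw3 hw4 hw5 using hch
  refine ⟨ge_of_tendsto' ht hw3, ?_⟩
  have hF := lintegral_liminf_le (u := atTop) (μ := (volume : Measure (ES N))) (f := fun n x => ENNReal.ofReal (V x * h x * w n x)) fun n =>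
    ((H.Vm.mul H.meas).mul (hw1 n).measurable).ennreal_ofReal
  have hlim : liminf (fun n => ∫⁻ x, ENNReal.ofReal (V x * h x * w n x)) atTop ≤ ENNReal.ofReal (∫ x, h x * lap φ x) := by
    have := (ENNReal.continuous_ofReal.tendsto _).comp ht
    rw [← this.liminf_eq]
    exact liminf_le_liminf (Eventually.of_forall hw4)
  refine le_trans (lintegral_mono fun x => ?_) (hF.trans hlim)
  rcases (H.nn x).eq_or_lt with h0 | h0
  · simp [← h0]
  · have hlo : Tendsto (fun n : ℕ => ENNReal.ofReal (V x * h x * (φ x - 1 / ((n : ℝ) + 1)))) atTop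
        (𝓝 (ENNReal.ofReal (V x * h x * φ x))) := by
      have := (hεt.const_sub (φ x)).const_mul (V x * h x)
      rw [sub_zero] at this
      exact (ENNReal.continuous_ofReal.tendsto _).comp this
    rw [← hlo.liminf_eq]
    refine liminf_le_liminf ?_
    have : ∀ᶠ n : ℕ in atTop, 1 / ((n : ℝ) + 1) < h x / 4 := hεt.eventually (gt_mem_nhds (by linarith))
    filter_upwards [this] with n hn
    refine ENNReal.ofReal_le_ofReal (mul_le_mul_of_nonneg_left (hw5 n x (by linarith)) (mul_nonneg (H.V0 x) (H.nn x)))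
end

section
variable {N : ℕ} {Ω : Set (ES N)} {y : ES N} {V h : ES N → ℝ} {a : ℝ}

lemma Sol.contAt (H : Sol Ω y V h a) {x : ES N} (hx : x ≠ y) : ContinuousAt h x :=
  H.hc.continuousAt (isOpen_compl_singleton.mem_nhds hx)

lemma Sol.submean (H : Sol Ω y V h a) {x : ES N} {s : ℝ} (hs : 0 < s) (hy : y ∉ closedBall x s) :
    h x ≤ mm h x s := by
  have hd : s < dist y x := by rw [mem_closedBall, not_le] at hy; exact hy
  set s0 := (s + dist y x) / 2 with hs0
  have h1 : s < s0 := by rw [hs0]; linarith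
  have h2 : y ∉ closedBall x s0 := by rw [mem_closedBall, not_le, hs0]; linarith
  refine mm_ge (s0 := s0) (H.intOn (isCompact_closedBall x s0) h2) (H.contAt ?_) ?_ ⟨hs, h1⟩
  · rintro rfl; simp at hd; linarith
  · intro r hr
    have := (H.ext (qs_contDiff r x) (qs_hcs hr.1 x)
      (fun hh => h2 (closedBall_subset_closedBall hr.2.le (qs_tsupport hr.1 x hh)))
      (fun z _ => qs_nonneg hr.1 x z)).1
    simpa only [mul_comm] using this

lemma Sol.supermean (H : Sol Ω y V h a) {x : ES N} {s : ℝ} (hs : 0 < s) (hb : ball x (2 * s) ⊆ Ω) :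
    mm h x s ≤ Real.exp a * h x := by
  set s0 := 3 * s / 2 with hs0
  have hsub : closedBall x s0 ⊆ Ω := (closedBall_subset_ball (by rw [hs0]; linarith)).trans hb
  have hyn : y ∉ closedBall x s0 := fun hh => H.yn (hsub hh)
  have := mm_le_exp (u := h) (x := x) (s0 := s0) (Λ := 4 * a / s ^ 2) (H.intOn (isCompact_closedBall x s0) hyn) (H.contAt ?_) ?_
    (s := s) ⟨hs, by rw [hs0]; linarith⟩
  · convert this using 3
    field_simp
  · rintro rfl; exact hyn (mem_closedBall_self (by rw [hs0]; linarith))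
  · intro r hr
    have hrs : closedBall x r ⊆ closedBall x s0 := closedBall_subset_closedBall hr.2.le
    have e1 : ∫ z, lap (qs r x) z * h z = ∫ z, V z * h z * qs r x z := by
      rw [← H.weak (qs r x) ⟨qs_contDiff r x, qs_hcs hr.1 x, (qs_tsupport hr.1 x).trans (hrs.trans hsub)⟩]
      simp only [mul_comm]
    rw [e1]
    unfold mm
    rw [← integral_const_mul]
    refine integral_mono (H.Vh_int (qs_contDiff r x).continuous (qs_hcs hr.1 x) ((qs_tsupport hr.1 x).trans (hrs.trans hsub)))
      ((psi_mul_integrable hr.1 ((H.intOn (isCompact_closedBall x s0) hyn).mono_set hrs)).const_mul _) fun z => ?_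
    by_cases hz : z ∈ closedBall x r
    · have hVz : V z ≤ 4 * a / s ^ 2 := by
        have hd : s / 2 ≤ dista Ω z := by
          refine le_dista H.yn (Subset.trans (fun w hw => ?_) hb)
          have h1 := mem_closedBall.1 (hrs hz)
          have h2 := mem_ball.1 hw
          rw [mem_ball]
          have := dist_triangle w z x
          rw [hs0] at h1; linarith
        rw [le_div_iff₀ (by positivity)]
        have h3 := H.Va z (hsub (hrs hz))
        have h4 : (s / 2) ^ 2 ≤ dista Ω z ^ 2 := pow_le_pow_left₀ (by linarith) hd 2
        nlinarith [H.V0 z]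
      have hq := qs_le hr.1 x z
      have hqn := qs_nonneg hr.1 x z
      have hhn := H.nn z
      have hV0 := H.V0 z
      have hL : 0 ≤ 4 * a / s ^ 2 := hV0.trans hVz
      calc V z * h z * qs r x z ≤ (4 * a / s ^ 2) * h z * (psi r x z / 2) := by gcongr
        _ = _ := by ring
    · rw [mem_closedBall, not_le] at hz
      simp only [qs_zero hr.1 hz.le, psi_zero hr.1 hz.le]; simp

lemma exists_harnack (N : ℕ) (a : ℝ) (ha : 0 ≤ a) : ∃ C : ℝ, 1 ≤ C ∧ ∀ (Ω : Set (ES N)) (y : ES N) (V h : ES N → ℝ),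
    Sol Ω y V h a → ∀ (x z : ES N) (s : ℝ), 0 < s → dist x z ≤ s → ball z (8 * s) ⊆ Ω → h x ≤ C * h z := by
  obtain ⟨C1, hC1, hp1⟩ := exists_psi_le N
  obtain ⟨c1, hc1, hp2⟩ := exists_le_psi N (θ := 1 / 2) (by norm_num) (by norm_num)
  set C := C1 / c1 * 4 ^ N * Real.exp a with hC
  have hCpos : 0 < C := by positivity
  refine ⟨max 1 C, le_max_left _ _, fun Ω y V h H x z s hs hxz hb => ?_⟩
  have hxb : closedBall x s ⊆ Ω := fun w hw => hb (by
    rw [mem_ball]; have := mem_closedBall.1 hw; have := dist_triangle w x z; linarith)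
  have hyx : y ∉ closedBall x s := fun hh => H.yn (hxb hh)
  have hzb : closedBall z (4 * s) ⊆ Ω := (closedBall_subset_ball (by linarith)).trans hb
  have hyz : y ∉ closedBall z (4 * s) := fun hh => H.yn (hzb hh)
  have h1 := H.submean hs hyx
  have h2 := H.supermean (x := z) (s := 4 * s) (by linarith) (by rw [← mul_assoc]; norm_num; exact hb)
  have h3 : mm h x s ≤ C1 / c1 * 4 ^ N * mm h z (4 * s) := by
    unfold mm
    rw [← integral_const_mul]
    refine integral_mono (psi_mul_integrable hs (H.intOn (isCompact_closedBall x s) hyx))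
      ((psi_mul_integrable (by linarith) (H.intOn (isCompact_closedBall z (4 * s)) hyz)).const_mul _) fun w => ?_
    have hhn := H.nn w
    by_cases hw : w ∈ closedBall x s
    · have e1 := hp1 s hs x w
      have e2 := hp2 (4 * s) (by linarith) z w (by
        have := mem_closedBall.1 hw; have := dist_triangle w x z; linarith)
      have e3 : C1 * (s ^ N)⁻¹ = C1 / c1 * 4 ^ N * (c1 * ((4 * s) ^ N)⁻¹) := by
        rw [mul_pow]; field_simp
      have : psi s x w ≤ C1 / c1 * 4 ^ N * psi (4 * s) z w := by
        refine e1.trans ?_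
        rw [e3]
        exact mul_le_mul_of_nonneg_left e2 (by positivity)
      simp only; rw [← mul_assoc]
      exact mul_le_mul_of_nonneg_right this hhn
    · rw [mem_closedBall, not_le] at hw
      have := psi_nonneg (show 0 < 4 * s by linarith) z w
      simp only [psi_zero hs hw.le, zero_mul]
      positivity
  have hz0 := H.nn z
  calc h x ≤ C1 / c1 * 4 ^ N * (Real.exp a * h z) := (h1.trans h3).trans (mul_le_mul_of_nonneg_left h2 (by positivity))
    _ = C * h z := by rw [hC]; ring
    _ ≤ _ := mul_le_mul_of_nonneg_right (le_max_right _ _) hz0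

/-- chain along a segment -/
lemma harnack_chain {C : ℝ} (hC1 : 1 ≤ C) (hC : ∀ (x z : ES N) (s : ℝ), 0 < s → dist x z ≤ s → ball z (8 * s) ⊆ Ω → h x ≤ C * h z)
    {s : ℝ} (hs : 0 < s) : ∀ (n : ℕ) (x z : ES N), dist x z ≤ n * s →
    (∀ w ∈ segment ℝ x z, ball w (8 * s) ⊆ Ω) → h x ≤ C ^ n * h z := by
  intro n
  induction n with
  | zero =>
    intro x z hd _
    simp only [Nat.cast_zero, zero_mul] at hd
    rw [dist_le_zero.1 hd]; simp
  | succ n ih =>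
    intro x z hd hseg
    set t : ℝ := 1 / ((n : ℝ) + 1) with ht
    have hn : (0:ℝ) < (n : ℝ) + 1 := by positivity
    have ht0 : 0 < t := by positivity
    have ht1 : t ≤ 1 := by rw [ht, div_le_one hn]; linarith [(Nat.cast_nonneg n : (0:ℝ) ≤ n)]
    set x' := AffineMap.lineMap x z t with hx'
    have hx's : x' ∈ segment ℝ x z := by
      rw [segment_eq_image_lineMap]; exact ⟨t, ⟨ht0.le, ht1⟩, rfl⟩
    push_cast at hd
    have d1 : dist x x' ≤ s := by
      rw [hx', dist_left_lineMap, Real.norm_of_nonneg ht0.le, ht, one_div, inv_mul_le_iff₀ hn]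
      exact hd
    have d2 : dist x' z ≤ n * s := by
      rw [hx', dist_lineMap_right, Real.norm_of_nonneg (by linarith)]
      have : 1 - t = n / (n + 1) := by rw [ht]; field_simp; ring
      rw [this, div_mul_eq_mul_div, div_le_iff₀ hn]
      nlinarith [(Nat.cast_nonneg n : (0:ℝ) ≤ n)]
    have e1 := hC x x' s hs d1 (hseg x' hx's)
    have e2 := ih x' z d2 (fun w hw => hseg w ((convex_segment x z).segment_subset hx's (right_mem_segment ℝ x z) hw))
    calc h x ≤ C * h x' := e1
      _ ≤ C * (C ^ n * h z) := mul_le_mul_of_nonneg_left e2 (by linarith)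
      _ = _ := by ring
end

section
variable {N : ℕ}

lemma J_rpow (e : ℝ) {p x : ES N} (hx : x ≠ p) :
    J (fun z => ‖z - p‖ ^ e) x ((e * ‖x - p‖ ^ (e - 2)) • (x - p)) (e * (N + e - 2) * ‖x - p‖ ^ (e - 2)) := by
  have hR : 0 < ‖x - p‖ := norm_pos_iff.2 (sub_ne_zero.2 hx)
  have hR2 : 0 < ‖x - p‖ ^ 2 := by positivity
  have e0 : ∀ (b r : ℝ), 0 ≤ r → (r ^ 2) ^ (b / 2) = r ^ b := by
    intro b r hr
    rw [← Real.rpow_natCast r 2, ← Real.rpow_mul hr]; congr 1; push_cast; ring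
  have hd1 : ∀ t : ℝ, 0 < t → deriv (fun t : ℝ => t ^ (e / 2)) t = (e / 2) * t ^ (e / 2 - 1) := by
    intro t ht
    exact (Real.hasDerivAt_rpow_const (Or.inl ht.ne')).deriv
  have hd2 : deriv (deriv (fun t : ℝ => t ^ (e / 2))) (‖x - p‖ ^ 2) =
      (e / 2) * ((e / 2 - 1) * (‖x - p‖ ^ 2) ^ (e / 2 - 1 - 1)) := by
    have : deriv (fun t : ℝ => t ^ (e / 2)) =ᶠ[𝓝 (‖x - p‖ ^ 2)] fun t => (e / 2) * t ^ (e / 2 - 1) := by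
      filter_upwards [lt_mem_nhds hR2] with t ht using hd1 t ht
    rw [this.deriv_eq]
    exact ((Real.hasDerivAt_rpow_const (Or.inl hR2.ne')).const_mul _).deriv
  have h1 := (J_sq p x).comp (φ := fun t : ℝ => t ^ (e / 2))
    (Real.contDiffAt_rpow_const_of_ne hR2.ne') (hd1 _ hR2) hd2
  refine (h1.of_eq ?_ ?_).congr (Eventually.of_forall fun z => (e0 e _ (norm_nonneg _)).symm)
  · rw [show e / 2 - 1 = (e - 2) / 2 by ring, e0 _ _ hR.le, smul_smul]; congr 1; ring
  · rw [show e / 2 - 1 - 1 = (e - 4) / 2 by ring, show e / 2 - 1 = (e - 2) / 2 by ring, e0 _ _ hR.le, e0 _ _ hR.le]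
    have : ‖x - p‖ ^ (e - 2) = ‖x - p‖ ^ (e - 4) * ‖x - p‖ ^ 2 := by
      rw [← Real.rpow_natCast, ← Real.rpow_add hR]; congr 1; push_cast; ring
    rw [norm_smul, Real.norm_of_nonneg (by norm_num : (0:ℝ) ≤ 2), this]
    ring

lemma J_tau_rpow (e : ℝ) {ν p x : ES N} (hx : x ≠ p) :
    J (fun z => inner ℝ ν (z - p) * ‖z - p‖ ^ e) x
      (inner ℝ ν (x - p) • ((e * ‖x - p‖ ^ (e - 2)) • (x - p)) + ‖x - p‖ ^ e • ν)
      (inner ℝ ν (x - p) * (e * (N + e)) * ‖x - p‖ ^ (e - 2)) := by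
  refine ((J_lin ν p x).mul (J_rpow e hx)).of_eq rfl ?_
  rw [inner_smul_right]; ring

lemma J_tau2_rpow (e : ℝ) {ν p x : ES N} (hν : ‖ν‖ = 1) (hx : x ≠ p) :
    J (fun z => inner ℝ ν (z - p) * (inner ℝ ν (z - p) * ‖z - p‖ ^ e)) x
      (inner ℝ ν (x - p) • (inner ℝ ν (x - p) • ((e * ‖x - p‖ ^ (e - 2)) • (x - p)) + ‖x - p‖ ^ e • ν)
        + (inner ℝ ν (x - p) * ‖x - p‖ ^ e) • ν)
      (inner ℝ ν (x - p) ^ 2 * (e * (N + e + 2)) * ‖x - p‖ ^ (e - 2) + 2 * ‖x - p‖ ^ e) := by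
  refine ((J_lin ν p x).mul (J_tau_rpow e hx)).of_eq rfl ?_
  rw [inner_add_right, inner_smul_right, inner_smul_right, inner_smul_right, real_inner_self_eq_norm_sq, hν]; ring

/-- harmonic kernel -/
def Pk (N : ℕ) (ν p : ES N) (z : ES N) : ℝ := inner ℝ ν (z - p) * ‖z - p‖ ^ (-(N : ℝ))

def kap (N : ℕ) (α : ℝ) : ℝ := α * (N - α)
def MM (N : ℕ) (α : ℝ) : ℝ := 2 * N ^ 2 / kap N α
def gam (N : ℕ) (α : ℝ) : ℝ := 1 + α - N

def Bf (N : ℕ) (α : ℝ) (ν p : ES N) (z : ES N) : ℝ :=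
  ‖z - p‖ ^ gam N α + MM N α * (inner ℝ ν (z - p) * ‖z - p‖ ^ (gam N α - 1))
    - N * (inner ℝ ν (z - p) * (inner ℝ ν (z - p) * ‖z - p‖ ^ (gam N α - 2)))

lemma J_Pk {ν p x : ES N} (hx : x ≠ p) :
    J (Pk N ν p) x (inner ℝ ν (x - p) • ((-(N:ℝ) * ‖x - p‖ ^ (-(N:ℝ) - 2)) • (x - p)) + ‖x - p‖ ^ (-(N:ℝ)) • ν) 0 :=
  (J_tau_rpow (-(N:ℝ)) hx).of_eq rfl (by ring)

def cst (N : ℕ) (α : ℝ) : ℝ := min (1 / (4 * N ^ 2)) (1 / (4 * MM N α))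

variable {α : ℝ}

lemma kap_pos (hN : 2 ≤ N) (h0 : 0 < α) (h1 : α ≤ 1) : 0 < kap N α := by
  have : (2:ℝ) ≤ N := by exact_mod_cast hN
  exact mul_pos h0 (by linarith)

lemma MM_ge (hN : 2 ≤ N) (h0 : 0 < α) (h1 : α ≤ 1) : 2 * N ≤ MM N α := by
  have h2 : (2:ℝ) ≤ N := by exact_mod_cast hN
  unfold MM
  rw [le_div_iff₀ (kap_pos hN h0 h1)]
  have h3 : kap N α ≤ N := by
    have := mul_le_mul_of_nonneg_right h1 (show (0:ℝ) ≤ N - α by linarith)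
    unfold kap; linarith
  have := mul_le_mul_of_nonneg_left h3 (show (0:ℝ) ≤ 2 * N by linarith)
  linarith

lemma MM_pos (hN : 2 ≤ N) (h0 : 0 < α) (h1 : α ≤ 1) : 0 < MM N α := by
  have h2 : (2:ℝ) ≤ N := by exact_mod_cast hN
  linarith [MM_ge hN h0 h1]

lemma cst_pos (hN : 2 ≤ N) (h0 : 0 < α) (h1 : α ≤ 1) : 0 < cst N α := by
  have h2 : (2:ℝ) ≤ N := by exact_mod_cast hN
  have := MM_pos hN h0 h1
  exact lt_min (by positivity) (by positivity)

lemma abs_tau_le {ν : ES N} (hν : ‖ν‖ = 1) (v : ES N) : |inner ℝ ν v| ≤ ‖v‖ := by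
  have := abs_real_inner_le_norm ν v
  rwa [hν, one_mul] at this

lemma rpow_split {R : ℝ} (hR : 0 < R) (e : ℝ) : R ^ (e - 1) = R ^ e / R ∧ R ^ (e - 2) = R ^ e / R ^ 2 := by
  constructor
  · rw [Real.rpow_sub_one hR.ne']
  · rw [Real.rpow_sub hR]; norm_num

lemma Bf_eq {ν p x : ES N} (hx : x ≠ p) :
    Bf N α ν p x = ‖x - p‖ ^ gam N α * (1 + MM N α * (inner ℝ ν (x - p) / ‖x - p‖)
      - N * (inner ℝ ν (x - p) / ‖x - p‖) ^ 2) := by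
  have hR : 0 < ‖x - p‖ := norm_pos_iff.2 (sub_ne_zero.2 hx)
  unfold Bf
  rw [(rpow_split hR _).1, (rpow_split hR _).2]
  field_simp

lemma tau_div_abs {ν p x : ES N} (hν : ‖ν‖ = 1) (hx : x ≠ p) : |inner ℝ ν (x - p) / ‖x - p‖| ≤ 1 := by
  have hR : 0 < ‖x - p‖ := norm_pos_iff.2 (sub_ne_zero.2 hx)
  rw [abs_div, abs_norm, div_le_one hR]
  exact abs_tau_le hν _

lemma Bf_le (hN : 2 ≤ N) (h0 : 0 < α) (h1 : α ≤ 1) {ν p x : ES N} (hν : ‖ν‖ = 1) (hx : x ≠ p) :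
    Bf N α ν p x ≤ (1 + MM N α) * ‖x - p‖ ^ gam N α := by
  have hR : 0 < ‖x - p‖ := norm_pos_iff.2 (sub_ne_zero.2 hx)
  rw [Bf_eq hx, mul_comm]
  have hc := abs_le.1 (tau_div_abs hν hx)
  have hM := MM_pos hN h0 h1
  refine mul_le_mul_of_nonneg_right ?_ (by positivity)
  have : (0:ℝ) ≤ N * (inner ℝ ν (x - p) / ‖x - p‖) ^ 2 := by positivity
  nlinarith [hc.2]

lemma Bf_ge (hN : 2 ≤ N) (h0 : 0 < α) (h1 : α ≤ 1) {ν p x : ES N} (hν : ‖ν‖ = 1) (hx : x ≠ p)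
    (ht : 0 ≤ inner ℝ ν (x - p)) : ‖x - p‖ ^ gam N α ≤ Bf N α ν p x := by
  have hR : 0 < ‖x - p‖ := norm_pos_iff.2 (sub_ne_zero.2 hx)
  rw [Bf_eq hx]
  have hc := abs_le.1 (tau_div_abs hν hx)
  set c := inner ℝ ν (x - p) / ‖x - p‖
  have hc0 : 0 ≤ c := div_nonneg ht hR.le
  have h2 : (2:ℝ) ≤ N := by exact_mod_cast hN
  have hM := MM_ge hN h0 h1
  refine le_mul_of_one_le_right (by positivity) ?_
  have : c ^ 2 ≤ c := by nlinarith [hc.2]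
  nlinarith

lemma Bf_ge_half (hN : 2 ≤ N) (h0 : 0 < α) (h1 : α ≤ 1) {ν p x : ES N} (hν : ‖ν‖ = 1) (hx : x ≠ p)
    (ht : - cst N α * ‖x - p‖ ≤ inner ℝ ν (x - p)) : ‖x - p‖ ^ gam N α / 2 ≤ Bf N α ν p x := by
  have hR : 0 < ‖x - p‖ := norm_pos_iff.2 (sub_ne_zero.2 hx)
  rcases le_total 0 (inner ℝ ν (x - p)) with h | h
  · have := Bf_ge hN h0 h1 hν hx h
    have : 0 < ‖x - p‖ ^ gam N α := by positivity
    linarith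
  rw [Bf_eq hx, div_eq_mul_inv]
  have hM := MM_ge hN h0 h1
  have hMp := MM_pos hN h0 h1
  have h2 : (2:ℝ) ≤ N := by exact_mod_cast hN
  set c := inner ℝ ν (x - p) / ‖x - p‖ with hcd
  have hc0 : c ≤ 0 := div_nonpos_of_nonpos_of_nonneg h hR.le
  have hc1 : - cst N α ≤ c := by rw [hcd, le_div_iff₀ hR]; exact ht
  have hc2 : -1 ≤ 4 * MM N α * c := by
    have : cst N α ≤ 1 / (4 * MM N α) := min_le_right _ _
    have : -(1 / (4 * MM N α)) ≤ c := by linarith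
    have := mul_le_mul_of_nonneg_left this (show 0 ≤ 4 * MM N α by positivity)
    field_simp at this
    linarith
  refine mul_le_mul_of_nonneg_left ?_ (by positivity)
  have hc3 : N * c ^ 2 ≤ 1 / 32 * 1 := by
    have e1 : (MM N α * c) ^ 2 ≤ (1 / 4) ^ 2 := by
      apply sq_le_sq'
      · linarith
      · nlinarith
    have e2 : (N : ℝ) ≤ MM N α ^ 2 / 2 := by nlinarith
    nlinarith [sq_nonneg c]
  norm_num at hc3 ⊢
  linarith

lemma br_aux {n α c : ℝ} (h2 : 2 ≤ n) (h0 : 0 < α) (h1 : α ≤ 1) (hc : -1 ≤ c) (hc' : c ≤ 1)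
    (hc1 : -(1 / (4 * n ^ 2)) ≤ c) :
    (n - 1 - α) * (1 - α) - 2 * n ^ 2 * c - 2 * n + n * ((n + 1 - α) * (1 + α)) * c ^ 2 ≤ - n := by
  have l1 : (n - 1 - α) * (1 - α) ≤ n - 1 := by
    have e : n - 1 - (n - 1 - α) * (1 - α) = α * (n - α) := by ring
    have : 0 ≤ α * (n - α) := mul_nonneg h0.le (by linarith)
    linarith
  have l2 : (n + 1 - α) * (1 + α) ≤ 2 * n := by
    have e : 2 * n - (n + 1 - α) * (1 + α) = (n - 1 - α) * (1 - α) := by ring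
    have : 0 ≤ (n - 1 - α) * (1 - α) := mul_nonneg (by linarith) (by linarith)
    linarith
  have l3 : n * ((n + 1 - α) * (1 + α)) * c ^ 2 ≤ 2 * n ^ 2 * c ^ 2 := by
    have := mul_le_mul_of_nonneg_left l2 (by positivity : (0:ℝ) ≤ n * c ^ 2)
    linarith
  rcases le_total 0 c with hp | hp
  · have : c ^ 2 ≤ c := by nlinarith
    have := mul_le_mul_of_nonneg_left this (by positivity : (0:ℝ) ≤ 2 * n ^ 2)
    linarith
  · have h3 : -1 ≤ 4 * n ^ 2 * c := by
      have := mul_le_mul_of_nonneg_left hc1 (by positivity : (0:ℝ) ≤ 4 * n ^ 2)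
      have h4 : 4 * n ^ 2 * -(1 / (4 * n ^ 2)) = -1 := by field_simp
      linarith
    have h5 : n ^ 2 * c ^ 2 ≤ 1 / 4 := by
      have h6 : n ^ 2 * c ^ 2 = (n ^ 2 * (-c)) * (-c) := by ring
      rw [h6]
      have : n ^ 2 * (-c) ≤ 1 / 4 := by linarith
      nlinarith
    linarith

set_option maxHeartbeats 800000 in
lemma Bf_lap (hN : 2 ≤ N) (h0 : 0 < α) (h1 : α ≤ 1) {ν p x : ES N} (hν : ‖ν‖ = 1) (hx : x ≠ p) :
    ∃ g l, J (Bf N α ν p) x g l ∧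
      ‖g‖ ≤ (N + MM N α * (N + 2) + N * (N + 3)) * ‖x - p‖ ^ (gam N α - 1) ∧
      (- cst N α * ‖x - p‖ ≤ inner ℝ ν (x - p) → l ≤ - N * ‖x - p‖ ^ (gam N α - 2)) := by
  have hR : 0 < ‖x - p‖ := norm_pos_iff.2 (sub_ne_zero.2 hx)
  have h2 : (2:ℝ) ≤ N := by exact_mod_cast hN
  have hM := MM_ge hN h0 h1
  have hMp := MM_pos hN h0 h1
  have hJ := (((J_rpow (gam N α) hx).add ((J_tau_rpow (gam N α - 1) (ν := ν) hx).cmul (MM N α))).sub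
    ((J_tau2_rpow (gam N α - 2) hν hx).cmul (N:ℝ)))
  refine ⟨_, _, hJ, ?_, ?_⟩
  · have ht := abs_tau_le hν (x - p)
    set τ := inner ℝ ν (x - p) with hτ
    set R := ‖x - p‖ with hRd
    set γ := gam N α with hγ
    have hγb : |γ| ≤ N ∧ |γ - 1| ≤ N ∧ |γ - 2| ≤ N + 1 := by
      rw [hγ]; unfold gam
      refine ⟨abs_le.2 ⟨by linarith, by linarith⟩, abs_le.2 ⟨by linarith, by linarith⟩, abs_le.2 ⟨by linarith, by linarith⟩⟩
    have hP : 0 < R ^ (γ - 1) := by positivity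
    have b1 : R ^ (γ - 2) * R = R ^ (γ - 1) := by
      rw [← Real.rpow_add_one hR.ne']; congr 1; ring
    have b2 : R ^ (γ - 1 - 2) * R = R ^ (γ - 2) := by
      rw [← Real.rpow_add_one hR.ne']; congr 1; ring
    have b3 : R ^ (γ - 2 - 2) * R = R ^ (γ - 1 - 2) := by
      rw [← Real.rpow_add_one hR.ne']; congr 1; ring
    have q2 : 0 < R ^ (γ - 2) := by positivity
    have q3 : 0 < R ^ (γ - 1 - 2) := by positivity
    have q4 : 0 < R ^ (γ - 2 - 2) := by positivity
    have n1 : ‖(γ * R ^ (γ - 2)) • (x - p)‖ ≤ N * R ^ (γ - 1) := by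
      rw [norm_smul, norm_mul, Real.norm_of_nonneg q2.le, mul_assoc, ← hRd, b1, Real.norm_eq_abs]
      exact mul_le_mul_of_nonneg_right hγb.1 hP.le
    have n2 : ‖τ • (((γ - 1) * R ^ (γ - 1 - 2)) • (x - p)) + R ^ (γ - 1) • ν‖ ≤ (N + 1) * R ^ (γ - 1) := by
      refine (norm_add_le _ _).trans ?_
      have : ‖τ • (((γ - 1) * R ^ (γ - 1 - 2)) • (x - p))‖ ≤ N * R ^ (γ - 1) := by
        rw [norm_smul, norm_smul, norm_mul, Real.norm_of_nonneg q3.le, Real.norm_eq_abs, Real.norm_eq_abs, mul_assoc |γ - 1|, ← hRd, b2, ← b1]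
        calc |τ| * (|γ - 1| * R ^ (γ - 2)) ≤ R * (N * R ^ (γ - 2)) := by gcongr; exact hγb.2.1
          _ = _ := by ring
      rw [norm_smul (R ^ (γ - 1)) ν, hν, Real.norm_of_nonneg hP.le]; linarith
    have n3 : ‖τ • (τ • (((γ - 2) * R ^ (γ - 2 - 2)) • (x - p)) + R ^ (γ - 2) • ν) + (τ * R ^ (γ - 2)) • ν‖ ≤ (N + 3) * R ^ (γ - 1) := by
      refine (norm_add_le _ _).trans ?_
      have m1 : ‖(τ * R ^ (γ - 2)) • ν‖ ≤ R ^ (γ - 1) := by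
        rw [norm_smul, hν, mul_one, norm_mul, Real.norm_of_nonneg q2.le, ← b1, Real.norm_eq_abs, mul_comm]
        gcongr
      have m2 : ‖τ • (((γ - 2) * R ^ (γ - 2 - 2)) • (x - p)) + R ^ (γ - 2) • ν‖ ≤ (N + 2) * R ^ (γ - 2) := by
        refine (norm_add_le _ _).trans ?_
        have : ‖τ • (((γ - 2) * R ^ (γ - 2 - 2)) • (x - p))‖ ≤ (N + 1) * R ^ (γ - 2) := by
          rw [norm_smul, norm_smul, norm_mul, Real.norm_of_nonneg q4.le, Real.norm_eq_abs, Real.norm_eq_abs, mul_assoc |γ - 2|, ← hRd, b3, ← b2]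
          calc |τ| * (|γ - 2| * R ^ (γ - 1 - 2)) ≤ R * ((N + 1) * R ^ (γ - 1 - 2)) := by gcongr; exact hγb.2.2
            _ = _ := by ring
        rw [norm_smul (R ^ (γ - 2)) ν, hν, Real.norm_of_nonneg q2.le]; linarith
      have m3 : ‖τ • (τ • (((γ - 2) * R ^ (γ - 2 - 2)) • (x - p)) + R ^ (γ - 2) • ν)‖ ≤ (N + 2) * R ^ (γ - 1) := by
        rw [norm_smul, Real.norm_eq_abs, ← b1]
        calc |τ| * _ ≤ R * ((N + 2) * R ^ (γ - 2)) := by gcongr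
          _ = _ := by ring
      linarith
    refine (norm_sub_le _ _).trans ?_
    have m4 := norm_add_le ((γ * R ^ (γ - 2)) • (x - p)) (MM N α • (τ • (((γ - 1) * R ^ (γ - 1 - 2)) • (x - p)) + R ^ (γ - 1) • ν))
    rw [norm_smul (MM N α), Real.norm_of_nonneg hMp.le] at m4
    rw [norm_smul (N:ℝ), Real.norm_of_nonneg (by linarith : (0:ℝ) ≤ N)]
    have m5 := mul_le_mul_of_nonneg_left n2 hMp.le
    have m6 := mul_le_mul_of_nonneg_left n3 (by linarith : (0:ℝ) ≤ N)
    nlinarith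
  · intro ht
    have hc := abs_le.1 (tau_div_abs hν hx)
    set τ := inner ℝ ν (x - p) with hτ
    set R := ‖x - p‖ with hRd
    have hγ : gam N α = 1 + α - N := rfl
    set γ := gam N α
    have b2 : R ^ (γ - 1 - 2) = R ^ (γ - 2) / R := by
      rw [show γ - 1 - 2 = (γ - 2) - 1 by ring]; exact (rpow_split hR _).1
    have b3 : R ^ (γ - 2 - 2) = R ^ (γ - 2) / R ^ 2 := (rpow_split hR _).2
    have hq : 0 < R ^ (γ - 2) := by positivity
    have hk : MM N α * kap N α = 2 * N ^ 2 := by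
      unfold MM; field_simp [(kap_pos hN h0 h1).ne']
    set c := τ / R with hcd
    have hc1 : - cst N α ≤ c := by rw [hcd, le_div_iff₀ hR]; exact ht
    have key : γ * (N + γ - 2) * R ^ (γ - 2) + MM N α * (τ * ((γ - 1) * (N + (γ - 1))) * R ^ (γ - 1 - 2))
       - N * (τ ^ 2 * ((γ - 2) * (N + (γ - 2) + 2)) * R ^ (γ - 2 - 2) + 2 * R ^ (γ - 2))
       = R ^ (γ - 2) * ((N - 1 - α) * (1 - α) - 2 * N ^ 2 * c - 2 * N + N * ((N + 1 - α) * (1 + α)) * c ^ 2) := by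
      rw [b2, b3, ← hk, hγ, hcd]; unfold kap; field_simp; ring
    rw [key]
    have hbr := br_aux (n := (N:ℝ)) h2 h0 h1 hc.1 hc.2 (hc1.trans' (neg_le_neg (min_le_left _ _)))
    have := mul_le_mul_of_nonneg_left hbr hq.le
    linarith
end

section
/-- Local description of a C^{1,α} boundary through a defining function. -/
structure Geo {N : ℕ} (Ω : Set (ES N)) (y : ES N) (α A ρ : ℝ) (d : ES N → ℝ) (G : ES N → ES N) : Prop where
  hN : 2 ≤ N
  a0 : 0 < α
  a1 : α ≤ 1
  A1 : 1 ≤ A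
  r0 : 0 < ρ
  r1 : ρ ≤ 1
  dy : d y = 0
  tay : ∀ p x, |d x - d p - inner ℝ (G p) (x - p)| ≤ A * ‖x - p‖ ^ (1 + α)
  hol : ∀ x z, ‖G x - G z‖ ≤ A * ‖x - z‖ ^ α
  G1 : ∀ x, 1 ≤ ‖G x‖
  GA : ∀ x ∈ ball y ρ, ‖G x‖ ≤ A
  mem : ∀ x ∈ ball y ρ, (x ∈ Ω ↔ 0 < d x)

lemma frontier_d {N : ℕ} {Ω : Set (ES N)} {y : ES N} {ε : ℝ} (hε : 0 < ε) {d : ES N → ℝ}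
    (hd : Continuous d) (hO : IsOpen Ω) (hy : y ∈ frontier Ω) (h : ∀ x ∈ ball y ε, (x ∈ Ω ↔ 0 < d x)) : d y = 0 := by
  have hyn : y ∉ Ω := by
    rw [hO.frontier_eq] at hy; exact hy.2
  apply le_antisymm
  · by_contra hc
    exact hyn ((h y (mem_ball_self hε)).2 (not_le.1 hc))
  · by_contra hc
    push Not at hc
    have h1 : ∀ᶠ x in 𝓝 y, d x < 0 := hd.continuousAt.eventually_lt continuousAt_const hc
    have h2 := h1.and (ball_mem_nhds y hε)
    have h3 : y ∈ closure Ω := frontier_subset_closure hy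
    obtain ⟨x, hx, hx2⟩ := mem_closure_iff_nhds.1 h3 _ h2
    have := (h x hx.2).1 hx2
    linarith [hx.1]

lemma exists_geo {N : ℕ} (hN : 2 ≤ N) {Ω : Set (ES N)} {y : ES N} {α : ℝ} (h0 : 0 < α) (h1 : α ≤ 1) (hO : IsOpen Ω)
    (hy : y ∈ frontier Ω) (hsm : IsC1AlphaNear Ω α y) : ∃ A ρ d G, Geo Ω y α A ρ d G := by
  obtain ⟨g, i, f, C, ε, hε, hf, hH, hi, hm⟩ := hsm
  set D : ES N → (ES N →L[ℝ] ℝ) := fun x => ((EuclideanSpace.proj i : ES N →L[ℝ] ℝ) - fderiv ℝ f (g x)).comp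
    (g.toContinuousLinearEquiv : ES N →L[ℝ] ES N) with hD
  set G : ES N → ES N := fun x => (InnerProductSpace.toDual ℝ (ES N)).symm (D x) with hG
  set d : ES N → ℝ := fun x => g x i - f (g x) with hdd
  have hinner : ∀ x v, inner ℝ (G x) v = g v i - fderiv ℝ f (g x) (g v) := by
    intro x v
    rw [hG]; simp only
    rw [InnerProductSpace.toDual_symm_apply]; simp [hD]
  have hrp : ((α.toNNReal : ℝ≥0) : ℝ) = α := Real.coe_toNNReal _ h0.le
  have hol0 : ∀ z w, ‖fderiv ℝ f z - fderiv ℝ f w‖ ≤ C * ‖z - w‖ ^ α := by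
    intro z w
    have := hH.dist_le z w
    rwa [dist_eq_norm, dist_eq_norm, hrp] at this
  have hol : ∀ x z, ‖G x - G z‖ ≤ C * ‖x - z‖ ^ α := by
    intro x z
    rw [hG]; simp only
    rw [← map_sub, LinearIsometryEquiv.norm_map]
    have : D x - D z = (fderiv ℝ f (g z) - fderiv ℝ f (g x)).comp (g.toContinuousLinearEquiv : ES N →L[ℝ] ES N) := by
      ext v; simp [hD]
    rw [this]
    refine ContinuousLinearMap.opNorm_le_bound _ (by positivity) fun v => ?_
    have h2 := hol0 (g z) (g x)
    rw [← map_sub, LinearIsometryEquiv.norm_map, norm_sub_rev z x] at h2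
    refine ((fderiv ℝ f (g z) - fderiv ℝ f (g x)).le_opNorm (g v)).trans ?_
    rw [LinearIsometryEquiv.norm_map]
    gcongr
  have htay : ∀ p x, |d x - d p - inner ℝ (G p) (x - p)| ≤ C * ‖x - p‖ ^ (1 + α) := by
    intro p x
    have hx : ∀ w ∈ closedBall (g p) ‖g x - g p‖, ‖fderiv ℝ f w - fderiv ℝ f (g p)‖ ≤ C * ‖g x - g p‖ ^ α := by
      intro w hw
      rw [mem_closedBall, dist_eq_norm] at hw
      exact (hol0 _ _).trans (by gcongr)
    have h2 := (convex_closedBall (g p) ‖g x - g p‖).norm_image_sub_le_of_norm_fderiv_le' (𝕜 := ℝ) (f := f)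
      (fun w _ => (hf.differentiable one_ne_zero).differentiableAt) hx
      (mem_closedBall_self (norm_nonneg _)) (show g x ∈ closedBall (g p) ‖g x - g p‖ by
        rw [mem_closedBall, dist_eq_norm])
    rw [← map_sub, LinearIsometryEquiv.norm_map, Real.norm_eq_abs] at h2
    have e : d x - d p - inner ℝ (G p) (x - p) = -(f (g x) - f (g p) - fderiv ℝ f (g p) (g (x - p))) := by
      rw [hinner, hdd]; simp only [map_sub, PiLp.sub_apply]; ring
    rw [e, abs_neg, add_comm 1 α]
    refine h2.trans (le_of_eq ?_)
    rcases (norm_nonneg (x - p)).eq_or_lt with h | h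
    · rw [← h, Real.zero_rpow (by linarith : α + 1 ≠ 0), mul_zero, mul_zero]
    · rw [Real.rpow_add_one h.ne']; ring
  have hG1 : ∀ x, 1 ≤ ‖G x‖ := by
    intro x
    have hz : fderiv ℝ f (g x) (EuclideanSpace.single i 1) = 0 := by
      have h3 := ((hf.differentiable one_ne_zero).differentiableAt (x := g x)).hasFDerivAt.hasLineDerivAt (EuclideanSpace.single i 1)
      have h4 : HasLineDerivAt ℝ f 0 (g x) (EuclideanSpace.single i 1) := by
        unfold HasLineDerivAt
        refine (hasDerivAt_const (0:ℝ) (f (g x))).congr_of_eventuallyEq (Eventually.of_forall fun t => ?_)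
        apply hi
        intro j hj
        simp [hj]
      exact HasDerivAt.unique h3 h4
    have h5 := hinner x (g.symm (EuclideanSpace.single i 1))
    rw [LinearIsometryEquiv.apply_symm_apply, hz] at h5
    have h6 := real_inner_le_norm (G x) (g.symm (EuclideanSpace.single i 1))
    rw [h5, LinearIsometryEquiv.norm_map g.symm] at h6
    have h7 : ‖(EuclideanSpace.single i (1:ℝ) : ES N)‖ = 1 := by simp
    have h8 : (EuclideanSpace.single i (1:ℝ) : ES N) i = 1 := by simp
    rw [h7, h8] at h6; linarith
  have hmem : ∀ x ∈ ball y ε, (x ∈ Ω ↔ 0 < d x) := by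
    intro x hx; rw [hm x hx, hdd]; simp only [sub_pos]
  have hdc : Continuous d := by
    have := hf.continuous
    rw [hdd]; fun_prop
  refine ⟨1 + C + ‖G y‖, min ε 1, d, G, hN, h0, h1, ?_, lt_min hε one_pos, min_le_right _ _,
    frontier_d hε hdc hO hy hmem, ?_, ?_, hG1, ?_, ?_⟩
  · have : (0:ℝ) ≤ C := C.2
    linarith [norm_nonneg (G y)]
  · intro p x
    refine (htay p x).trans ?_
    gcongr; linarith [norm_nonneg (G y)]
  · intro p x
    refine (hol p x).trans ?_
    gcongr; linarith [norm_nonneg (G y)]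
  · intro x hx
    have h6 := hol x y
    have h7 : ‖x - y‖ ^ α ≤ 1 := by
      apply Real.rpow_le_one (norm_nonneg _) _ h0.le
      rw [← dist_eq_norm]; exact (mem_ball.1 hx).le.trans (min_le_right _ _)
    have h8 : ‖G x‖ ≤ ‖G x - G y‖ + ‖G y‖ := by
      simpa using norm_add_le (G x - G y) (G y)
    have : (C:ℝ) * ‖x - y‖ ^ α ≤ C := mul_le_of_le_one_right C.2 h7
    linarith
  · intro x hx
    exact hmem x (ball_subset_ball (min_le_left _ _) hx)
end

section
variable {N : ℕ} {Ω : Set (ES N)} {y : ES N} {α A ρ : ℝ} {d : ES N → ℝ} {G : ES N → ES N}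

def nv (G : ES N → ES N) (p : ES N) : ES N := ‖G p‖⁻¹ • G p

lemma Geo.nv_norm (H : Geo Ω y α A ρ d G) (p : ES N) : ‖nv G p‖ = 1 := by
  have := H.G1 p
  unfold nv
  rw [norm_smul, norm_inv, norm_norm, inv_mul_cancel₀ (by linarith)]

lemma Geo.inner_G (H : Geo Ω y α A ρ d G) (p v : ES N) : inner ℝ (G p) v = ‖G p‖ * inner ℝ (nv G p) v := by
  have := H.G1 p
  unfold nv
  rw [real_inner_smul_left, ← mul_assoc, mul_inv_cancel₀ (by linarith), one_mul]

lemma Geo.d_ge (H : Geo Ω y α A ρ d G) (p x : ES N) :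
    d p + ‖G p‖ * inner ℝ (nv G p) (x - p) - A * ‖x - p‖ ^ (1 + α) ≤ d x := by
  have := (abs_le.1 (H.tay p x)).1
  rw [H.inner_G] at this; linarith

lemma Geo.d_le (H : Geo Ω y α A ρ d G) (p x : ES N) :
    d x ≤ d p + ‖G p‖ * inner ℝ (nv G p) (x - p) + A * ‖x - p‖ ^ (1 + α) := by
  have := (abs_le.1 (H.tay p x)).2
  rw [H.inner_G] at this; linarith

lemma Geo.rpow_le_one' (H : Geo Ω y α A ρ d G) {r : ℝ} (h0 : 0 ≤ r) (h1 : r ≤ 1) : r ^ (1 + α) ≤ r := by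
  have := Real.rpow_le_rpow_of_exponent_ge' h0 h1 zero_le_one (show (1:ℝ) ≤ 1 + α by linarith [H.a0])
  rwa [Real.rpow_one] at this

lemma Geo.d_lip (H : Geo Ω y α A ρ d G) {p x : ES N} (hp : p ∈ ball y ρ) (hx : ‖x - p‖ ≤ 1) :
    |d x - d p| ≤ 2 * A * ‖x - p‖ := by
  have h1 := H.tay p x
  have h2 := abs_real_inner_le_norm (G p) (x - p)
  have h3 := mul_le_mul_of_nonneg_right (H.GA p hp) (norm_nonneg (x - p))
  have h4 := mul_le_mul_of_nonneg_left (H.rpow_le_one' (norm_nonneg (x - p)) hx) (show 0 ≤ A by linarith [H.A1])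
  have h5 : |d x - d p| ≤ |d x - d p - inner ℝ (G p) (x - p)| + |inner ℝ (G p) (x - p)| := by
    simpa using abs_add_le (d x - d p - inner ℝ (G p) (x - p)) (inner ℝ (G p) (x - p))
  linarith

lemma Geo.d_le_R (H : Geo Ω y α A ρ d G) {p : ES N} (hp : p ∈ ball y ρ) : |d p| ≤ 2 * A * ‖p - y‖ := by
  have := H.d_lip (mem_ball_self H.r0) (x := p) (by
    rw [← dist_eq_norm]; exact (mem_ball.1 hp).le.trans H.r1)
  rwa [H.dy, sub_zero] at this

lemma Geo.ball_sub (H : Geo Ω y α A ρ d G) {p : ES N} (hp : p ∈ ball y (ρ / 2)) : ball p (d p / (2 * A)) ⊆ Ω := by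
  intro x hx
  have hA := H.A1
  have hr := H.r0
  have hp' : p ∈ ball y ρ := ball_subset_ball (by linarith) hp
  rw [mem_ball, dist_eq_norm] at hx hp
  have h1 := H.d_le_R hp'
  have h2 : d p / (2 * A) ≤ ‖p - y‖ := by
    rw [div_le_iff₀ (by linarith)]; linarith [le_abs_self (d p)]
  have hx1 : x ∈ ball y ρ := by
    rw [mem_ball, dist_eq_norm]
    have := norm_add_le (x - p) (p - y)
    rw [sub_add_sub_cancel] at this; linarith
  rw [H.mem x hx1]
  have h3 := H.d_lip hp' (x := x) (by linarith [H.r1])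
  rw [lt_div_iff₀ (by linarith)] at hx
  have := (abs_le.1 h3).1
  linarith

lemma Pk_le {ν p x : ES N} (hν : ‖ν‖ = 1) (hx : x ≠ p) : Pk N ν p x ≤ ‖x - p‖ ^ (1 - (N:ℝ)) := by
  have hR : 0 < ‖x - p‖ := norm_pos_iff.2 (sub_ne_zero.2 hx)
  unfold Pk
  have := (le_abs_self _).trans (abs_tau_le hν (x - p))
  calc _ ≤ ‖x - p‖ * ‖x - p‖ ^ (-(N:ℝ)) := by gcongr
    _ = _ := by rw [show 1 - (N:ℝ) = 1 + -(N:ℝ) by ring, Real.rpow_add hR, Real.rpow_one]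

/-- lower barrier -/
def Pm (N : ℕ) (α A : ℝ) (ν p : ES N) (z : ES N) : ℝ := Pk N ν p z - A * Bf N α ν p z

lemma Pm_le (hN : 2 ≤ N) (h0 : 0 < α) (h1 : α ≤ 1) (hA : 0 ≤ A) {ν p x : ES N} (hν : ‖ν‖ = 1) (hx : x ≠ p)
    (ht : 0 ≤ inner ℝ ν (x - p)) : Pm N α A ν p x ≤ Pk N ν p x := by
  have hR : 0 < ‖x - p‖ := norm_pos_iff.2 (sub_ne_zero.2 hx)
  have := Bf_ge hN h0 h1 hν hx ht
  have h2 : 0 < ‖x - p‖ ^ gam N α := by positivity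
  unfold Pm
  nlinarith

lemma Pm_pos_imp (hN : 2 ≤ N) (h0 : 0 < α) (h1 : α ≤ 1) (hA : 0 ≤ A) {ν p x : ES N} (hν : ‖ν‖ = 1) (hx : x ≠ p)
    (ht : 0 ≤ inner ℝ ν (x - p)) (hp : 0 < Pm N α A ν p x) : A * ‖x - p‖ ^ (1 + α) < inner ℝ ν (x - p) := by
  have hR : 0 < ‖x - p‖ := norm_pos_iff.2 (sub_ne_zero.2 hx)
  have h3 := mul_le_mul_of_nonneg_left (Bf_ge hN h0 h1 hν hx ht) hA
  unfold Pm Pk at hp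
  have e : ‖x - p‖ ^ gam N α = ‖x - p‖ ^ (1 + α) * ‖x - p‖ ^ (-(N:ℝ)) := by
    rw [← Real.rpow_add hR]; congr 1
  rw [e] at h3
  have h4 : 0 < ‖x - p‖ ^ (-(N:ℝ)) := by positivity
  have : (A * ‖x - p‖ ^ (1 + α)) * ‖x - p‖ ^ (-(N:ℝ)) < inner ℝ ν (x - p) * ‖x - p‖ ^ (-(N:ℝ)) := by linarith
  exact lt_of_mul_lt_mul_right this h4.le

lemma Pm_J (hN : 2 ≤ N) (h0 : 0 < α) (h1 : α ≤ 1) (hA : 0 < A) {ν p x : ES N} (hν : ‖ν‖ = 1) (hx : x ≠ p) :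
    ∃ g l, J (Pm N α A ν p) x g l ∧ (- cst N α * ‖x - p‖ ≤ inner ℝ ν (x - p) → 0 < l) := by
  obtain ⟨g, l, hJ, -, hl⟩ := Bf_lap hN h0 h1 hν hx
  refine ⟨_, _, (J_Pk hx).sub (hJ.cmul A), fun ht => ?_⟩
  have h2 := hl ht
  have hR : 0 < ‖x - p‖ := norm_pos_iff.2 (sub_ne_zero.2 hx)
  have h3 : 0 < ‖x - p‖ ^ (gam N α - 2) := by positivity
  have h4 : (2:ℝ) ≤ N := by exact_mod_cast hN
  have h5 : l < 0 := by nlinarith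
  have := mul_pos hA (neg_pos.2 h5)
  linarith

lemma Pm_cont (hN : 2 ≤ N) (h0 : 0 < α) (h1 : α ≤ 1) (hA : 0 < A) {ν p x : ES N} (hν : ‖ν‖ = 1) (hx : x ≠ p) :
    ContinuousAt (Pm N α A ν p) x := by
  obtain ⟨g, l, hJ, -⟩ := Pm_J hN h0 h1 hA hν hx
  exact hJ.1.continuousAt

lemma Sol.neg_sub {K : ES N → ℝ} (H : Sol Ω y (fun _ => 0) K 0) {x : ES N} {s : ℝ} (hs : 0 < s) (hb : ball x (2 * s) ⊆ Ω) :
    - K x ≤ mm (fun z => - K z) x s := by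
  have h1 := H.supermean hs hb
  rw [Real.exp_zero, one_mul] at h1
  have : mm (fun z => - K z) x s = - mm K x s := by
    unfold mm; simp only [mul_neg]; rw [integral_neg]
  rw [this]; linarith

lemma Geo.cmp (H : Geo Ω y α A ρ d G) {K : ES N → ℝ} (HK : Sol Ω y (fun _ => 0) K 0) {C : ℝ} (hC1 : 1 ≤ C)
    (hC : ∀ (x z : ES N) (s : ℝ), 0 < s → dist x z ≤ s → ball z (8 * s) ⊆ Ω → K x ≤ C * K z)
    {p : ES N} (hp : p ∈ ball y (ρ / 4)) (hpd : 0 < d p) {R0 : ℝ} (hR0 : 0 < R0) (hR1 : R0 ≤ ρ / 4)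
    {x : ES N} (hx : d p / (32 * A) ≤ ‖x - p‖) (hx0 : 0 ≤ inner ℝ (nv G p) (x - p)) :
    K p * (d p / (32 * A)) ^ ((N:ℝ) - 1) / C * (Pm N α A (nv G p) p x - R0 ^ (1 - (N:ℝ))) ≤ K x := by
  have hA := H.A1
  have hrho := H.r0
  have hN2 : (2:ℝ) ≤ N := by exact_mod_cast H.hN
  set ν := nv G p with hν
  have hν1 : ‖ν‖ = 1 := H.nv_norm p
  set r := d p / (32 * A) with hr
  have hr0 : 0 < r := by positivity
  set lam := K p * r ^ ((N:ℝ) - 1) / C with hlam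
  set b : ES N → ℝ := fun z => Pm N α A ν p z - R0 ^ (1 - (N:ℝ)) with hb
  have hKp := HK.nn p
  have hl0 : 0 ≤ lam := by positivity
  rcases hl0.eq_or_lt with hl | hl
  · rw [← hl, zero_mul]; exact HK.nn x
  by_contra hcon
  push Not at hcon
  change K x < lam * b x at hcon
  have hne : ∀ z, r ≤ ‖z - p‖ → z ≠ p := by
    rintro z hz rfl; rw [sub_self, norm_zero] at hz; linarith
  have hq0 : 0 < R0 ^ (1 - (N:ℝ)) := by positivity
  have prop : ∀ z, r ≤ ‖z - p‖ → 0 ≤ inner ℝ ν (z - p) → 0 ≤ b z →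
      ‖z - p‖ ≤ R0 ∧ 0 < inner ℝ ν (z - p) ∧ z ∈ Ω := by
    intro z h1 h2 h3
    have hz := hne z h1
    have hzR : 0 < ‖z - p‖ := hr0.trans_le h1
    have h4 : R0 ^ (1 - (N:ℝ)) ≤ Pm N α A ν p z := by simp only [hb] at h3; linarith
    have h5 := (Pm_le H.hN H.a0 H.a1 (by linarith : 0 ≤ A) hν1 hz h2)
    have h6 := h4.trans (h5.trans (Pk_le hν1 hz))
    have h7 : ‖z - p‖ ≤ R0 := by
      rwa [Real.rpow_le_rpow_iff_of_neg hR0 hzR (by linarith)] at h6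
    have h8 := Pm_pos_imp H.hN H.a0 H.a1 (by linarith : 0 ≤ A) hν1 hz h2 (hq0.trans_le h4)
    have h9 : 0 ≤ A * ‖z - p‖ ^ (1 + α) := by positivity
    refine ⟨h7, h9.trans_lt h8, ?_⟩
    have hzy : z ∈ ball y ρ := by
      rw [mem_ball, dist_eq_norm] at *
      have := norm_add_le (z - p) (p - y)
      rw [sub_add_sub_cancel] at this; linarith
    rw [H.mem z hzy]
    have h10 := H.d_ge p z
    have h11 := le_mul_of_one_le_left h2 (H.G1 p)
    linarith
  set T : Set (ES N) := {z | r ≤ ‖z - p‖ ∧ 0 ≤ inner ℝ ν (z - p)} with hT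
  have hTc : IsClosed T :=
    (isClosed_le (f := fun _ => r) (g := fun z => ‖z - p‖) continuous_const (by fun_prop)).inter
      (isClosed_le (f := fun _ => (0:ℝ)) (g := fun z => inner ℝ ν (z - p)) continuous_const (by fun_prop))
  have hbc : ContinuousOn b T := fun z hz =>
    ((Pm_cont H.hN H.a0 H.a1 (by linarith) hν1 (hne z hz.1)).sub continuousAt_const).continuousWithinAt
  set S := T ∩ b ⁻¹' Ici 0 with hS
  have hSc : IsClosed S := hbc.preimage_isClosed_of_isClosed hTc isClosed_Ici
  have hScomp : IsCompact S := (isCompact_closedBall p R0).of_isClosed_subset hSc fun z hz => by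
    rw [mem_closedBall, dist_eq_norm]; exact (prop z hz.1.1 hz.1.2 hz.2).1
  have hxb : 0 < b x := by
    by_contra hc
    have := mul_nonpos_of_nonneg_of_nonpos hl.le (not_lt.1 hc)
    linarith [HK.nn x]
  have hxS : x ∈ S := ⟨⟨hx, hx0⟩, hxb.le⟩
  have hSO : ∀ z ∈ S, z ∈ Ω := fun z hz => (prop z hz.1.1 hz.1.2 hz.2).2.2
  have hSy : ∀ z ∈ S, z ≠ y := fun z hz h => HK.yn (h ▸ hSO z hz)
  obtain ⟨w, hwS, hw⟩ := hScomp.exists_isMaxOn ⟨x, hxS⟩ (f := fun z => - K z - -(lam * b z)) (by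
    refine ContinuousOn.sub (ContinuousOn.neg (HK.hc.mono fun z hz => hSy z hz)) (ContinuousOn.neg ?_)
    exact (hbc.mono inter_subset_left).const_smul lam)
  have hwx : - K x - -(lam * b x) ≤ - K w - -(lam * b w) := hw hxS
  have hwpos : K w < lam * b w := by linarith
  have hwb : 0 < b w := by
    by_contra hc
    have := mul_nonpos_of_nonneg_of_nonpos hl.le (not_lt.1 hc)
    linarith [HK.nn w]
  have hwprop := prop w hwS.1.1 hwS.1.2 hwS.2
  have hwr : r < ‖w - p‖ := by
    refine lt_of_le_of_ne hwS.1.1 fun he => ?_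
    have hball : ball w (8 * r) ⊆ Ω := by
      refine Subset.trans ?_ (H.ball_sub (p := p) (ball_subset_ball (by linarith) hp))
      intro z hz
      rw [mem_ball, dist_eq_norm] at *
      have := norm_add_le (z - w) (w - p)
      rw [sub_add_sub_cancel] at this
      have h9 : d p / (2 * A) = 16 * r := by rw [hr]; field_simp; norm_num
      rw [h9]; linarith
    have h1 := hC p w r hr0 (by rw [dist_comm, dist_eq_norm, ← he]) hball
    have h2 : b w ≤ r ^ (1 - (N:ℝ)) := by
      have := (Pm_le H.hN H.a0 H.a1 (by linarith : 0 ≤ A) hν1 (hne w hwS.1.1) hwS.1.2).trans (Pk_le hν1 (hne w hwS.1.1))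
      rw [← he] at this
      simp only [hb]; linarith
    have h3 : lam * b w ≤ lam * r ^ (1 - (N:ℝ)) := mul_le_mul_of_nonneg_left h2 hl.le
    have h4 : lam * r ^ (1 - (N:ℝ)) = K p / C := by
      have : r ^ ((N:ℝ) - 1) * r ^ (1 - (N:ℝ)) = 1 := by
        rw [← Real.rpow_add hr0]; simp
      rw [hlam, div_mul_eq_mul_div, mul_assoc, this, mul_one]
    have h5 : K p / C ≤ K w := by rw [div_le_iff₀ (by linarith)]; linarith
    linarith
  have hwp := hne w hwS.1.1
  obtain ⟨g, l, hJ, hlpos⟩ := Pm_J H.hN H.a0 H.a1 (show 0 < A by linarith) hν1 hwp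
  have hJ2 := ((hJ.sub (J_const (R0 ^ (1 - (N:ℝ))) w)).cmul lam).neg
  have hl1 : 0 < l := hlpos (by
    have := cst_pos H.hN H.a0 H.a1
    have : 0 ≤ cst N α * ‖w - p‖ := by positivity
    linarith [hwprop.2.1])
  obtain ⟨s0, hs0, hs0b⟩ := Metric.isOpen_iff.1 HK.op w hwprop.2.2
  refine no_local_max (h := fun z => - K z) (W := fun z => -(lam * b z)) (x := w) (s0 := s0 / 2) (by linarith) hJ2.1 ?_ ?_ ?_ ?_
  · rw [hJ2.2.2]
    have := mul_pos hl hl1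
    linarith
  · refine (HK.intOn (isCompact_closedBall _ _) fun hh => HK.yn (hs0b ?_)).neg
    exact closedBall_subset_ball (by linarith) hh
  · intro s hs
    exact HK.neg_sub hs.1 ((ball_subset_ball (by linarith [hs.2])).trans hs0b)
  · have e1 : ∀ᶠ z in 𝓝 w, r < ‖z - p‖ :=
      (show Continuous fun z : ES N => ‖z - p‖ by fun_prop).continuousAt.eventually (lt_mem_nhds hwr)
    have e2 : ∀ᶠ z in 𝓝 w, 0 < inner ℝ ν (z - p) :=
      (show Continuous fun z : ES N => inner ℝ ν (z - p) by fun_prop).continuousAt.eventually (lt_mem_nhds hwprop.2.1)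
    have e3 : ∀ᶠ z in 𝓝 w, 0 < b z :=
      ((Pm_cont H.hN H.a0 H.a1 (by linarith) hν1 hwp).sub continuousAt_const).eventually (lt_mem_nhds hwb)
    filter_upwards [e1, e2, e3] with z h1 h2 h3
    exact hw ⟨⟨h1.le, h2.le⟩, h3.le⟩

end

section
variable {N : ℕ} {Ω : Set (ES N)} {y : ES N} {α A ρ : ℝ} {d : ES N → ℝ} {G : ES N → ES N}

lemma small_rpow {α : ℝ} (h0 : 0 < α) (c : ℝ) {r ε : ℝ} (hr : 0 < r) (hε : 0 < ε) :
    ∃ t, 0 < t ∧ t ≤ r ∧ c * t ^ α ≤ ε := by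
  have h1 : Tendsto (fun t : ℝ => c * t ^ α) (𝓝[>] 0) (𝓝 0) := by
    have := (Real.continuousAt_rpow_const 0 α (Or.inr h0.le)).tendsto
    rw [Real.zero_rpow h0.ne'] at this
    simpa using (this.const_mul c).mono_left nhdsWithin_le_nhds
  have h2 := (h1.eventually (ge_mem_nhds hε)).and ((Ioc_mem_nhdsGT hr : Ioc (0:ℝ) r ∈ 𝓝[>] 0))
  obtain ⟨t, ht, ht2⟩ := h2.exists
  exact ⟨t, ht2.1, ht2.2, ht⟩

lemma Geo.nv_lip (H : Geo Ω y α A ρ d G) (p q : ES N) : ‖nv G p - nv G q‖ ≤ 2 * A * ‖p - q‖ ^ α := by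
  have h1 := H.hol p q
  have hp := H.G1 p
  have hq := H.G1 q
  have e : nv G p - nv G q = ‖G p‖⁻¹ • (G p - G q) + (‖G p‖⁻¹ - ‖G q‖⁻¹) • G q := by
    unfold nv; rw [smul_sub, sub_smul]; abel
  have h2 : ‖‖G p‖⁻¹ • (G p - G q)‖ ≤ ‖G p - G q‖ := by
    rw [norm_smul, norm_inv, norm_norm]
    exact mul_le_of_le_one_left (norm_nonneg _) (inv_le_one_of_one_le₀ hp)
  have h3 : ‖(‖G p‖⁻¹ - ‖G q‖⁻¹) • G q‖ ≤ ‖G p - G q‖ := by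
    rw [norm_smul, Real.norm_eq_abs]
    have e2 : ‖G p‖⁻¹ - ‖G q‖⁻¹ = (‖G q‖ - ‖G p‖) / (‖G p‖ * ‖G q‖) := by
      field_simp
    rw [e2, abs_div, abs_of_pos (show 0 < ‖G p‖ * ‖G q‖ by positivity)]
    have h4 := abs_norm_sub_norm_le (G q) (G p)
    rw [norm_sub_rev] at h4
    calc |‖G q‖ - ‖G p‖| / (‖G p‖ * ‖G q‖) * ‖G q‖ = |‖G q‖ - ‖G p‖| / ‖G p‖ := by field_simp
      _ ≤ |‖G q‖ - ‖G p‖| := div_le_self (abs_nonneg _) hp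
      _ ≤ _ := h4
  rw [e]
  have := norm_add_le (‖G p‖⁻¹ • (G p - G q)) ((‖G p‖⁻¹ - ‖G q‖⁻¹) • G q)
  linarith

lemma Pm_ge (hN : 2 ≤ N) (h0 : 0 < α) (h1 : α ≤ 1) (hA : 0 ≤ A) {ν p x : ES N} (hν : ‖ν‖ = 1) (hx : x ≠ p) :
    (inner ℝ ν (x - p) - A * (1 + MM N α) * ‖x - p‖ ^ (1 + α)) * ‖x - p‖ ^ (-(N:ℝ)) ≤ Pm N α A ν p x := by
  have hR : 0 < ‖x - p‖ := norm_pos_iff.2 (sub_ne_zero.2 hx)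
  have h3 := mul_le_mul_of_nonneg_left (Bf_le hN h0 h1 hν hx) hA
  have e : ‖x - p‖ ^ gam N α = ‖x - p‖ ^ (1 + α) * ‖x - p‖ ^ (-(N:ℝ)) := by
    rw [← Real.rpow_add hR]; congr 1
  rw [e] at h3
  unfold Pm Pk
  linarith

/-- first upper bound -/
lemma Geo.ub1 (H : Geo Ω y α A ρ d G) {K : ES N → ℝ} (HK : Sol Ω y (fun _ => 0) K 0) :
    ∃ C r, 0 < C ∧ 0 < r ∧ r ≤ ρ / 4 ∧ ∀ p ∈ ball y r, 0 < d p → K p ≤ C * d p ^ (1 - (N:ℝ)) := by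
  obtain ⟨C, hC1, hC0⟩ := exists_harnack N 0 le_rfl
  have hC := hC0 Ω y _ K HK
  have hA := H.A1
  have hrho := H.r0
  have hN2 : (2:ℝ) ≤ N := by exact_mod_cast H.hN
  have hMM := MM_pos H.hN H.a0 H.a1
  obtain ⟨t1, ht0, ht1, ht2⟩ := small_rpow H.a0 (8 * (A * (1 + MM N α))) (r := ρ / 128) (ε := 1) (by linarith) one_pos
  set ρ1 := t1 / 2 with hρ1
  have hρ0 : 0 < ρ1 := by linarith
  obtain ⟨ρ2, h20, h21, h22⟩ := small_rpow H.a0 (2 * A) (r := ρ1 / 4) (ε := 1 / 4) (by linarith) (by norm_num)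
  set ν := nv G y with hν
  have hν1 : ‖ν‖ = 1 := H.nv_norm y
  set x := y + ρ1 • ν with hx
  have hq : 0 < (2 * ρ1) ^ (-(N:ℝ)) := by positivity
  set b0 := (2 * ρ1) ^ (-(N:ℝ)) * (ρ1 / 4) - (64 * ρ1) ^ (1 - (N:ℝ)) with hb0
  have hb0p : 0 < b0 := by
    have e1 : (64 * ρ1) ^ (1 - (N:ℝ)) = 64 * ρ1 * ((32:ℝ) ^ (-(N:ℝ)) * (2 * ρ1) ^ (-(N:ℝ))) := by
      rw [← Real.mul_rpow (by norm_num) (by positivity), show (1:ℝ) - N = 1 + -N by ring,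
        Real.rpow_add (by positivity), Real.rpow_one]; ring_nf
    have e2 : (32:ℝ) ^ (-(N:ℝ)) ≤ (32:ℝ) ^ (-(2:ℝ)) :=
      Real.rpow_le_rpow_of_exponent_le (by norm_num) (by linarith)
    have e3 : (32:ℝ) ^ (-(2:ℝ)) = 1 / 1024 := by
      rw [Real.rpow_neg (by norm_num)]; norm_num
    rw [e3] at e2
    rw [hb0, e1]
    have e4 : 64 * ρ1 * ((32:ℝ) ^ (-(N:ℝ)) * (2 * ρ1) ^ (-(N:ℝ))) ≤ 64 * ρ1 * (1 / 1024 * (2 * ρ1) ^ (-(N:ℝ))) := by gcongr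
    have e5 := mul_pos hρ0 hq
    linarith
  have hKx := HK.nn x
  refine ⟨K x * C / b0 * (32 * A) ^ ((N:ℝ) - 1) + 1, ρ2, by positivity, h20, by linarith, ?_⟩
  intro p hp hpd
  have hp4 : p ∈ ball y (ρ / 4) := ball_subset_ball (by linarith) hp
  rw [mem_ball, dist_eq_norm] at hp
  have hpr : p ∈ ball y ρ := ball_subset_ball (by linarith) hp4
  set μ := nv G p with hμ
  have hμ1 : ‖μ‖ = 1 := H.nv_norm p
  have hxp : x - p = ρ1 • ν - (p - y) := by rw [hx]; abel
  have hτ : ρ1 / 2 ≤ inner ℝ μ (x - p) := by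
    have i1 : inner ℝ μ (x - p) = ρ1 * inner ℝ μ ν - inner ℝ μ (p - y) := by
      rw [hxp, inner_sub_right, inner_smul_right]
    have i2 : inner ℝ μ (p - y) ≤ ρ2 := ((le_abs_self _).trans (abs_tau_le hμ1 _)).trans hp.le
    have i3 : 3 / 4 ≤ inner ℝ μ ν := by
      have j1 : inner ℝ μ ν = 1 + inner ℝ (μ - ν) ν := by
        rw [inner_sub_left, real_inner_self_eq_norm_sq, hν1]; ring
      have j2 := abs_real_inner_le_norm (μ - ν) ν
      rw [hν1, mul_one] at j2
      have j3 := H.nv_lip p y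
      have j4 : ‖p - y‖ ^ α ≤ ρ2 ^ α := Real.rpow_le_rpow (norm_nonneg _) hp.le H.a0.le
      have j5 : 2 * A * ‖p - y‖ ^ α ≤ 2 * A * ρ2 ^ α := by gcongr
      have j6 := (abs_le.1 j2).1
      rw [j1]; linarith
    rw [i1]
    have := mul_le_mul_of_nonneg_left i3 hρ0.le
    linarith
  have hR1 : ‖x - p‖ ≤ 2 * ρ1 := by
    rw [hxp]
    have := norm_sub_le (ρ1 • ν) (p - y)
    rw [norm_smul, hν1, Real.norm_of_nonneg hρ0.le] at this
    linarith
  have hR2 : ρ1 / 2 ≤ ‖x - p‖ := hτ.trans ((le_abs_self _).trans (abs_tau_le hμ1 _))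
  have hR0 : 0 < ‖x - p‖ := by linarith
  have hne : x ≠ p := by rintro h; rw [h, sub_self, norm_zero] at hR0; exact lt_irrefl _ hR0
  have hdp := (le_abs_self _).trans (H.d_le_R hpr)
  have hrr : d p / (32 * A) ≤ ‖x - p‖ := by
    rw [div_le_iff₀ (by linarith)]
    have : 2 * A * ‖p - y‖ ≤ 2 * A * ρ2 := by gcongr
    have : A * (ρ1 / 2) ≤ A * ‖x - p‖ := by gcongr
    have : A * ρ2 ≤ A * (ρ1 / 4) := by gcongr
    have : 0 < A * ρ1 := by positivity
    linarith
  have hcmp := H.cmp HK hC1 hC hp4 hpd (R0 := 64 * ρ1) (by linarith) (by linarith) hrr (by linarith)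
  have hb : b0 ≤ Pm N α A μ p x - (64 * ρ1) ^ (1 - (N:ℝ)) := by
    have k1 := Pm_ge H.hN H.a0 H.a1 (show 0 ≤ A by linarith) hμ1 hne
    have k2 : A * (1 + MM N α) * ‖x - p‖ ^ (1 + α) ≤ ρ1 / 4 := by
      have k3 : ‖x - p‖ ^ (1 + α) ≤ (2 * ρ1) ^ (1 + α) := Real.rpow_le_rpow hR0.le hR1 (by linarith [H.a0])
      have k4 : (2 * ρ1) ^ (1 + α) = t1 * t1 ^ α := by
        rw [show 2 * ρ1 = t1 by rw [hρ1]; ring, Real.rpow_add ht0, Real.rpow_one]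
      have k5 : A * (1 + MM N α) * ‖x - p‖ ^ (1 + α) ≤ A * (1 + MM N α) * (t1 * t1 ^ α) := by
        rw [← k4]; gcongr
      have k6 := mul_le_mul_of_nonneg_left ht2 ht0.le
      rw [hρ1]; linarith
    have k7 : (2 * ρ1) ^ (-(N:ℝ)) ≤ ‖x - p‖ ^ (-(N:ℝ)) :=
      Real.rpow_le_rpow_of_nonpos hR0 hR1 (by linarith)
    have k8 : (2 * ρ1) ^ (-(N:ℝ)) * (ρ1 / 4) ≤ (inner ℝ μ (x - p) - A * (1 + MM N α) * ‖x - p‖ ^ (1 + α)) * ‖x - p‖ ^ (-(N:ℝ)) := by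
      rw [mul_comm]
      exact mul_le_mul (by linarith) k7 hq.le (by linarith)
    rw [hb0]; linarith
  have hKp := HK.nn p
  have h5 : K p * (d p / (32 * A)) ^ ((N:ℝ) - 1) / C * b0 ≤ K x := by
    refine le_trans ?_ hcmp
    gcongr
  have h6 : (d p / (32 * A)) ^ ((N:ℝ) - 1) = d p ^ ((N:ℝ) - 1) / (32 * A) ^ ((N:ℝ) - 1) :=
    Real.div_rpow hpd.le (by linarith) _
  have h7 : d p ^ (1 - (N:ℝ)) = (d p ^ ((N:ℝ) - 1))⁻¹ := by
    rw [← Real.rpow_neg hpd.le]; congr 1; ring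
  rw [h6] at h5
  rw [h7]
  have h8 : 0 < d p ^ ((N:ℝ) - 1) := by positivity
  have h9 : 0 < (32 * A) ^ ((N:ℝ) - 1) := by positivity
  set X := d p ^ ((N:ℝ) - 1)
  set Y := (32 * A) ^ ((N:ℝ) - 1)
  have h10 : K p * X ≤ K x * C / b0 * Y := by
    have : K p * (X / Y) / C * b0 = K p * X * (b0 / (Y * C)) := by field_simp
    rw [this] at h5
    have h11 : 0 < b0 / (Y * C) := by positivity
    have h12 := (le_div_iff₀ h11).2 h5
    refine h12.trans (le_of_eq ?_)
    field_simp
  rw [← div_eq_mul_inv, le_div_iff₀ h8]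
  linarith

end

section
variable {N : ℕ} {Ω : Set (ES N)} {y : ES N} {α A ρ : ℝ} {d : ES N → ℝ} {G : ES N → ES N}

lemma mem_ball_norm {x y : ES N} {r : ℝ} : x ∈ ball y r ↔ ‖x - y‖ < r := by rw [mem_ball, dist_eq_norm]

lemma Geo.theta_step (H : Geo Ω y α A ρ d G) : ∃ θ r, 0 < θ ∧ θ < 1 ∧ 0 < r ∧ r ≤ ρ / 2 ∧
    ∀ (V h : ES N → ℝ) (a : ℝ), Sol Ω y V h a → ∀ x ∈ ball y r, 0 < d x → 8 * d x < ‖x - y‖ →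
    ∀ M, 0 ≤ M → (∀ z, ‖z - x‖ ≤ 8 * d x → h z ≤ M) → h x ≤ θ * M := by
  obtain ⟨c, hc, hpsi⟩ := exists_le_psi N (θ := 3 / 4) (by norm_num) (by norm_num)
  have hA := H.A1
  have hrho := H.r0
  obtain ⟨r, hr0, hr1, hr2⟩ := small_rpow H.a0 A (r := ρ / 2) (ε := 1 / 8) (by linarith) (by norm_num)
  set ω := (volume (ball (0 : ES N) 1)).toReal with hω
  have hωp : 0 < ω := ENNReal.toReal_pos (measure_ball_pos _ _ one_pos).ne' measure_ball_lt_top.ne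
  have hθ' : 0 < c * ((4:ℝ) ^ N)⁻¹ * ω := by positivity
  refine ⟨max (1 - c * ((4:ℝ) ^ N)⁻¹ * ω) (1 / 2), r, by positivity, max_lt (by linarith) (by norm_num), hr0, hr1, ?_⟩
  intro V h a HS x hx hd hdR M hM hb
  rw [mem_ball_norm] at hx
  set t := 8 * d x with ht
  have ht0 : 0 < t := by linarith
  have hyb : y ∉ closedBall x t := by
    rw [mem_closedBall, dist_comm, dist_eq_norm]; linarith
  set ν := nv G x with hν
  have hν1 : ‖ν‖ = 1 := H.nv_norm x
  set q := x - (t / 2) • ν with hq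
  set B := ball q (t / 4) with hB
  have hBx : ∀ z ∈ B, ‖z - x‖ ≤ 3 / 4 * t ∧ h z = 0 := by
    intro z hz
    rw [hB, mem_ball_norm] at hz
    have e : z - x = (z - q) - (t / 2) • ν := by rw [hq]; abel
    have h1 : ‖z - x‖ ≤ 3 / 4 * t := by
      rw [e]
      have := norm_sub_le (z - q) ((t / 2) • ν)
      rw [norm_smul, hν1, Real.norm_of_nonneg (by linarith)] at this
      linarith
    refine ⟨h1, HS.h0 z ?_⟩
    have hzy : z ∈ ball y ρ := by
      rw [mem_ball_norm]
      have := norm_add_le (z - x) (x - y)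
      rw [sub_add_sub_cancel] at this; linarith
    rw [H.mem z hzy, not_lt]
    have h2 := H.d_le x z
    have h3 : inner ℝ ν (z - x) ≤ - (t / 4) := by
      rw [e, inner_sub_right, inner_smul_right, real_inner_self_eq_norm_sq, hν1]
      have := (le_abs_self _).trans (abs_tau_le hν1 (z - q))
      linarith
    have h4 : ‖G x‖ * inner ℝ ν (z - x) ≤ - (t / 4) := by
      have := H.G1 x
      nlinarith
    have h5 : A * ‖z - x‖ ^ (1 + α) ≤ t / 8 := by
      have h6 : ‖z - x‖ ^ (1 + α) ≤ t ^ (1 + α) := Real.rpow_le_rpow (norm_nonneg _) (by linarith) (by linarith [H.a0])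
      rw [Real.rpow_add ht0, Real.rpow_one] at h6
      have h7 : t ^ α ≤ r ^ α := Real.rpow_le_rpow ht0.le (by linarith) H.a0.le
      have h8 : A * ‖z - x‖ ^ (1 + α) ≤ A * (t * r ^ α) := by
        refine mul_le_mul_of_nonneg_left (h6.trans ?_) (by linarith)
        gcongr
      have h9 := mul_le_mul_of_nonneg_left hr2 ht0.le
      linarith
    linarith
  have hsub := HS.submean ht0 hyb
  have hInt := HS.intOn (isCompact_closedBall x t) hyb
  have hBvol : (volume B).toReal = (t / 4) ^ N * ω := by
    rw [hB, Measure.addHaar_ball_of_pos _ _ (by linarith), ENNReal.toReal_mul, finrank_euclideanSpace_fin,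
      ENNReal.toReal_ofReal (by positivity)]
  have hmain : mm h x t ≤ ∫ z, (M * psi t x z - M * (B.indicator (fun _ => c * (t ^ N)⁻¹) z)) := by
    have hBi : Integrable (B.indicator (fun _ => c * (t ^ N)⁻¹)) := by
      rw [integrable_indicator_iff measurableSet_ball]
      exact integrableOn_const measure_ball_lt_top.ne
    refine integral_mono (psi_mul_integrable ht0 hInt) (((psi_integrable ht0).const_mul M).sub (hBi.const_mul M)) fun z => ?_
    have hp := psi_nonneg ht0 x z
    by_cases hz : z ∈ B
    · obtain ⟨h1, h2⟩ := hBx z hz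
      simp only [indicator_of_mem hz, h2, mul_zero]
      have := hpsi t ht0 x z (by rwa [dist_eq_norm])
      have := mul_le_mul_of_nonneg_left this hM
      linarith
    · simp only [indicator_of_notMem hz, mul_zero, sub_zero]
      by_cases hz2 : ‖z - x‖ ≤ t
      · rw [mul_comm]; exact mul_le_mul_of_nonneg_right (hb z hz2) hp
      · rw [psi_zero ht0 (by rw [dist_eq_norm]; linarith)]; simp
  have hBi : Integrable (B.indicator (fun _ => c * (t ^ N)⁻¹)) := by
    rw [integrable_indicator_iff measurableSet_ball]
    exact integrableOn_const measure_ball_lt_top.ne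
  rw [integral_sub ((psi_integrable ht0).const_mul M) (hBi.const_mul M), integral_const_mul, integral_const_mul,
    psi_integral ht0, integral_indicator measurableSet_ball, setIntegral_const, smul_eq_mul, measureReal_def, hBvol] at hmain
  have e : (t / 4) ^ N * ω * (c * (t ^ N)⁻¹) = c * ((4:ℝ) ^ N)⁻¹ * ω := by
    rw [div_pow]; field_simp
  rw [e] at hmain
  have := mul_le_mul_of_nonneg_right (le_max_left (1 - c * ((4:ℝ) ^ N)⁻¹ * ω) (1 / 2)) hM
  linarith

lemma Geo.theta2 (H : Geo Ω y α A ρ d G) : ∃ θ ε r, 0 < θ ∧ θ < 1 ∧ 0 < ε ∧ ε ≤ 1 / 32 ∧ 0 < r ∧ r ≤ ρ / 2 ∧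
    ∀ (V h : ES N → ℝ) (a : ℝ), Sol Ω y V h a → ∀ x ∈ ball y r, 0 < d x → ∀ l, 0 < l → l ≤ ‖x - y‖ → d x ≤ ε * l →
    ∀ M, 0 ≤ M → (∀ z, ‖z - x‖ ≤ 8 * d x → h z ≤ M * (l - 8 * d x) ^ (1 - (N:ℝ))) → h x ≤ θ * (M * l ^ (1 - (N:ℝ))) := by
  obtain ⟨θ, r, h0, h1, hr0, hr1, hst⟩ := H.theta_step
  have hN2 : (2:ℝ) ≤ N := by exact_mod_cast H.hN
  set ε := (1 - θ) / (32 * N) with hε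
  have hε0 : 0 < ε := div_pos (by linarith) (by linarith)
  have hεN : 32 * (N * ε) = 1 - θ := by rw [hε]; field_simp
  have hε1 : ε ≤ 1 / 32 := by
    have : 2 * ε ≤ N * ε := by gcongr
    linarith
  refine ⟨(1 + θ) / 2, ε, r, by linarith, by linarith, hε0, hε1, hr0, hr1, ?_⟩
  intro V h a HS x hx hd l hl hlR hdl M hM hb
  have hl8 : 0 < l - 8 * d x := by nlinarith
  have h2 := hst V h a HS x hx hd (by linarith) (M * (l - 8 * d x) ^ (1 - (N:ℝ))) (by positivity) hb
  refine h2.trans ?_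
  have hB := one_add_mul_self_le_rpow_one_add (s := -(8 * ε)) (by linarith) (p := (N:ℝ) - 1) (by linarith)
  have h4 : l * (1 + -(8 * ε)) ≤ l - 8 * d x := by linarith
  have h5 : (l - 8 * d x) ^ (1 - (N:ℝ)) ≤ (l * (1 + -(8 * ε))) ^ (1 - (N:ℝ)) :=
    Real.rpow_le_rpow_of_nonpos (mul_pos hl (by linarith)) h4 (by linarith)
  rw [Real.mul_rpow hl.le (by linarith)] at h5
  set X := (1 + -(8 * ε)) ^ ((N:ℝ) - 1) with hX
  have hXe : (1 + -(8 * ε)) ^ (1 - (N:ℝ)) = X⁻¹ := by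
    rw [hX, ← Real.rpow_neg (by linarith)]; congr 1; ring
  rw [hXe] at h5
  have hX0 : 1 - (1 - θ) / 4 ≤ X := by nlinarith
  have hXp : 0 < X := by linarith
  have h6 : θ * X⁻¹ ≤ (1 + θ) / 2 := by
    rw [← div_eq_mul_inv, div_le_iff₀ hXp]
    nlinarith
  have h7 : 0 < l ^ (1 - (N:ℝ)) := by positivity
  calc θ * (M * (l - 8 * d x) ^ (1 - (N:ℝ))) ≤ θ * (M * (l ^ (1 - (N:ℝ)) * X⁻¹)) := by gcongr
    _ = (θ * X⁻¹) * (M * l ^ (1 - (N:ℝ))) := by ring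
    _ ≤ _ := by gcongr

lemma Geo.ub2 (H : Geo Ω y α A ρ d G) {K : ES N → ℝ} (HK : Sol Ω y (fun _ => 0) K 0) :
    ∃ C r, 0 < C ∧ 0 < r ∧ r ≤ ρ / 4 ∧ ∀ x ∈ ball y r, x ≠ y → K x ≤ C * ‖x - y‖ ^ (1 - (N:ℝ)) := by
  obtain ⟨C1, r1, hC1, hr10, hr1ρ, hub⟩ := H.ub1 HK
  obtain ⟨θ, ε, r2, hθ0, hθ1, hε0, hε1, hr20, hr2, hst⟩ := H.theta2
  have hN2 : (2:ℝ) ≤ N := by exact_mod_cast H.hN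
  have hrho1 := H.r1
  set r := min r1 r2 / 2 with hr
  have hr0 : 0 < r := by have := lt_min hr10 hr20; linarith
  have hrr1 : r < r1 := by have := min_le_left r1 r2; linarith
  have hrr2 : r < r2 := by have := min_le_right r1 r2; linarith
  have hcpt : ∀ s, IsCompact {x : ES N | s ≤ ‖x - y‖ ∧ ‖x - y‖ ≤ r} := by
    intro s
    refine (isCompact_closedBall y r).of_isClosed_subset ?_ fun z hz => by rw [mem_closedBall, dist_eq_norm]; exact hz.2
    exact (isClosed_le (f := fun _ => s) (g := fun x : ES N => ‖x - y‖) continuous_const (by fun_prop)).inter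
      (isClosed_le (f := fun x : ES N => ‖x - y‖) (g := fun _ => r) (by fun_prop) continuous_const)
  have hcont : ∀ s, 0 < s → ContinuousOn K {x : ES N | s ≤ ‖x - y‖ ∧ ‖x - y‖ ≤ r} := by
    intro s hs
    refine HK.hc.mono fun z hz => ?_
    rintro rfl
    have := hz.1
    rw [sub_self, norm_zero] at this; linarith
  obtain ⟨B, hB⟩ := (hcpt (r / 2)).bddAbove_image (hcont (r / 2) (by linarith))
  have hB' : ∀ x, r / 2 ≤ ‖x - y‖ → ‖x - y‖ ≤ r → K x ≤ B := fun x h1 h2 => hB ⟨x, ⟨h1, h2⟩, rfl⟩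
  set C2 := max (max B (C1 * ε ^ (1 - (N:ℝ)))) 1 with hC2
  have hC2p : 0 < C2 := by positivity
  have key : ∀ s, 0 < s → ∀ x, s < ‖x - y‖ → ‖x - y‖ ≤ r → K x * (‖x - y‖ - s) ^ ((N:ℝ) - 1) ≤ C2 := by
    intro s hs x hxs hxr
    obtain ⟨w, hw, hmax⟩ := (hcpt s).exists_isMaxOn ⟨x, ⟨hxs.le, hxr⟩⟩
      (f := fun z => K z * (‖z - y‖ - s) ^ ((N:ℝ) - 1)) (by
        refine (hcont s hs).mul ?_
        refine ContinuousOn.rpow_const (by fun_prop) fun z hz => Or.inr (by linarith))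
    have hxw : K x * (‖x - y‖ - s) ^ ((N:ℝ) - 1) ≤ K w * (‖w - y‖ - s) ^ ((N:ℝ) - 1) := hmax ⟨hxs.le, hxr⟩
    refine hxw.trans ?_
    set M := K w * (‖w - y‖ - s) ^ ((N:ℝ) - 1) with hM
    have hws : 0 ≤ ‖w - y‖ - s := by linarith [hw.1]
    have hKw := HK.nn w
    have hM0 : 0 ≤ M := by positivity
    rcases hws.eq_or_lt with h | hl
    · rw [hM, ← h, Real.zero_rpow (by linarith), mul_zero]; exact hC2p.le
    have hle1 : (‖w - y‖ - s) ^ ((N:ℝ) - 1) ≤ 1 := Real.rpow_le_one hws (by linarith [hw.2]) (by linarith)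
    have hwb : w ∈ ball y ρ := by rw [mem_ball_norm]; linarith [hw.2]
    rcases le_total (r / 2) ‖w - y‖ with h | h
    · refine le_trans ?_ ((le_max_left _ _).trans (le_max_left _ _))
      refine le_trans ?_ (hB' w h hw.2)
      exact mul_le_of_le_one_right hKw hle1
    rcases le_or_gt (d w) 0 with hd | hd
    · have : K w = 0 := HK.h0 w fun hh => by
        rw [H.mem w hwb] at hh; linarith
      rw [hM, this, zero_mul]; exact hC2p.le
    set l := ‖w - y‖ - s with hldef
    have hll : l ^ (1 - (N:ℝ)) * l ^ ((N:ℝ) - 1) = 1 := by rw [← Real.rpow_add hl]; simp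
    rcases le_total (d w) (ε * l) with h3 | h3
    · have hz : ∀ z, ‖z - w‖ ≤ 8 * d w → K z ≤ M * (l - 8 * d w) ^ (1 - (N:ℝ)) := by
        intro z hz
        have hlpos : 0 < l - 8 * d w := by nlinarith
        have t1 : ‖w - y‖ - ‖z - w‖ ≤ ‖z - y‖ := by
          have := norm_sub_norm_le (w - y) (w - z)
          rw [sub_sub_sub_cancel_left, norm_sub_rev w z] at this; linarith
        have t2 : ‖z - y‖ ≤ ‖z - w‖ + ‖w - y‖ := by
          have := norm_add_le (z - w) (w - y); rwa [sub_add_sub_cancel] at this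
        have t3 : l - 8 * d w ≤ ‖z - y‖ - s := by linarith
        have hmz : K z * (‖z - y‖ - s) ^ ((N:ℝ) - 1) ≤ M := hmax ⟨by linarith, by nlinarith⟩
        have hKz := HK.nn z
        have t4 : (l - 8 * d w) ^ ((N:ℝ) - 1) ≤ (‖z - y‖ - s) ^ ((N:ℝ) - 1) :=
          Real.rpow_le_rpow hlpos.le t3 (by linarith)
        have t5 : K z * (l - 8 * d w) ^ ((N:ℝ) - 1) ≤ M := (mul_le_mul_of_nonneg_left t4 hKz).trans hmz
        have t6 : (l - 8 * d w) ^ (1 - (N:ℝ)) = ((l - 8 * d w) ^ ((N:ℝ) - 1))⁻¹ := by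
          rw [← Real.rpow_neg hlpos.le]; congr 1; ring
        rw [t6, ← div_eq_mul_inv, le_div_iff₀ (by positivity)]
        exact t5
      have h4 := hst _ K 0 HK w (by rw [mem_ball_norm]; linarith [hw.2]) hd l hl (by linarith) h3 M hM0 hz
      have h5 : M ≤ θ * M := by
        calc M = K w * l ^ ((N:ℝ) - 1) := hM
          _ ≤ θ * (M * l ^ (1 - (N:ℝ))) * l ^ ((N:ℝ) - 1) := by gcongr
          _ = θ * M * (l ^ (1 - (N:ℝ)) * l ^ ((N:ℝ) - 1)) := by ring
          _ = θ * M := by rw [hll, mul_one]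
      nlinarith
    · refine le_trans ?_ ((le_max_right _ _).trans (le_max_left _ _))
      have h4 := hub w (by rw [mem_ball_norm]; linarith [hw.2]) hd
      have h5 : d w ^ (1 - (N:ℝ)) ≤ (ε * l) ^ (1 - (N:ℝ)) :=
        Real.rpow_le_rpow_of_nonpos (by positivity) h3 (by linarith)
      rw [Real.mul_rpow hε0.le hl.le] at h5
      calc M = K w * l ^ ((N:ℝ) - 1) := hM
        _ ≤ C1 * (ε ^ (1 - (N:ℝ)) * l ^ (1 - (N:ℝ))) * l ^ ((N:ℝ) - 1) := by
          gcongr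
          exact h4.trans (by gcongr)
        _ = C1 * ε ^ (1 - (N:ℝ)) * (l ^ (1 - (N:ℝ)) * l ^ ((N:ℝ) - 1)) := by ring
        _ = _ := by rw [hll, mul_one]
  refine ⟨C2 * (2:ℝ)⁻¹ ^ (1 - (N:ℝ)), r, by positivity, hr0, by linarith, ?_⟩
  intro x hx hxy
  rw [mem_ball_norm] at hx
  have hR : 0 < ‖x - y‖ := norm_pos_iff.2 (sub_ne_zero.2 hxy)
  have h1 := key (‖x - y‖ / 2) (by linarith) x (by linarith) hx.le
  rw [show ‖x - y‖ - ‖x - y‖ / 2 = 2⁻¹ * ‖x - y‖ by ring] at h1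
  rw [mul_assoc, ← Real.mul_rpow (by norm_num) hR.le]
  have t6 : (2⁻¹ * ‖x - y‖) ^ (1 - (N:ℝ)) = ((2⁻¹ * ‖x - y‖) ^ ((N:ℝ) - 1))⁻¹ := by
    rw [← Real.rpow_neg (by positivity)]; congr 1; ring
  rw [t6, ← div_eq_mul_inv, le_div_iff₀ (by positivity)]
  exact h1

lemma Geo.decay (H : Geo Ω y α A ρ d G) {K : ES N → ℝ} (HK : Sol Ω y (fun _ => 0) K 0) {η : ℝ} (hη : 0 < η) :
    ∃ κ r, 0 < κ ∧ κ ≤ 1 ∧ 0 < r ∧ r ≤ ρ / 4 ∧ ∀ x ∈ ball y r, x ≠ y → d x ≤ κ * ‖x - y‖ → K x ≤ η * ‖x - y‖ ^ (1 - (N:ℝ)) := by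
  obtain ⟨C, r0, hC, hr0, hrρ, hub⟩ := H.ub2 HK
  obtain ⟨θ, ε, r2, hθ0, hθ1, hε0, hε1, hr20, hr2, hst⟩ := H.theta2
  have hA := H.A1
  have hrho1 := H.r1
  have hN2 : (2:ℝ) ≤ N := by exact_mod_cast H.hN
  have key : ∀ k : ℕ, ∃ κ r, 0 < κ ∧ κ ≤ 1 ∧ 0 < r ∧ r ≤ r0 ∧ r ≤ r2 ∧
      ∀ x ∈ ball y r, x ≠ y → d x ≤ κ * ‖x - y‖ → K x ≤ C * θ ^ k * ‖x - y‖ ^ (1 - (N:ℝ)) := by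
    intro k
    induction k with
    | zero =>
      refine ⟨1, min r0 r2, one_pos, le_rfl, lt_min hr0 hr20, min_le_left _ _, min_le_right _ _, fun x hx hxy _ => ?_⟩
      rw [pow_zero, mul_one]
      exact hub x (ball_subset_ball (min_le_left _ _) hx) hxy
    | succ k ih =>
      obtain ⟨κ, r, hκ, hκ1, hr, hrr0, hrr2, ih⟩ := ih
      refine ⟨min ε (κ / (34 * A)), r / 2, lt_min hε0 (by positivity), (min_le_left _ _).trans (by linarith),
        by linarith, by linarith, by linarith, ?_⟩
      intro x hx hxy hdx
      rw [mem_ball_norm] at hx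
      have hR : 0 < ‖x - y‖ := norm_pos_iff.2 (sub_ne_zero.2 hxy)
      have hxρ : x ∈ ball y ρ := by rw [mem_ball_norm]; linarith
      rcases le_or_gt (d x) 0 with hd | hd
      · have : K x = 0 := HK.h0 x fun hh => by
          rw [H.mem x hxρ] at hh; linarith
        rw [this]; positivity
      have hd1 : d x ≤ ε * ‖x - y‖ := hdx.trans (by gcongr; exact min_le_left _ _)
      have hd2 : d x ≤ κ / (34 * A) * ‖x - y‖ := hdx.trans (by gcongr; exact min_le_right _ _)
      have hl8 : 0 < ‖x - y‖ - 8 * d x := by nlinarith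
      have h1 := hst _ K 0 HK x (by rw [mem_ball_norm]; linarith) hd ‖x - y‖ hR le_rfl hd1 (C * θ ^ k) (by positivity) ?_
      · refine h1.trans (le_of_eq ?_)
        rw [pow_succ]; ring
      intro z hz
      have t1 : ‖x - y‖ - ‖z - x‖ ≤ ‖z - y‖ := by
        have := norm_sub_norm_le (x - y) (x - z)
        rw [sub_sub_sub_cancel_left, norm_sub_rev x z] at this; linarith
      have t2 : ‖z - y‖ ≤ ‖z - x‖ + ‖x - y‖ := by
        have := norm_add_le (z - x) (x - y); rwa [sub_add_sub_cancel] at this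
      have hd8 : 8 * d x ≤ ‖x - y‖ / 4 := by nlinarith
      have hzy : z ≠ y := by
        rintro rfl
        rw [sub_self, norm_zero] at t1; linarith
      have hdz : d z ≤ κ * ‖z - y‖ := by
        have h3 := (abs_le.1 (H.d_lip hxρ (x := z) (by linarith))).2
        have h4 : 2 * A * ‖z - x‖ ≤ 2 * A * (8 * d x) := by gcongr
        have h5 : d z ≤ 17 * A * d x := by nlinarith
        have h6 : 17 * A * d x ≤ 17 * A * (κ / (34 * A) * ‖x - y‖) := by gcongr
        have h7 : 17 * A * (κ / (34 * A) * ‖x - y‖) = κ * (‖x - y‖ / 2) := by field_simp; norm_num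
        have h8 : κ * (‖x - y‖ / 2) ≤ κ * ‖z - y‖ := by gcongr; linarith
        linarith
      refine (ih z (by rw [mem_ball_norm]; linarith) hzy hdz).trans ?_
      have : ‖z - y‖ ^ (1 - (N:ℝ)) ≤ (‖x - y‖ - 8 * d x) ^ (1 - (N:ℝ)) :=
        Real.rpow_le_rpow_of_nonpos hl8 (by linarith) (by linarith)
      gcongr
  obtain ⟨k, hk⟩ := exists_pow_lt_of_lt_one (show 0 < η / C by positivity) hθ1
  obtain ⟨κ, r, hκ, hκ1, hr, hrr0, -, hh⟩ := key k
  refine ⟨κ, r, hκ, hκ1, hr, hrr0.trans hrρ, fun x hx hxy hdx => (hh x hx hxy hdx).trans ?_⟩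
  rw [lt_div_iff₀ hC] at hk
  have : C * θ ^ k ≤ η := by linarith
  gcongr

end

section
variable {N : ℕ} {Ω : Set (ES N)} {y : ES N} {α A ρ : ℝ} {d : ES N → ℝ} {G : ES N → ES N}

def Mw (N : ℕ) (α : ℝ) : ℝ := 2 * (N + 2) / α

/-- local superharmonic function comparable to the distance -/
def Wf (N : ℕ) (α A : ℝ) (ν p : ES N) (z : ES N) : ℝ :=
  inner ℝ ν (z - p) + 2 * A * (‖z - p‖ ^ (1 + α) - Mw N α * (inner ℝ ν (z - p) * ‖z - p‖ ^ α)
    - 2 * N * (inner ℝ ν (z - p) * (inner ℝ ν (z - p) * ‖z - p‖ ^ (α - 1))))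

lemma contDiffAt_norm_rpow (e : ℝ) {p x : ES N} (hx : x ≠ p) {n : WithTop ℕ∞} :
    ContDiffAt ℝ n (fun z => ‖z - p‖ ^ e) x :=
  (ContDiffAt.norm ℝ (contDiffAt_id.sub contDiffAt_const) (sub_ne_zero.2 hx)).rpow_const_of_ne (norm_ne_zero_iff.2 (sub_ne_zero.2 hx))

lemma contDiff_inner_sub (ν p : ES N) {n : WithTop ℕ∞} : ContDiff ℝ n (fun z => inner ℝ ν (z - p)) :=
  contDiff_const.inner ℝ (contDiff_id.sub contDiff_const)

lemma Wf_contDiffAt {ν p x : ES N} (hx : x ≠ p) {n : WithTop ℕ∞} : ContDiffAt ℝ n (Wf N α A ν p) x := by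
  have h1 := (contDiff_inner_sub ν p (n := n)).contDiffAt (x := x)
  unfold Wf
  exact h1.add (contDiffAt_const.mul (((contDiffAt_norm_rpow _ hx).sub (contDiffAt_const.mul (h1.mul (contDiffAt_norm_rpow _ hx)))).sub
    (contDiffAt_const.mul (h1.mul (h1.mul (contDiffAt_norm_rpow _ hx))))))

lemma Mw_pos (hN : 2 ≤ N) (h0 : 0 < α) : 0 < Mw N α := by
  unfold Mw; positivity

lemma Wf_eq {ν p x : ES N} (hx : x ≠ p) : Wf N α A ν p x = inner ℝ ν (x - p) + 2 * A * ‖x - p‖ ^ (1 + α) *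
    (1 - Mw N α * (inner ℝ ν (x - p) / ‖x - p‖) - 2 * N * (inner ℝ ν (x - p) / ‖x - p‖) ^ 2) := by
  have hR : 0 < ‖x - p‖ := norm_pos_iff.2 (sub_ne_zero.2 hx)
  unfold Wf
  rw [Real.rpow_sub_one hR.ne', show 1 + α = α + 1 by ring, Real.rpow_add_one hR.ne']
  field_simp

lemma Wf_key {n c α : ℝ} (hN2 : 2 ≤ n) (h0 : 0 < α) (h1 : α ≤ 1) (hc1 : -1 ≤ c) (hc2 : c ≤ 1) (hcN : - 1 ≤ 10 * (n * c)) :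
    (1 + α) * (n + α - 1) - (2 * (n + 2)) * c * (n + α) - 2 * n * (c ^ 2 * ((α - 1) * (n + α + 1)) + 2) ≤ - n := by
    have k1 : (1 + α) * (n + α - 1) ≤ 2 * n := by nlinarith
    have k2 : (1 - α) * (n + α + 1) ≤ n + 2 := by nlinarith
    have k3 : 2 * n * c ^ 2 * ((1 - α) * (n + α + 1)) ≤ 2 * n * c ^ 2 * (n + 2) := by gcongr
    rcases le_total 0 c with h | h
    · have k4 : c ^ 2 ≤ c := by nlinarith
      have k5 : 2 * n * (n + 2) * c ^ 2 ≤ 2 * n * (n + 2) * c := by gcongr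
      have k6 : 0 ≤ c * α * (n + 2) := by positivity
      linarith
    · have k4 : c ^ 2 ≤ - c := by nlinarith
      have k5 : 2 * n * (n + 2) * c ^ 2 ≤ 2 * n * (n + 2) * (- c) := by gcongr
      have k6 : 2 * (n + 2) * (-c) * (n + α) ≤ 2 * (n + 2) * (-c) * (n + 1) := by
        have : 0 ≤ -c := by linarith
        gcongr
      have k7 : (n + 2) * (n * (-c)) * 4 ≤ (n + 2) * (1 / 10) * 4 := by
        have : n * (-c) ≤ 1 / 10 := by linarith
        gcongr
      have k8 : 2 * (n + 2) * (-c) ≤ 2 * n * (2 * (- c)) := by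
        have : 0 ≤ -c := by linarith
        nlinarith
      linarith

set_option maxHeartbeats 1000000 in
lemma Wf_spec (hN : 2 ≤ N) (h0 : 0 < α) (h1 : α ≤ 1) (hA : 0 < A) {ν p x : ES N} (hν : ‖ν‖ = 1) (hx : x ≠ p)
    (hs : 2 * A * (10 * N + 4 * Mw N α) * ‖x - p‖ ^ α ≤ 1 / 2) :
    ∃ g l, J (Wf N α A ν p) x g l ∧ ‖g‖ ≤ 2 ∧ Wf N α A ν p x ≤ 2 * ‖x - p‖ ∧
      (- (A * ‖x - p‖ ^ (1 + α)) ≤ inner ℝ ν (x - p) → l ≤ - (2 * A * N * ‖x - p‖ ^ (α - 1)) ∧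
        inner ℝ ν (x - p) / 2 + A * ‖x - p‖ ^ (1 + α) ≤ Wf N α A ν p x) := by
  have hR : 0 < ‖x - p‖ := norm_pos_iff.2 (sub_ne_zero.2 hx)
  have hN2 : (2:ℝ) ≤ N := by exact_mod_cast hN
  have hM := Mw_pos hN h0
  have hMe : Mw N α * α = 2 * (N + 2) := by unfold Mw; field_simp
  have hcb := tau_div_abs hν hx
  have hta := abs_tau_le hν (x - p)
  have hRa : 0 < ‖x - p‖ ^ α := by positivity
  refine ⟨_, _, (J_lin ν p x).add (((J_rpow (1 + α) hx).sub ((J_tau_rpow α hx).cmul (Mw N α))).sub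
    ((J_tau2_rpow (α - 1) hν hx).cmul (2 * N)) |>.cmul (2 * A)), ?_, ?_, ?_⟩
  · set R := ‖x - p‖ with hRd
    set τ := inner ℝ ν (x - p) with hτ
    have e1 : ‖((1 + α) * R ^ (1 + α - 2)) • (x - p)‖ ≤ 2 * R ^ α := by
      rw [norm_smul, ← hRd, Real.norm_of_nonneg (by positivity), show 1 + α - 2 = α - 1 by ring, Real.rpow_sub_one hR.ne']
      rw [mul_assoc, div_mul_cancel₀ _ hR.ne']
      gcongr; linarith
    have e2 : ‖τ • ((α * R ^ (α - 2)) • (x - p)) + R ^ α • ν‖ ≤ 2 * R ^ α := by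
      refine (norm_add_le _ _).trans ?_
      rw [norm_smul, norm_smul, norm_smul, hν, ← hRd, Real.norm_of_nonneg hRa.le, Real.norm_of_nonneg (by positivity : 0 ≤ α * R ^ (α - 2)),
        Real.norm_eq_abs, (rpow_split hR _).2]
      have : |τ| * (α * (R ^ α / R ^ 2) * R) ≤ R * (α * (R ^ α / R ^ 2) * R) := by gcongr
      have e : R * (α * (R ^ α / R ^ 2) * R) = α * R ^ α := by field_simp
      nlinarith
    have e3 : ‖τ • (τ • (((α - 1) * R ^ (α - 1 - 2)) • (x - p)) + R ^ (α - 1) • ν) + (τ * R ^ (α - 1)) • ν‖ ≤ 3 * R ^ α := by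
      have hR1 : R ^ (α - 1) = R ^ α / R := Real.rpow_sub_one hR.ne' _
      have hR3 : R ^ (α - 1 - 2) = R ^ α / R ^ 3 := by
        rw [show α - 1 - 2 = α - (3:ℕ) by push_cast; ring, Real.rpow_sub hR, Real.rpow_natCast]
      have t1 : ‖τ • (R ^ (α - 1) • ν)‖ ≤ R ^ α := by
        rw [norm_smul, norm_smul, hν, mul_one, Real.norm_of_nonneg (by positivity : 0 ≤ R ^ (α - 1)), Real.norm_eq_abs, hR1]
        calc |τ| * (R ^ α / R) ≤ R * (R ^ α / R) := by gcongr
          _ = _ := by field_simp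
      have t2 : ‖(τ * R ^ (α - 1)) • ν‖ ≤ R ^ α := by rw [← smul_smul]; exact t1
      have t3 : ‖τ • (τ • (((α - 1) * R ^ (α - 1 - 2)) • (x - p)))‖ ≤ R ^ α := by
        rw [norm_smul, norm_smul, norm_smul, ← hRd, hR3, norm_mul, Real.norm_eq_abs, Real.norm_eq_abs,
          Real.norm_of_nonneg (by positivity : 0 ≤ R ^ α / R ^ 3)]
        have : |α - 1| ≤ 1 := abs_le.2 ⟨by linarith, by linarith⟩
        calc |τ| * (|τ| * (|α - 1| * (R ^ α / R ^ 3) * R)) ≤ R * (R * (1 * (R ^ α / R ^ 3) * R)) := by gcongr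
          _ = _ := by field_simp
      rw [smul_add]
      exact (norm_add_le _ _).trans ((add_le_add ((norm_add_le _ _).trans (add_le_add t3 t1)) t2).trans (by linarith))
    refine (norm_add_le _ _).trans ?_
    rw [hν, norm_smul, Real.norm_of_nonneg (by positivity : 0 ≤ 2 * A)]
    have e4 := (norm_sub_le (((1 + α) * R ^ (1 + α - 2)) • (x - p)) (Mw N α • (τ • ((α * R ^ (α - 2)) • (x - p)) + R ^ α • ν)))
    have e5 := norm_sub_le (((1 + α) * R ^ (1 + α - 2)) • (x - p) - Mw N α • (τ • ((α * R ^ (α - 2)) • (x - p)) + R ^ α • ν))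
      ((2 * (N:ℝ)) • (τ • (τ • (((α - 1) * R ^ (α - 1 - 2)) • (x - p)) + R ^ (α - 1) • ν) + (τ * R ^ (α - 1)) • ν))
    rw [norm_smul (Mw N α), Real.norm_of_nonneg hM.le] at e4
    rw [norm_smul (2 * (N:ℝ)), Real.norm_of_nonneg (by positivity : 0 ≤ 2 * (N:ℝ))] at e5
    have e6 := mul_le_mul_of_nonneg_left e2 hM.le
    have e7 := mul_le_mul_of_nonneg_left e3 (by positivity : 0 ≤ 2 * (N:ℝ))
    have e8 := e5.trans (add_le_add (e4.trans (add_le_add e1 e6)) e7)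
    have e9 := mul_le_mul_of_nonneg_left e8 (by positivity : 0 ≤ 2 * A)
    have e10 : 2 * A * (2 * R ^ α + Mw N α * (2 * R ^ α) + 2 * ↑N * (3 * R ^ α)) ≤ 2 * A * (10 * N + 4 * Mw N α) * R ^ α := by
      have : 0 ≤ 2 * A * R ^ α * ((4 * N - 2) + 2 * Mw N α) := by
        have : 0 ≤ 4 * (N:ℝ) - 2 := by linarith
        positivity
      linarith
    linarith
  · rw [Wf_eq hx, show 1 + α = α + 1 by ring, Real.rpow_add_one hR.ne']
    set R := ‖x - p‖ with hRd
    set τ := inner ℝ ν (x - p) with hτ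
    set c := τ / R with hc
    have h2 : 1 - Mw N α * c - 2 * N * c ^ 2 ≤ 10 * N + 4 * Mw N α := by
      have := abs_le.1 hcb
      nlinarith [sq_nonneg c]
    have h3 := mul_le_mul_of_nonneg_left h2 (by positivity : 0 ≤ 2 * A * (R ^ α * R))
    have h4 := mul_le_mul_of_nonneg_right hs hR.le
    have := (abs_le.1 hta).2
    linarith
  · intro ht
    rw [Wf_eq hx]
    set R := ‖x - p‖ with hRd
    set τ := inner ℝ ν (x - p) with hτ
    set c := τ / R with hc
    have hτc : τ = c * R := by rw [hc]; field_simp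
    have hcb' := abs_le.1 hcb
    have hRR : R ^ (1 + α) = R ^ α * R := by rw [show 1 + α = α + 1 by ring, Real.rpow_add_one hR.ne']
    have hAR : 20 * N * (A * R ^ α) ≤ 1 / 2 := by
      have : 0 ≤ A * R ^ α * Mw N α := by positivity
      linarith
    have hcl : - (1 / (10 * N)) ≤ c := by
      have h2 : - (A * R ^ α) ≤ c := by
        have : - (A * R ^ α) * R ≤ c * R := by rw [← hτc]; rw [hRR] at ht; linarith
        exact le_of_mul_le_mul_right this hR
      have h3 : A * R ^ α ≤ 1 / (10 * N) := by
        rw [le_div_iff₀ (by positivity)]; linarith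
      linarith
    have hcN : - 1 ≤ 10 * (N * c) := by
      have := mul_le_mul_of_nonneg_left hcl (by positivity : 0 ≤ 10 * (N:ℝ))
      have e : 10 * (N:ℝ) * (-(1 / (10 * N))) = -1 := by field_simp
      linarith
    constructor
    · have hR1 : R ^ (α - 1) = R ^ α / R := Real.rpow_sub_one hR.ne' _
      have hR2 : R ^ (α - 2) = R ^ α / R ^ 2 := (rpow_split hR _).2
      have hR3 : R ^ (α - 1 - 2) = R ^ α / R ^ 3 := by
        rw [show α - 1 - 2 = α - (3:ℕ) by push_cast; ring, Real.rpow_sub hR, Real.rpow_natCast]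
      have hR4 : R ^ (1 + α - 2) = R ^ α / R := by rw [← hR1]; congr 1; ring
      rw [hR1, hR2, hR3, hR4, hτc]
      have e : 0 + 2 * A * ((1 + α) * (↑N + (1 + α) - 2) * (R ^ α / R) - Mw N α * (c * R * (α * (↑N + α)) * (R ^ α / R ^ 2)) -
          2 * ↑N * ((c * R) ^ 2 * ((α - 1) * (↑N + (α - 1) + 2)) * (R ^ α / R ^ 3) + 2 * (R ^ α / R))) =
          2 * A * (R ^ α / R) * ((1 + α) * (N + α - 1) - (Mw N α * α) * c * (N + α) - 2 * N * (c ^ 2 * ((α - 1) * (N + α + 1)) + 2)) := by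
        field_simp; ring
      rw [e, hMe]
      have key := Wf_key hN2 h0 h1 hcb'.1 hcb'.2 hcN
      have := mul_le_mul_of_nonneg_left key (by positivity : 0 ≤ 2 * A * (R ^ α / R))
      linarith
    · rcases le_total 0 c with h | h
      · have k1 : Mw N α * c + 2 * N * c ^ 2 ≤ (Mw N α + 2 * N) * c := by
          have k0 : c ^ 2 ≤ c := by nlinarith [hcb'.2]
          have := mul_le_mul_of_nonneg_left k0 (by positivity : 0 ≤ 2 * (N:ℝ))
          linarith
        have k2 := mul_le_mul_of_nonneg_left k1 (by positivity : 0 ≤ 2 * A * R ^ (1 + α))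
        have k3 : 2 * A * R ^ (1 + α) * ((Mw N α + 2 * N) * c) ≤ τ / 2 := by
          have : 2 * A * (Mw N α + 2 * N) * R ^ α ≤ 1 / 2 := by
            have : 0 ≤ A * R ^ α * Mw N α := by positivity
            have : 0 ≤ A * R ^ α * N := by positivity
            linarith
          have := mul_le_mul_of_nonneg_right this (by positivity : 0 ≤ R * c)
          rw [hRR, hτc]; linarith
        have : 0 ≤ A * R ^ (1 + α) := by positivity
        linarith
      · have k1 : 2 * N * c ^ 2 ≤ 1 / 10 := by nlinarith
        have k2 : 0 ≤ Mw N α * (- c) := mul_nonneg hM.le (by linarith)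
        have k3 : 9 / 10 ≤ 1 - Mw N α * c - 2 * N * c ^ 2 := by linarith
        have k4 := mul_le_mul_of_nonneg_left k3 (by positivity : 0 ≤ 2 * A * R ^ (1 + α))
        have : 0 ≤ A * R ^ (1 + α) := by positivity
        linarith

lemma Geo.tau_ge (H : Geo Ω y α A ρ d G) {x : ES N} (hx : x ∈ ball y ρ) (hxΩ : x ∈ Ω) :
    - (A * ‖x - y‖ ^ (1 + α)) ≤ inner ℝ (nv G y) (x - y) := by
  have h1 := (H.mem x hx).1 hxΩ
  have h2 := H.d_le y x
  rw [H.dy] at h2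
  have h3 := H.G1 y
  by_contra hc
  push Not at hc
  have h4 : 0 ≤ A * ‖x - y‖ ^ (1 + α) := by
    have := H.A1
    positivity
  nlinarith

/-! cutoffs -/

lemma st_deriv_bdd : ∃ C, 1 ≤ C ∧ (∀ t, |deriv Real.smoothTransition t| ≤ C) ∧ ∀ t, |deriv (deriv Real.smoothTransition) t| ≤ C := by
  have hd : ContDiff ℝ (⊤ : ℕ∞) (deriv Real.smoothTransition) :=
    (contDiff_infty_iff_deriv.1 st_contDiff).2
  have hdd : ContDiff ℝ (⊤ : ℕ∞) (deriv (deriv Real.smoothTransition)) :=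
    (contDiff_infty_iff_deriv.1 hd).2
  have hz : ∀ t ∉ Icc (0:ℝ) 1, deriv Real.smoothTransition t = 0 := by
    intro t ht
    rw [mem_Icc, not_and_or, not_le, not_le] at ht
    rcases ht with h | h
    · have : Real.smoothTransition =ᶠ[𝓝 t] fun _ => 0 := by
        filter_upwards [gt_mem_nhds h] with v hv using Real.smoothTransition.zero_of_nonpos hv.le
      rw [this.deriv_eq]; simp
    · have : Real.smoothTransition =ᶠ[𝓝 t] fun _ => 1 := by
        filter_upwards [lt_mem_nhds h] with v hv using Real.smoothTransition.one_of_one_le hv.le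
      rw [this.deriv_eq]; simp
  have hz2 : ∀ t ∉ Icc (0:ℝ) 1, deriv (deriv Real.smoothTransition) t = 0 := by
    intro t ht
    have : deriv Real.smoothTransition =ᶠ[𝓝 t] fun _ => 0 := by
      filter_upwards [isClosed_Icc.isOpen_compl.mem_nhds ht] with v hv using hz v hv
    rw [this.deriv_eq]; simp
  obtain ⟨C1, h1⟩ := isCompact_Icc.exists_bound_of_continuousOn (s := Icc (0:ℝ) 1) hd.continuous.continuousOn
  obtain ⟨C2, h2⟩ := isCompact_Icc.exists_bound_of_continuousOn (s := Icc (0:ℝ) 1) hdd.continuous.continuousOn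
  refine ⟨max 1 (max C1 C2), le_max_left _ _, fun t => ?_, fun t => ?_⟩
  · by_cases ht : t ∈ Icc (0:ℝ) 1
    · exact (h1 t ht).trans ((le_max_left _ _).trans (le_max_right _ _))
    · rw [hz t ht, abs_zero]; positivity
  · by_cases ht : t ∈ Icc (0:ℝ) 1
    · exact (h2 t ht).trans ((le_max_right _ _).trans (le_max_right _ _))
    · rw [hz2 t ht, abs_zero]; positivity

def cut (p : ES N) (σ : ℝ) (x : ES N) : ℝ := Real.smoothTransition (‖x - p‖ ^ 2 / (3 * σ ^ 2) - 1 / 3)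

lemma cut_contDiff (p : ES N) (σ : ℝ) {n : ℕ∞} : ContDiff ℝ n (cut p σ) := by
  refine ContDiff.comp (g := Real.smoothTransition) Real.smoothTransition.contDiff ?_
  exact (((contDiff_id.sub contDiff_const).norm_sq ℝ).div_const _).sub contDiff_const

lemma cut_nonneg (p : ES N) (σ : ℝ) (x : ES N) : 0 ≤ cut p σ x := Real.smoothTransition.nonneg _
lemma cut_le_one (p : ES N) (σ : ℝ) (x : ES N) : cut p σ x ≤ 1 := Real.smoothTransition.le_one _

lemma cut_zero {p x : ES N} {σ : ℝ} (hσ : 0 < σ) (hx : ‖x - p‖ ≤ σ) : cut p σ x = 0 := by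
  apply Real.smoothTransition.zero_of_nonpos
  rw [sub_nonpos, div_le_div_iff₀ (by positivity) (by norm_num)]
  nlinarith [norm_nonneg (x - p)]

lemma cut_one {p x : ES N} {σ : ℝ} (hσ : 0 < σ) (hx : 2 * σ ≤ ‖x - p‖) : cut p σ x = 1 := by
  apply Real.smoothTransition.one_of_one_le
  have : 4 / 3 ≤ ‖x - p‖ ^ 2 / (3 * σ ^ 2) := by
    rw [div_le_div_iff₀ (by norm_num) (by positivity)]
    nlinarith [norm_nonneg (x - p)]
  linarith

lemma continuous_norm_sub (p : ES N) : Continuous (fun z => ‖z - p‖) := by fun_prop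

lemma cut_J (N : ℕ) : ∃ C, 1 ≤ C ∧ ∀ (p x : ES N) (σ : ℝ), 0 < σ → ∃ g l, J (cut p σ) x g l ∧ ‖g‖ ≤ C / σ ∧ |l| ≤ C / σ ^ 2 ∧
    (‖x - p‖ < σ ∨ 2 * σ < ‖x - p‖ → g = 0 ∧ l = 0) := by
  obtain ⟨C, hC1, hd, hdd⟩ := st_deriv_bdd
  refine ⟨C * (4 + 2 * N), by nlinarith [(Nat.cast_nonneg N : (0:ℝ) ≤ N)], fun p x σ hσ => ?_⟩
  by_cases h1 : ‖x - p‖ < σ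
  · refine ⟨0, 0, (J_const 0 x).congr ?_, by simp; positivity, by simp; positivity, fun _ => ⟨rfl, rfl⟩⟩
    filter_upwards [(continuous_norm_sub p).continuousAt.eventually_lt_const h1] with z hz using cut_zero hσ hz.le
  by_cases h2 : 2 * σ < ‖x - p‖
  · refine ⟨0, 0, (J_const 1 x).congr ?_, by simp; positivity, by simp; positivity, fun _ => ⟨rfl, rfl⟩⟩
    filter_upwards [(continuous_norm_sub p).continuousAt.eventually_const_lt h2] with z hz using cut_one hσ hz.le
  have hj := (((J_sq p x).cmul (1 / (3 * σ ^ 2))).sub (J_const (1 / 3) x)).comp (φ := Real.smoothTransition)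
    (Real.smoothTransition.contDiff.contDiffAt) rfl rfl
  refine ⟨_, _, hj.congr (Eventually.of_forall fun z => ?_), ?_, ?_, fun h => by tauto⟩
  · unfold cut; congr 1; ring
  · set D := deriv Real.smoothTransition (1 / (3 * σ ^ 2) * ‖x - p‖ ^ 2 - 1 / 3) with hD
    rw [sub_zero, norm_smul, norm_smul, norm_smul, Real.norm_of_nonneg (by positivity : 0 ≤ 1 / (3 * σ ^ 2)),
      Real.norm_of_nonneg (by norm_num : (0:ℝ) ≤ 2), Real.norm_eq_abs]
    calc |D| * (1 / (3 * σ ^ 2) * (2 * ‖x - p‖)) ≤ C * (1 / (3 * σ ^ 2) * (2 * (2 * σ))) := by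
          gcongr
          · exact hd _
          · linarith
      _ = C * (4 / 3) / σ := by field_simp; ring
      _ ≤ _ := by gcongr; nlinarith [(Nat.cast_nonneg N : (0:ℝ) ≤ N)]
  · set D := deriv Real.smoothTransition (1 / (3 * σ ^ 2) * ‖x - p‖ ^ 2 - 1 / 3) with hD
    set D2 := deriv (deriv Real.smoothTransition) (1 / (3 * σ ^ 2) * ‖x - p‖ ^ 2 - 1 / 3) with hD2
    rw [sub_zero, sub_zero, norm_smul, norm_smul, Real.norm_of_nonneg (by positivity : 0 ≤ 1 / (3 * σ ^ 2)),
      Real.norm_of_nonneg (by norm_num : (0:ℝ) ≤ 2)]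
    refine (abs_add_le _ _).trans ?_
    rw [abs_mul, abs_mul D2, abs_of_nonneg (by positivity : 0 ≤ 1 / (3 * σ ^ 2) * (2 * (N:ℝ))), abs_of_nonneg (by positivity : 0 ≤ (1 / (3 * σ ^ 2) * (2 * ‖x - p‖)) ^ 2)]
    calc |D| * (1 / (3 * σ ^ 2) * (2 * N)) + |D2| * (1 / (3 * σ ^ 2) * (2 * ‖x - p‖)) ^ 2
        ≤ C * (1 / (3 * σ ^ 2) * (2 * N)) + C * (1 / (3 * σ ^ 2) * (2 * (2 * σ))) ^ 2 := by
          gcongr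
          · exact hd _
          · exact hdd _
          · linarith
      _ = C * (2 * N / 3 + 16 / 9) / σ ^ 2 := by field_simp; ring
      _ ≤ _ := div_le_div_of_nonneg_right (mul_le_mul_of_nonneg_left (by linarith [(Nat.cast_nonneg N : (0:ℝ) ≤ N)]) (by linarith)) (by positivity)
end

section
variable {N : ℕ} {Ω : Set (ES N)} {y : ES N} {α A ρ : ℝ} {d : ES N → ℝ} {G : ES N → ES N}

lemma jj_lin {ε w : ℝ} (hε : 0 < ε) (hw : 2 * ε ≤ w) : w - jj ε w = 2 * ε - jj ε (2 * ε) := by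
  have hc : Continuous (fun t : ℝ => Real.smoothTransition (t / ε - 1)) := st_cont.comp (by fun_prop)
  have h1 : jj ε w - jj ε (2 * ε) = ∫ t in (2 * ε)..w, Real.smoothTransition (t / ε - 1) :=
    intervalIntegral.integral_interval_sub_left (hc.intervalIntegrable _ _) (hc.intervalIntegrable _ _)
  have h2 : ∫ t in (2 * ε)..w, Real.smoothTransition (t / ε - 1) = ∫ t in (2 * ε)..w, (1:ℝ) := by
    apply intervalIntegral.integral_congr
    intro t ht
    rw [uIcc_of_le hw] at ht
    apply Real.smoothTransition.one_of_one_le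
    have : 2 ≤ t / ε := by rw [le_div_iff₀ hε]; exact ht.1
    linarith
  rw [h2] at h1
  simp at h1
  linarith

lemma ff_mono (ε : ℝ) : Monotone (fun w => w - jj ε w) := by
  intro a b hab
  have := jj_lip ε b a
  have h2 := (abs_le.1 this).2
  rw [abs_of_nonneg (by linarith)] at h2
  simp only; linarith

lemma ff_min {ε w : ℝ} (hε : 0 < ε) : min w ε ≤ w - jj ε w := by
  rcases le_total w ε with h | h
  · rw [jj_zero hε h]; simp
  · have := ff_mono ε h
    simp only [jj_zero hε le_rfl] at this
    exact (min_le_right _ _).trans (by linarith)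

set_option maxHeartbeats 1000000 in
lemma Geo.testfun (H : Geo Ω y α A ρ d G) (hop : IsOpen Ω) (hbd : Bornology.IsBounded Ω) (hy : y ∉ Ω) :
    ∃ C c r r0 : ℝ, ∃ p0 : ES N, 0 < C ∧ 0 < c ∧ 0 < r ∧ r ≤ ρ / 8 ∧ 0 < r0 ∧ closedBall p0 r0 ⊆ Ω ∧
    ∀ σ, 0 < σ → σ ≤ r → ∃ φ : ES N → ℝ, ContDiff ℝ (⊤ : ℕ∞) φ ∧ HasCompactSupport φ ∧ y ∉ tsupport φ ∧ (∀ x ∈ Ω, 0 ≤ φ x) ∧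
      (∀ x ∈ Ω, 2 * σ ≤ ‖x - y‖ → ‖x - y‖ ≤ r → c * inner ℝ (nv G y) (x - y) ≤ φ x) ∧
      ∀ x ∈ Ω, lap φ x ≤ indicator {x | σ ≤ ‖x - y‖ ∧ ‖x - y‖ ≤ 2 * σ} (fun _ => C / σ) x - indicator (ball p0 r0) (fun _ => c) x := by
  obtain ⟨Cc, hCc1, hcut⟩ := cut_J N
  have hA1 := H.A1
  have hA0 : 0 < A := by linarith
  have hN2 : (2:ℝ) ≤ N := by exact_mod_cast H.hN
  have hρ := H.r0
  have hρ1 := H.r1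
  set ν := nv G y with hν
  have hν1 : ‖ν‖ = 1 := H.nv_norm y
  have hM := Mw_pos H.hN H.a0
  obtain ⟨r1, hr1, hr1ρ, hr1s⟩ := small_rpow H.a0 (2 * A * (10 * N + 4 * Mw N α)) (show 0 < ρ / 8 by linarith) (show (0:ℝ) < 1 / 2 by norm_num)
  have hs : ∀ x : ES N, ‖x - y‖ ≤ r1 → 2 * A * (10 * N + 4 * Mw N α) * ‖x - y‖ ^ α ≤ 1 / 2 := by
    intro x hx
    refine le_trans ?_ hr1s
    have : ‖x - y‖ ^ α ≤ r1 ^ α := Real.rpow_le_rpow (norm_nonneg _) hx H.a0.le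
    gcongr
  have hτl : ∀ x ∈ Ω, ‖x - y‖ ≤ r1 → - (A * ‖x - y‖ ^ (1 + α)) ≤ inner ℝ ν (x - y) := fun x hx hxr =>
    H.tau_ge (mem_ball_norm.2 (by linarith)) hx
  have hxy : ∀ x ∈ Ω, x ≠ y := fun x hx h => hy (h ▸ hx)
  set W := Wf N α A ν y with hW
  set ε := A / 8 * (r1 / 2) ^ (1 + α) with hε
  have hε0 : 0 < ε := by positivity
  set F : ℝ → ℝ := fun w => w - jj ε w with hF
  have hFs : ContDiff ℝ (⊤ : ℕ∞) F := contDiff_id.sub (jj_contDiff ε)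
  have hF1 : deriv F = fun w => 1 - Real.smoothTransition (w / ε - 1) := by
    funext w; exact ((hasDerivAt_id w).sub (jj_hasDerivAt ε w)).deriv
  have hF2 : ∀ w, deriv (deriv F) w = - deriv (deriv (jj ε)) w := by
    intro w; rw [hF1, jj_deriv, deriv_const_sub]
  set Fi := F (2 * ε) with hFi
  have hFw : ∀ w, 2 * ε ≤ w → F w = Fi := fun w hw => jj_lin hε0 hw
  have hF0 : ∀ w, 0 ≤ w → 0 ≤ F w := fun w hw => by
    have := jj_le (ε := ε) hw
    simp only [hF]; linarith
  have hFle : ∀ w, F w ≤ w := fun w => by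
    have := jj_nonneg hε0 w
    simp only [hF]; linarith
  -- the point p0
  set t := min (r1 / 8) (ε / 8) with ht
  have ht0 : 0 < t := lt_min (by linarith) (by linarith)
  have htr : t ≤ r1 / 8 := min_le_left _ _
  have htε : t ≤ ε / 8 := min_le_right _ _
  set p0 := y + t • ν with hp0
  have hp0y : p0 - y = t • ν := by rw [hp0]; abel
  have hp0n : ‖p0 - y‖ = t := by rw [hp0y, norm_smul, hν1, Real.norm_of_nonneg ht0.le, mul_one]
  have hp0Ω : p0 ∈ Ω := by
    refine (H.mem p0 (mem_ball_norm.2 (by linarith))).2 ?_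
    have h1 := H.d_ge y p0
    rw [H.dy, hp0n, ← hν, hp0y, inner_smul_right, real_inner_self_eq_norm_sq, hν1] at h1
    have h2 := hs p0 (by linarith)
    rw [hp0n] at h2
    have h3 := H.G1 y
    have h4 : t ^ (1 + α) = t ^ α * t := by rw [show 1 + α = α + 1 by ring, Real.rpow_add_one ht0.ne']
    have h5 : A * t ^ α ≤ 1 / 2 := by
      have : 0 ≤ A * t ^ α * Mw N α := by positivity
      have : 0 ≤ A * t ^ α * (20 * N - 1) := mul_nonneg (by positivity) (by linarith)
      linarith
    have h6 := mul_le_mul_of_nonneg_right h5 ht0.le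
    have h7 := mul_le_mul_of_nonneg_right h3 ht0.le
    rw [h4] at h1
    linarith
  obtain ⟨r0', hr0', hb0'⟩ := Metric.nhds_basis_closedBall.mem_iff.1 (hop.mem_nhds hp0Ω)
  set r0 := min r0' (t / 4) with hr0
  have hr00 : 0 < r0 := lt_min hr0' (by linarith)
  have hr0t : r0 ≤ t / 4 := min_le_right _ _
  have hB : ∀ x ∈ ball p0 r0, t / 2 < ‖x - y‖ ∧ ‖x - y‖ < 2 * t := by
    intro x hx
    rw [mem_ball_norm] at hx
    have h1 := norm_sub_norm_le (p0 - y) (p0 - x)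
    have h2 := norm_add_le (x - p0) (p0 - y)
    rw [sub_add_sub_cancel] at h2
    rw [norm_sub_rev p0 x, hp0n, show p0 - y - (p0 - x) = x - y by abel] at h1
    constructor <;> linarith
  set c := min (1 / 2) ε with hc
  have hc0 : 0 < c := lt_min (by norm_num) hε0
  obtain ⟨Θ, hΘs, hΘc, -, hΘ0, hΘ1⟩ := exists_cutoff hbd.isCompact_closure isOpen_univ (subset_univ (closure Ω))
  have hΘe : ∀ x ∈ Ω, ∀ᶠ z in 𝓝 x, Θ z = 1 := fun x hx => by
    rw [eventually_nhdsSet_iff_forall] at hΘ1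
    exact hΘ1 x (subset_closure hx)
  refine ⟨8 * Cc, c, t / 4, r0, p0, by linarith, hc0, by linarith, by linarith, hr00,
    (closedBall_subset_closedBall (min_le_left _ _)).trans hb0', fun σ hσ hσr => ?_⟩
  have hyz : ∀ᶠ z in 𝓝 y, cut y σ z = 0 := by
    filter_upwards [ball_mem_nhds y hσ] with z hz
    exact cut_zero hσ (mem_ball_norm.1 hz).le
  set φ : ES N → ℝ := fun x => Θ x * (cut y σ x * (Fi + (1 - cut y (r1 / 2) x) * (F (W x) - Fi))) with hφ
  have hloc : ∀ x ∈ Ω, ‖x - y‖ < r1 / 2 → φ =ᶠ[𝓝 x] fun z => cut y σ z * F (W z) := by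
    intro x hx hxr
    filter_upwards [hΘe x hx, (continuous_norm_sub y).continuousAt.eventually_lt_const hxr] with z h1 h2
    simp only [hφ, h1, cut_zero (by linarith : 0 < r1 / 2) h2.le]
    ring
  have hfar : ∀ x ∈ Ω, r1 / 2 ≤ ‖x - y‖ → φ =ᶠ[𝓝 x] fun _ => Fi := by
    intro x hx hxr
    have h3 : ∀ᶠ z in 𝓝 x, (1 - cut y (r1 / 2) z) * (F (W z) - Fi) = 0 := by
      rcases le_or_gt ‖x - y‖ r1 with h | h
      · obtain ⟨g, l, hJ, -, -, h5⟩ := Wf_spec H.hN H.a0 H.a1 hA0 hν1 (hxy x hx) (hs x h)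
        have h6 := (h5 (hτl x hx h)).2
        have h7 := hτl x hx h
        have h8 : (r1 / 2) ^ (1 + α) ≤ ‖x - y‖ ^ (1 + α) := Real.rpow_le_rpow (by linarith) hxr (by linarith [H.a0])
        have h9 : 2 * ε < W x := by
          have := mul_le_mul_of_nonneg_left h8 hA0.le
          have : 0 < A * (r1 / 2) ^ (1 + α) := by positivity
          rw [hε, hW]; linarith
        filter_upwards [hJ.1.continuousAt.eventually_const_lt h9] with z hz
        rw [hFw _ hz.le]; ring
      · filter_upwards [(continuous_norm_sub y).continuousAt.eventually_const_lt h] with z hz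
        rw [cut_one (by linarith) (by linarith : 2 * (r1 / 2) ≤ ‖z - y‖)]; ring
    have h4 : 2 * σ < ‖x - y‖ := by linarith
    filter_upwards [hΘe x hx, h3, (continuous_norm_sub y).continuousAt.eventually_const_lt h4] with z a1 a2 a3
    simp only [hφ, a1, a2, cut_one hσ a3.le]; ring
  refine ⟨φ, ?_, ?_, ?_, ?_, ?_, ?_⟩
  · rw [contDiff_iff_contDiffAt]
    intro x
    rcases eq_or_ne x y with rfl | hx
    · refine (contDiffAt_const (c := (0:ℝ))).congr_of_eventuallyEq ?_
      filter_upwards [hyz] with z hz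
      simp only [hφ, hz]; ring
    · exact hΘs.contDiffAt.mul ((cut_contDiff y σ).contDiffAt.mul (contDiffAt_const.add
        ((contDiffAt_const.sub (cut_contDiff y _).contDiffAt).mul ((hFs.contDiffAt.comp x (Wf_contDiffAt hx)).sub contDiffAt_const))))
  · exact hΘc.mul_right
  · rw [notMem_tsupport_iff_eventuallyEq]
    filter_upwards [hyz] with z hz
    simp only [hφ, hz]; simp
  · intro x hx
    rcases lt_or_ge ‖x - y‖ (r1 / 2) with h | h
    · rw [(hloc x hx h).eq_of_nhds]
      obtain ⟨g, l, hJ, -, -, h5⟩ := Wf_spec H.hN H.a0 H.a1 hA0 hν1 (hxy x hx) (hs x (by linarith))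
      have h6 := (h5 (hτl x hx (by linarith))).2
      have h7 := hτl x hx (by linarith)
      have : 0 ≤ A * ‖x - y‖ ^ (1 + α) := by positivity
      exact mul_nonneg (cut_nonneg _ _ _) (hF0 _ (by rw [hW]; linarith))
    · rw [(hfar x hx h).eq_of_nhds]
      exact hF0 _ (by linarith)
  · intro x hx h1 h2
    rw [(hloc x hx (by linarith)).eq_of_nhds]
    simp only [cut_one hσ h1, one_mul]
    obtain ⟨g, l, hJ, -, -, h5⟩ := Wf_spec H.hN H.a0 H.a1 hA0 hν1 (hxy x hx) (hs x (by linarith))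
    have h6 := (h5 (hτl x hx (by linarith))).2
    have h7 := hτl x hx (by linarith)
    have h8 : 0 ≤ A * ‖x - y‖ ^ (1 + α) := by positivity
    have h9 := (abs_le.1 (abs_tau_le hν1 (x - y))).2
    rcases le_total (inner ℝ ν (x - y)) 0 with h0 | h0
    · exact (mul_nonpos_of_nonneg_of_nonpos hc0.le h0).trans (hF0 _ (by rw [hW]; linarith))
    · refine le_trans ?_ (ff_min hε0)
      refine le_min ?_ ?_
      · have := mul_le_mul_of_nonneg_right (min_le_left (1 / 2) ε) h0
        rw [hW]; linarith
      · have := mul_le_mul_of_nonneg_right (min_le_right (1 / 2) ε) h0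
        have : ε * inner ℝ ν (x - y) ≤ ε * 1 := mul_le_mul_of_nonneg_left (by linarith) hε0.le
        linarith
  · intro x hx
    have hC : 0 ≤ 8 * Cc / σ := by positivity
    rcases lt_or_ge ‖x - y‖ (r1 / 2) with h | h
    · obtain ⟨g, l, hJ, hg, hW2, h5⟩ := Wf_spec H.hN H.a0 H.a1 hA0 hν1 (hxy x hx) (hs x (by linarith))
      obtain ⟨hl, h6⟩ := h5 (hτl x hx (by linarith))
      have h7 := hτl x hx (by linarith)
      have h8 : 0 ≤ A * ‖x - y‖ ^ (1 + α) := by positivity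
      have hW0 : 0 ≤ W x := by rw [hW]; linarith
      obtain ⟨gc, lc, hJc, hgc, hlc, hz⟩ := hcut y x σ hσ
      have hR0 : 0 < ‖x - y‖ := norm_pos_iff.2 (sub_ne_zero.2 (hxy x hx))
      have hRp : 1 ≤ ‖x - y‖ ^ (α - 1) := Real.one_le_rpow_of_pos_of_le_one_of_nonpos hR0 (by linarith) (by linarith [H.a1])
      have hJF := hJ.comp (φ := F) (hFs.contDiffAt.of_le two_le_top) rfl rfl
      have hl0 : l ≤ 0 := hl.trans (by have : 0 ≤ 2 * A * N * ‖x - y‖ ^ (α - 1) := by positivity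
                                       linarith)
      have hd0 : 0 ≤ deriv F (W x) := by
        rw [hF1]; have := Real.smoothTransition.le_one (W x / ε - 1)
        simp only; linarith
      have hd1 : deriv F (W x) ≤ 1 := by
        rw [hF1]; have := Real.smoothTransition.nonneg (W x / ε - 1)
        simp only; linarith
      have hd2 : deriv (deriv F) (W x) ≤ 0 := by
        rw [hF2]; have := jj_d2_nonneg hε0 (W x); linarith
      rw [((hJc.mul hJF).congr (hloc x hx h)).2.2]
      have hneg : deriv F (W x) * l + deriv (deriv F) (W x) * ‖g‖ ^ 2 ≤ 0 :=
        add_nonpos (mul_nonpos_of_nonneg_of_nonpos hd0 hl0) (mul_nonpos_of_nonpos_of_nonneg hd2 (by positivity))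
      have hcn := mul_nonpos_of_nonneg_of_nonpos (cut_nonneg y σ x) hneg
      by_cases hb : x ∈ ball p0 r0
      · obtain ⟨b1, b2⟩ := hB x hb
        have hn : x ∉ {x | σ ≤ ‖x - y‖ ∧ ‖x - y‖ ≤ 2 * σ} := fun hh => by have := hh.2; linarith
        obtain ⟨z1, z2⟩ := hz (Or.inr (by linarith))
        rw [indicator_of_notMem hn, indicator_of_mem hb, z1, z2, inner_zero_left, cut_one hσ (by linarith)]
        have hWε : W x < ε := by rw [hW]; linarith
        have e1 : deriv F (W x) = 1 := by
          rw [hF1]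
          simp only
          rw [Real.smoothTransition.zero_of_nonpos]
          · ring
          · rw [sub_nonpos, div_le_one hε0]; exact hWε.le
        have e2 : deriv (deriv F) (W x) = 0 := by rw [hF2, jj_d2_zero hε0 hWε, neg_zero]
        have e1' : deriv F (Wf N α A ν y x) = 1 := e1
        have e2' : deriv (deriv F) (Wf N α A ν y x) = 0 := e2
        rw [e1', e2']
        have : 2 * A * N * 1 ≤ 2 * A * N * ‖x - y‖ ^ (α - 1) := by gcongr
        have : 1 * 1 ≤ A * N := by gcongr; linarith
        have : c ≤ 1 / 2 := min_le_left _ _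
        linarith
      · rw [indicator_of_notMem hb, sub_zero]
        by_cases hn : x ∈ {x | σ ≤ ‖x - y‖ ∧ ‖x - y‖ ≤ 2 * σ}
        · rw [indicator_of_mem hn]
          have k1 : F (W x) * lc ≤ 4 * Cc / σ := by
            calc F (W x) * lc ≤ F (W x) * |lc| := mul_le_mul_of_nonneg_left (le_abs_self _) (hF0 _ hW0)
              _ ≤ (4 * σ) * (Cc / σ ^ 2) := by
                refine mul_le_mul ((hFle _).trans ?_) hlc (abs_nonneg _) (by positivity)
                have := hn.2
                rw [hW]; linarith
              _ = _ := by field_simp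
          have k2 : inner ℝ gc (deriv F (W x) • g) ≤ 2 * Cc / σ := by
            calc inner ℝ gc (deriv F (W x) • g) ≤ ‖gc‖ * ‖deriv F (W x) • g‖ := real_inner_le_norm _ _
              _ ≤ (Cc / σ) * 2 := by
                refine mul_le_mul hgc ?_ (norm_nonneg _) (by positivity)
                rw [norm_smul, Real.norm_of_nonneg hd0]
                nlinarith [norm_nonneg g]
              _ = _ := by ring
          have : 8 * Cc / σ = 4 * Cc / σ + 2 * (2 * Cc / σ) := by ring
          rw [this]
          exact add_le_add (by linarith [hcn, k1]) (by linarith [k2])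
        · rw [indicator_of_notMem hn]
          obtain ⟨z1, z2⟩ := hz (by
            by_contra hcon; push Not at hcon; exact hn ⟨hcon.1, hcon.2⟩)
          rw [z1, z2, inner_zero_left]
          linarith [hcn]
    · rw [lap_congr (hfar x hx h), (J_const Fi x).2.2]
      have hb : x ∉ ball p0 r0 := fun hb => by have := (hB x hb).2; linarith
      rw [indicator_of_notMem hb, sub_zero]
      exact indicator_nonneg (fun _ _ => hC) x
end

section
variable {N : ℕ} {Ω : Set (ES N)} {y : ES N} {α A ρ : ℝ} {d : ES N → ℝ} {G : ES N → ES N}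

def Ann (y : ES N) (σ : ℝ) : Set (ES N) := {x | σ ≤ ‖x - y‖ ∧ ‖x - y‖ ≤ 2 * σ}

lemma Ann_closed (y : ES N) (σ : ℝ) : IsClosed (Ann y σ) :=
  (isClosed_le continuous_const (continuous_norm_sub y)).inter (isClosed_le (continuous_norm_sub y) continuous_const)

lemma Ann_sub (y : ES N) (σ : ℝ) : Ann y σ ⊆ closedBall y (2 * σ) := fun x hx => by
  rw [mem_closedBall, dist_eq_norm]; exact hx.2

lemma Ann_compact (y : ES N) (σ : ℝ) : IsCompact (Ann y σ) :=
  (isCompact_closedBall y (2 * σ)).of_isClosed_subset (Ann_closed y σ) (Ann_sub y σ)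

lemma Ann_y {y : ES N} {σ : ℝ} (hσ : 0 < σ) : y ∉ Ann y σ := fun h => by
  have := h.1; simp at this; linarith

lemma Ann_vol (N : ℕ) : ∃ C, 0 < C ∧ ∀ (y : ES N) (σ : ℝ), 0 < σ → (volume (Ann y σ)).toReal ≤ C * σ ^ N := by
  refine ⟨2 ^ N * ((volume (ball (0 : ES N) 1)).toReal + 1), by positivity, fun y σ hσ => ?_⟩
  have h1 : volume (Ann y σ) ≤ volume (closedBall y (2 * σ)) := measure_mono (Ann_sub y σ)
  have h2 := ENNReal.toReal_mono (measure_closedBall_lt_top.ne) h1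
  rw [Measure.addHaar_closedBall _ _ (by linarith), ENNReal.toReal_mul, finrank_euclideanSpace_fin,
      ENNReal.toReal_ofReal (by positivity), mul_pow] at h2
  refine h2.trans ?_
  have : 0 ≤ (2:ℝ) ^ N * σ ^ N := by positivity
  nlinarith

lemma Geo.test_sol (H : Geo Ω y α A ρ d G) (hop : IsOpen Ω) (hbd : Bornology.IsBounded Ω) (hy : y ∉ Ω) :
    ∃ C r r0 : ℝ, ∃ p0 : ES N, 0 < C ∧ 0 < r ∧ r ≤ ρ / 8 ∧ 0 < r0 ∧ closedBall p0 r0 ⊆ Ω ∧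
    ∀ (V h : ES N → ℝ) (a : ℝ), Sol Ω y V h a → ∀ σ, 0 < σ → σ ≤ r →
      ∫ x in ball p0 r0, h x ≤ C / σ * ∫ x in Ann y σ, h x ∧
      ∫⁻ x in {x | x ∈ Ω ∧ 2 * σ ≤ ‖x - y‖ ∧ ‖x - y‖ ≤ r}, ENNReal.ofReal (V x * h x * inner ℝ (nv G y) (x - y))
        ≤ ENNReal.ofReal (C / σ * ∫ x in Ann y σ, h x) := by
  obtain ⟨C, c, r, r0, p0, hC, hc, hr, hrρ, hr0, hb0, hmain⟩ := H.testfun hop hbd hy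
  refine ⟨C / c, r, r0, p0, by positivity, hr, hrρ, hr0, hb0, fun V h a HS σ hσ hσr => ?_⟩
  obtain ⟨φ, hφs, hφc, hφy, hφ0, hφτ, hφl⟩ := hmain σ hσ hσr
  obtain ⟨e1, e2⟩ := HS.ext hφs hφc hφy hφ0
  have hi1 : IntegrableOn h (Ann y σ) := HS.intOn (Ann_compact y σ) (Ann_y hσ)
  have hi2 : IntegrableOn h (ball p0 r0) :=
    (HS.intOn (isCompact_closedBall p0 r0) fun hh => hy (hb0 hh)).mono_set ball_subset_closedBall
  have hle : ∫ x, h x * lap φ x ≤ C / σ * (∫ x in Ann y σ, h x) - c * ∫ x in ball p0 r0, h x := by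
    rw [← integral_indicator (Ann_closed y σ).measurableSet, ← integral_indicator measurableSet_ball, ← integral_const_mul,
      ← integral_const_mul, ← integral_sub ((hi1.integrable_indicator (Ann_closed y σ).measurableSet).const_mul _)
        ((hi2.integrable_indicator measurableSet_ball).const_mul _)]
    refine integral_mono ?_ (((hi1.integrable_indicator (Ann_closed y σ).measurableSet).const_mul _).sub
        ((hi2.integrable_indicator measurableSet_ball).const_mul _)) fun x => ?_
    · have := integrable_mul_of_supp (u := h) (lap_continuous (hφs.of_le two_le_top)) (hcs_lap hφc) (tsupport_lap_subset φ)
        (HS.intOn hφc hφy)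
      simpa only [mul_comm] using this
    · by_cases hx : x ∈ Ω
      · have h1 := mul_le_mul_of_nonneg_left (hφl x hx) (HS.nn x)
        refine h1.trans (le_of_eq ?_)
        rw [mul_sub]
        change h x * (Ann y σ).indicator _ x - _ = _
        by_cases ha : x ∈ Ann y σ <;> by_cases hb : x ∈ ball p0 r0 <;> simp only [ha, hb, indicator_of_mem, indicator_of_notMem, not_false_eq_true] <;> ring
      · have : h x = 0 := HS.h0 x hx
        have e3 : (Ann y σ).indicator h x = 0 := by by_cases ha : x ∈ Ann y σ <;> simp [ha, this]
        have e4 : (ball p0 r0).indicator h x = 0 := indicator_of_notMem (fun hh => hx (hb0 (ball_subset_closedBall hh))) _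
        simp only [this, e3, e4]; simp
  have hn2 : 0 ≤ ∫ x in ball p0 r0, h x := integral_nonneg fun x => HS.nn x
  have ee : C / c / σ * (∫ x in Ann y σ, h x) = c⁻¹ * (C / σ * ∫ x in Ann y σ, h x) := by field_simp
  constructor
  · rw [ee, ← div_eq_inv_mul, le_div_iff₀ hc]; linarith
  · rw [ee, ENNReal.ofReal_mul (by positivity)]
    calc _ ≤ ∫⁻ x in {x | x ∈ Ω ∧ 2 * σ ≤ ‖x - y‖ ∧ ‖x - y‖ ≤ r}, ENNReal.ofReal c⁻¹ * ENNReal.ofReal (V x * h x * φ x) := by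
          refine setLIntegral_mono' ?_ fun x hx => ?_
          · exact hop.measurableSet.inter ((isClosed_le continuous_const (continuous_norm_sub y)).inter (isClosed_le (continuous_norm_sub y) continuous_const)).measurableSet
          · rw [← ENNReal.ofReal_mul (by positivity)]
            apply ENNReal.ofReal_le_ofReal
            have h1 := hφτ x hx.1 hx.2.1 hx.2.2
            have h2 := mul_le_mul_of_nonneg_left h1 (mul_nonneg (HS.V0 x) (HS.nn x))
            rw [← div_eq_inv_mul, le_div_iff₀ hc]; linarith
      _ = ENNReal.ofReal c⁻¹ * ∫⁻ x in {x | x ∈ Ω ∧ 2 * σ ≤ ‖x - y‖ ∧ ‖x - y‖ ≤ r}, ENNReal.ofReal (V x * h x * φ x) :=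
          lintegral_const_mul' _ _ ENNReal.ofReal_ne_top
      _ ≤ _ := by
          gcongr
          refine (setLIntegral_le_lintegral _ _).trans (e2.trans (ENNReal.ofReal_le_ofReal ?_))
          have := mul_nonneg hc.le hn2
          linarith

lemma rpow_one_sub_mul_pow {σ : ℝ} (hσ : 0 < σ) : σ ^ (1 - (N:ℝ)) * σ ^ N = σ := by
  rw [← Real.rpow_natCast σ N, ← Real.rpow_add hσ]; simp

lemma Geo.lower (H : Geo Ω y α A ρ d G) {K V h : ES N → ℝ} {a : ℝ} (HK : Sol Ω y (fun _ => 0) K 0) (HS : Sol Ω y V h a)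
    (hle : ∀ x, h x ≤ K x) (hpos : ∀ x ∈ Ω, 0 < h x) :
    ∃ c κ r, 0 < c ∧ 0 < κ ∧ 0 < r ∧ r ≤ ρ / 8 ∧ ∀ σ, 0 < σ → σ ≤ r → ∃ x ∈ Ann y σ, κ * σ ≤ d x ∧ c * σ ^ (1 - (N:ℝ)) ≤ h x := by
  obtain ⟨C, r, r0, p0, hC, hr, hrρ, hr0, hb0, hmain⟩ := H.test_sol HK.op HK.bdd HK.yn
  obtain ⟨Cv, hCv, hvol⟩ := Ann_vol N
  set I0 := ∫ x in ball p0 r0, h x with hI0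
  have hi2 : IntegrableOn h (ball p0 r0) :=
    (HS.intOn (isCompact_closedBall p0 r0) fun hh => HK.yn (hb0 hh)).mono_set ball_subset_closedBall
  have hI : 0 < I0 := by
    rw [hI0, setIntegral_pos_iff_support_of_nonneg_ae (Eventually.of_forall fun x => HS.nn x) hi2]
    have : ball p0 r0 ⊆ Function.support h ∩ ball p0 r0 := fun x hx => ⟨(hpos x (hb0 (ball_subset_closedBall hx))).ne', hx⟩
    exact (measure_ball_pos volume p0 hr0).trans_le (measure_mono this)
  set η := I0 / (4 * C * Cv) with hη
  have hη0 : 0 < η := by positivity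
  obtain ⟨κ, r', hκ, hκ1, hr', hr'ρ, hdec⟩ := H.decay HK hη0
  refine ⟨η, κ, min r (r' / 4), hη0, hκ, lt_min hr (by linarith), (min_le_left _ _).trans hrρ, fun σ hσ hσr => ?_⟩
  by_contra hcon
  push Not at hcon
  have hσ1 : σ ≤ r := hσr.trans (min_le_left _ _)
  have hσ2 : σ ≤ r' / 4 := hσr.trans (min_le_right _ _)
  have hb : ∀ x ∈ Ann y σ, h x ≤ η * σ ^ (1 - (N:ℝ)) := by
    intro x hx
    by_cases hd : κ * σ ≤ d x
    · exact (hcon x hx hd).le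
    · push Not at hd
      have h1 : x ∈ ball y r' := mem_ball_norm.2 (by have := hx.2; linarith)
      have hxy : x ≠ y := by rintro rfl; exact Ann_y hσ hx
      have h2 := hdec x h1 hxy (hd.le.trans (mul_le_mul_of_nonneg_left hx.1 hκ.le))
      refine (hle x).trans (h2.trans ?_)
      refine mul_le_mul_of_nonneg_left ?_ hη0.le
      have : (2:ℝ) ≤ N := by exact_mod_cast H.hN
      exact Real.rpow_le_rpow_of_nonpos hσ hx.1 (by linarith)
  have h1 := (hmain V h a HS σ hσ hσ1).1
  have h2 : ∫ x in Ann y σ, h x ≤ ∫ x in Ann y σ, η * σ ^ (1 - (N:ℝ)) :=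
    setIntegral_mono_on (HS.intOn (Ann_compact y σ) (Ann_y hσ)) (integrableOn_const (Ann_compact y σ).measure_lt_top.ne)
      (Ann_closed y σ).measurableSet hb
  rw [setIntegral_const, smul_eq_mul, measureReal_def] at h2
  have h3 := mul_le_mul_of_nonneg_right (hvol y σ hσ) (by positivity : 0 ≤ η * σ ^ (1 - (N:ℝ)))
  have h4 : Cv * σ ^ N * (η * σ ^ (1 - (N:ℝ))) = Cv * η * σ := by
    rw [← rpow_one_sub_mul_pow (N := N) hσ]
    rw [rpow_one_sub_mul_pow (N := N) hσ]
    have := rpow_one_sub_mul_pow (N := N) hσ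
    linear_combination Cv * η * this
  have h5 : C / σ * (∫ x in Ann y σ, h x) ≤ C / σ * (Cv * η * σ) := by gcongr; linarith
  have h6 : C / σ * (Cv * η * σ) = I0 / 4 := by rw [hη]; field_simp
  linarith

lemma Geo.cone (H : Geo Ω y α A ρ d G) {K V h : ES N → ℝ} {a : ℝ} (HK : Sol Ω y (fun _ => 0) K 0) (HS : Sol Ω y V h a)
    (hle : ∀ x, h x ≤ K x) (hpos : ∀ x ∈ Ω, 0 < h x) {η : ℝ} (hη : 0 < η) :
    ∃ c r, 0 < c ∧ 0 < r ∧ r ≤ ρ / 8 ∧ ∀ x, ‖x - y‖ < r → x ≠ y → η * ‖x - y‖ ≤ inner ℝ (nv G y) (x - y) → c * ‖x - y‖ ^ (1 - (N:ℝ)) ≤ h x := by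
  obtain ⟨c, κ, r, hc, hκ, hr, hrρ, hlow⟩ := H.lower HK HS hle hpos
  obtain ⟨C, hC1, hC⟩ := exists_harnack N a HS.ca
  have hC' := hC Ω y V h HS
  have hA1 := H.A1
  set κ' := min η (κ / (2 * A)) with hκ'
  have hκ0 : 0 < κ' := lt_min hη (by positivity)
  obtain ⟨r1, hr1, hr1r, hr1s⟩ := small_rpow H.a0 (16 * A) (show 0 < min r (ρ / 8) from lt_min hr (by linarith [H.r0])) (show 0 < min (κ') (κ) by positivity)
  have hr1a : r1 ≤ r := hr1r.trans (min_le_left _ _)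
  have hr1b : r1 ≤ ρ / 8 := hr1r.trans (min_le_right _ _)
  have hs1 : 16 * A * r1 ^ α ≤ κ' := hr1s.trans (min_le_left _ _)
  have hs2 : 16 * A * r1 ^ α ≤ κ := hr1s.trans (min_le_right _ _)
  set n := ⌈(48 * A) / κ' * 2⌉₊ with hn
  refine ⟨c / C ^ n, r1, by positivity, hr1, hr1b, fun x hx hxy hxη => ?_⟩
  set σ := ‖x - y‖ with hσd
  have hσ : 0 < σ := norm_pos_iff.2 (sub_ne_zero.2 hxy)
  obtain ⟨z, hz, hzd, hzc⟩ := hlow σ hσ (by linarith)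
  have hRp : ∀ w : ES N, ‖w - y‖ ≤ 2 * σ → A * ‖w - y‖ ^ (1 + α) ≤ 4 * (A * r1 ^ α) * σ := by
    intro w hw
    have h1 : ‖w - y‖ ^ (1 + α) ≤ (2 * σ) ^ (1 + α) := Real.rpow_le_rpow (norm_nonneg _) hw (by linarith [H.a0])
    have h2 : (2 * σ) ^ (1 + α) = (2 ^ α * σ ^ α) * (2 * σ) := by
      rw [show 1 + α = α + 1 by ring, Real.rpow_add_one (by positivity), Real.mul_rpow (by norm_num) hσ.le]
    have h3 : (2:ℝ) ^ α ≤ 2 := by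
      have := Real.rpow_le_rpow_of_exponent_le (by norm_num : (1:ℝ) ≤ 2) H.a1
      simpa using this
    have h4 : σ ^ α ≤ r1 ^ α := Real.rpow_le_rpow hσ.le hx.le H.a0.le
    rw [h2] at h1
    calc A * ‖w - y‖ ^ (1 + α) ≤ A * ((2 * r1 ^ α) * (2 * σ)) := by
          refine mul_le_mul_of_nonneg_left (h1.trans ?_) (by linarith)
          gcongr
      _ = _ := by ring
  set ν := nv G y with hν
  have hzτ : κ' * σ ≤ inner ℝ ν (z - y) := by
    have h1 := H.d_le y z
    rw [H.dy, ← hν] at h1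
    have h2 := hRp z hz.2
    have h3 : κ / 2 * σ ≤ ‖G y‖ * inner ℝ ν (z - y) := by
      have := mul_le_mul_of_nonneg_right hs2 hσ.le
      have := mul_pos hκ hσ
      linarith
    have h4 := H.GA y (mem_ball_self H.r0)
    have h5 : 0 ≤ inner ℝ ν (z - y) := by
      have : 0 < ‖G y‖ * inner ℝ ν (z - y) := lt_of_lt_of_le (by positivity) h3
      exact (pos_of_mul_pos_right this (norm_nonneg _)).le
    have h6 : κ / 2 * σ ≤ A * inner ℝ ν (z - y) := h3.trans (mul_le_mul_of_nonneg_right h4 h5)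
    have h7 : κ' * σ ≤ κ / (2 * A) * σ := mul_le_mul_of_nonneg_right (min_le_right _ _) hσ.le
    have h8 : κ / (2 * A) * σ ≤ inner ℝ ν (z - y) := by
      rw [show κ / (2 * A) * σ = (κ / 2 * σ) / A by field_simp, div_le_iff₀ (by linarith)]; linarith
    linarith
  have hxτ : κ' * σ ≤ inner ℝ ν (x - y) := (mul_le_mul_of_nonneg_right (min_le_left _ _) hσ.le).trans hxη
  have hseg : ∀ w ∈ segment ℝ z x, ball w (8 * (κ' / (32 * A) * σ)) ⊆ Ω := by
    intro w hw
    have hwR : ‖w - y‖ ≤ 2 * σ := by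
      have := (convex_closedBall y (2 * σ)).segment_subset (Ann_sub y σ hz) (show x ∈ closedBall y (2 * σ) by
        rw [mem_closedBall, dist_eq_norm]; linarith) hw
      rwa [mem_closedBall, dist_eq_norm] at this
    have hwτ : κ' * σ ≤ inner ℝ ν (w - y) := by
      obtain ⟨s, t, hs, ht, hst, rfl⟩ := hw
      have : s • z + t • x - y = s • (z - y) + t • (x - y) := by
        have : y = s • y + t • y := by rw [← add_smul, hst, one_smul]
        nth_rw 1 [this]; module
      rw [this, inner_add_right, inner_smul_right, inner_smul_right]
      have h1 := mul_le_mul_of_nonneg_left hzτ hs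
      have h2 := mul_le_mul_of_nonneg_left hxτ ht
      have : s * (κ' * σ) + t * (κ' * σ) = κ' * σ := by rw [← add_mul, hst, one_mul]
      linarith
    have hdw : κ' / 2 * σ ≤ d w := by
      have h1 := H.d_ge y w
      rw [H.dy, ← hν] at h1
      have h2 := hRp w hwR
      have h3 := mul_le_mul_of_nonneg_right hs1 hσ.le
      have h4 := H.G1 y
      have h5 : 0 ≤ inner ℝ ν (w - y) := le_trans (by positivity) hwτ
      have h6 := mul_le_mul_of_nonneg_right h4 h5
      have := mul_pos hκ0 hσ
      linarith
    refine (ball_subset_ball ?_).trans (H.ball_sub (mem_ball_norm.2 (by linarith)))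
    rw [le_div_iff₀ (by linarith)]
    calc 8 * (κ' / (32 * A) * σ) * (2 * A) = κ' / 2 * σ := by field_simp; ring
      _ ≤ _ := hdw
  have hchain := harnack_chain hC1 hC' (s := κ' / (32 * A) * σ) (by positivity) n z x (by
    have h1 : dist z x ≤ 3 * σ := by
      rw [dist_eq_norm]
      have := norm_sub_le (z - y) (x - y)
      rw [sub_sub_sub_cancel_right] at this
      have := hz.2
      linarith
    have h2 : 48 * A / κ' * 2 ≤ n := Nat.le_ceil _
    have h3 := mul_le_mul_of_nonneg_right h2 (by positivity : 0 ≤ κ' / (32 * A) * σ)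
    have h4 : 48 * A / κ' * 2 * (κ' / (32 * A) * σ) = 3 * σ := by field_simp; ring
    linarith) hseg
  rw [div_mul_eq_mul_div, div_le_iff₀ (by positivity), mul_comm (h x)]
  linarith
end

section
variable {N : ℕ} {Ω : Set (ES N)} {y : ES N} {V h : ES N → ℝ} {a : ℝ}

lemma Sol.mollify (H : Sol Ω y V h a) {S : Set (ES N)} (hS : IsCompact S) (hSΩ : S ⊆ Ω) {ε : ℝ} (hε : 0 < ε) :
    ∃ g : ES N → ℝ, ContDiff ℝ (⊤ : ℕ∞) g ∧ (∀ x ∈ S, |g x - h x| ≤ ε) ∧ ∀ x ∈ S, 0 ≤ lap g x := by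
  obtain ⟨δ, hδ, hδS⟩ := hS.exists_cthickening_subset_open H.op hSΩ
  set T2 := cthickening δ S with hT2
  have hT2c : IsCompact T2 := hS.cthickening
  have hyT2 : y ∉ T2 := fun hh => H.yn (hδS hh)
  have hcT2 : ContinuousOn h T2 := H.hc.mono fun x hx => by rintro rfl; exact hyT2 hx
  obtain ⟨δ1, hδ1, hu1⟩ := Metric.uniformContinuousOn_iff.1 (hT2c.uniformContinuousOn_of_continuous hcT2) ε hε
  set s := min (δ / 2) (δ1 / 2) with hs_def
  have hs : 0 < s := by positivity
  have s1 : s ≤ δ / 2 := min_le_left _ _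
  have s2 : s ≤ δ1 / 2 := min_le_right _ _
  set h' := T2.indicator h with hh'
  have hh'i : Integrable h' := (H.intOn hT2c hyT2).integrable_indicator hT2c.measurableSet
  set g : ES N → ℝ := fun x => mm h' x s with hg
  have hgs : ContDiff ℝ (⊤ : ℕ∞) g := mm_contDiff hh'i.locallyIntegrable hs
  refine ⟨g, hgs, fun x hx => ?_, fun x hx => ?_⟩
  · refine mm_close hs hh'i.integrableOn fun z hz => ?_
    have hx2 : x ∈ T2 := self_subset_cthickening S hx
    have hz2 : z ∈ T2 := mem_cthickening_of_dist_le z x _ _ hx ((mem_closedBall.1 hz).trans (by linarith))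
    rw [hh', indicator_of_mem hz2]
    have := hu1 z hz2 x hx2 (by have := mem_closedBall.1 hz; linarith)
    rw [Real.dist_eq] at this; exact this.le
  · by_contra hneg
    push Not at hneg
    have hlc : Continuous (lap g) := lap_continuous (hgs.of_le two_le_top)
    have hev : ∀ᶠ z in 𝓝 x, lap g z < 0 := hlc.continuousAt.eventually_lt continuousAt_const hneg
    obtain ⟨r, hr, hrb⟩ := Metric.eventually_nhds_iff_ball.1 hev
    obtain ⟨w, hws, hwc, hwS, hw01, hw1⟩ := exists_cutoff (isCompact_singleton (x := x)) (isOpen_ball (x := x) (ε := min r (δ / 2)))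
      (singleton_subset_iff.2 (mem_ball_self (lt_min hr (by linarith))))
    have hwx : w x = 1 := by
      rw [nhdsSet_singleton] at hw1; exact hw1.self_of_nhds
    have i1 : Integrable w := hws.continuous.integrable_of_hasCompactSupport hwc
    have i2 : Integrable (lap w) := (lap_continuous (hws.of_le two_le_top)).integrable_of_hasCompactSupport (hcs_lap hwc)
    have e1 : ∫ z, g z * lap w z = ∫ z, w z * lap g z :=
      green (hgs.of_le two_le_top) (hws.of_le two_le_top) hwc
    have e2 : ∫ z, g z * lap w z = ∫ z, h' z * mm (lap w) z s := mm_swap hh'i i2 hs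
    have hmw : ContDiff ℝ (⊤ : ℕ∞) (fun x => mm w x s) := mm_contDiff i1.locallyIntegrable hs
    have hmt : tsupport (fun x => mm w x s) ⊆ T2 := by
      refine (mm_tsupport hs).trans ?_
      have h1 : tsupport w ⊆ cthickening (δ / 2) S := fun z hz =>
        mem_cthickening_of_dist_le z x _ _ hx ((mem_ball.1 (hwS hz)).le.trans (min_le_right _ _))
      have h2 := cthickening_cthickening_subset (ε := δ / 2) (δ := δ / 2) (by linarith) (by linarith) S
      rw [add_halves] at h2
      exact ((cthickening_mono s1 _).trans (cthickening_subset_of_subset _ h1)).trans h2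
    have htest : IsTestFun Ω (fun x => mm w x s) :=
      ⟨hmw, hT2c.of_isClosed_subset (isClosed_tsupport _) hmt, hmt.trans hδS⟩
    have e3 : ∫ z, h' z * mm (lap w) z s = ∫ z, h z * lap (fun x => mm w x s) z := by
      congr 1; funext z
      rw [← lap_mm hws hwc z hs]
      by_cases hz : z ∈ T2
      · rw [hh', indicator_of_mem hz]
      · rw [lap_eq_zero_of_notMem fun hh => hz (hmt hh), mul_zero, mul_zero]
    have e4 := H.weak _ htest
    have p1 : 0 ≤ ∫ z, w z * lap g z := by
      rw [← e1, e2, e3, e4]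
      exact integral_nonneg fun z => mul_nonneg (mul_nonneg (H.V0 z) (H.nn z)) (mm_nonneg hs z fun z => (hw01 z).1)
    have p2 : 0 < ∫ z, -(w z * lap g z) := by
      refine Continuous.integral_pos_of_hasCompactSupport_nonneg_nonzero (x := x) (hws.continuous.mul hlc).neg ?_ (fun z => ?_) ?_
      · exact hwc.mono fun z hz hw => hz (by simp [hw])
      · by_cases hz : z ∈ tsupport w
        · have := hrb z (ball_subset_ball (min_le_left _ _) (hwS hz))
          have := mul_nonneg (hw01 z).1 (neg_nonneg.2 this.le)
          show 0 ≤ -(w z * lap g z)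
          linarith
        · simp [image_eq_zero_of_notMem_tsupport hz]
      · simp [hwx]; exact hneg.ne
    rw [integral_neg] at p2
    linarith
end

section
variable {N : ℕ} {Ω : Set (ES N)} {y : ES N} {α A ρ : ℝ} {d : ES N → ℝ} {G : ES N → ES N}

lemma setLInt_le_of_le {S : Set (ES N)} (hS : MeasurableSet S) {f g : ES N → ℝ} (hf : Integrable f) (h0 : ∀ x, 0 ≤ f x)
    (hg : ∀ x ∈ S, g x ≤ f x) {C : ℝ} (hC : ∫ x, f x ≤ C) : ∫⁻ x in S, ENNReal.ofReal (g x) ≤ ENNReal.ofReal C := by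
  calc _ ≤ ∫⁻ x in S, ENNReal.ofReal (f x) := setLIntegral_mono' hS fun x hx => ENNReal.ofReal_le_ofReal (hg x hx)
    _ ≤ ∫⁻ x, ENNReal.ofReal (f x) := setLIntegral_le_lintegral _ _
    _ = ENNReal.ofReal (∫ x, f x) := (ofReal_integral_eq_lintegral_ofReal hf (Eventually.of_forall h0)).symm
    _ ≤ _ := ENNReal.ofReal_le_ofReal hC

/-- two-sided radial cutoff -/
def chi (y : ES N) (σ r : ℝ) (x : ES N) : ℝ := cut y σ x * (1 - cut y r x)

/-- counting function of the two transition annuli -/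
def kk (y : ES N) (σ r : ℝ) (x : ES N) : ℝ := (Ann y σ).indicator (fun _ => 1) x + (Ann y r).indicator (fun _ => 1) x

lemma chi_contDiff (y : ES N) (σ r : ℝ) : ContDiff ℝ (⊤ : ℕ∞) (chi y σ r) :=
  (cut_contDiff y σ).mul (contDiff_const.sub (cut_contDiff y r))

lemma chi_nonneg (y : ES N) (σ r : ℝ) (x : ES N) : 0 ≤ chi y σ r x :=
  mul_nonneg (cut_nonneg y σ x) (by linarith [cut_le_one y r x])

lemma chi_le_one (y : ES N) (σ r : ℝ) (x : ES N) : chi y σ r x ≤ 1 :=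
  mul_le_one₀ (cut_le_one y σ x) (by linarith [cut_le_one y r x]) (by linarith [cut_nonneg y r x])

lemma chi_tsupp (y : ES N) {σ r : ℝ} (hσ : 0 < σ) (hr : 0 < r) : tsupport (chi y σ r) ⊆ {x | σ ≤ ‖x - y‖ ∧ ‖x - y‖ ≤ 2 * r} := by
  refine tsupport_subset_of ((isClosed_le continuous_const (continuous_norm_sub y)).inter
    (isClosed_le (continuous_norm_sub y) continuous_const)) fun x hx => ?_
  constructor
  · by_contra hc
    exact hx (by unfold chi; rw [cut_zero hσ (not_le.1 hc).le, zero_mul])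
  · by_contra hc
    exact hx (by unfold chi; rw [cut_one hr (not_le.1 hc).le, sub_self, mul_zero])

lemma chi_hcs (y : ES N) {σ r : ℝ} (hσ : 0 < σ) (hr : 0 < r) : HasCompactSupport (chi y σ r) :=
  (isCompact_closedBall y (2 * r)).of_isClosed_subset (isClosed_tsupport _) fun x hx => by
    rw [mem_closedBall, dist_eq_norm]; exact (chi_tsupp y hσ hr hx).2

lemma chi_one {y x : ES N} {σ r : ℝ} (hσ : 0 < σ) (hr : 0 < r) (h1 : 2 * σ ≤ ‖x - y‖) (h2 : ‖x - y‖ ≤ r) : chi y σ r x = 1 := by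
  unfold chi; rw [cut_one hσ h1, cut_zero hr h2]; simp

lemma kk_nonneg (y : ES N) (σ r : ℝ) (x : ES N) : 0 ≤ kk y σ r x :=
  add_nonneg (indicator_nonneg (fun _ _ => zero_le_one) x) (indicator_nonneg (fun _ _ => zero_le_one) x)

lemma ind_le_one (S : Set (ES N)) (x : ES N) : S.indicator (fun _ => (1:ℝ)) x ≤ 1 :=
  indicator_le_self' (fun _ _ => zero_le_one) x

lemma kk_le_two (y : ES N) (σ r : ℝ) (x : ES N) : kk y σ r x ≤ 2 := by
  unfold kk; linarith [ind_le_one (Ann y σ) x, ind_le_one (Ann y r) x]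

lemma cut_J2 (N : ℕ) : ∃ C, 1 ≤ C ∧ ∀ (p x : ES N) (σ : ℝ), 0 < σ → ∃ g l, J (cut p σ) x g l ∧
    ‖g‖ * ‖x - p‖ ≤ C * (Ann p σ).indicator (fun _ => 1) x ∧ |l| * ‖x - p‖ ^ 2 ≤ C * (Ann p σ).indicator (fun _ => 1) x := by
  obtain ⟨C, hC, hJ⟩ := cut_J N
  refine ⟨4 * C, by linarith, fun p x σ hσ => ?_⟩
  obtain ⟨g, l, h1, h2, h3, h4⟩ := hJ p x σ hσ
  refine ⟨g, l, h1, ?_⟩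
  by_cases hx : x ∈ Ann p σ
  · rw [indicator_of_mem hx]
    have hR := hx.2
    constructor
    · calc ‖g‖ * ‖x - p‖ ≤ C / σ * (2 * σ) := by gcongr
        _ = 2 * C := by field_simp
        _ ≤ _ := by linarith
    · calc |l| * ‖x - p‖ ^ 2 ≤ C / σ ^ 2 * (2 * σ) ^ 2 := by gcongr
        _ = 4 * C := by field_simp; ring
        _ ≤ _ := by linarith
  · have : ‖x - p‖ < σ ∨ 2 * σ < ‖x - p‖ := by
      by_contra hc; push Not at hc; exact hx hc
    obtain ⟨rfl, rfl⟩ := h4 this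
    rw [indicator_of_notMem hx]; simp

lemma chi_J (N : ℕ) : ∃ C, 1 ≤ C ∧ ∀ (y x : ES N) (σ r : ℝ), 0 < σ → 0 < r → ∃ g l, J (chi y σ r) x g l ∧
    ‖g‖ * ‖x - y‖ ≤ C * kk y σ r x ∧ |l| * ‖x - y‖ ^ 2 ≤ C * kk y σ r x := by
  obtain ⟨C, hC, hJ⟩ := cut_J2 N
  refine ⟨C + C ^ 2, by nlinarith, fun y x σ r hσ hr => ?_⟩
  obtain ⟨g1, l1, j1, a1, b1⟩ := hJ y x σ hσ
  obtain ⟨g2, l2, j2, a2, b2⟩ := hJ y x r hr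
  refine ⟨_, _, (j1.mul ((J_const 1 x).sub j2)), ?_, ?_⟩
  · set i1 := (Ann y σ).indicator (fun _ => (1:ℝ)) x
    set i2 := (Ann y r).indicator (fun _ => (1:ℝ)) x
    have hk : kk y σ r x = i1 + i2 := rfl
    have hk0 := kk_nonneg y σ r x
    have e1 : ‖cut y σ x • (0 - g2) + (1 - cut y r x) • g1‖ ≤ ‖g2‖ + ‖g1‖ := by
      refine (norm_add_le _ _).trans ?_
      rw [norm_smul, norm_smul, zero_sub, norm_neg, Real.norm_of_nonneg (cut_nonneg y σ x),
        Real.norm_of_nonneg (by linarith [cut_le_one y r x])]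
      have := mul_le_mul_of_nonneg_right (cut_le_one y σ x) (norm_nonneg g2)
      have := mul_le_mul_of_nonneg_right (show 1 - cut y r x ≤ 1 by linarith [cut_nonneg y r x]) (norm_nonneg g1)
      linarith
    have e2 := mul_le_mul_of_nonneg_right e1 (norm_nonneg (x - y))
    have e3 : 0 ≤ C ^ 2 * kk y σ r x := by positivity
    rw [hk] at e3 ⊢
    nlinarith
  · set i1 := (Ann y σ).indicator (fun _ => (1:ℝ)) x with hi1
    set i2 := (Ann y r).indicator (fun _ => (1:ℝ)) x with hi2
    have hi10 : 0 ≤ i1 := indicator_nonneg (fun _ _ => zero_le_one) x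
    have hi20 : 0 ≤ i2 := indicator_nonneg (fun _ _ => zero_le_one) x
    have hi1' : i1 ≤ 1 := ind_le_one _ x
    have hi2' : i2 ≤ 1 := ind_le_one _ x
    have hk : kk y σ r x = i1 + i2 := rfl
    have e1 : |cut y σ x * (0 - l2) + (1 - cut y r x) * l1 + 2 * inner ℝ g1 (0 - g2)| ≤ |l2| + |l1| + 2 * (‖g1‖ * ‖g2‖) := by
      refine (abs_add_le _ _).trans (add_le_add ((abs_add_le _ _).trans (add_le_add ?_ ?_)) ?_)
      · rw [abs_mul, zero_sub, abs_neg, abs_of_nonneg (cut_nonneg y σ x)]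
        exact mul_le_of_le_one_left (abs_nonneg _) (cut_le_one y σ x)
      · rw [abs_mul, abs_of_nonneg (by linarith [cut_le_one y r x])]
        exact mul_le_of_le_one_left (abs_nonneg _) (by linarith [cut_nonneg y r x])
      · rw [abs_mul, abs_of_pos (by norm_num : (0:ℝ) < 2), zero_sub, inner_neg_right, abs_neg]
        have := abs_real_inner_le_norm g1 g2
        linarith
    have e2 := mul_le_mul_of_nonneg_right e1 (sq_nonneg ‖x - y‖)
    have e3 : (‖g1‖ * ‖x - y‖) * (‖g2‖ * ‖x - y‖) ≤ (C * i1) * (C * i2) := by gcongr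
    have e4 : 2 * (i1 * i2) ≤ i1 + i2 := by nlinarith
    have e5 := mul_le_mul_of_nonneg_left e4 (sq_nonneg C)
    rw [hk]
    refine e2.trans ?_
    nlinarith

lemma Ann_meas (y : ES N) (σ : ℝ) : MeasurableSet (Ann y σ) := (Ann_closed y σ).measurableSet

lemma norm_rpow_meas (y : ES N) (e : ℝ) : Measurable fun x : ES N => ‖x - y‖ ^ e :=
  (continuous_norm_sub y).measurable.pow_const e

lemma Ann_int (N : ℕ) : ∃ C, 0 < C ∧ ∀ (y : ES N) (σ : ℝ), 0 < σ →
    Integrable (fun x => (Ann y σ).indicator (fun _ => (1:ℝ)) x * ‖x - y‖ ^ (-(N:ℝ))) ∧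
    ∫ x, (Ann y σ).indicator (fun _ => (1:ℝ)) x * ‖x - y‖ ^ (-(N:ℝ)) ≤ C := by
  obtain ⟨C, hC, hv⟩ := Ann_vol N
  refine ⟨C, hC, fun y σ hσ => ?_⟩
  have hi : Integrable ((Ann y σ).indicator fun _ => σ ^ (-(N:ℝ))) :=
    (integrableOn_const (Ann_compact y σ).measure_lt_top.ne).integrable_indicator (Ann_meas y σ)
  have hle : ∀ x, (Ann y σ).indicator (fun _ => (1:ℝ)) x * ‖x - y‖ ^ (-(N:ℝ)) ≤ (Ann y σ).indicator (fun _ => σ ^ (-(N:ℝ))) x := by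
    intro x
    by_cases hx : x ∈ Ann y σ
    · rw [indicator_of_mem hx, indicator_of_mem hx, one_mul]
      exact Real.rpow_le_rpow_of_nonpos hσ hx.1 (by simp)
    · rw [indicator_of_notMem hx, indicator_of_notMem hx, zero_mul]
  have hnn : ∀ x, 0 ≤ (Ann y σ).indicator (fun _ => (1:ℝ)) x * ‖x - y‖ ^ (-(N:ℝ)) := fun x =>
    mul_nonneg (indicator_nonneg (fun _ _ => zero_le_one) x) (by positivity)
  have hi2 : Integrable (fun x => (Ann y σ).indicator (fun _ => (1:ℝ)) x * ‖x - y‖ ^ (-(N:ℝ))) := by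
    refine hi.mono' ((measurable_const.indicator (Ann_meas y σ)).mul (norm_rpow_meas y _)).aestronglyMeasurable
      (Eventually.of_forall fun x => ?_)
    rw [Real.norm_of_nonneg (hnn x)]; exact hle x
  refine ⟨hi2, (integral_mono hi2 hi hle).trans ?_⟩
  rw [integral_indicator (Ann_meas y σ), setIntegral_const, smul_eq_mul, measureReal_def]
  have := mul_le_mul_of_nonneg_right (hv y σ hσ) (by positivity : 0 ≤ σ ^ (-(N:ℝ)))
  refine this.trans (le_of_eq ?_)
  rw [mul_assoc, Real.rpow_neg hσ.le, Real.rpow_natCast, mul_inv_cancel₀ (by positivity), mul_one]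

lemma kk_int (N : ℕ) : ∃ C, 0 < C ∧ ∀ (y : ES N) (σ r : ℝ), 0 < σ → 0 < r →
    Integrable (fun x => kk y σ r x * ‖x - y‖ ^ (-(N:ℝ))) ∧ ∫ x, kk y σ r x * ‖x - y‖ ^ (-(N:ℝ)) ≤ C := by
  obtain ⟨C, hC, hv⟩ := Ann_int N
  refine ⟨2 * C, by positivity, fun y σ r hσ hr => ?_⟩
  obtain ⟨i1, l1⟩ := hv y σ hσ
  obtain ⟨i2, l2⟩ := hv y r hr
  simp only [kk, add_mul]
  refine ⟨i1.add i2, ?_⟩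
  rw [integral_add i1 i2]; linarith

lemma rpow_ball_int (hN : 2 ≤ N) (h0 : 0 < α) (y : ES N) (r : ℝ) :
    IntegrableOn (fun x => ‖x - y‖ ^ (α - N)) (ball y r) := by
  have hN' : 1 ≤ N := by omega
  have h1 : IntegrableOn (fun x : ES N => ‖x‖ ^ (α - N)) (ball 0 r) := by
    refine integrableOn_ball_of_norm_le_rpow (C := 1) (α := N - α) (by simpa using hN') (by simpa using h0)
      (Eventually.of_forall fun x => ?_) (measurable_norm.pow_const _).aestronglyMeasurable
    rw [Real.norm_of_nonneg (by positivity), one_mul, neg_sub]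
  have h2 := (measurePreserving_sub_right (volume : Measure (ES N)) y).integrableOn_comp_preimage
    (measurableEmbedding_subRight y) (f := fun x : ES N => ‖x‖ ^ (α - N)) (s := ball 0 r)
  have h3 := h2.2 h1
  have : (fun x => x - y) ⁻¹' ball (0 : ES N) r = ball y r := by
    ext x; simp [dist_eq_norm]
  rw [this] at h3
  exact h3
end

section
variable {N : ℕ} {Ω : Set (ES N)} {y : ES N} {α A ρ : ℝ} {d : ES N → ℝ} {G : ES N → ES N}

lemma contDiff_mul_of_supp {χ f : ES N → ℝ} {n : WithTop ℕ∞} (h1 : ContDiff ℝ n χ) (h2 : ∀ x ∈ tsupport χ, ContDiffAt ℝ n f x) :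
    ContDiff ℝ n (fun x => χ x * f x) :=
  contDiff_iff_contDiffAt.2 fun x => by
    by_cases hx : x ∈ tsupport χ
    · exact h1.contDiffAt.mul (h2 x hx)
    · have e : (fun x => χ x * f x) =ᶠ[𝓝 x] fun _ => 0 := by
        filter_upwards [notMem_tsupport_iff_eventuallyEq.1 hx] with z hz
        simp [hz]
      exact contDiffAt_const.congr_of_eventuallyEq e

lemma integral_add3 {f g h : ES N → ℝ} (hf : Integrable f) (hg : Integrable g) (hh : Integrable h) :
    ∫ x, (f x + g x + h x) = (∫ x, f x) + (∫ x, g x) + (∫ x, h x) := by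
  have := integral_add (hf.add hg) hh
  rw [integral_add' hf hg] at this
  exact this

lemma chi_ne {x : ES N} {σ r : ℝ} (hσ : 0 < σ) (hr : 0 < r) (hx : x ∈ tsupport (chi y σ r)) : x ≠ y := by
  have := (chi_tsupp y hσ hr hx).1
  rintro rfl; simp at this; linarith

lemma abs_arctan_le (t : ℝ) : |Real.arctan t| ≤ 2 := by
  have h1 := Real.neg_pi_div_two_lt_arctan t
  have h2 := Real.arctan_lt_pi_div_two t
  have h3 := Real.pi_le_four
  rw [abs_le]; constructor <;> linarith

lemma strip_pt (hN : 2 ≤ N) (h0 : 0 < α) (h1 : α ≤ 1) {ν : ES N} (hν : ‖ν‖ = 1) : ∃ C, 1 ≤ C ∧ ∀ (y x : ES N) (σ r : ℝ), 0 < σ → 0 < r → 2 * r ≤ 1 →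
    chi y σ r x * ‖x - y‖ ^ (-(N:ℝ)) / (1 + (inner ℝ ν (x - y) * ‖x - y‖ ^ (-(1 + α))) ^ 2) ≤
      fderiv ℝ (fun z => chi y σ r z * (‖z - y‖ ^ gam N α * Real.arctan (inner ℝ ν (z - y) * ‖z - y‖ ^ (-(1 + α))))) x ν
      + C * (kk y σ r x * ‖x - y‖ ^ (-(N:ℝ))) + C * (ball y 2).indicator (fun x => ‖x - y‖ ^ (α - N)) x := by
  obtain ⟨C, hC, hJ⟩ := chi_J N
  refine ⟨2 * C + 2 * N + 2, by nlinarith [(Nat.cast_nonneg N : (0:ℝ) ≤ N)], fun y x σ r hσ hr hr2 => ?_⟩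
  have hNN : (2:ℝ) ≤ N := by exact_mod_cast hN
  by_cases hx : x ∈ tsupport (chi y σ r)
  swap
  · have e1 : chi y σ r x = 0 := image_eq_zero_of_notMem_tsupport hx
    have e2 : fderiv ℝ (fun z => chi y σ r z * (‖z - y‖ ^ gam N α * Real.arctan (inner ℝ ν (z - y) * ‖z - y‖ ^ (-(1 + α))))) x = 0 :=
      image_eq_zero_of_notMem_tsupport fun h => hx (tsupport_mul_subset_left (tsupport_fderiv_subset ℝ h))
    rw [e1, e2]
    have : 0 ≤ (ball y 2).indicator (fun x => ‖x - y‖ ^ (α - N)) x := indicator_nonneg (fun _ _ => by positivity) _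
    have := kk_nonneg y σ r x
    simp only [zero_mul, zero_div, _root_.zero_apply, zero_add]
    positivity
  have hxy := chi_ne hσ hr hx
  have hR : 0 < ‖x - y‖ := norm_pos_iff.2 (sub_ne_zero.2 hxy)
  have hR1 : ‖x - y‖ ≤ 1 := (chi_tsupp y hσ hr hx).2.trans hr2
  rw [indicator_of_mem (by rw [mem_ball, dist_eq_norm]; linarith)]
  obtain ⟨g, l, j, b1, -⟩ := hJ y x σ r hσ hr
  set τ := inner ℝ ν (x - y) with hτ
  set R := ‖x - y‖ with hRd
  set t := τ * R ^ (-(1 + α)) with ht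
  have jt := J_tau_rpow (-(1 + α)) (ν := ν) hxy
  have ja := jt.comp (φ := Real.arctan) Real.contDiff_arctan.contDiffAt rfl rfl
  have jF := j.mul ((J_rpow (gam N α) hxy).mul ja)
  rw [jF.2.1 ν]
  simp only [inner_add_left, inner_smul_left, real_inner_self_eq_norm_sq, hν, Real.deriv_arctan, ← hτ, ← hRd, ← ht, real_inner_comm ν (x - y), RCLike.conj_to_real]
  set c := chi y σ r x with hc
  have c0 : 0 ≤ c := chi_nonneg _ _ _ _
  have c1 : c ≤ 1 := chi_le_one _ _ _ _
  have hτR : |τ| ≤ R := (abs_real_inner_le_norm _ _).trans (by rw [hν, one_mul])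
  have hg : |inner ℝ g ν| ≤ ‖g‖ := (abs_real_inner_le_norm _ _).trans (by rw [hν, mul_one])
  set gn := (inner ℝ g ν : ℝ)
  set at' := Real.arctan t
  have hat : |at'| ≤ 2 := abs_arctan_le t
  set k := kk y σ r x
  have k0 : 0 ≤ k := kk_nonneg _ _ _ _
  -- powers
  have p1 : R ^ gam N α * R ^ (-(1 + α)) = R ^ (-(N:ℝ)) := by rw [← Real.rpow_add hR]; congr 1; simp [gam]; ring
  have p2 : R ^ (gam N α - 2) * R = R ^ (α - N) := by
    conv_lhs => rw [← Real.rpow_one R, ← Real.rpow_mul hR.le, ← Real.rpow_add hR]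
    congr 1; simp [gam]; ring
  have p3 : R ^ gam N α ≤ R ^ (-(N:ℝ)) * R := by
    conv_rhs => rw [← Real.rpow_one R, ← Real.rpow_mul hR.le, ← Real.rpow_add hR]
    refine Real.rpow_le_rpow_of_exponent_ge hR hR1 ?_
    simp [gam]; linarith
  have p4 : R ^ gam N α * R ^ (-(1 + α) - 2) * τ ^ 2 ≤ R ^ (α - N) * (1 + t ^ 2) := by
    have : R ^ gam N α * R ^ (-(1 + α) - 2) * τ ^ 2 = R ^ (2 * α - N) * t ^ 2 := by
      have e1 : R ^ gam N α * R ^ (-(1 + α) - 2) = R ^ (2 * α - N) * (R ^ (-(1 + α))) ^ 2 := by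
        rw [← Real.rpow_natCast (R ^ (-(1+α))), ← Real.rpow_mul hR.le, ← Real.rpow_add hR, ← Real.rpow_add hR]; congr 1; simp [gam]; ring
      rw [e1, ht]; ring
    rw [this]
    have e2 : R ^ (2 * α - N) ≤ R ^ (α - N) := Real.rpow_le_rpow_of_exponent_ge hR hR1 (by linarith)
    have : 0 ≤ R ^ (α - N) := by positivity
    nlinarith [sq_nonneg t]
  clear jF ja jt
  set Rg := R ^ gam N α
  set Re := R ^ (-(1 + α))
  set Rn := R ^ (-(N:ℝ))
  set Ra := R ^ (α - N)
  set Rg2 := R ^ (gam N α - 2)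
  set Re2 := R ^ (-(1 + α) - 2)
  have g0 : 0 ≤ Rg := by positivity
  have ra0 : 0 ≤ Ra := by positivity
  have rn0 : 0 ≤ Rn := by positivity
  have re20 : 0 ≤ Re2 := by positivity
  have rg20 : 0 ≤ Rg2 := by positivity
  clear_value Rg Re Rn Ra Rg2 Re2 at' gn k c t τ
  have T0 : 0 < 1 + t ^ 2 := by positivity
  -- error 1
  have E1 : -(Rg * at' * gn) ≤ 2 * C * (k * Rn) := by
    have : |Rg * at' * gn| ≤ (Rn * R) * 2 * ‖g‖ := by
      rw [abs_mul, abs_mul, abs_of_nonneg g0]; gcongr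
    have : -(Rg * at' * gn) ≤ (Rn * R) * 2 * ‖g‖ := (neg_le_abs _).trans this
    calc _ ≤ _ := this
      _ = 2 * Rn * (‖g‖ * R) := by ring
      _ ≤ 2 * Rn * (C * k) := by gcongr
      _ = _ := by ring
  have E2 : -(c * (at' * (gam N α * Rg2 * τ))) ≤ 2 * N * Ra := by
    have hgam : |gam N α| ≤ N := by rw [abs_le]; simp only [gam]; constructor <;> linarith
    have : |c * (at' * (gam N α * Rg2 * τ))| ≤ 1 * (2 * (N * Rg2 * R)) := by
      rw [abs_mul, abs_mul, abs_mul, abs_mul, abs_of_nonneg c0, abs_of_nonneg rg20]; gcongr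
    calc _ ≤ _ := (neg_le_abs _).trans this
      _ = 2 * N * (Rg2 * R) := by ring
      _ = _ := by rw [p2]
  have E3 : c * ((1 + α) * (Rg * Re2 * τ ^ 2)) / (1 + t ^ 2) ≤ 2 * Ra := by
    rw [div_le_iff₀ T0]
    have : 0 ≤ Rg * Re2 * τ ^ 2 := by positivity
    calc c * ((1 + α) * (Rg * Re2 * τ ^ 2)) ≤ 1 * (2 * (Ra * (1 + t ^ 2))) := by gcongr; linarith
      _ = _ := by ring
  have key : c * Rn / (1 + t ^ 2) = (c * (Rg * (1 / (1 + t ^ 2) * (τ * (-(1 + α) * Re2 * τ) + Re * 1 ^ 2)) + at' * (gam N α * Rg2 * τ)) + Rg * at' * gn)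
      - Rg * at' * gn - c * (at' * (gam N α * Rg2 * τ)) + c * ((1 + α) * (Rg * Re2 * τ ^ 2)) / (1 + t ^ 2) := by
    rw [← p1]; field_simp; ring
  have m1 : 0 ≤ k * Rn := by positivity
  have m2 : 2 * N * Ra + 2 * Ra ≤ (2 * C + 2 * N + 2) * Ra := by nlinarith
  have m3 : 2 * C * (k * Rn) ≤ (2 * C + 2 * N + 2) * (k * Rn) := by nlinarith
  rw [key]
  linarith

lemma int_ind_ball (hN : 2 ≤ N) (h0 : 0 < α) (y : ES N) : Integrable ((ball y 2).indicator (fun x => ‖x - y‖ ^ (α - N))) :=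
  (integrable_indicator_iff measurableSet_ball).2 (rpow_ball_int hN h0 y 2)

lemma strip (hN : 2 ≤ N) (h0 : 0 < α) (h1 : α ≤ 1) {ν : ES N} (hν : ‖ν‖ = 1) (y : ES N) (B : ℝ) : ∃ C, 0 < C ∧ ∀ σ r : ℝ, 0 < σ → 0 < r → 2 * r ≤ 1 →
    ∫⁻ x in {x | |inner ℝ ν (x - y)| ≤ B * ‖x - y‖ ^ (1 + α) ∧ 2 * σ ≤ ‖x - y‖ ∧ ‖x - y‖ ≤ r}, ENNReal.ofReal (‖x - y‖ ^ (-(N:ℝ))) ≤ ENNReal.ofReal C := by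
  obtain ⟨C, hC, hp⟩ := strip_pt hN h0 h1 hν
  obtain ⟨Ck, hCk, hk⟩ := kk_int N
  set I := ∫ x, (ball y 2).indicator (fun x => ‖x - y‖ ^ (α - N)) x
  have hI : 0 ≤ I := integral_nonneg fun x => indicator_nonneg (fun _ _ => by positivity) _
  refine ⟨(1 + B ^ 2) * (C * Ck + C * I), by positivity, fun σ r hσ hr hr2 => ?_⟩
  set F := fun z => chi y σ r z * (‖z - y‖ ^ gam N α * Real.arctan (inner ℝ ν (z - y) * ‖z - y‖ ^ (-(1 + α)))) with hF
  have hFc : ContDiff ℝ 2 F := contDiff_mul_of_supp ((chi_contDiff y σ r).of_le two_le_top) fun x hx => by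
    have hxy := chi_ne hσ hr hx
    exact (contDiffAt_norm_rpow _ hxy).mul (Real.contDiff_arctan.contDiffAt.comp x (((contDiff_inner_sub ν y).contDiffAt).mul (contDiffAt_norm_rpow _ hxy)))
  have hFs : HasCompactSupport F := (chi_hcs y hσ hr).mul_right
  have i1 : Integrable fun x => fderiv ℝ F x ν := by
    refine Continuous.integrable_of_hasCompactSupport ?_ ?_
    · exact (hFc.continuous_fderiv (by norm_num)).clm_apply continuous_const
    · exact (hFs.fderiv ℝ).comp_left (g := fun (L : ES N →L[ℝ] ℝ) => L ν) (by simp)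
  obtain ⟨i2, l2⟩ := hk y σ r hσ hr
  have i3 := int_ind_ball hN h0 y
  have z1 := int_fderiv_zero (hFc.of_le (by norm_num)) hFs ν
  have hcont : Continuous fun x : ES N => inner ℝ ν (x - y) := by fun_prop
  refine setLInt_le_of_le (f := fun x => (1 + B ^ 2) * (fderiv ℝ F x ν + C * (kk y σ r x * ‖x - y‖ ^ (-(N:ℝ))) + C * (ball y 2).indicator (fun x => ‖x - y‖ ^ (α - N)) x)) ?_ ?_ ?_ ?_ ?_
  · refine MeasurableSet.inter ?_ (MeasurableSet.inter ?_ ?_)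
    · exact measurableSet_le hcont.abs.measurable (((norm_rpow_meas y _)).const_mul B)
    · exact measurableSet_le measurable_const (continuous_norm_sub y).measurable
    · exact measurableSet_le (continuous_norm_sub y).measurable measurable_const
  · exact ((i1.add (i2.const_mul C)).add (i3.const_mul C)).const_mul _
  · intro x
    refine mul_nonneg (by positivity) (le_trans ?_ (hp y x σ r hσ hr hr2))
    have := chi_nonneg y σ r x
    positivity
  · rintro x ⟨h1, h2, h3⟩
    refine le_trans ?_ (mul_le_mul_of_nonneg_left (hp y x σ r hσ hr hr2) (by positivity))
    rw [chi_one hσ hr h2 h3, one_mul]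
    have hR : 0 < ‖x - y‖ := by linarith
    set t := inner ℝ ν (x - y) * ‖x - y‖ ^ (-(1 + α))
    have ht : |t| ≤ B := by
      rw [abs_mul, abs_of_pos (by positivity : 0 < ‖x - y‖ ^ (-(1 + α))), Real.rpow_neg hR.le, ← div_eq_mul_inv, div_le_iff₀ (by positivity)]
      exact h1
    have : t ^ 2 ≤ B ^ 2 := by rw [← sq_abs t]; gcongr
    rw [mul_div_assoc', le_div_iff₀ (by positivity), mul_comm]
    gcongr
  · rw [integral_const_mul, integral_add3 i1 (i2.const_mul C) (i3.const_mul C), z1, integral_const_mul, integral_const_mul, zero_add]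
    gcongr
end

section
variable {N : ℕ} {Ω : Set (ES N)} {y : ES N} {α A ρ : ℝ} {d : ES N → ℝ} {G : ES N → ES N}

lemma continuous_mul_of_supp {χ f : ES N → ℝ} (h1 : Continuous χ) (h2 : ∀ x ∈ tsupport χ, ContinuousAt f x) :
    Continuous (fun x => χ x * f x) :=
  continuous_iff_continuousAt.2 fun x => by
    by_cases hx : x ∈ tsupport χ
    · exact h1.continuousAt.mul (h2 x hx)
    · have e : (fun x => χ x * f x) =ᶠ[𝓝 x] fun _ => 0 := by
        filter_upwards [notMem_tsupport_iff_eventuallyEq.1 hx] with z hz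
        simp [hz]
      exact continuousAt_const.congr e.symm

lemma J.grad_unique {u : ES N → ℝ} {x g g' : ES N} {l l' : ℝ} (h : J u x g l) (h' : J u x g' l') : g = g' :=
  ext_inner_right ℝ fun v => by rw [← h.2.1, h'.2.1]

lemma bad_local {P g : ES N → ℝ} {x kP kg ν : ES N} {lP lg ε c C : ℝ} (hP : J P x kP lP) (hg : J g x kg lg)
    (P0 : 0 < P x) (g0 : 0 ≤ g x) (lP0 : 0 ≤ lP) (lg0 : 0 ≤ lg) (hε : 0 < ε) (hν : ‖ν‖ = 1)
    (hC : ∀ t, |deriv Real.smoothTransition t| ≤ C) :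
    ∃ kΨ lΨ kW lW s T, J (fun z => P z * jj ε (c - g z / P z)) x kΨ lΨ ∧
      J (fun z => P z * Real.smoothTransition ((c - g z / P z) / ε - 1) ^ 2) x kW lW ∧ 0 ≤ T ∧ T ≤ lΨ + lg ∧
      inner ℝ kW ν = Real.smoothTransition ((c - g x / P x) / ε - 1) ^ 2 * inner ℝ kP ν
        + 2 * P x * Real.smoothTransition ((c - g x / P x) / ε - 1) * s ∧ P x * s ^ 2 ≤ C / ε * T := by
  have hcu : ContDiffAt ℝ 2 (fun z => g z / P z) x := hg.1.div hP.1 P0.ne'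
  have ju := exists_J hcu
  set ku := gradient (fun z => g z / P z) x
  set lu := lap (fun z => g z / P z) x
  have jg := (hP.mul ju).congr (v := g) (by
    filter_upwards [hP.1.continuousAt.eventually (lt_mem_nhds P0)] with z hz
    field_simp)
  have el := hg.2.2.symm.trans jg.2.2
  set ux := g x / P x with hux
  have ux0 : 0 ≤ ux := by positivity
  have jw := (J_const c x).sub ju
  have jf := jw.comp (φ := jj ε) ((jj_contDiff ε).of_le two_le_top).contDiffAt rfl rfl
  have hst2 : ContDiff ℝ 2 (fun t : ℝ => Real.smoothTransition (t / ε - 1)) :=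
    (st_contDiff.of_le two_le_top).comp (by fun_prop)
  have jq := jw.comp (φ := fun t : ℝ => Real.smoothTransition (t / ε - 1)) hst2.contDiffAt (a := deriv (deriv (jj ε)) (c - ux)) (by rw [jj_deriv]) rfl
  have jΨ := hP.mul jf
  have jW := hP.mul (jq.mul jq)
  have hS : deriv (jj ε) (c - ux) = Real.smoothTransition ((c - ux) / ε - 1) := by rw [jj_deriv]
  have hb0 := jj_d2_nonneg hε (c - ux)
  have hbC : deriv (deriv (jj ε)) (c - ux) ≤ C / ε := by
    rw [jj_deriv]
    have : HasDerivAt (fun t : ℝ => Real.smoothTransition (t / ε - 1)) (deriv Real.smoothTransition ((c - ux) / ε - 1) * (1 / ε)) (c - ux) := by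
      have h1 : HasDerivAt (fun t : ℝ => t / ε - 1) (1 / ε) (c - ux) := ((hasDerivAt_id _).div_const ε).sub_const 1
      exact HasDerivAt.comp (c - ux) ((st_contDiff.differentiable (by simp)) _).hasDerivAt h1
    rw [this.deriv, mul_one_div]
    gcongr
    exact (le_abs_self _).trans (hC _)
  set b := deriv (deriv (jj ε)) (c - ux) with hb
  set S := Real.smoothTransition ((c - ux) / ε - 1) with hSd
  have S0 : 0 ≤ S := Real.smoothTransition.nonneg _
  have S1 : S ≤ 1 := Real.smoothTransition.le_one _
  have hf0 : 0 ≤ jj ε (c - ux) := jj_nonneg hε _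
  refine ⟨_, _, _, _, -b * inner ℝ ku ν, P x * b * ‖ku‖ ^ 2, jΨ, jW.congr (Eventually.of_forall fun z => by simp only; ring), by positivity, ?_, ?_, ?_⟩
  · simp only [zero_sub, norm_neg, inner_smul_right, inner_neg_right]
    rw [hS] 
    have e1 : 0 ≤ (jj ε (c - ux) + ux * S) * lP := by positivity
    have e2 : 0 ≤ (1 - S) * lg := mul_nonneg (by linarith) lg0
    have e3 : S * lg = S * (P x * lu + ux * lP + 2 * inner ℝ kP ku) := by rw [el]
    nlinarith
  · simp only [inner_add_left, inner_smul_left, zero_sub, inner_neg_left, RCLike.conj_to_real]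
    ring
  · have h1 : |inner ℝ ku ν| ≤ ‖ku‖ := (abs_real_inner_le_norm _ _).trans (by rw [hν, mul_one])
    have h2 : (inner ℝ ku ν : ℝ) ^ 2 ≤ ‖ku‖ ^ 2 := by rw [← sq_abs]; gcongr
    have hCε : 0 ≤ C / ε := hb0.trans hbC
    calc P x * (-b * inner ℝ ku ν) ^ 2 = P x * b * (b * (inner ℝ ku ν : ℝ) ^ 2) := by ring
      _ ≤ P x * b * (C / ε * ‖ku‖ ^ 2) := by gcongr
      _ = _ := by ring

lemma bad_alg {c q P Rn τ gW Pν s C T : ℝ} (c0 : 0 ≤ c) (P0 : 0 < P) (hPτ : P ≤ τ * Rn) (hRn : 0 < Rn)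
    (hgW : gW = q ^ 2 * Pν + 2 * P * q * s) (hq : q ≠ 0 → Rn / 2 ≤ Pν) (hs : P * s ^ 2 ≤ C * T) :
    1 / 4 * (c * q ^ 2 * Rn) ≤ c * gW + 4 * C * (c * τ * T) := by
  have h1 : q ^ 2 * (Rn / 2) ≤ q ^ 2 * Pν := by
    by_cases h : q = 0
    · simp [h]
    · have := hq h; gcongr
  have hτ : 0 < τ := by
    by_contra h
    have : τ * Rn ≤ 0 := mul_nonpos_of_nonpos_of_nonneg (not_lt.1 h) hRn.le
    linarith
  have h2 : -(2 * P * q * s) ≤ q ^ 2 * Rn / 4 + 4 * (τ * (C * T)) := by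
    have h3 : 0 ≤ (q * Rn / 2 + 2 * P * s) ^ 2 / Rn := by positivity
    have h4 : (q * Rn / 2 + 2 * P * s) ^ 2 / Rn = q ^ 2 * Rn / 4 + 2 * P * q * s + 4 * (P / Rn) * (P * s ^ 2) := by
      field_simp; ring
    have h5 : 4 * (P / Rn) * (P * s ^ 2) ≤ 4 * τ * (C * T) := by
      have : P / Rn ≤ τ := by rw [div_le_iff₀ hRn]; exact hPτ
      gcongr
    nlinarith
  have h6 : q ^ 2 * Rn / 4 ≤ gW + 4 * (τ * (C * T)) := by rw [hgW]; linarith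
  have := mul_le_mul_of_nonneg_left h6 c0
  nlinarith

lemma Pm_J2 (hN : 2 ≤ N) (h0 : 0 < α) (h1 : α ≤ 1) (hA : 0 < A) : ∃ κ r, 0 < κ ∧ 0 < r ∧ r ≤ 1 ∧ ∀ (ν p x : ES N), ‖ν‖ = 1 → x ≠ p → ‖x - p‖ ≤ r →
    ∃ g l, J (Pm N α A ν p) x g l ∧ (- cst N α * ‖x - p‖ ≤ inner ℝ ν (x - p) → 0 < l) ∧
      (|inner ℝ ν (x - p)| ≤ κ * ‖x - p‖ → ‖x - p‖ ^ (-(N:ℝ)) / 2 ≤ inner ℝ g ν) := by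
  have h4 : (2:ℝ) ≤ N := by exact_mod_cast hN
  set C := (N + MM N α * (N + 2) + N * (N + 3)) with hC
  obtain ⟨r, hr, hr1, hrα⟩ := small_rpow h0 (A * C) one_pos (show (0:ℝ) < 1 / 4 by norm_num)
  refine ⟨1 / (2 * N), r, by positivity, hr, hr1, fun ν p x hν hx hxr => ?_⟩
  obtain ⟨g, l, hJ, hg, hl⟩ := Bf_lap hN h0 h1 hν hx
  have hR : 0 < ‖x - p‖ := norm_pos_iff.2 (sub_ne_zero.2 hx)
  refine ⟨_, _, (J_Pk hx).sub (hJ.cmul A), fun ht => ?_, fun ht => ?_⟩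
  · have h2 := hl ht
    have h3 : 0 < ‖x - p‖ ^ (gam N α - 2) := by positivity
    nlinarith [mul_pos hA (mul_pos (by linarith : (0:ℝ) < N) h3)]
  · simp only [inner_sub_left, inner_add_left, inner_smul_left, RCLike.conj_to_real, real_inner_self_eq_norm_sq, hν, real_inner_comm ν (x - p)]
    set τ := inner ℝ ν (x - p)
    set R := ‖x - p‖ with hRd
    have hM := MM_pos hN h0 h1
    have hC0 : 0 ≤ C := by positivity
    have e1 : |inner ℝ g ν| ≤ C * R ^ (gam N α - 1) := ((abs_real_inner_le_norm _ _).trans (by rw [hν, mul_one])).trans hg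
    have e2 : R ^ (gam N α - 1) = R ^ α * R ^ (-(N:ℝ)) := by rw [← Real.rpow_add hR]; congr 1; simp [gam]; ring
    have e3 : R ^ (-(N:ℝ) - 2) = R ^ (-(N:ℝ)) / R ^ 2 := (rpow_split hR _).2
    have e4 : R ^ α ≤ r ^ α := by gcongr
    have e5 : τ ^ 2 ≤ (1 / (2 * N) * R) ^ 2 := by rw [← sq_abs]; gcongr
    have e6 : τ * (-(N:ℝ) * R ^ (-(N:ℝ) - 2) * τ) ≥ - (1 / 4 * R ^ (-(N:ℝ))) := by
      rw [e3]
      have : τ * (-(N:ℝ) * (R ^ (-(N:ℝ)) / R ^ 2) * τ) = - ((N * R ^ (-(N:ℝ)) / R ^ 2) * τ ^ 2) := by ring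
      rw [this]
      have : (N * R ^ (-(N:ℝ)) / R ^ 2) * τ ^ 2 ≤ (N * R ^ (-(N:ℝ)) / R ^ 2) * (1 / (2 * N) * R) ^ 2 := by gcongr
      have e7 : (N * R ^ (-(N:ℝ)) / R ^ 2) * (1 / (2 * N) * R) ^ 2 = R ^ (-(N:ℝ)) / (4 * N) := by field_simp; ring
      have e8 : R ^ (-(N:ℝ)) / (4 * N) ≤ R ^ (-(N:ℝ)) / 4 := by gcongr; linarith
      linarith
    have e9 : A * inner ℝ g ν ≤ 1 / 4 * R ^ (-(N:ℝ)) := by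
      calc A * inner ℝ g ν ≤ A * (C * (r ^ α * R ^ (-(N:ℝ)))) := by
            have := (le_abs_self _).trans e1
            rw [e2] at this
            gcongr
            exact this.trans (by gcongr)
        _ = (A * C * r ^ α) * R ^ (-(N:ℝ)) := by ring
        _ ≤ _ := by gcongr
    linarith
end

section
variable {N : ℕ} {Ω : Set (ES N)} {y : ES N} {α A ρ : ℝ} {d : ES N → ℝ} {G : ES N → ES N}

lemma Geo.vht (H : Geo Ω y α A ρ d G) {K V h : ES N → ℝ} {a : ℝ} (HK : Sol Ω y (fun _ => 0) K 0) (HS : Sol Ω y V h a)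
    (hle : ∀ x, h x ≤ K x) : ∃ C r, 0 < C ∧ 0 < r ∧ r ≤ ρ / 8 ∧ ∀ σ, 0 < σ →
      ∫⁻ x in {x | x ∈ Ω ∧ 2 * σ ≤ ‖x - y‖ ∧ ‖x - y‖ ≤ r}, ENNReal.ofReal (V x * h x * inner ℝ (nv G y) (x - y)) ≤ ENNReal.ofReal C := by
  obtain ⟨C, r, r0, p0, hC, hr, hrρ, hr0, hb0, hmain⟩ := H.test_sol HK.op HK.bdd HK.yn
  obtain ⟨Cv, hCv, hvol⟩ := Ann_vol N
  obtain ⟨Cu, ru, hCu, hru, -, hub⟩ := H.ub2 HK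
  refine ⟨C * Cv * Cu, r, by positivity, hr, hrρ, fun σ' hσ' => ?_⟩
  set σ := min σ' (min r (ru / 4)) with hσd
  have hσ : 0 < σ := by positivity
  have hσ1 : σ ≤ r := (min_le_right _ _).trans (min_le_left _ _)
  have hσ2 : σ ≤ ru / 4 := (min_le_right _ _).trans (min_le_right _ _)
  have hσ3 : σ ≤ σ' := min_le_left _ _
  refine (lintegral_mono_set (fun x hx => ⟨hx.1, by linarith [hx.2.1], hx.2.2⟩ : {x | x ∈ Ω ∧ 2 * σ' ≤ ‖x - y‖ ∧ ‖x - y‖ ≤ r} ⊆ {x | x ∈ Ω ∧ 2 * σ ≤ ‖x - y‖ ∧ ‖x - y‖ ≤ r})).trans ?_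
  refine ((hmain V h a HS σ hσ hσ1).2).trans (ENNReal.ofReal_le_ofReal ?_)
  have hb : ∀ x ∈ Ann y σ, h x ≤ Cu * σ ^ (1 - (N:ℝ)) := by
    intro x hx
    have h1 : x ∈ ball y ru := mem_ball_norm.2 (by have := hx.2; linarith)
    have hxy : x ≠ y := by rintro rfl; exact Ann_y hσ hx
    refine (hle x).trans ((hub x h1 hxy).trans ?_)
    refine mul_le_mul_of_nonneg_left ?_ hCu.le
    have : (2:ℝ) ≤ N := by exact_mod_cast H.hN
    exact Real.rpow_le_rpow_of_nonpos hσ hx.1 (by linarith)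
  have h2 : ∫ x in Ann y σ, h x ≤ ∫ x in Ann y σ, Cu * σ ^ (1 - (N:ℝ)) :=
    setIntegral_mono_on (HS.intOn (Ann_compact y σ) (Ann_y hσ)) (integrableOn_const (Ann_compact y σ).measure_lt_top.ne)
      (Ann_closed y σ).measurableSet hb
  rw [setIntegral_const, smul_eq_mul, measureReal_def] at h2
  have h3 := mul_le_mul_of_nonneg_right (hvol y σ hσ) (by positivity : 0 ≤ Cu * σ ^ (1 - (N:ℝ)))
  have h4 : Cv * σ ^ N * (Cu * σ ^ (1 - (N:ℝ))) = Cv * Cu * σ := by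
    have := rpow_one_sub_mul_pow (N := N) hσ
    linear_combination Cv * Cu * this
  have h5 : C / σ * (∫ x in Ann y σ, h x) ≤ C / σ * (Cv * Cu * σ) := by gcongr; linarith
  have h6 : C / σ * (Cv * Cu * σ) = C * Cv * Cu := by field_simp
  linarith

lemma phi_J (N : ℕ) : ∃ C, 1 ≤ C ∧ ∀ (ν y x : ES N) (σ r : ℝ), ‖ν‖ = 1 → 0 < σ → 0 < r → x ≠ y →
    |lap (fun z => chi y σ r z * inner ℝ ν (z - y)) x| ≤ C * (kk y σ r x / ‖x - y‖) := by
  obtain ⟨C, hC, hJ⟩ := chi_J N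
  refine ⟨3 * C, by linarith, fun ν y x σ r hν hσ hr hxy => ?_⟩
  obtain ⟨g, l, j, b1, b2⟩ := hJ y x σ r hσ hr
  rw [(j.mul (J_lin ν y x)).2.2]
  have hR : 0 < ‖x - y‖ := norm_pos_iff.2 (sub_ne_zero.2 hxy)
  have ht := abs_tau_le hν (x - y)
  have hg : |inner ℝ g ν| ≤ ‖g‖ := (abs_real_inner_le_norm _ _).trans (by rw [hν, mul_one])
  rw [mul_div_assoc', le_div_iff₀ hR]
  have e : |chi y σ r x * 0 + inner ℝ ν (x - y) * l + 2 * inner ℝ g ν| ≤ ‖x - y‖ * |l| + 2 * ‖g‖ := by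
    rw [mul_zero, zero_add]
    refine (abs_add_le _ _).trans ?_
    rw [abs_mul, abs_mul, abs_two]
    gcongr
  nlinarith

end

section
variable {N : ℕ} {Ω : Set (ES N)} {y : ES N} {α A ρ : ℝ} {d : ES N → ℝ} {G : ES N → ES N}

lemma bad_core (hN : 2 ≤ N) (h0 : 0 < α) (h1 : α ≤ 1) (hA : 0 < A) : ∃ C κ r2, 0 < C ∧ 0 < κ ∧ 0 < r2 ∧ r2 ≤ 1 ∧
    ∀ (ν y : ES N) (σ r c m : ℝ) (g η : ES N → ℝ), ‖ν‖ = 1 → 0 < σ → 0 < r → 3 * r ≤ r2 → 0 < c → 0 < m →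
      ContDiff ℝ (⊤ : ℕ∞) g → ContDiff ℝ (⊤ : ℕ∞) η → (∀ z, 0 ≤ η z) →
      (∀ z ∈ tsupport η, 0 ≤ lap g z) → (∀ z ∈ tsupport η, 0 < inner ℝ ν (z - y)) →
      (∀ z, σ / 2 ≤ ‖z - y‖ → ‖z - y‖ ≤ 3 * r → A * ‖z - y‖ ^ (1 + α) ≤ inner ℝ ν (z - y) →
        η z = 1 ∧ m ≤ g z ∧ (κ * ‖z - y‖ ≤ inner ℝ ν (z - y) → c * Pm N α A ν y z ≤ g z)) →
      ∫⁻ x in {x | (0 < inner ℝ ν (x - y) ∧ 0 < Pm N α A ν y x ∧ g x / Pm N α A ν y x ≤ 3 / 4 * c) ∧ 2 * σ ≤ ‖x - y‖ ∧ ‖x - y‖ ≤ r},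
        ENNReal.ofReal (‖x - y‖ ^ (-(N:ℝ))) ≤ ENNReal.ofReal (C * (1 + c⁻¹ * ∫ x, chi y σ r x * inner ℝ ν (x - y) * η x * lap g x)) := by
  obtain ⟨κ, r2, hκ, hr2, hr21, hPJ⟩ := Pm_J2 (α := α) (A := A) hN h0 h1 hA
  obtain ⟨CS, hCS, hS', -⟩ := st_deriv_bdd
  obtain ⟨Cχ, hCχ, hχJ⟩ := chi_J N
  obtain ⟨Cφ, hCφ, hφJ⟩ := phi_J N
  obtain ⟨Ck, hCk, hk⟩ := kk_int N
  have hcst := cst_pos hN h0 h1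
  refine ⟨4 * (Cχ * Ck + 32 * CS * (Cφ * Ck)) + 128 * CS, κ, r2, by positivity, hκ, hr2, hr21, ?_⟩
  intro ν y σ r c m g η hν hσ hr hr3 hc hm hg hη hη0 hlg hητ hE
  set P := Pm N α A ν y with hP
  set D : Set (ES N) := {x | 0 < inner ℝ ν (x - y) ∧ 0 < P x} with hD
  set ε := c / 8 with hε
  have hε0 : 0 < ε := by positivity
  set Ψ := D.indicator (fun z => P z * jj ε (c - g z / P z)) with hΨ
  set Wf := fun z => P z * Real.smoothTransition ((c - g z / P z) / ε - 1) ^ 2 with hWf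
  set W := D.indicator Wf with hW
  set φ := fun z => chi y σ r z * inner ℝ ν (z - y) with hφ
  set χ := chi y σ r with hχ
  have hτc : Continuous fun z : ES N => (inner ℝ ν (z - y) : ℝ) := by fun_prop
  have hRc := continuous_norm_sub y
  have hDτ : ∀ z ∈ D, z ≠ y → A * ‖z - y‖ ^ (1 + α) < inner ℝ ν (z - y) := fun z hz hzy =>
    Pm_pos_imp hN h0 h1 hA.le hν hzy hz.1.le hz.2
  have hne : ∀ z, σ / 2 ≤ ‖z - y‖ → z ≠ y := fun z hz => by
    rintro rfl; simp at hz; linarith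
  have hDE : ∀ z ∈ D, σ / 2 ≤ ‖z - y‖ → ‖z - y‖ ≤ 3 * r → η z = 1 ∧ m ≤ g z ∧ (κ * ‖z - y‖ ≤ inner ℝ ν (z - y) → c * P z ≤ g z) :=
    fun z hz a b => hE z a b (hDτ z hz (hne z a)).le
  have hann : ∀ x ∈ tsupport χ, σ ≤ ‖x - y‖ ∧ ‖x - y‖ ≤ 2 * r := fun x hx => chi_tsupp y hσ hr hx
  have hannE : ∀ x ∈ tsupport χ, ∀ᶠ z in 𝓝 x, σ / 2 ≤ ‖z - y‖ ∧ ‖z - y‖ ≤ 3 * r := fun x hx => by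
    have := hann x hx
    filter_upwards [hRc.continuousAt.eventually (lt_mem_nhds (show σ / 2 < ‖x - y‖ by linarith)),
      hRc.continuousAt.eventually (gt_mem_nhds (show ‖x - y‖ < 3 * r by linarith))] with z a b
    exact ⟨a.le, b.le⟩
  have hDo : ∀ x ∈ D, x ≠ y → ∀ᶠ z in 𝓝 x, z ∈ D := fun x hx hxy => by
    filter_upwards [hτc.continuousAt.eventually (lt_mem_nhds hx.1),
      (Pm_cont hN h0 h1 hA hν hxy).eventually (lt_mem_nhds hx.2)] with z a b
    exact ⟨a, b⟩
  have hz : ∀ x ∈ tsupport χ, x ∉ D → ∀ᶠ z in 𝓝 x, z ∈ D → c - g z / P z ≤ 0 := by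
    intro x hx hxD
    have hxy := chi_ne hσ hr hx
    have hR : 0 < ‖x - y‖ := norm_pos_iff.2 (sub_ne_zero.2 hxy)
    by_cases hτ : 0 < (inner ℝ ν (x - y) : ℝ)
    · have hPx : P x ≤ 0 := not_lt.1 fun h => hxD ⟨hτ, h⟩
      filter_upwards [hannE x hx, (Pm_cont hN h0 h1 hA hν hxy).eventually (gt_mem_nhds (show P x < m / c from hPx.trans_lt (by positivity)))] with z hz hzP hzD
      have h2 := (hDE z hzD hz.1 hz.2).2.1
      rw [sub_nonpos, le_div_iff₀ hzD.2]
      rw [lt_div_iff₀ hc] at hzP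
      linarith
    · have hcc : ContinuousAt (fun z => A * ‖z - y‖ ^ (1 + α) - inner ℝ ν (z - y)) x :=
        (((hRc.rpow_const (fun _ => Or.inr (by linarith))).const_mul A).sub hτc).continuousAt
      have : 0 < A * ‖x - y‖ ^ (1 + α) - inner ℝ ν (x - y) := by
        have : 0 < A * ‖x - y‖ ^ (1 + α) := by positivity
        linarith
      filter_upwards [hcc.eventually (lt_mem_nhds this), hannE x hx] with z hz1 hz2 hzD
      have := hDτ z hzD (hne z hz2.1)
      linarith
  -- vanishing off D
  have hΨ0 : ∀ x ∈ tsupport χ, x ∉ D → Ψ =ᶠ[𝓝 x] fun _ => 0 := fun x hx hxD => by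
    filter_upwards [hz x hx hxD] with z h
    by_cases hzD : z ∈ D
    · rw [hΨ, indicator_of_mem hzD, jj_zero hε0 ((h hzD).trans hε0.le), mul_zero]
    · rw [hΨ, indicator_of_notMem hzD]
  have hW0 : ∀ x ∈ tsupport χ, x ∉ D → W =ᶠ[𝓝 x] fun _ => 0 := fun x hx hxD => by
    filter_upwards [hz x hx hxD] with z h
    by_cases hzD : z ∈ D
    · rw [hW, indicator_of_mem hzD, hWf]
      have : (c - g z / P z) / ε - 1 ≤ 0 := by
        have := div_nonpos_of_nonpos_of_nonneg (h hzD) hε0.le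
        linarith
      simp only [Real.smoothTransition.zero_of_nonpos this]; simp
    · rw [hW, indicator_of_notMem hzD]
  have hΨD : ∀ x ∈ D, x ≠ y → Ψ =ᶠ[𝓝 x] (fun z => P z * jj ε (c - g z / P z)) := fun x hx hxy => by
    filter_upwards [hDo x hx hxy] with z h
    rw [hΨ, indicator_of_mem h]
  have hWD : ∀ x ∈ D, x ≠ y → W =ᶠ[𝓝 x] Wf := fun x hx hxy => by
    filter_upwards [hDo x hx hxy] with z h
    rw [hW, indicator_of_mem h]
  have hg2 : ∀ x, J g x (gradient g x) (lap g x) := fun x => exists_J (hg.of_le two_le_top).contDiffAt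
  -- local jets on D
  have hloc : ∀ x ∈ tsupport χ, x ∈ D → ∃ kP lP kΨ lΨ kW lW s T, J P x kP lP ∧ (|inner ℝ ν (x - y)| ≤ κ * ‖x - y‖ → ‖x - y‖ ^ (-(N:ℝ)) / 2 ≤ inner ℝ kP ν) ∧
      J Ψ x kΨ lΨ ∧ J W x kW lW ∧ 0 ≤ T ∧ T ≤ lΨ + lap g x ∧
      inner ℝ kW ν = Real.smoothTransition ((c - g x / P x) / ε - 1) ^ 2 * inner ℝ kP ν
        + 2 * P x * Real.smoothTransition ((c - g x / P x) / ε - 1) * s ∧ P x * s ^ 2 ≤ CS / ε * T := by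
    intro x hx hxD
    have hxy := chi_ne hσ hr hx
    have ha := hann x hx
    have hR : 0 < ‖x - y‖ := norm_pos_iff.2 (sub_ne_zero.2 hxy)
    obtain ⟨kP, lP, jP, hlP, hkP⟩ := hPJ ν y x hν hxy (by linarith)
    have hx2 := hDE x hxD (by linarith) (by linarith)
    have hlg0 : 0 ≤ lap g x := hlg x (subset_tsupport _ (by rw [Function.mem_support, hx2.1]; norm_num))
    obtain ⟨kΨ, lΨ, kW, lW, s, T, j1, j2, t0, t1, t2, t3⟩ := bad_local (ε := ε) (c := c) jP (hg2 x) hxD.2 (hm.le.trans hx2.2.1)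
      (hlP (by nlinarith [hxD.1])).le hlg0 hε0 hν hS'
    exact ⟨kP, lP, kΨ, lΨ, kW, lW, s, T, jP, hkP, j1.congr (hΨD x hxD hxy), j2.congr (hWD x hxD hxy), t0, t1, t2, t3⟩
  have hΨc : ∀ x ∈ tsupport χ, ContDiffAt ℝ 2 Ψ x := fun x hx => by
    by_cases hxD : x ∈ D
    · obtain ⟨kP, lP, kΨ, lΨ, kW, lW, s, T, jP, hkP, j1, -⟩ := hloc x hx hxD
      exact j1.1
    · exact contDiffAt_const.congr_of_eventuallyEq (hΨ0 x hx hxD)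
  have hWc : ∀ x ∈ tsupport χ, ContDiffAt ℝ 2 W x := fun x hx => by
    by_cases hxD : x ∈ D
    · obtain ⟨kP, lP, kΨ, lΨ, kW, lW, s, T, jP, hkP, j1, j2, -⟩ := hloc x hx hxD
      exact j2.1
    · exact contDiffAt_const.congr_of_eventuallyEq (hW0 x hx hxD)
  have hχ2 : ContDiff ℝ 2 χ := (chi_contDiff y σ r).of_le two_le_top
  have hχW : ContDiff ℝ 2 (fun z => χ z * W z) := contDiff_mul_of_supp hχ2 hWc
  have hχWs : HasCompactSupport (fun z => χ z * W z) := (chi_hcs y hσ hr).mul_right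
  have hφ2 : ContDiff ℝ 2 φ := hχ2.mul ((contDiff_inner_sub ν y).of_le two_le_top)
  have hφs : HasCompactSupport φ := (chi_hcs y hσ hr).mul_right
  have hφt : tsupport φ ⊆ tsupport χ := tsupport_mul_subset_left
  have hPle : ∀ x ∈ D, x ≠ y → P x ≤ inner ℝ ν (x - y) * ‖x - y‖ ^ (-(N:ℝ)) := fun x hx hxy =>
    Pm_le hN h0 h1 hA.le hν hxy hx.1.le
  have hPle2 : ∀ x ∈ D, x ≠ y → P x ≤ ‖x - y‖ ^ (-(N:ℝ)) * ‖x - y‖ := fun x hx hxy => by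
    have h3 := (le_abs_self _).trans (abs_tau_le hν (x - y))
    have h4 := hPle x hx hxy
    have : 0 ≤ ‖x - y‖ ^ (-(N:ℝ)) := by positivity
    nlinarith
  have hφη : ∀ x, 0 ≤ φ x * η x * lap g x := fun x => by
    by_cases hx : x ∈ tsupport η
    · exact mul_nonneg (mul_nonneg (mul_nonneg (chi_nonneg _ _ _ _) (hητ x hx).le) (hη0 x)) (hlg x hx)
    · rw [image_eq_zero_of_notMem_tsupport hx]; simp
  have hkk0 : ∀ x, 0 ≤ kk y σ r x * ‖x - y‖ ^ (-(N:ℝ)) := fun x => mul_nonneg (kk_nonneg _ _ _ _) (by positivity)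
  -- pointwise inequality
  have hpt : ∀ x, 1 / 4 * (D.indicator (fun z => χ z * Real.smoothTransition ((c - g z / P z) / ε - 1) ^ 2 * ‖z - y‖ ^ (-(N:ℝ))) x)
      ≤ fderiv ℝ (fun z => χ z * W z) x ν + Cχ * (kk y σ r x * ‖x - y‖ ^ (-(N:ℝ))) + 4 * (CS / ε) * (φ x * lap Ψ x + φ x * η x * lap g x) := by
    intro x
    have hcc : 0 ≤ 4 * (CS / ε) := by positivity
    by_cases hx : x ∈ tsupport χ
    swap
    · have e1 : χ x = 0 := image_eq_zero_of_notMem_tsupport hx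
      have e2 : fderiv ℝ (fun z => χ z * W z) x = 0 :=
        image_eq_zero_of_notMem_tsupport fun h => hx (tsupport_mul_subset_left (tsupport_fderiv_subset ℝ h))
      have e3 : φ x = 0 := by simp only [hφ]; rw [e1, zero_mul]
      have e4 : D.indicator (fun z => χ z * Real.smoothTransition ((c - g z / P z) / ε - 1) ^ 2 * ‖z - y‖ ^ (-(N:ℝ))) x = 0 := by
        by_cases hxD : x ∈ D
        · rw [indicator_of_mem hxD, e1]; simp
        · rw [indicator_of_notMem hxD]
      rw [e2, e3, e4]
      have := mul_nonneg (by linarith : 0 ≤ Cχ) (hkk0 x)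
      simp only [_root_.zero_apply, zero_mul, mul_zero, add_zero, zero_add]
      exact this
    have hxy := chi_ne hσ hr hx
    have ha := hann x hx
    have hR : 0 < ‖x - y‖ := norm_pos_iff.2 (sub_ne_zero.2 hxy)
    by_cases hxD : x ∈ D
    swap
    · have e2 : fderiv ℝ (fun z => χ z * W z) x = 0 := by
        have : (fun z => χ z * W z) =ᶠ[𝓝 x] fun _ => 0 := by
          filter_upwards [hW0 x hx hxD] with z hz
          rw [hz, mul_zero]
        rw [this.fderiv_eq]; simp
      have e3 : lap Ψ x = 0 := by rw [lap_congr (hΨ0 x hx hxD)]; exact (J_const 0 x).2.2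
      rw [e2, e3, indicator_of_notMem hxD]
      have h2 := mul_nonneg (by linarith : 0 ≤ Cχ) (hkk0 x)
      have h3 := mul_nonneg hcc (hφη x)
      simp only [_root_.zero_apply, zero_mul, mul_zero, add_zero, zero_add]
      linarith
    obtain ⟨kP, lP, kΨ, lΨ, kW, lW, s, T, jP, hkP, j1, j2, t0, t1, t2, t3⟩ := hloc x hx hxD
    obtain ⟨kχ, lχ, jχ, b1, -⟩ := hχJ y x σ r hσ hr
    have hx2 := hDE x hxD (by linarith) (by linarith)
    rw [(jχ.mul j2).2.1 ν, indicator_of_mem hxD, j1.2.2]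
    simp only [inner_add_left, inner_smul_left, RCLike.conj_to_real]
    have c0 : 0 ≤ χ x := chi_nonneg _ _ _ _
    have hRn : 0 < ‖x - y‖ ^ (-(N:ℝ)) := by positivity
    have hq : Real.smoothTransition ((c - g x / P x) / ε - 1) ≠ 0 → ‖x - y‖ ^ (-(N:ℝ)) / 2 ≤ inner ℝ kP ν := by
      intro hq
      refine hkP ?_
      rw [abs_of_pos hxD.1]
      by_contra hcon
      have h3 := hx2.2.2 (not_le.1 hcon).le
      apply hq
      refine Real.smoothTransition.zero_of_nonpos ?_
      have h4 : c ≤ g x / P x := by rw [le_div_iff₀ hxD.2]; exact h3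
      have := div_nonpos_of_nonpos_of_nonneg (sub_nonpos.2 h4) hε0.le
      linarith
    have h5 := bad_alg c0 hxD.2 (hPle x hxD hxy) hRn t2 hq t3
    have h6 : χ x * inner ℝ ν (x - y) * T ≤ φ x * lΨ + φ x * η x * lap g x := by
      rw [hx2.1, mul_one, ← mul_add]
      exact mul_le_mul_of_nonneg_left t1 (mul_nonneg c0 hxD.1.le)
    have h7 := mul_le_mul_of_nonneg_left h6 hcc
    have hWx : W x = Wf x := indicator_of_mem hxD _
    have h8 : - (W x * inner ℝ kχ ν) ≤ Cχ * (kk y σ r x * ‖x - y‖ ^ (-(N:ℝ))) := by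
      have hkχ : |inner ℝ kχ ν| ≤ ‖kχ‖ := (abs_real_inner_le_norm _ _).trans (by rw [hν, mul_one])
      have w0 : 0 ≤ W x := by rw [hWx]; exact mul_nonneg hxD.2.le (by positivity)
      have w1 : W x ≤ ‖x - y‖ ^ (-(N:ℝ)) * ‖x - y‖ := by
        rw [hWx]
        refine le_trans ?_ (hPle2 x hxD hxy)
        have s0 := Real.smoothTransition.nonneg ((c - g x / P x) / ε - 1)
        have s1 := Real.smoothTransition.le_one ((c - g x / P x) / ε - 1)
        exact mul_le_of_le_one_right hxD.2.le (pow_le_one₀ s0 s1)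
      calc - (W x * inner ℝ kχ ν) ≤ |W x * inner ℝ kχ ν| := neg_le_abs _
        _ = W x * |inner ℝ kχ ν| := by rw [abs_mul, abs_of_nonneg w0]
        _ ≤ (‖x - y‖ ^ (-(N:ℝ)) * ‖x - y‖) * ‖kχ‖ := by gcongr
        _ = ‖x - y‖ ^ (-(N:ℝ)) * (‖kχ‖ * ‖x - y‖) := by ring
        _ ≤ ‖x - y‖ ^ (-(N:ℝ)) * (Cχ * kk y σ r x) := by gcongr
        _ = _ := by ring
    linarith
  -- integrability
  have i1 : Integrable fun x => fderiv ℝ (fun z => χ z * W z) x ν := by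
    refine Continuous.integrable_of_hasCompactSupport ?_ ?_
    · exact (hχW.continuous_fderiv (by norm_num)).clm_apply continuous_const
    · exact (hχWs.fderiv ℝ).comp_left (g := fun (L : ES N →L[ℝ] ℝ) => L ν) (by simp)
  obtain ⟨i2, l2⟩ := hk y σ r hσ hr
  have i3 : Integrable fun x => φ x * lap Ψ x :=
    (continuous_mul_of_supp hφ2.continuous fun x hx => lap_continuousAt (hΨc x (hφt hx))).integrable_of_hasCompactSupport hφs.mul_right
  have i4 : Integrable fun x => φ x * η x * lap g x :=
    ((hφ2.continuous.mul hη.continuous).mul (lap_continuous (hg.of_le two_le_top))).integrable_of_hasCompactSupport hφs.mul_right.mul_right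
  have z1 := int_fderiv_zero (hχW.of_le (by norm_num)) hχWs ν
  have z3 : ∫ x, φ x * lap Ψ x ≤ c * Cφ * Ck := by
    rw [← green_loc hφ2 hφs fun x hx => hΨc x (hφt hx)]
    calc ∫ x, Ψ x * lap φ x ≤ ∫ x, c * Cφ * (kk y σ r x * ‖x - y‖ ^ (-(N:ℝ))) := by
          refine integral_mono ?_ (i2.const_mul _) ?_
          · exact ((continuous_mul_of_supp (χ := lap φ) (f := Ψ) (lap_continuous hφ2) fun x hx =>
              (hΨc x (hφt (tsupport_lap_subset φ hx))).continuousAt).integrable_of_hasCompactSupport (hcs_lap hφs).mul_right).congr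
              (Eventually.of_forall fun x => mul_comm _ _)
          · intro x
            by_cases hxD : x ∈ D
            · by_cases hx : x ∈ tsupport χ
              · have hxy := chi_ne hσ hr hx
                have ha := hann x hx
                have hR : 0 < ‖x - y‖ := norm_pos_iff.2 (sub_ne_zero.2 hxy)
                have hx2 := hDE x hxD (by linarith) (by linarith)
                have hΨx : Ψ x = P x * jj ε (c - g x / P x) := indicator_of_mem hxD _
                have hgp : 0 ≤ g x / P x := div_nonneg (hm.le.trans hx2.2.1) hxD.2.le
                have j0 := jj_nonneg hε0 (c - g x / P x)
                have j1 : jj ε (c - g x / P x) ≤ c := (jj_mono ε (by linarith)).trans (jj_le hc.le)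
                have p0 := hxD.2
                have hkk := kk_nonneg y σ r x
                calc Ψ x * lap φ x ≤ |Ψ x * lap φ x| := le_abs_self _
                  _ = Ψ x * |lap φ x| := by rw [abs_mul, abs_of_nonneg (by rw [hΨx]; positivity)]
                  _ ≤ ((‖x - y‖ ^ (-(N:ℝ)) * ‖x - y‖) * c) * (Cφ * (kk y σ r x / ‖x - y‖)) := by
                      rw [hΨx]
                      gcongr
                      · exact hPle2 x hxD hxy
                      · exact hφJ ν y x σ r hν hσ hr hxy
                  _ = _ := by field_simp
              · have : lap φ x = 0 := lap_eq_zero_of_notMem fun h => hx (hφt h)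
                simp only [this, mul_zero]
                exact mul_nonneg (by positivity) (hkk0 x)
            · have : Ψ x = 0 := indicator_of_notMem hxD _
              simp only [this, zero_mul]
              exact mul_nonneg (by positivity) (hkk0 x)
      _ ≤ c * Cφ * Ck := by rw [integral_const_mul]; gcongr
  set I := ∫ x, φ x * η x * lap g x with hI
  have hI0 : 0 ≤ I := integral_nonneg hφη
  have i34 : Integrable fun x => φ x * lap Ψ x + φ x * η x * lap g x := i3.add i4
  have hPm : Measurable P := by
    have h1 : Measurable fun z : ES N => (inner ℝ ν (z - y) : ℝ) := hτc.measurable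
    have h2 := fun e => norm_rpow_meas y e
    exact (h1.mul (h2 _)).sub ((((h2 _).add ((h1.mul (h2 _)).const_mul _)).sub ((h1.mul (h1.mul (h2 _))).const_mul _)).const_mul _)
  refine setLInt_le_of_le (f := fun x => 4 * (fderiv ℝ (fun z => χ z * W z) x ν + Cχ * (kk y σ r x * ‖x - y‖ ^ (-(N:ℝ))) + 4 * (CS / ε) * (φ x * lap Ψ x + φ x * η x * lap g x))) ?_ ?_ ?_ ?_ ?_
  · refine MeasurableSet.inter (MeasurableSet.inter ?_ (MeasurableSet.inter ?_ ?_)) (MeasurableSet.inter ?_ ?_)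
    · exact measurableSet_lt measurable_const hτc.measurable
    · exact measurableSet_lt measurable_const hPm
    · exact measurableSet_le (hg.continuous.measurable.div hPm) measurable_const
    · exact measurableSet_le measurable_const hRc.measurable
    · exact measurableSet_le hRc.measurable measurable_const
  · exact ((i1.add (i2.const_mul Cχ)).add (i34.const_mul _)).const_mul _
  · intro x
    refine mul_nonneg (by norm_num) (le_trans ?_ (hpt x))
    refine mul_nonneg (by norm_num) (indicator_nonneg (fun z _ => ?_) _)
    exact mul_nonneg (mul_nonneg (chi_nonneg _ _ _ _) (by positivity)) (by positivity)
  · rintro x ⟨⟨h1, h2, h3⟩, h4, h5⟩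
    have hxD : x ∈ D := ⟨h1, h2⟩
    have := hpt x
    have hχ1 : χ x = 1 := chi_one hσ hr h4 h5
    rw [indicator_of_mem hxD, hχ1, Real.smoothTransition.one_of_one_le] at this
    · linarith
    · have : 2 ≤ (c - g x / P x) / ε := by
        rw [le_div_iff₀ hε0, hε]
        linarith
      linarith
  · rw [integral_const_mul, integral_add3 i1 (i2.const_mul Cχ) (i34.const_mul _), z1, integral_const_mul, integral_const_mul, integral_add i3 i4, zero_add]
    have e1 : CS / ε = 8 * CS * c⁻¹ := by rw [hε]; field_simp
    have e2 : c⁻¹ * c = 1 := inv_mul_cancel₀ hc.ne'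
    rw [e1]
    have e3 : 4 * (8 * CS * c⁻¹) * ((∫ x, φ x * lap Ψ x) + I) ≤ 4 * (8 * CS * c⁻¹) * (c * Cφ * Ck + I) := by gcongr
    have e4 : 4 * (8 * CS * c⁻¹) * (c * Cφ * Ck + I) = 32 * CS * (Cφ * Ck) + 32 * CS * (c⁻¹ * I) := by
      have : c⁻¹ * (c * Cφ * Ck) = Cφ * Ck := by rw [← mul_assoc, ← mul_assoc, e2, one_mul]
      linear_combination 32 * CS * this
    have e5 : 0 ≤ c⁻¹ * I := by positivity
    have e6 : Cχ * (∫ x, kk y σ r x * ‖x - y‖ ^ (-(N:ℝ))) ≤ Cχ * Ck := by gcongr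
    have e7 : 0 ≤ (Cχ * Ck + 32 * CS * (Cφ * Ck)) * (c⁻¹ * I) := by positivity
    nlinarith
end

section
variable {N : ℕ} {Ω : Set (ES N)} {y : ES N} {α A ρ : ℝ} {d : ES N → ℝ} {G : ES N → ES N}

lemma Geo.bad (H : Geo Ω y α A ρ d G) {K V h : ES N → ℝ} {a : ℝ} (HK : Sol Ω y (fun _ => 0) K 0) (HS : Sol Ω y V h a)
    (hle : ∀ x, h x ≤ K x) (hpos : ∀ x ∈ Ω, 0 < h x) : ∃ c r B C, 0 < c ∧ 0 < r ∧ r ≤ ρ / 8 ∧ 0 ≤ B ∧ 0 < C ∧ ∀ σ, 0 < σ →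
      ∫⁻ x in {x | (B * ‖x - y‖ ^ (1 + α) < inner ℝ (nv G y) (x - y) ∧ h x < c * (inner ℝ (nv G y) (x - y) * ‖x - y‖ ^ (-(N:ℝ)))) ∧
        2 * σ ≤ ‖x - y‖ ∧ ‖x - y‖ ≤ r}, ENNReal.ofReal (‖x - y‖ ^ (-(N:ℝ))) ≤ ENNReal.ofReal C := by
  have hA1 := H.A1
  have hν := H.nv_norm y
  obtain ⟨Cb, κ, r2, hCb, hκ, hr2, hr21, hcore⟩ := bad_core (α := α) (A := 2 * A) H.hN H.a0 H.a1 (by linarith)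
  obtain ⟨cc, rc, hcc, hrc, hrcρ, hcone⟩ := H.cone HK HS hle hpos hκ
  obtain ⟨Cv, rv, hCv, hrv, hrvρ, hvht⟩ := H.vht HK HS hle
  have hMM := MM_pos H.hN H.a0 H.a1
  set c1 := cc / 2 with hc1
  have hc10 : 0 < c1 := by positivity
  set r := min (r2 / 3) (min (rc / 6) (rv / 3)) with hr_def
  have hr : 0 < r := by positivity
  have hr_1 : 3 * r ≤ r2 := by have : r ≤ r2 / 3 := min_le_left _ _; linarith
  have hr_2 : 6 * r ≤ rc := by have : r ≤ rc / 6 := (min_le_right _ _).trans (min_le_left _ _); linarith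
  have hr_3 : 3 * r ≤ rv := by have : r ≤ rv / 3 := (min_le_right _ _).trans (min_le_right _ _); linarith
  have hρ := H.r0
  set ν := nv G y with hνd
  set B := 2 * (2 * A * (1 + MM N α)) with hB
  have hB0 : 0 ≤ B := by positivity
  refine ⟨c1 / 4, r, B, Cb * (1 + c1⁻¹ * (Cv + 1)), by positivity, hr, by linarith, hB0, by positivity, fun σ hσ => ?_⟩
  have hτc : Continuous fun x : ES N => inner ℝ ν (x - y) := continuous_const.inner (continuous_id.sub continuous_const)
  set E : Set (ES N) := {z | σ / 2 ≤ ‖z - y‖ ∧ ‖z - y‖ ≤ 3 * r ∧ 2 * A * ‖z - y‖ ^ (1 + α) ≤ inner ℝ ν (z - y)} with hE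
  have hα := H.a0
  have hEc : IsCompact E := by
    refine (isCompact_closedBall y (3 * r)).of_isClosed_subset ?_ fun x hx => by
      rw [mem_closedBall, dist_eq_norm]; exact hx.2.1
    refine (isClosed_le continuous_const (continuous_norm_sub y)).inter ((isClosed_le (continuous_norm_sub y) continuous_const).inter
      (isClosed_le (continuous_const.mul ((continuous_norm_sub y).rpow_const fun x => Or.inr (by linarith))) hτc))
  set U : Set (ES N) := Ω ∩ {x | 0 < inner ℝ ν (x - y)} with hU
  have hUo : IsOpen U := HS.op.inter (isOpen_lt continuous_const hτc)
  have hEU : E ⊆ U := by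
    intro x hx
    have hR : 0 < ‖x - y‖ := lt_of_lt_of_le (by positivity) hx.1
    have hp : 0 < A * ‖x - y‖ ^ (1 + α) := by positivity
    have ht := hx.2.2
    have ht0 : 0 < inner ℝ ν (x - y) := by linarith
    refine ⟨(H.mem x (mem_ball_norm.2 (by linarith [hx.2.1]))).2 ?_, ht0⟩
    have h1 := H.d_ge y x
    rw [H.dy] at h1
    have h2 := H.G1 y
    have h3 : 1 * inner ℝ ν (x - y) ≤ ‖G y‖ * inner ℝ ν (x - y) := by gcongr
    rw [← hνd] at h1
    linarith
  obtain ⟨η, hη, hηc, hηU, hη01, hη1⟩ := exists_cutoff hEc hUo hEU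
  have hηΩ : tsupport η ⊆ Ω := hηU.trans inter_subset_left
  have hcE : ContinuousOn h E := HS.hc.mono fun x hx => by rintro rfl; exact HS.yn (hEU hx).1
  obtain ⟨m0, hm0, hm⟩ := hEc.exists_forall_le' hcE (a := 0) fun x hx => hpos x (hEU hx).1
  set φ : ES N → ℝ := fun z => chi y σ r z * inner ℝ ν (z - y) * η z with hφ
  have hφs : ContDiff ℝ (⊤ : ℕ∞) φ := ((chi_contDiff y σ r).mul (contDiff_inner_sub ν y)).mul hη
  have hφt : tsupport φ ⊆ tsupport η := tsupport_mul_subset_right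
  have hφc : HasCompactSupport φ := hηc.mul_left
  have hφ2 : ContDiff ℝ 2 φ := hφs.of_le two_le_top
  have hlc : Continuous (lap φ) := lap_continuous hφ2
  set L := ∫ x, |lap φ x| with hL
  have hL0 : 0 ≤ L := integral_nonneg fun x => abs_nonneg _
  set ε := min (m0 / 8) (1 / (1 + L)) with hεd
  have hε : 0 < ε := by positivity
  obtain ⟨g, hg, hgε, hgl⟩ := HS.mollify hηc hηΩ hε
  have hεm : ε ≤ m0 / 8 := min_le_left _ _
  have hεL : ε * L ≤ 1 := by
    calc ε * L ≤ 1 / (1 + L) * L := by gcongr; exact min_le_right _ _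
      _ ≤ 1 := by rw [div_mul_eq_mul_div, div_le_one (by linarith)]; linarith
  have hEη : ∀ x ∈ E, η x = 1 := fun x hx => hη1.self_of_nhdsSet x hx
  have hEt : ∀ x ∈ E, x ∈ tsupport η := fun x hx => subset_tsupport _ (by rw [Function.mem_support, hEη x hx]; norm_num)
  have hIlow : ∫ x, φ x * lap g x ≤ Cv + 1 := by
    rw [← green (hg.of_le two_le_top) hφ2 hφc]
    have i1 : Integrable fun x => h x * lap φ x := by
      have := integrable_mul_of_supp (u := h) hlc (hcs_lap hφc) ((tsupport_lap_subset φ).trans hφt) (HS.intOn hηc fun hy => HS.yn (hηΩ hy))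
      exact this.congr (Eventually.of_forall fun x => mul_comm _ _)
    have i2 : Integrable fun x => |lap φ x| := (hlc.integrable_of_hasCompactSupport (hcs_lap hφc)).abs
    have i0 : Integrable fun x => g x * lap φ x := (hg.continuous.mul hlc).integrable_of_hasCompactSupport (hcs_lap hφc).mul_left
    have e1 : ∫ x, g x * lap φ x ≤ ∫ x, (h x * lap φ x + ε * |lap φ x|) := by
      refine integral_mono i0 (i1.add (i2.const_mul ε)) fun x => ?_
      by_cases hx : x ∈ tsupport φ
      · have h1 := hgε x (hφt hx)
        have h2 : (g x - h x) * lap φ x ≤ ε * |lap φ x| := by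
          refine (le_abs_self _).trans ?_
          rw [abs_mul]; gcongr
        show g x * lap φ x ≤ h x * lap φ x + ε * |lap φ x|
        linarith
      · show g x * lap φ x ≤ h x * lap φ x + ε * |lap φ x|
        rw [lap_eq_zero_of_notMem hx]; simp
    rw [integral_add i1 (i2.const_mul ε), integral_const_mul, HS.weak φ ⟨hφs, hφc, hφt.trans hηΩ⟩] at e1
    have e2 : ∫ x, V x * h x * φ x ≤ Cv := by
      have i3 := HS.Vh_int hφs.continuous hφc (hφt.trans hηΩ)
      have hφ0 : ∀ x, 0 ≤ φ x := by
        intro x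
        by_cases hx : x ∈ tsupport η
        · exact mul_nonneg (mul_nonneg (chi_nonneg _ _ _ _) (hηU hx).2.le) (hη01 x).1
        · simp only [hφ]; rw [image_eq_zero_of_notMem_tsupport hx, mul_zero]
      have hn : ∀ x, 0 ≤ V x * h x * φ x := fun x => mul_nonneg (mul_nonneg (HS.V0 x) (HS.nn x)) (hφ0 x)
      rw [← ENNReal.ofReal_le_ofReal_iff hCv.le, ofReal_integral_eq_lintegral_ofReal i3 (Eventually.of_forall hn)]
      refine le_trans ?_ (hvht (σ / 2) (by positivity))
      have hm : MeasurableSet {x | x ∈ Ω ∧ 2 * (σ / 2) ≤ ‖x - y‖ ∧ ‖x - y‖ ≤ rv} :=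
        HS.op.measurableSet.inter ((isClosed_le continuous_const (continuous_norm_sub y)).inter (isClosed_le (continuous_norm_sub y) continuous_const)).measurableSet
      rw [← lintegral_indicator hm]
      refine lintegral_mono fun x => ?_
      by_cases hx : φ x = 0
      · rw [hx]; simp
      · have hxη : x ∈ tsupport η := hφt (subset_tsupport _ hx)
        have hxχ : x ∈ tsupport (chi y σ r) := subset_tsupport _ fun h0 => hx (by simp only [hφ]; rw [h0]; simp)
        have := chi_tsupp y hσ hr hxχ
        rw [indicator_of_mem (by exact ⟨hηΩ hxη, by linarith [this.1], by linarith [this.2]⟩)]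
        refine ENNReal.ofReal_le_ofReal (mul_le_mul_of_nonneg_left ?_ (mul_nonneg (HS.V0 x) (HS.nn x)))
        have ht := (hηU hxη).2
        have h1 : chi y σ r x * η x ≤ 1 := mul_le_one₀ (chi_le_one _ _ _ _) (hη01 x).1 (hη01 x).2
        calc φ x = (chi y σ r x * η x) * inner ℝ ν (x - y) := by simp only [hφ]; ring
          _ ≤ 1 * inner ℝ ν (x - y) := mul_le_mul_of_nonneg_right h1 (le_of_lt ht)
          _ = _ := one_mul _
    linarith
  have hmain := hcore ν y σ r c1 (m0 / 2) g η hν hσ hr hr_1 hc10 (by positivity) hg hη (fun z => (hη01 z).1) hgl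
    (fun z hz => (hηU hz).2) (by
      intro z hz1 hz2 hz3
      have hzE : z ∈ E := ⟨hz1, hz2, hz3⟩
      have h1 := abs_le.1 (hgε z (hEt z hzE))
      have h2 := hm z hzE
      refine ⟨hEη z hzE, by linarith, fun hk => ?_⟩
      have hR : 0 < ‖z - y‖ := lt_of_lt_of_le (by positivity) hz1
      have hzy : z ≠ y := by rintro rfl; simp at hR
      have h3 := hcone z (by linarith) hzy hk
      have h4 := (Pm_le H.hN H.a0 H.a1 (by linarith : 0 ≤ 2 * A) hν hzy (hEU hzE).2.le).trans (Pk_le hν hzy)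
      have h5 := mul_le_mul_of_nonneg_left h4 hc10.le
      have : cc = 2 * c1 := by rw [hc1]; ring
      rw [this] at h3
      linarith)
  refine le_trans ?_ (hmain.trans (ENNReal.ofReal_le_ofReal ?_))
  · refine lintegral_mono_set ?_
    rintro x ⟨⟨h1, h2⟩, h3, h4⟩
    have hR : 0 < ‖x - y‖ := by linarith
    have hxy : x ≠ y := by rintro rfl; simp at hR
    have hRp : 0 < ‖x - y‖ ^ (1 + α) := by positivity
    have hRN : 0 < ‖x - y‖ ^ (-(N:ℝ)) := by positivity
    have hP := Pm_ge H.hN H.a0 H.a1 (by linarith : 0 ≤ 2 * A) hν hxy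
    have hBp : 0 ≤ B * ‖x - y‖ ^ (1 + α) := by positivity
    have ht : 0 < inner ℝ ν (x - y) := by linarith
    have hAB : 2 * A * ‖x - y‖ ^ (1 + α) ≤ B * ‖x - y‖ ^ (1 + α) := by
      gcongr; rw [hB]; nlinarith
    have hP2 : 1 / 2 * (inner ℝ ν (x - y) * ‖x - y‖ ^ (-(N:ℝ))) ≤ Pm N α (2 * A) ν y x := by
      refine le_trans ?_ hP
      rw [← mul_assoc]
      refine mul_le_mul_of_nonneg_right ?_ hRN.le
      have : 2 * A * (1 + MM N α) * ‖x - y‖ ^ (1 + α) = B * ‖x - y‖ ^ (1 + α) / 2 := by rw [hB]; ring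
      linarith
    have hQ : 0 < inner ℝ ν (x - y) * ‖x - y‖ ^ (-(N:ℝ)) := mul_pos ht hRN
    have hP0 : 0 < Pm N α (2 * A) ν y x := by linarith
    have hxE : x ∈ E := ⟨by linarith, by linarith, by linarith⟩
    have hg1 := abs_le.1 (hgε x (hEt x hxE))
    have hm1 := hm x hxE
    refine ⟨⟨ht, hP0, ?_⟩, h3, h4⟩
    rw [div_le_iff₀ hP0]
    have := mul_le_mul_of_nonneg_left hP2 hc10.le
    have : h x < c1 / 2 * Pm N α (2 * A) ν y x := by linarith
    nlinarith [mul_pos hc10 hP0]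
  · have : c1⁻¹ * (∫ x, φ x * lap g x) ≤ c1⁻¹ * (Cv + 1) := by gcongr
    exact mul_le_mul_of_nonneg_left (by linarith) hCb.le
end

section
variable {N : ℕ} {Ω : Set (ES N)} {y : ES N} {α A ρ : ℝ} {d : ES N → ℝ} {G : ES N → ES N}

lemma Geo.dista_le (H : Geo Ω y α A ρ d G) {x : ES N} (hx : 3 * ‖x - y‖ < ρ)
    (ht : 9 * A * ‖x - y‖ ^ (1 + α) < inner ℝ (nv G y) (x - y)) : dista Ω x ≤ 2 * inner ℝ (nv G y) (x - y) := by
  have hν := H.nv_norm y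
  have hA := H.A1
  have hα := H.a0
  set ν := nv G y with hνd
  set t := inner ℝ ν (x - y) with htd
  have hp : 0 ≤ 9 * A * ‖x - y‖ ^ (1 + α) := by positivity
  have ht0 : 0 < t := by linarith
  have htR : t ≤ ‖x - y‖ := (le_abs_self _).trans (abs_tau_le hν (x - y))
  have hz : x - (2 * t) • ν ∉ Ω := by
    have h1 : ‖x - (2 * t) • ν - y‖ ≤ 3 * ‖x - y‖ := by
      rw [show x - (2 * t) • ν - y = (x - y) - (2 * t) • ν by abel]
      refine (norm_sub_le _ _).trans ?_
      rw [norm_smul, hν, Real.norm_of_nonneg (by linarith)]; linarith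
    intro hc
    have h2 := (H.mem _ (mem_ball_norm.2 (by linarith))).1 hc
    have h3 := H.d_le y (x - (2 * t) • ν)
    rw [H.dy, ← hνd] at h3
    have h4 : inner ℝ ν (x - (2 * t) • ν - y) = - t := by
      rw [show x - (2 * t) • ν - y = (x - y) - (2 * t) • ν by abel, inner_sub_right, real_inner_smul_right, real_inner_self_eq_norm_sq, hν, ← htd]
      ring
    rw [h4] at h3
    have h5 : ‖x - (2 * t) • ν - y‖ ^ (1 + α) ≤ 9 * ‖x - y‖ ^ (1 + α) := by
      refine (Real.rpow_le_rpow (norm_nonneg _) h1 (by linarith)).trans ?_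
      rw [Real.mul_rpow (by norm_num) (norm_nonneg _)]
      gcongr
      calc (3:ℝ) ^ (1 + α) ≤ 3 ^ (2:ℝ) := Real.rpow_le_rpow_of_exponent_le (by norm_num) (by linarith [H.a1])
        _ = 9 := by norm_num
    have h6 : A * ‖x - (2 * t) • ν - y‖ ^ (1 + α) ≤ A * (9 * ‖x - y‖ ^ (1 + α)) := by gcongr
    nlinarith [H.G1 y]
  calc dista Ω x ≤ dist x (x - (2 * t) • ν) := infDist_le_dist_of_mem hz
    _ = 2 * t := by rw [dist_eq_norm, sub_sub_cancel, norm_smul, hν, Real.norm_of_nonneg (by linarith), mul_one]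

lemma Geo.fwd (H : Geo Ω y α A ρ d G) {K V h : ES N → ℝ} {a : ℝ} (HK : Sol Ω y (fun _ => 0) K 0) (HS : Sol Ω y V h a)
    (hle : ∀ x, h x ≤ K x) (hpos : ∀ x ∈ Ω, 0 < h x) :
    ∫⁻ x in Ω, ENNReal.ofReal (dista Ω x ^ 2 / ‖x - y‖ ^ N * V x) < ⊤ := by
  have hν := H.nv_norm y
  have hA := H.A1
  have hα := H.a0
  have hρ0 := H.r0
  have hρ1 := H.r1
  have ha := HS.ca
  obtain ⟨c, rb, Bb, Cb, hc, hrb, hrbρ, hBb, hCb, hbad⟩ := H.bad HK HS hle hpos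
  obtain ⟨Cv, rv, hCv, hrv, hrvρ, hvht⟩ := H.vht HK HS hle
  set B := max Bb (9 * A) with hB
  obtain ⟨Cs, hCs, hstrip⟩ := strip (N := N) H.hN H.a0 H.a1 hν y B
  set ν := nv G y with hνd
  set r := min rb rv with hr_def
  have hr : 0 < r := by positivity
  have hr1 : r ≤ rb := min_le_left _ _
  have hr2 : r ≤ rv := min_le_right _ _
  set F : ES N → ℝ≥0∞ := fun x => ENNReal.ofReal (dista Ω x ^ 2 / ‖x - y‖ ^ N * V x) with hF
  have hτm : Measurable fun x : ES N => inner ℝ ν (x - y) := (continuous_const.inner (continuous_id.sub continuous_const)).measurable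
  have hRm : Measurable fun x : ES N => ‖x - y‖ := (continuous_norm_sub y).measurable
  have hFa : ∀ x ∈ Ω, F x ≤ ENNReal.ofReal a * ENNReal.ofReal (‖x - y‖ ^ (-(N:ℝ))) := by
    intro x hx
    rw [← ENNReal.ofReal_mul ha]
    refine ENNReal.ofReal_le_ofReal ?_
    rw [Real.rpow_neg (norm_nonneg _), Real.rpow_natCast, ← div_eq_mul_inv, div_mul_eq_mul_div, mul_comm]
    gcongr
    exact HS.Va x hx
  set M : ℝ≥0∞ := ENNReal.ofReal (a * r ^ (-(N:ℝ))) * volume Ω + (ENNReal.ofReal a * ENNReal.ofReal Cs + (ENNReal.ofReal a * ENNReal.ofReal Cb + ENNReal.ofReal (4 / c) * ENNReal.ofReal Cv)) with hM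
  have hMt : M < ⊤ := by
    have := HS.bdd.measure_lt_top (μ := volume)
    rw [hM]
    refine ENNReal.add_lt_top.2 ⟨ENNReal.mul_lt_top ENNReal.ofReal_lt_top this, ENNReal.add_lt_top.2 ⟨ENNReal.mul_lt_top ENNReal.ofReal_lt_top ENNReal.ofReal_lt_top, ENNReal.add_lt_top.2 ⟨ENNReal.mul_lt_top ENNReal.ofReal_lt_top ENNReal.ofReal_lt_top, ENNReal.mul_lt_top ENNReal.ofReal_lt_top ENNReal.ofReal_lt_top⟩⟩⟩
  have key : ∀ σ, 0 < σ → ∫⁻ x in Ω ∩ {x | 2 * σ ≤ ‖x - y‖}, F x ≤ M := by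
    intro σ hσ
    set T : Set (ES N) := {x | 2 * σ ≤ ‖x - y‖ ∧ ‖x - y‖ ≤ r} with hT
    have hTm : MeasurableSet T := (measurableSet_le measurable_const hRm).inter (measurableSet_le hRm measurable_const)
    set S1 : Set (ES N) := Ω ∩ {x | r ≤ ‖x - y‖} with hS1
    set S2 : Set (ES N) := Ω ∩ ({x | |inner ℝ ν (x - y)| ≤ B * ‖x - y‖ ^ (1 + α)} ∩ T) with hS2
    set S3 : Set (ES N) := Ω ∩ ({x | B * ‖x - y‖ ^ (1 + α) < inner ℝ ν (x - y)} ∩ {x | h x < c * (inner ℝ ν (x - y) * ‖x - y‖ ^ (-(N:ℝ)))} ∩ T) with hS3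
    set S4 : Set (ES N) := Ω ∩ ({x | B * ‖x - y‖ ^ (1 + α) < inner ℝ ν (x - y)} ∩ {x | c * (inner ℝ ν (x - y) * ‖x - y‖ ^ (-(N:ℝ))) ≤ h x} ∩ T) with hS4
    have hΩm := HS.op.measurableSet
    have m0 : MeasurableSet {x : ES N | B * ‖x - y‖ ^ (1 + α) < inner ℝ ν (x - y)} := measurableSet_lt (measurable_const.mul (hRm.pow_const _)) hτm
    have mq : Measurable fun x : ES N => c * (inner ℝ ν (x - y) * ‖x - y‖ ^ (-(N:ℝ))) := measurable_const.mul (hτm.mul (hRm.pow_const _))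
    have m1 : MeasurableSet S1 := hΩm.inter (measurableSet_le measurable_const hRm)
    have m2 : MeasurableSet S2 := hΩm.inter ((measurableSet_le hτm.abs (measurable_const.mul (hRm.pow_const _))).inter hTm)
    have m3 : MeasurableSet S3 := hΩm.inter ((m0.inter (measurableSet_lt HS.meas mq)).inter hTm)
    have m4 : MeasurableSet S4 := hΩm.inter ((m0.inter (measurableSet_le mq HS.meas)).inter hTm)
    have hBA : ∀ x : ES N, 9 * A * ‖x - y‖ ^ (1 + α) ≤ B * ‖x - y‖ ^ (1 + α) := fun x =>
      mul_le_mul_of_nonneg_right (le_max_right _ _) (by positivity)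
    have hBb' : ∀ x : ES N, Bb * ‖x - y‖ ^ (1 + α) ≤ B * ‖x - y‖ ^ (1 + α) := fun x =>
      mul_le_mul_of_nonneg_right (le_max_left _ _) (by positivity)
    have hsub : Ω ∩ {x | 2 * σ ≤ ‖x - y‖} ⊆ S1 ∪ (S2 ∪ (S3 ∪ S4)) := by
      rintro x ⟨hxΩ, hx2⟩
      by_cases h1 : r ≤ ‖x - y‖
      · exact Or.inl ⟨hxΩ, h1⟩
      push Not at h1
      have hxT : x ∈ T := ⟨hx2, h1.le⟩
      refine Or.inr ?_
      by_cases h2 : |inner ℝ ν (x - y)| ≤ B * ‖x - y‖ ^ (1 + α)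
      · exact Or.inl ⟨hxΩ, h2, hxT⟩
      have h3 : B * ‖x - y‖ ^ (1 + α) < inner ℝ ν (x - y) := by
        by_contra h4
        push Not at h4
        refine h2 (abs_le.2 ⟨?_, h4⟩)
        have h5 := H.tau_ge (mem_ball_norm.2 (by linarith)) hxΩ
        have h6 : 0 ≤ A * ‖x - y‖ ^ (1 + α) := by positivity
        linarith [hBA x]
      refine Or.inr ?_
      by_cases h4 : h x < c * (inner ℝ ν (x - y) * ‖x - y‖ ^ (-(N:ℝ)))
      · exact Or.inl ⟨hxΩ, ⟨h3, h4⟩, hxT⟩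
      · exact Or.inr ⟨hxΩ, ⟨h3, not_lt.1 h4⟩, hxT⟩
    refine (lintegral_mono_set hsub).trans ?_
    refine (lintegral_union_le _ _ _).trans (add_le_add ?_ ((lintegral_union_le _ _ _).trans (add_le_add ?_ ((lintegral_union_le _ _ _).trans (add_le_add ?_ ?_)))))
    · calc ∫⁻ x in S1, F x ≤ ∫⁻ x in S1, ENNReal.ofReal (a * r ^ (-(N:ℝ))) := by
            refine setLIntegral_mono' m1 fun x hx => (hFa x hx.1).trans ?_
            rw [← ENNReal.ofReal_mul ha]
            refine ENNReal.ofReal_le_ofReal (mul_le_mul_of_nonneg_left ?_ ha)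
            exact Real.rpow_le_rpow_of_nonpos hr hx.2 (by simp)
        _ = ENNReal.ofReal (a * r ^ (-(N:ℝ))) * volume S1 := by rw [setLIntegral_const]
        _ ≤ _ := by gcongr; exact inter_subset_left
    · calc ∫⁻ x in S2, F x ≤ ∫⁻ x in S2, ENNReal.ofReal a * ENNReal.ofReal (‖x - y‖ ^ (-(N:ℝ))) :=
            setLIntegral_mono' m2 fun x hx => hFa x hx.1
        _ = ENNReal.ofReal a * ∫⁻ x in S2, ENNReal.ofReal (‖x - y‖ ^ (-(N:ℝ))) := lintegral_const_mul' _ _ ENNReal.ofReal_ne_top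
        _ ≤ _ := by
          gcongr
          refine le_trans (lintegral_mono_set ?_) (hstrip σ r hσ hr (by linarith))
          intro x hx; exact hx.2
    · calc ∫⁻ x in S3, F x ≤ ∫⁻ x in S3, ENNReal.ofReal a * ENNReal.ofReal (‖x - y‖ ^ (-(N:ℝ))) :=
            setLIntegral_mono' m3 fun x hx => hFa x hx.1
        _ = ENNReal.ofReal a * ∫⁻ x in S3, ENNReal.ofReal (‖x - y‖ ^ (-(N:ℝ))) := lintegral_const_mul' _ _ ENNReal.ofReal_ne_top
        _ ≤ _ := by
          gcongr
          refine le_trans (lintegral_mono_set ?_) (hbad σ hσ)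
          rintro x ⟨-, ⟨h1, h2⟩, h3⟩
          exact ⟨⟨(hBb' x).trans_lt h1, h2⟩, h3.1, h3.2.trans hr1⟩
    · calc ∫⁻ x in S4, F x ≤ ∫⁻ x in S4, ENNReal.ofReal (4 / c) * ENNReal.ofReal (V x * h x * inner ℝ ν (x - y)) := by
            refine setLIntegral_mono' m4 fun x hx => ?_
            rw [← ENNReal.ofReal_mul (by positivity)]
            refine ENNReal.ofReal_le_ofReal ?_
            obtain ⟨hxΩ, ⟨h1, h2⟩, h3⟩ := hx
            have hR3 : 3 * ‖x - y‖ < ρ := by linarith [h3.2]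
            have hd := H.dista_le hR3 ((hBA x).trans_lt h1)
            rw [← hνd] at hd
            have hd0 : 0 ≤ dista Ω x := infDist_nonneg
            have ht0 : 0 ≤ inner ℝ ν (x - y) := by linarith
            have hV := HS.V0 x
            calc dista Ω x ^ 2 / ‖x - y‖ ^ N * V x ≤ (2 * inner ℝ ν (x - y)) ^ 2 / ‖x - y‖ ^ N * V x := by gcongr
              _ = 4 / c * (V x * (c * (inner ℝ ν (x - y) * ‖x - y‖ ^ (-(N:ℝ)))) * inner ℝ ν (x - y)) := by
                rw [Real.rpow_neg (norm_nonneg _), Real.rpow_natCast]; field_simp; ring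
              _ ≤ _ := by gcongr; exact h2
        _ = ENNReal.ofReal (4 / c) * ∫⁻ x in S4, ENNReal.ofReal (V x * h x * inner ℝ ν (x - y)) := lintegral_const_mul' _ _ ENNReal.ofReal_ne_top
        _ ≤ _ := by
          gcongr
          refine le_trans (lintegral_mono_set ?_) (hvht σ hσ)
          rintro x ⟨h0, -, h3⟩
          exact ⟨h0, h3.1, h3.2.trans hr2⟩
  refine lt_of_le_of_lt ?_ hMt
  have hU : Ω = ⋃ n : ℕ, Ω ∩ {x | 2 * (1 / ((n:ℝ) + 1)) ≤ ‖x - y‖} := by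
    ext x
    simp only [mem_iUnion, mem_inter_iff, mem_ofPred_eq]
    refine ⟨fun hx => ?_, fun ⟨n, hx, _⟩ => hx⟩
    have hxy : x ≠ y := by rintro rfl; exact HS.yn hx
    have hR : 0 < ‖x - y‖ := norm_pos_iff.2 (sub_ne_zero.2 hxy)
    obtain ⟨n, hn⟩ := exists_nat_one_div_lt (half_pos hR)
    exact ⟨n, hx, by linarith⟩
  have hdir : Directed (· ⊆ ·) fun n : ℕ => Ω ∩ {x : ES N | 2 * (1 / ((n:ℝ) + 1)) ≤ ‖x - y‖} := by
    refine Monotone.directed_le fun n m hnm x hx => ⟨hx.1, ?_⟩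
    have hx2 : 2 * (1 / ((n:ℝ) + 1)) ≤ ‖x - y‖ := hx.2
    show 2 * (1 / ((m:ℝ) + 1)) ≤ ‖x - y‖
    have := Nat.one_div_le_one_div (α := ℝ) hnm
    linarith
  calc ∫⁻ x in Ω, F x = ∫⁻ x in ⋃ n : ℕ, Ω ∩ {x | 2 * (1 / ((n:ℝ) + 1)) ≤ ‖x - y‖}, F x := by rw [← hU]
    _ = ⨆ n : ℕ, ∫⁻ x in Ω ∩ {x | 2 * (1 / ((n:ℝ) + 1)) ≤ ‖x - y‖}, F x := setLIntegral_iUnion_of_directed _ hdir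
    _ ≤ M := iSup_le fun n => key _ (by positivity)
end

section
variable {N : ℕ} {Ω : Set (ES N)} {y : ES N} {α A ρ : ℝ} {d : ES N → ℝ} {G : ES N → ES N}

lemma Geo.K_ge (H : Geo Ω y α A ρ d G) {K : ES N → ℝ} (HK : Sol Ω y (fun _ => 0) K 0) (hpos : ∀ x ∈ Ω, 0 < K x) :
    ∃ c, 0 < c ∧ ∀ x, 0 < inner ℝ (nv G y) (x - y) → c * (Pm N α A (nv G y) y x - (ρ / 4) ^ (1 - (N:ℝ))) ≤ K x := by
  obtain ⟨C, hC1, hC0⟩ := exists_harnack N 0 le_rfl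
  have hC := hC0 Ω y _ K HK
  have hA := H.A1
  have hρ := H.r0
  have hα := H.a0
  have hν := H.nv_norm y
  obtain ⟨cc, rc, hcc, hrc, hrcρ, hcone⟩ := H.cone HK HK (fun _ => le_rfl) hpos (η := 1 / 2) (by norm_num)
  obtain ⟨t1, ht0, ht1, ht2⟩ := small_rpow H.a0 A (r := rc) (ε := 1 / 2) hrc (by norm_num)
  have hN2 : (2:ℝ) ≤ N := by exact_mod_cast H.hN
  refine ⟨cc * (64 * A) ^ (1 - (N:ℝ)) / C, by positivity, fun x hx => ?_⟩
  set ν := nv G y with hνd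
  have hxy : x ≠ y := by rintro rfl; simp at hx
  set p : ℝ → ES N := fun σ => y + σ • ν with hp
  have hpt : Tendsto p (𝓝[>] 0) (𝓝 y) := by
    have : Continuous p := by fun_prop
    have h := this.tendsto 0
    simp only [hp, zero_smul, add_zero] at h
    exact h.mono_left nhdsWithin_le_nhds
  have hnt : Tendsto (fun σ => nv G (p σ)) (𝓝[>] 0) (𝓝 ν) := by
    rw [tendsto_iff_norm_sub_tendsto_zero]
    have h1 : Tendsto (fun σ => 2 * A * ‖p σ - y‖ ^ α) (𝓝[>] 0) (𝓝 (2 * A * 0 ^ α)) :=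
      ((tendsto_iff_norm_sub_tendsto_zero.1 hpt).rpow_const (Or.inr hα.le)).const_mul _
    rw [Real.zero_rpow hα.ne', mul_zero] at h1
    exact squeeze_zero (fun _ => norm_nonneg _) (fun σ => H.nv_lip (p σ) y) h1
  have hR : 0 < ‖x - y‖ := norm_pos_iff.2 (sub_ne_zero.2 hxy)
  have hRt : Tendsto (fun σ => ‖x - p σ‖) (𝓝[>] 0) (𝓝 ‖x - y‖) := (tendsto_const_nhds.sub hpt).norm
  have hτt : Tendsto (fun σ => inner ℝ (nv G (p σ)) (x - p σ)) (𝓝[>] 0) (𝓝 (inner ℝ ν (x - y))) := hnt.inner (tendsto_const_nhds.sub hpt)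
  have hRe : ∀ e : ℝ, Tendsto (fun σ => ‖x - p σ‖ ^ e) (𝓝[>] 0) (𝓝 (‖x - y‖ ^ e)) := fun e => hRt.rpow_const (Or.inl hR.ne')
  have hPt : Tendsto (fun σ => Pm N α A (nv G (p σ)) (p σ) x) (𝓝[>] 0) (𝓝 (Pm N α A ν y x)) := by
    unfold Pm Pk Bf
    exact (hτt.mul (hRe _)).sub ((((hRe _).add ((hτt.mul (hRe _)).const_mul _)).sub ((hτt.mul (hτt.mul (hRe _))).const_mul _)).const_mul _)
  refine le_of_tendsto ((hPt.sub_const _).const_mul _) ?_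
  have e1 : ∀ᶠ σ in 𝓝[>] (0:ℝ), 0 < inner ℝ (nv G (p σ)) (x - p σ) := hτt.eventually (lt_mem_nhds hx)
  have e2 : ∀ᶠ σ in 𝓝[>] (0:ℝ), ‖x - y‖ / 2 < ‖x - p σ‖ := hRt.eventually (lt_mem_nhds (by linarith))
  have e3 : ∀ᶠ σ in 𝓝[>] (0:ℝ), σ ∈ Ioo 0 (min t1 (‖x - y‖ / 2)) := Ioo_mem_nhdsGT (by positivity)
  filter_upwards [e1, e2, e3] with σ h1 h2 h3
  have hσ : 0 < σ := h3.1
  have hσ1 : σ < t1 := h3.2.trans_le (min_le_left _ _)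
  have hσ2 : σ < ‖x - y‖ / 2 := h3.2.trans_le (min_le_right _ _)
  have hpy : p σ - y = σ • ν := by simp [hp]
  have hpn : ‖p σ - y‖ = σ := by rw [hpy, norm_smul, hν, Real.norm_of_nonneg hσ.le, mul_one]
  have hpi : inner ℝ ν (p σ - y) = σ := by rw [hpy, real_inner_smul_right, real_inner_self_eq_norm_sq, hν]; ring
  have hpb : p σ ∈ ball y (ρ / 4) := mem_ball_norm.2 (by rw [hpn]; linarith)
  have hpb' : p σ ∈ ball y ρ := mem_ball_norm.2 (by rw [hpn]; linarith)
  have hσα : A * σ ^ (1 + α) ≤ σ / 2 := by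
    rw [Real.rpow_add hσ, Real.rpow_one]
    have : A * σ ^ α ≤ A * t1 ^ α := by gcongr
    nlinarith
  have hd1 : σ / 2 ≤ d (p σ) := by
    have := H.d_ge y (p σ)
    rw [H.dy, ← hνd, hpi, hpn] at this
    nlinarith [H.G1 y]
  have hd2 : d (p σ) ≤ 2 * A * σ := by
    have := H.d_le_R hpb'
    rw [hpn] at this
    exact (le_abs_self _).trans this
  have hcmp := H.cmp HK hC1 hC hpb (by linarith) (R0 := ρ / 4) (by linarith) le_rfl (x := x) (by
    rw [div_le_iff₀ (by positivity)]
    nlinarith [mul_pos (by linarith : 0 < A) hσ]) h1.le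
  rcases le_total (Pm N α A (nv G (p σ)) (p σ) x - (ρ / 4) ^ (1 - (N:ℝ))) 0 with hneg | hge
  · exact (mul_nonpos_of_nonneg_of_nonpos (by positivity) hneg).trans (HK.nn x)
  refine le_trans (mul_le_mul_of_nonneg_right ?_ hge) hcmp
  have hK := hcone (p σ) (by rw [hpn]; linarith) (fun h => by rw [h] at hpn; simp at hpn; linarith) (by rw [hpn, hpi]; linarith)
  rw [hpn] at hK
  refine div_le_div_of_nonneg_right ?_ (by linarith : (0:ℝ) ≤ C)
  calc cc * (64 * A) ^ (1 - (N:ℝ)) = (cc * σ ^ (1 - (N:ℝ))) * (σ / (64 * A)) ^ ((N:ℝ) - 1) := by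
        rw [Real.div_rpow hσ.le (by positivity), show 1 - (N:ℝ) = -((N:ℝ) - 1) by ring, Real.rpow_neg hσ.le, Real.rpow_neg (by positivity)]
        have : σ ^ ((N:ℝ) - 1) ≠ 0 := by positivity
        field_simp
    _ ≤ K (p σ) * (d (p σ) / (32 * A)) ^ ((N:ℝ) - 1) := by
        refine mul_le_mul hK (Real.rpow_le_rpow (by positivity) ?_ (by linarith)) (by positivity) (HK.nn _)
        rw [div_le_div_iff₀ (by positivity) (by positivity)]
        nlinarith [mul_le_mul_of_nonneg_left hd1 (by linarith : 0 ≤ A)]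

lemma Geo.w0 (H : Geo Ω y α A ρ d G) {K : ES N → ℝ} (HK : Sol Ω y (fun _ => 0) K 0) (hpos : ∀ x ∈ Ω, 0 < K x) :
    ∃ (w : ES N → ℝ) (c C r : ℝ), 0 < c ∧ 0 < C ∧ 0 < r ∧ (∀ x, 0 ≤ w x) ∧ (∀ x, w x ≤ K x) ∧
      (∀ x, x ≠ y → ContDiffAt ℝ 2 w x ∧ 0 ≤ lap w x) ∧
      (∀ x, w x ≠ 0 → x ∈ Ω ∧ 0 < inner ℝ (nv G y) (x - y) ∧ inner ℝ (nv G y) (x - y) ≤ C * dista Ω x ∧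
        w x ≤ C * (inner ℝ (nv G y) (x - y) * ‖x - y‖ ^ (-(N:ℝ)))) ∧
      ∀ σ x, 0 < σ → σ ≤ r → ‖x - (y + σ • nv G y)‖ ≤ σ / 2 → c * σ ^ (1 - (N:ℝ)) ≤ w x := by
  obtain ⟨c2, hc2, hKge⟩ := H.K_ge HK hpos
  have hA := H.A1
  have hρ := H.r0
  have hα := H.a0
  have hν := H.nv_norm y
  have hMM := MM_pos H.hN H.a0 H.a1
  have hN2 : (2:ℝ) ≤ N := by exact_mod_cast H.hN
  set ν := nv G y with hνd
  set C0 := (ρ / 4) ^ (1 - (N:ℝ)) with hC0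
  have hC0p : 0 < C0 := by positivity
  have hA2 : 0 < 2 * A := by linarith
  set P := Pm N α (2 * A) ν y with hP
  have hτc : Continuous fun x : ES N => inner ℝ ν (x - y) := continuous_const.inner (continuous_id.sub continuous_const)
  classical
  set w : ES N → ℝ := fun x => if 0 < inner ℝ ν (x - y) then c2 * jj 1 (P x - C0) else 0 with hw
  have hwp : ∀ x, 0 < inner ℝ ν (x - y) → w x = c2 * jj 1 (P x - C0) := fun x hx => if_pos hx
  have hwn : ∀ x, ¬ 0 < inner ℝ ν (x - y) → w x = 0 := fun x hx => if_neg hx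
  have hw0 : ∀ x, 0 ≤ w x := by
    intro x
    by_cases hx : 0 < inner ℝ ν (x - y)
    · rw [hwp x hx]; exact mul_nonneg hc2.le (jj_nonneg one_pos _)
    · rw [hwn x hx]
  have hwne : ∀ x, w x ≠ 0 → 0 < inner ℝ ν (x - y) ∧ C0 + 1 < P x := by
    intro x hx
    have h1 : 0 < inner ℝ ν (x - y) := by
      by_contra h; exact hx (hwn x h)
    refine ⟨h1, ?_⟩
    by_contra h
    exact hx (by rw [hwp x h1, jj_zero one_pos (by linarith), mul_zero])
  set b := (3 / 2 : ℝ) ^ (-(N:ℝ)) with hb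
  have hbp : 0 < b := by positivity
  obtain ⟨t1, ht0, ht1, ht2⟩ := small_rpow H.a0 (2 * A * (1 + MM N α) * 9) (r := min 1 (b / (8 * (C0 + 2)))) (ε := 1) (by positivity) one_pos
  refine ⟨w, c2 * (b / 8), max (4 * A) c2, t1, by positivity, by positivity, ht0, hw0, ?_, ?_, ?_, ?_⟩
  · intro x
    by_cases hx : w x = 0
    · rw [hx]; exact HK.nn x
    obtain ⟨h1, h2⟩ := hwne x hx
    have hxy : x ≠ y := by rintro rfl; simp at h1
    rw [hwp x h1]
    refine le_trans ?_ (hKge x h1)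
    refine mul_le_mul_of_nonneg_left ((jj_le (by linarith)).trans ?_) hc2.le
    have := Bf_ge H.hN H.a0 H.a1 hν hxy h1.le
    have h3 : 0 ≤ ‖x - y‖ ^ gam N α := by positivity
    have : 0 ≤ A * Bf N α ν y x := mul_nonneg (by linarith) (h3.trans this)
    simp only [hP]
    unfold Pm
    linarith
  · intro x hxy
    by_cases ht : 0 < inner ℝ ν (x - y)
    · obtain ⟨g, l, hJ, hl⟩ := Pm_J H.hN H.a0 H.a1 hA2 hν hxy
      have hl' : 0 < l := hl (by
        have := cst_pos H.hN H.a0 H.a1 (N := N)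
        have := mul_nonneg this.le (norm_nonneg (x - y)); linarith)
      have e : w =ᶠ[𝓝 x] fun z => c2 * jj 1 (P z - C0) := by
        filter_upwards [(isOpen_lt continuous_const hτc).mem_nhds ht] with z hz
        exact hwp z hz
      have j2 := (((hJ.sub (J_const C0 x)).comp (φ := jj 1) ((jj_contDiff 1).of_le two_le_top).contDiffAt rfl rfl).cmul c2).congr e
      refine ⟨j2.1, ?_⟩
      rw [j2.2.2]
      have h1 : 0 ≤ deriv (jj 1) (P x - C0) := by rw [jj_deriv]; exact Real.smoothTransition.nonneg _
      have h2 := jj_d2_nonneg one_pos (P x - C0)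
      rw [sub_zero]
      positivity
    · have hP0 : P x ≤ 0 ∨ inner ℝ ν (x - y) < 0 := by
        by_contra hc
        push Not at hc
        have := Pm_pos_imp H.hN H.a0 H.a1 hA2.le hν hxy hc.2 hc.1
        have h3 : 0 ≤ 2 * A * ‖x - y‖ ^ (1 + α) := by positivity
        linarith
      have e : w =ᶠ[𝓝 x] fun z => 0 := by
        rcases hP0 with h | h
        · have := (Pm_cont H.hN H.a0 H.a1 hA2 hν hxy).eventually (gt_mem_nhds (lt_of_le_of_lt h one_pos))
          filter_upwards [this] with z hz
          by_contra hc
          have := (hwne z hc).2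
          simp only [hP] at this
          linarith
        · filter_upwards [(isOpen_lt hτc continuous_const).mem_nhds h] with z hz
          exact hwn z (not_lt.2 (le_of_lt hz))
      have j2 := (J_const 0 x).congr e
      exact ⟨j2.1, j2.2.2.ge⟩
  · intro x hx
    obtain ⟨h1, h2⟩ := hwne x hx
    have hxy : x ≠ y := by rintro rfl; simp at h1
    have hR : 0 < ‖x - y‖ := norm_pos_iff.2 (sub_ne_zero.2 hxy)
    have h3 := Pm_le H.hN H.a0 H.a1 hA2.le hν hxy h1.le
    have h4 := Pk_le (N := N) hν hxy
    have h5 : ‖x - y‖ < ρ / 4 := by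
      by_contra hc
      push Not at hc
      have : ‖x - y‖ ^ (1 - (N:ℝ)) ≤ C0 := Real.rpow_le_rpow_of_nonpos (by linarith) hc (by linarith)
      linarith
    have h6 := Pm_pos_imp H.hN H.a0 H.a1 hA2.le hν hxy h1.le (by linarith)
    have h7 : inner ℝ ν (x - y) / 2 ≤ d x := by
      have := H.d_ge y x
      rw [H.dy, ← hνd] at this
      nlinarith [H.G1 y]
    have hxb : x ∈ ball y (ρ / 2) := mem_ball_norm.2 (by linarith)
    have h8 := le_dista HK.yn (H.ball_sub hxb)
    refine ⟨(H.mem x (mem_ball_norm.2 (by linarith))).2 (by linarith), h1, ?_, ?_⟩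
    · have hd0 : 0 ≤ dista Ω x := infDist_nonneg
      refine le_trans ?_ (mul_le_mul_of_nonneg_right (le_max_left _ _) hd0)
      rw [div_le_iff₀ hA2] at h8
      linarith
    · have hk : 0 < Pk N ν y x := by linarith
      rw [hwp x h1]
      refine le_trans (mul_le_mul_of_nonneg_left ((jj_le (by linarith)).trans (by linarith : P x - C0 ≤ Pk N ν y x)) hc2.le) ?_
      exact mul_le_mul_of_nonneg_right (le_max_right _ _) hk.le
  · intro σ x hσ hσr hx
    have e1 : inner ℝ ν (x - y) = inner ℝ ν (x - (y + σ • ν)) + σ := by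
      rw [show x - y = (x - (y + σ • ν)) + σ • ν by abel, inner_add_right, real_inner_smul_right, real_inner_self_eq_norm_sq, hν]; ring
    have e2 := (abs_le.1 ((abs_tau_le hν (x - (y + σ • ν))).trans hx)).1
    have e3 : ‖x - y‖ ≤ 3 / 2 * σ := by
      rw [show x - y = (x - (y + σ • ν)) + σ • ν by abel]
      refine (norm_add_le _ _).trans ?_
      rw [norm_smul, hν, Real.norm_of_nonneg hσ.le]; linarith
    have ht : σ / 2 ≤ inner ℝ ν (x - y) := by linarith
    have ht0 : 0 < inner ℝ ν (x - y) := by linarith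
    have hxy : x ≠ y := by rintro rfl; simp at ht0
    have hR : 0 < ‖x - y‖ := norm_pos_iff.2 (sub_ne_zero.2 hxy)
    have e4 : 2 * A * (1 + MM N α) * ‖x - y‖ ^ (1 + α) ≤ σ / 4 := by
      have h1 : ‖x - y‖ ^ (1 + α) ≤ 9 / 4 * (σ * σ ^ α) := by
        refine (Real.rpow_le_rpow hR.le e3 (by linarith)).trans ?_
        rw [Real.mul_rpow (by norm_num) hσ.le, Real.rpow_add hσ, Real.rpow_one]
        gcongr
        calc (3 / 2 : ℝ) ^ (1 + α) ≤ (3 / 2) ^ (2:ℝ) := Real.rpow_le_rpow_of_exponent_le (by norm_num) (by linarith [H.a1])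
          _ = 9 / 4 := by norm_num
      have h2 : σ ^ α ≤ t1 ^ α := Real.rpow_le_rpow hσ.le hσr hα.le
      calc 2 * A * (1 + MM N α) * ‖x - y‖ ^ (1 + α) ≤ 2 * A * (1 + MM N α) * (9 / 4 * (σ * t1 ^ α)) := by gcongr; exact h1.trans (by gcongr)
        _ = σ / 4 * (2 * A * (1 + MM N α) * 9 * t1 ^ α) := by ring
        _ ≤ σ / 4 * 1 := by gcongr
        _ = σ / 4 := mul_one _
    have e5 := Pm_ge H.hN H.a0 H.a1 hA2.le hν hxy
    have e6 : b / 4 * σ ^ (1 - (N:ℝ)) ≤ P x := by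
      refine le_trans ?_ e5
      calc b / 4 * σ ^ (1 - (N:ℝ)) = σ / 4 * (3 / 2 * σ) ^ (-(N:ℝ)) := by
            rw [Real.mul_rpow (by norm_num) hσ.le, show 1 - (N:ℝ) = 1 + -(N:ℝ) by ring, Real.rpow_add hσ, Real.rpow_one]; ring
        _ ≤ (inner ℝ ν (x - y) - 2 * A * (1 + MM N α) * ‖x - y‖ ^ (1 + α)) * ‖x - y‖ ^ (-(N:ℝ)) := by
            refine mul_le_mul (by linarith) (Real.rpow_le_rpow_of_nonpos hR e3 (by linarith)) (by positivity) (by linarith)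
    have ht1' : σ ≤ 1 := hσr.trans (ht1.trans (min_le_left _ _))
    have e7 : C0 + 2 ≤ b / 8 * σ ^ (1 - (N:ℝ)) := by
      have h1 : σ ^ (-1:ℝ) ≤ σ ^ (1 - (N:ℝ)) := Real.rpow_le_rpow_of_exponent_ge hσ ht1' (by linarith)
      have h2 : σ ≤ b / (8 * (C0 + 2)) := hσr.trans (ht1.trans (min_le_right _ _))
      rw [le_div_iff₀ (by positivity)] at h2
      rw [Real.rpow_neg_one] at h1
      calc C0 + 2 = (σ * (8 * (C0 + 2))) / 8 * σ⁻¹ := by field_simp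
        _ ≤ b / 8 * σ⁻¹ := by gcongr
        _ ≤ _ := by gcongr
    rw [hwp x ht0, mul_assoc]
    refine mul_le_mul_of_nonneg_left ?_ hc2.le
    have := jj_ge one_pos (P x - C0)
    linarith
end

section
variable {N : ℕ} {Ω : Set (ES N)} {y : ES N} {α A ρ : ℝ} {d : ES N → ℝ} {G : ES N → ES N}

lemma max_ge_of {W K X : ℝ} (h0 : 0 ≤ W) (h1 : W ≤ K) : W * X ≤ max (K * X) 0 := by
  rcases le_total 0 X with h | h
  · exact (mul_le_mul_of_nonneg_right h1 h).trans (le_max_left _ _)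
  · exact (mul_nonpos_of_nonneg_of_nonpos h0 h).trans (le_max_right _ _)

lemma key_pt {w K V f U g L LU P Q s1 s2 t1 t2 ε M e : ℝ} (hw0 : 0 ≤ w) (hwK : w ≤ K) (hV : 0 ≤ V) (hg : 0 ≤ g)
    (hwU : w ≠ 0 → 0 < U ∧ g ≤ -LU) (hP : 0 ≤ P) (hQ : 0 ≤ Q) (h20 : 0 ≤ s2) (h21 : w ≠ 0 → s2 ≤ s1) (h11 : s1 ≤ 1)
    (ht1 : 0 ≤ t1) (ht2 : 0 ≤ t2) (hε : 0 < ε) (hM : 0 ≤ M) (he : 0 ≤ e) (hf : 0 < f → V ≤ M ∧ e = 1)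
    (hf1 : 2 * ε ≤ f → s1 = 1) (hf2 : 2 * ε ≤ f - U → s2 = 1) (h10 : 0 ≤ s1) :
    w * ((s1 * L + t1 * P) - (s2 * (L - LU) + t2 * Q)) + K * L - K * (s1 * L + t1 * P) + w * g - w * V * U
      - 2 * ε * M * (K * e) ≤ max (K * (L - V * f + g)) 0 := by
  have hK : 0 ≤ K := hw0.trans hwK
  have h00 : 0 ≤ 2 * ε * M * (K * e) := by positivity
  by_cases hw : w = 0
  · subst hw
    refine le_trans ?_ (max_ge_of (W := K * (1 - s1)) (by nlinarith) (by nlinarith))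
    have h1 : 0 ≤ K * (t1 * P) := by positivity
    have h2 : 0 ≤ K * (1 - s1) * g := mul_nonneg (mul_nonneg hK (by linarith)) hg
    have h3 : K * (1 - s1) * (V * f) ≤ 2 * ε * M * (K * e) := by
      rcases le_or_gt f 0 with h | h
      · exact (mul_nonpos_of_nonneg_of_nonpos (mul_nonneg hK (by linarith)) (mul_nonpos_of_nonneg_of_nonpos hV h)).trans h00
      · obtain ⟨hVM, rfl⟩ := hf h
        rcases le_or_gt (2 * ε) f with h' | h'
        · rw [hf1 h']; simpa using h00
        · calc K * (1 - s1) * (V * f) ≤ K * 1 * (M * (2 * ε)) := by gcongr; linarith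
            _ = _ := by ring
    nlinarith
  · obtain ⟨hU, hgU⟩ := hwU hw
    have h21 := h21 hw
    have hW0 : 0 ≤ w * (s1 - s2) + K * (1 - s1) := add_nonneg (mul_nonneg hw0 (by linarith)) (mul_nonneg hK (by linarith))
    have hWK : w * (s1 - s2) + K * (1 - s1) ≤ K := by nlinarith
    refine le_trans ?_ (max_ge_of hW0 hWK)
    have h1 : 0 ≤ (K - w) * (t1 * P) := mul_nonneg (by linarith) (by positivity)
    have h2 : 0 ≤ (K - w) * ((1 - s1) * g) := mul_nonneg (by linarith) (mul_nonneg (by linarith) hg)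
    have h3 : 0 ≤ w * (t2 * Q) := by positivity
    have h4 : 0 ≤ w * (s2 * (-LU - g)) := mul_nonneg hw0 (mul_nonneg h20 (by linarith))
    have h5 : (w * (s1 - s2) + K * (1 - s1)) * (V * f) ≤ w * V * U + 2 * ε * M * (K * e) := by
      have hwVU : 0 ≤ w * V * U := by positivity
      rcases le_or_gt f 0 with h | h
      · exact (mul_nonpos_of_nonneg_of_nonpos hW0 (mul_nonpos_of_nonneg_of_nonpos hV h)).trans (by positivity)
      · obtain ⟨hVM, rfl⟩ := hf h
        rcases le_or_gt (2 * ε) f with h' | h'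
        · rw [hf1 h'] at h21 ⊢
          rcases le_or_gt (2 * ε) (f - U) with h'' | h''
          · rw [hf2 h'']; simp; positivity
          · calc (w * (1 - s2) + K * (1 - 1)) * (V * f) = w * (1 - s2) * (V * f) := by ring
              _ ≤ w * 1 * (V * (U + 2 * ε)) := by gcongr <;> linarith
              _ = w * V * U + 2 * ε * (V * w) := by ring
              _ ≤ w * V * U + 2 * ε * (M * K) := by gcongr
              _ = _ := by ring
        · calc _ ≤ K * (M * (2 * ε)) := by gcongr
            _ ≤ _ := by nlinarith
    nlinarith

lemma V_bdd {V : ES N → ℝ} {a : ℝ} (op : IsOpen Ω) (yn : y ∉ Ω) (ca : 0 ≤ a) (Va : ∀ x ∈ Ω, V x * dista Ω x ^ 2 ≤ a)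
    {S : Set (ES N)} (hS : IsCompact S) (h : S ⊆ Ω) : ∃ M, 0 ≤ M ∧ ∀ x ∈ S, V x ≤ M := by
  rcases S.eq_empty_or_nonempty with he | hne
  · exact ⟨0, le_rfl, by simp [he]⟩
  obtain ⟨z, hz, hmin⟩ := hS.exists_isMinOn hne (dista_cont Ω).continuousOn
  have hp : ∀ x ∈ Ω, 0 < dista Ω x := fun x hx => by
    unfold dista
    rw [← (op.isClosed_compl).notMem_iff_infDist_pos ⟨y, yn⟩]
    exact fun h => h hx
  have hz0 := hp z (h hz)
  refine ⟨a / dista Ω z ^ 2, by positivity, fun x hx => ?_⟩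
  have hx0 := hp x (h hx)
  calc V x ≤ a / dista Ω x ^ 2 := by rw [le_div_iff₀ (by positivity)]; exact Va x (h hx)
    _ ≤ _ := by
      gcongr
      exact hmin hx

lemma key_eps {K V w U g : ES N → ℝ} {a : ℝ} (HK : Sol Ω y (fun _ => 0) K 0) (V0 : ∀ x, 0 ≤ V x) {φ : ES N → ℝ} (hφ : IsTestFun Ω φ)
    (hw0 : ∀ x, 0 ≤ w x) (hwK : ∀ x, w x ≤ K x) (hw2 : ∀ x, x ≠ y → ContDiffAt ℝ 2 w x ∧ 0 ≤ lap w x)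
    (hU : ContDiff ℝ 2 U) (hg : ∀ x, 0 ≤ g x) (hwU : ∀ x, w x ≠ 0 → 0 < U x ∧ g x ≤ - lap U x)
    (hi1 : Integrable fun x => w x * g x) (hi2 : Integrable fun x => w x * V x * U x)
    (hi3 : Integrable fun x => K x * (lap φ x - V x * φ x + g x)) {η : ES N → ℝ} (hη : ContDiff ℝ (⊤ : ℕ∞) η)
    (hηc : HasCompactSupport η) (hηs : tsupport η ⊆ Ω) (hη0 : ∀ x, 0 ≤ η x) (hη1 : ∀ x ∈ tsupport φ, ∀ᶠ z in 𝓝 x, η z = 1)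
    {M : ℝ} (hM : 0 ≤ M) (hVM : ∀ x ∈ tsupport φ, V x ≤ M) {ε : ℝ} (hε : 0 < ε) :
    (∫ x, w x * g x) - (∫ x, w x * V x * U x) - 2 * ε * M * (∫ x, K x * η x) ≤ ∫ x, max (K x * (lap φ x - V x * φ x + g x)) 0 := by
  obtain ⟨hφs, hφc, hφΩ⟩ := hφ
  have hφ2 : ContDiff ℝ 2 φ := hφs.of_le two_le_top
  set j := jj ε with hj
  have hj2 : ContDiff ℝ 2 j := (jj_contDiff ε).of_le two_le_top
  have hj1 : ∀ u, deriv j u = Real.smoothTransition (u / ε - 1) := fun u => by rw [hj, jj_deriv]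
  have hd0 : ∀ u, 0 ≤ deriv j u := fun u => by rw [hj1]; exact Real.smoothTransition.nonneg _
  have hd1 : ∀ u, deriv j u ≤ 1 := fun u => by rw [hj1]; exact Real.smoothTransition.le_one _
  have hdm : ∀ u v, u ≤ v → deriv j u ≤ deriv j v := fun u v h => by
    rw [hj1, hj1]; exact st_mono (by gcongr)
  have hd2 : ∀ u, 2 * ε ≤ u → deriv j u = 1 := fun u h => by
    rw [hj1]; apply Real.smoothTransition.one_of_one_le
    rw [le_sub_iff_add_le, le_div_iff₀ hε]; linarith
  -- the functions
  set χ : ES N → ℝ := fun x => j (φ x) - j (φ x - U x) with hχ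
  have hχ2 : ContDiff ℝ 2 χ := (hj2.comp hφ2).sub (hj2.comp (hφ2.sub hU))
  set v : ES N → ℝ := fun x => η x * χ x with hv
  have hv2 : ContDiff ℝ 2 v := (hη.of_le two_le_top).mul hχ2
  have hvc : HasCompactSupport v := hηc.mul_right
  have hvs : tsupport v ⊆ Ω := (tsupport_mul_subset_left).trans hηs
  set f : ES N → ℝ := fun x => j (φ x) with hf
  have hft : IsTestFun Ω f := by
    have hs : tsupport f ⊆ tsupport φ := tsupport_subset_of (isClosed_tsupport _) fun x hx => by
      by_contra hxn
      exact hx (by simp only [hf]; rw [image_eq_zero_of_notMem_tsupport hxn]; exact jj_zero hε hε.le)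
    exact ⟨(jj_contDiff ε).comp hφs, hφc.of_isClosed_subset (isClosed_tsupport _) hs, hs.trans hφΩ⟩
  have hT1 := HK.weak φ ⟨hφs, hφc, hφΩ⟩
  have hT2 := HK.weak f hft
  simp only [zero_mul, integral_zero] at hT1 hT2
  have hKi : ∀ ψ : ES N → ℝ, IsTestFun Ω ψ → Integrable (fun x => K x * lap ψ x) := fun ψ hψ => by
    have := integrable_mul_of_supp (lap_continuous (hψ.1.of_le two_le_top)) (hcs_lap hψ.2.1) (tsupport_lap_subset ψ) (HK.intOn hψ.2.1 fun h => HK.yn (hψ.2.2 h))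
    exact this.congr (Eventually.of_forall fun x => mul_comm _ _)
  have hKη : Integrable (fun x => K x * η x) := by
    have := integrable_mul_of_supp hη.continuous hηc subset_rfl (HK.intOn hηc fun h => HK.yn (hηs h))
    exact this.congr (Eventually.of_forall fun x => mul_comm _ _)
  have hwv : Integrable (fun x => w x * lap v x) := by
    have hw : IntegrableOn w (tsupport v) := ContinuousOn.integrableOn_compact hvc fun x hx =>
      ((hw2 x fun h => HK.yn (h ▸ hvs hx)).1.continuousAt).continuousWithinAt
    have := integrable_mul_of_supp (lap_continuous hv2) (hcs_lap hvc) (tsupport_lap_subset v) hw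
    exact this.congr (Eventually.of_forall fun x => mul_comm _ _)
  have hT3 : 0 ≤ ∫ x, w x * lap v x := by
    rw [green_loc hv2 hvc fun x hx => (hw2 x fun h => HK.yn (h ▸ hvs hx)).1]
    refine integral_nonneg fun x => ?_
    by_cases hx : x ∈ tsupport w
    · have hUx : 0 ≤ U x := by
        have : tsupport w ⊆ {x | 0 ≤ U x} := tsupport_subset_of (isClosed_le continuous_const hU.continuous) fun z hz => (hwU z hz).1.le
        exact this hx
      by_cases hxy : x = y
      · have : v x = 0 := image_eq_zero_of_notMem_tsupport fun h => HK.yn (hxy ▸ hvs h)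
        simp [this]
      · refine mul_nonneg (mul_nonneg (hη0 x) ?_) (hw2 x hxy).2
        exact sub_nonneg.2 (jj_mono ε (by linarith))
    · simp [lap_eq_zero_of_notMem hx]
  have hlapv : ∀ x, w x ≠ 0 → lap v x = lap χ x := fun x hx => by
    by_cases hxS : x ∈ tsupport φ
    · refine lap_congr ?_
      filter_upwards [hη1 x hxS] with z hz
      simp [hv, hz]
    · have hφ0 := notMem_tsupport_iff_eventuallyEq.1 hxS
      have hχ0 : χ =ᶠ[𝓝 x] fun _ => 0 := by
        filter_upwards [hφ0, hU.continuous.continuousAt.eventually (lt_mem_nhds (hwU x hx).1)] with z hz hz2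
        simp only [hχ, hz, Pi.zero_apply, zero_sub]
        rw [hj, jj_zero hε hε.le, jj_zero hε (by linarith), sub_zero]
      have hv0 : v =ᶠ[𝓝 x] fun _ => 0 := by
        filter_upwards [hχ0] with z hz
        simp [hv, hz]
      rw [lap_congr hχ0, lap_congr hv0]
  have hpt : ∀ x, w x * lap v x + K x * lap φ x - K x * lap f x + w x * g x - w x * V x * U x - 2 * ε * M * (K x * η x)
      ≤ max (K x * (lap φ x - V x * φ x + g x)) 0 := fun x => by
    have J1 := exists_J (hφ2.contDiffAt (x := x))
    have J2 := exists_J (hU.contDiffAt (x := x))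
    have J3 := J1.comp (hj2.contDiffAt (x := φ x)) rfl rfl
    have J4 := (J1.sub J2).comp (hj2.contDiffAt (x := φ x - U x)) rfl rfl
    have h1 : lap f x = _ := J3.2.2
    have h2 : lap χ x = _ := (J3.sub J4).2.2
    have h3 : w x * lap v x = w x * lap χ x := by
      by_cases hx : w x = 0
      · simp [hx]
      · rw [hlapv x hx]
    rw [h3, h1, h2]
    refine key_pt (hw0 x) (hwK x) (V0 x) (hg x) (hwU x) (sq_nonneg _) (sq_nonneg _) (hd0 _) (fun h => hdm _ _ (by linarith [(hwU x h).1]))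
      (hd1 _) (jj_d2_nonneg hε _) (jj_d2_nonneg hε _) hε hM (hη0 x) (fun h => ?_) (hd2 _) (hd2 _) (hd0 _)
    have hxS : x ∈ tsupport φ := by
      by_contra hn
      rw [image_eq_zero_of_notMem_tsupport hn] at h
      exact h.false
    exact ⟨hVM x hxS, (hη1 x hxS).self_of_nhds⟩
  have hmono := integral_mono (((((hwv.add (hKi φ ⟨hφs, hφc, hφΩ⟩)).sub (hKi f hft)).add hi1).sub hi2).sub (hKη.const_mul (2 * ε * M))) (hi3.sup (integrable_zero _ _ _)) hpt
  rw [integral_sub' ((((hwv.add (hKi φ ⟨hφs, hφc, hφΩ⟩)).sub (hKi f hft)).add hi1).sub hi2) (hKη.const_mul (2 * ε * M)),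
    integral_sub' (((hwv.add (hKi φ ⟨hφs, hφc, hφΩ⟩)).sub (hKi f hft)).add hi1) hi2,
    integral_add' ((hwv.add (hKi φ ⟨hφs, hφc, hφΩ⟩)).sub (hKi f hft)) hi1,
    integral_sub' (hwv.add (hKi φ ⟨hφs, hφc, hφΩ⟩)) (hKi f hft), integral_add' hwv (hKi φ ⟨hφs, hφc, hφΩ⟩), hT1, hT2, integral_const_mul] at hmono
  have : ∫ x, max (K x * (lap φ x - V x * φ x + g x)) 0 = ∫ x, ((fun x => K x * (lap φ x - V x * φ x + g x)) ⊔ fun _ => 0) x := rfl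
  rw [this]
  refine le_trans ?_ hmono
  linarith

lemma key_ineq {K V w U g : ES N → ℝ} {a : ℝ} (HK : Sol Ω y (fun _ => 0) K 0) (V0 : ∀ x, 0 ≤ V x) (ca : 0 ≤ a)
    (Va : ∀ x ∈ Ω, V x * dista Ω x ^ 2 ≤ a) {φ : ES N → ℝ} (hφ : IsTestFun Ω φ)
    (hw0 : ∀ x, 0 ≤ w x) (hwK : ∀ x, w x ≤ K x) (hw2 : ∀ x, x ≠ y → ContDiffAt ℝ 2 w x ∧ 0 ≤ lap w x)
    (hU : ContDiff ℝ 2 U) (hg : ∀ x, 0 ≤ g x) (hwU : ∀ x, w x ≠ 0 → 0 < U x ∧ g x ≤ - lap U x)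
    (hi1 : Integrable fun x => w x * g x) (hi2 : Integrable fun x => w x * V x * U x)
    (hi3 : Integrable fun x => K x * (lap φ x - V x * φ x + g x)) :
    (∫ x, w x * g x) - (∫ x, w x * V x * U x) ≤ ∫ x, max (K x * (lap φ x - V x * φ x + g x)) 0 := by
  obtain ⟨η, hη, hηc, hηs, hη0, hη1⟩ := exists_cutoff hφ.2.1 HK.op hφ.2.2
  obtain ⟨M, hM, hVM⟩ := V_bdd HK.op HK.yn ca Va hφ.2.1 hφ.2.2
  have hη1' : ∀ x ∈ tsupport φ, ∀ᶠ z in 𝓝 x, η z = 1 := fun x hx => hη1.filter_mono (nhds_le_nhdsSet hx)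
  have hI : 0 ≤ ∫ x, K x * η x := integral_nonneg fun x => mul_nonneg (HK.nn x) (hη0 x).1
  set I := ∫ x, K x * η x
  refine le_of_forall_pos_le_add fun e he => ?_
  have hp : 0 < 2 * M * I + 1 := by positivity
  have := key_eps (a := a) HK V0 hφ hw0 hwK hw2 hU hg hwU hi1 hi2 hi3 hη hηc hηs (fun x => (hη0 x).1) hη1' hM hVM (div_pos he hp)
  have h2 : 2 * (e / (2 * M * I + 1)) * M * I ≤ e := by
    rw [show 2 * (e / (2 * M * I + 1)) * M * I = e * (2 * M * I) / (2 * M * I + 1) by ring, div_le_iff₀ hp]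
    nlinarith
  linarith
end

section
variable {N : ℕ} {Ω : Set (ES N)} {y : ES N} {α A ρ : ℝ} {d : ES N → ℝ} {G : ES N → ES N}

/-- The comparison function used to detect the size of a minorant at scale `s`. -/
def UU {N : ℕ} (ν y : ES N) (s : ℝ) (x : ES N) : ℝ :=
  inner ℝ ν (x - y) * (s ^ (N:ℝ) * (‖x - y‖ ^ 2 + s ^ 2) ^ (-(N:ℝ) / 2))

lemma UU_J (ν y : ES N) {s : ℝ} (hs : 0 < s) (x : ES N) :
    ContDiffAt ℝ 2 (UU ν y s) x ∧ lap (UU ν y s) x =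
      -(N * (N + 2) * s ^ ((N:ℝ) + 2) * inner ℝ ν (x - y) * (‖x - y‖ ^ 2 + s ^ 2) ^ (-(N:ℝ) / 2 - 2)) := by
  have hq : 0 < ‖x - y‖ ^ 2 + s ^ 2 := by positivity
  set p := -(N:ℝ) / 2 with hp
  have J1 := (J_sq y x).add (J_const (s ^ 2) x)
  have J2 := J1.comp (φ := fun t => t ^ p) (a := p * (‖x - y‖ ^ 2 + s ^ 2) ^ (p - 1))
    (b := p * ((p - 1) * (‖x - y‖ ^ 2 + s ^ 2) ^ (p - 2))) (Real.contDiffAt_rpow_const_of_ne hq.ne')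
    (Real.deriv_rpow_const _ _) (by
      have : deriv (fun t : ℝ => t ^ p) = fun t => p * t ^ (p - 1) := funext fun t => Real.deriv_rpow_const _ _
      rw [this, deriv_const_mul_field, Real.deriv_rpow_const, show p - 1 - 1 = p - 2 by ring])
  have J3 := (J_lin ν y x).mul (J2.cmul (s ^ (N:ℝ)))
  refine ⟨J3.1, J3.2.2.trans ?_⟩
  have e1 : (‖x - y‖ ^ 2 + s ^ 2) ^ (p - 1) = (‖x - y‖ ^ 2 + s ^ 2) ^ (p - 2) * (‖x - y‖ ^ 2 + s ^ 2) := by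
    rw [show p - 1 = p - 2 + 1 by ring, Real.rpow_add hq, Real.rpow_one]
  have e2 : s ^ ((N:ℝ) + 2) = s ^ (N:ℝ) * s ^ 2 := by rw [Real.rpow_add hs, Real.rpow_two]
  rw [e1, e2]
  simp only [add_zero, inner_smul_right, norm_smul, mul_pow]
  norm_num
  rw [hp]
  ring

lemma UU_contDiff (ν y : ES N) {s : ℝ} (hs : 0 < s) : ContDiff ℝ 2 (UU ν y s) :=
  contDiff_iff_contDiffAt.2 fun x => (UU_J ν y hs x).1

lemma uu_fac {s R : ℝ} (hs : 0 < s) : s ^ (N:ℝ) * (R ^ 2 + s ^ 2) ^ (-(N:ℝ) / 2) ≤ 1 ∧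
    (0 < R → s ^ (N:ℝ) * (R ^ 2 + s ^ 2) ^ (-(N:ℝ) / 2) ≤ (s / R) ^ (N:ℝ)) ∧ 0 < s ^ (N:ℝ) * (R ^ 2 + s ^ 2) ^ (-(N:ℝ) / 2) := by
  have e : ∀ t : ℝ, 0 < t → (t ^ 2) ^ (-(N:ℝ) / 2) = t ^ (-(N:ℝ)) := fun t ht => by
    rw [← Real.rpow_natCast t 2, ← Real.rpow_mul ht.le]; congr 1; push_cast; ring
  have hn : -(N:ℝ) / 2 ≤ 0 := by
    have : (0:ℝ) ≤ N := Nat.cast_nonneg N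
    linarith
  refine ⟨?_, fun hR => ?_, by positivity⟩
  · calc s ^ (N:ℝ) * (R ^ 2 + s ^ 2) ^ (-(N:ℝ) / 2) ≤ s ^ (N:ℝ) * (s ^ 2) ^ (-(N:ℝ) / 2) := by
          refine mul_le_mul_of_nonneg_left ?_ (by positivity)
          exact Real.rpow_le_rpow_of_nonpos (by positivity) (by nlinarith [sq_nonneg R]) hn
      _ = 1 := by rw [e s hs, ← Real.rpow_add hs]; simp
  · calc s ^ (N:ℝ) * (R ^ 2 + s ^ 2) ^ (-(N:ℝ) / 2) ≤ s ^ (N:ℝ) * (R ^ 2) ^ (-(N:ℝ) / 2) := by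
          refine mul_le_mul_of_nonneg_left ?_ (by positivity)
          exact Real.rpow_le_rpow_of_nonpos (by positivity) (by nlinarith [sq_nonneg s]) hn
      _ = (s / R) ^ (N:ℝ) := by rw [e R hR, Real.rpow_neg hR.le, Real.div_rpow hs.le hR.le]; rfl

lemma UU_ball {ν y x : ES N} (hν : ‖ν‖ = 1) {s : ℝ} (hs : 0 < s) (hx : ‖x - (y + s • ν)‖ ≤ s / 2) :
    0 < inner ℝ ν (x - y) ∧ N * (N + 2) / 2 * 4 ^ (-(N:ℝ) / 2 - 2) * s⁻¹ ≤ - lap (UU ν y s) x := by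
  have e0 : x - y = (x - (y + s • ν)) + s • ν := by abel
  have hτ : s / 2 ≤ inner ℝ ν (x - y) := by
    rw [e0, inner_add_right, inner_smul_right, real_inner_self_eq_norm_sq, hν]
    have := abs_tau_le hν (x - (y + s • ν))
    have := (abs_le.1 this).1
    linarith
  have hR : ‖x - y‖ ≤ 3 / 2 * s := by
    rw [e0]
    refine (norm_add_le _ _).trans ?_
    rw [norm_smul, hν, Real.norm_of_nonneg hs.le]; linarith
  refine ⟨by linarith, ?_⟩
  rw [(UU_J ν y hs x).2, neg_neg]
  have hn : -(N:ℝ) / 2 - 2 ≤ 0 := by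
    have : (0:ℝ) ≤ N := Nat.cast_nonneg N
    linarith
  have h1 : (4:ℝ) ^ (-(N:ℝ) / 2 - 2) * s ^ (-(N:ℝ) - 4) ≤ (‖x - y‖ ^ 2 + s ^ 2) ^ (-(N:ℝ) / 2 - 2) := by
    have : s ^ (-(N:ℝ) - 4) = (s ^ 2) ^ (-(N:ℝ) / 2 - 2) := by
      rw [← Real.rpow_natCast s 2, ← Real.rpow_mul hs.le]; congr 1; push_cast; ring
    rw [this, ← Real.mul_rpow (by norm_num) (by positivity)]
    refine Real.rpow_le_rpow_of_nonpos (by positivity) ?_ hn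
    nlinarith [norm_nonneg (x - y)]
  calc N * (N + 2) / 2 * 4 ^ (-(N:ℝ) / 2 - 2) * s⁻¹
      = N * (N + 2) * s ^ ((N:ℝ) + 2) * (s / 2) * (4 ^ (-(N:ℝ) / 2 - 2) * s ^ (-(N:ℝ) - 4)) := by
        have : s⁻¹ = s ^ ((N:ℝ) + 2) * s * s ^ (-(N:ℝ) - 4) := by
          nth_rewrite 3 [← Real.rpow_one s]
          rw [← Real.rpow_add hs, ← Real.rpow_add hs, ← Real.rpow_neg_one]; congr 1; ring
        rw [this]; ring
    _ ≤ _ := by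
        have : 0 ≤ inner ℝ ν (x - y) := by linarith
        gcongr

/-- Bounded measurable functions vanishing outside a compact subset of `Ω`. -/
def Bc {N : ℕ} (Ω : Set (ES N)) (f : ES N → ℝ) : Prop :=
  Measurable f ∧ ∃ S, IsCompact S ∧ S ⊆ Ω ∧ ∃ M, (∀ x, |f x| ≤ M) ∧ ∀ x, x ∉ S → f x = 0

lemma Bc.add {f g : ES N → ℝ} (hf : Bc Ω f) (hg : Bc Ω g) : Bc Ω (fun x => f x + g x) := by
  obtain ⟨m1, S1, c1, s1, M1, b1, z1⟩ := hf
  obtain ⟨m2, S2, c2, s2, M2, b2, z2⟩ := hg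
  refine ⟨m1.add m2, S1 ∪ S2, c1.union c2, union_subset s1 s2, M1 + M2, fun x => ?_, fun x hx => ?_⟩
  · exact (abs_add_le _ _).trans (add_le_add (b1 x) (b2 x))
  · rw [mem_union, not_or] at hx
    simp only [z1 x hx.1, z2 x hx.2, add_zero]

lemma Bc.mul {f k : ES N → ℝ} (hf : Bc Ω f) (hk : Measurable k)
    (hb : ∀ S, IsCompact S → S ⊆ Ω → ∃ M, 0 ≤ M ∧ ∀ x ∈ S, |k x| ≤ M) : Bc Ω (fun x => k x * f x) := by
  obtain ⟨m1, S, c1, s1, M1, b1, z1⟩ := hf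
  obtain ⟨M, hM, hb⟩ := hb S c1 s1
  refine ⟨hk.mul m1, S, c1, s1, M * M1, fun x => ?_, fun x hx => by simp only [z1 x hx, mul_zero]⟩
  by_cases hx : x ∈ S
  · rw [abs_mul]; exact mul_le_mul (hb x hx) (b1 x) (abs_nonneg _) hM
  · simp only [z1 x hx, mul_zero, abs_zero]; exact mul_nonneg hM ((abs_nonneg _).trans (b1 x))

lemma Bc.memLp {f : ES N → ℝ} (hf : Bc Ω f) (hb : Bornology.IsBounded Ω) (p : ℝ≥0∞) : MemLp f p (volume.restrict Ω) := by
  obtain ⟨m1, S, c1, s1, M1, b1, z1⟩ := hf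
  have : IsFiniteMeasure (volume.restrict Ω) := isFiniteMeasure_restrict.2 hb.measure_lt_top.ne
  exact MemLp.of_bound m1.aestronglyMeasurable M1 (Eventually.of_forall b1)

lemma Bc.zero {f : ES N → ℝ} (hf : Bc Ω f) {x : ES N} (hx : x ∉ Ω) : f x = 0 := by
  obtain ⟨m1, S, c1, s1, M1, b1, z1⟩ := hf
  exact z1 x fun h => hx (s1 h)

lemma Bc.int {f : ES N → ℝ} (hf : Bc Ω f) (hb : Bornology.IsBounded Ω) : Integrable f :=
  (integrableOn_iff_integrable_of_support_subset fun x hx => by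
    by_contra h; exact hx (hf.zero h)).1 (memLp_one_iff_integrable.1 (hf.memLp hb 1))

lemma Bc.of_cont {f : ES N → ℝ} (hf : Continuous f) (hc : HasCompactSupport f) (hs : tsupport f ⊆ Ω) : Bc Ω f := by
  obtain ⟨M, hM⟩ := hc.exists_bound_of_continuous hf
  exact ⟨hf.measurable, _, hc, hs, M, hM, fun x hx => image_eq_zero_of_notMem_tsupport hx⟩

lemma Sol.bdd_on {K V : ES N → ℝ} {a : ℝ} (HK : Sol Ω y V K a) (S : Set (ES N)) (hS : IsCompact S) (h : S ⊆ Ω) :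
    ∃ M, 0 ≤ M ∧ ∀ x ∈ S, |K x| ≤ M := by
  obtain ⟨M, hM⟩ := hS.exists_bound_of_continuousOn (HK.hc.mono fun x hx => by rintro rfl; exact HK.yn (h hx))
  exact ⟨|M|, abs_nonneg _, fun x hx => (hM x hx).trans (le_abs_self _)⟩

lemma Bc.basic {K V : ES N → ℝ} {a : ℝ} (HK : Sol Ω y (fun _ => 0) K 0) (Vm : Measurable V) (V0 : ∀ x, 0 ≤ V x) (ca : 0 ≤ a)
    (Va : ∀ x ∈ Ω, V x * dista Ω x ^ 2 ≤ a) {φ : ES N → ℝ} (hφ : IsTestFun Ω φ) :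
    Bc Ω (fun x => K x * (lap φ x - V x * φ x)) := by
  refine Bc.mul ?_ HK.meas HK.bdd_on
  have h1 : Bc Ω (lap φ) := Bc.of_cont (lap_continuous (hφ.1.of_le two_le_top)) (hcs_lap hφ.2.1) ((tsupport_lap_subset φ).trans hφ.2.2)
  have h2 : Bc Ω φ := Bc.of_cont hφ.1.continuous hφ.2.1 hφ.2.2
  have h3 := h1.add (h2.mul (k := fun x => - V x) Vm.neg fun S hS h => by
    obtain ⟨M, hM, hb⟩ := V_bdd HK.op HK.yn ca Va hS h
    exact ⟨M, hM, fun x hx => by rw [abs_neg, abs_of_nonneg (V0 x)]; exact hb x hx⟩)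
  simpa [sub_eq_add_neg] using h3
end

section
variable {N : ℕ} {Ω : Set (ES N)} {y : ES N} {α A ρ : ℝ} {d : ES N → ℝ} {G : ES N → ES N}

lemma Geo.detect (H : Geo Ω y α A ρ d G) {K V : ES N → ℝ} {a : ℝ} (HK : Sol Ω y (fun _ => 0) K 0) (hpos : ∀ x ∈ Ω, 0 < K x)
    (Vm : Measurable V) (V0 : ∀ x, 0 ≤ V x) (ca : 0 ≤ a) (Va : ∀ x ∈ Ω, V x * dista Ω x ^ 2 ≤ a)
    (hInt : ∫⁻ x in Ω, ENNReal.ofReal (dista Ω x ^ 2 / ‖x - y‖ ^ N * V x) < ⊤) :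
    ∃ (g : ES N → ℝ) (c0 : ℝ), 0 < c0 ∧ Bc Ω g ∧ ∀ φ, IsTestFun Ω φ →
      c0 ≤ ∫ x, max (K x * (lap φ x - V x * φ x + g x)) 0 := by
  obtain ⟨w, c, C, r, hc, hC, hr, hw0, hwK, hw2, hwC, hwc⟩ := H.w0 HK hpos
  have hν := H.nv_norm y
  set ν := nv G y
  have hNN : (2:ℝ) ≤ N := by exact_mod_cast H.hN
  have hNp : (0:ℝ) < N := by linarith
  set κ : ℝ := N * (N + 2) / 2 * 4 ^ (-(N:ℝ) / 2 - 2) with hκ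
  have hκ0 : 0 < κ := by positivity
  have hwy : w y = 0 := by
    by_contra h; exact HK.yn (hwC y h).1
  have hwm : Measurable w := measurable_of_continuousOn_compl_singleton y fun x hx => (hw2 x hx).1.continuousAt.continuousWithinAt
  have hτm : Continuous fun x : ES N => inner ℝ ν (x - y) := continuous_const.inner (continuous_id.sub continuous_const)
  set τ : ES N → ℝ := fun x => inner ℝ ν (x - y) with hτ
  -- domination
  set D : ES N → ℝ := fun x => w x * V x * τ x with hD
  have hDi : Integrable D := by
    have h1 : IntegrableOn (fun x => dista Ω x ^ 2 / ‖x - y‖ ^ N * V x) Ω := by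
      refine ⟨Measurable.aestronglyMeasurable ?_, ?_⟩
      · have := (dista_cont Ω).measurable
        fun_prop
      · rw [hasFiniteIntegral_iff_ofReal]
        · exact hInt
        · exact Eventually.of_forall fun x => mul_nonneg (by positivity) (V0 x)
    have h2 : IntegrableOn D Ω := by
      refine Integrable.mono' (h1.const_mul (C * C ^ 2)) ((hwm.mul Vm).mul hτm.measurable).aestronglyMeasurable (Eventually.of_forall fun x => ?_)
      by_cases hx : w x = 0
      · simp only [hD, hx, zero_mul, norm_zero]
        exact mul_nonneg (by positivity) (mul_nonneg (by positivity) (V0 x))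
      · obtain ⟨-, h0, h3, h4⟩ := hwC x hx
        have hτ0 : 0 < τ x := h0
        rw [Real.norm_of_nonneg (mul_nonneg (mul_nonneg (hw0 x) (V0 x)) hτ0.le)]
        calc w x * V x * τ x ≤ (C * (τ x * ‖x - y‖ ^ (-(N:ℝ)))) * V x * τ x := by
              have := V0 x
              gcongr
          _ = C * τ x ^ 2 * (‖x - y‖ ^ (-(N:ℝ)) * V x) := by ring
          _ ≤ C * (C * dista Ω x) ^ 2 * (‖x - y‖ ^ (-(N:ℝ)) * V x) := by
              have := V0 x
              have h3 : τ x ≤ C * dista Ω x := h3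
              gcongr
          _ = C * C ^ 2 * (dista Ω x ^ 2 / ‖x - y‖ ^ N * V x) := by
              rw [Real.rpow_neg (norm_nonneg _), Real.rpow_natCast]; ring
    exact (integrableOn_iff_integrable_of_support_subset fun x hx => by
      refine (hwC x fun h => hx ?_).1
      simp [hD, h]).1 h2
  set F : ℕ → ES N → ℝ := fun n x => w x * V x * UU ν y (r / (n + 1)) x with hF
  have hs : ∀ n : ℕ, 0 < r / ((n:ℝ) + 1) := fun n => by positivity
  have hFm : ∀ n, Measurable (F n) := fun n => (hwm.mul Vm).mul (UU_contDiff ν y (hs n)).continuous.measurable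
  have hFD : ∀ n x, ‖F n x‖ ≤ D x := fun n x => by
    by_cases hx : w x = 0
    · simp [hF, hD, hx]
    · have hτ0 : 0 < τ x := (hwC x hx).2.1
      obtain ⟨f1, -, f3⟩ := uu_fac (N := N) (R := ‖x - y‖) (hs n)
      have hU : UU ν y (r / (n + 1)) x ≤ τ x := by
        have := mul_le_mul_of_nonneg_left f1 hτ0.le
        rwa [mul_one] at this
      have hU0 : 0 ≤ UU ν y (r / (n + 1)) x := mul_nonneg hτ0.le f3.le
      have hwV : 0 ≤ w x * V x := mul_nonneg (hw0 x) (V0 x)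
      rw [Real.norm_of_nonneg (mul_nonneg hwV hU0)]
      exact mul_le_mul_of_nonneg_left hU hwV
  have hst : Tendsto (fun n : ℕ => r / ((n:ℝ) + 1)) atTop (𝓝 0) := by
    have := (tendsto_one_div_add_atTop_nhds_zero_nat (𝕜 := ℝ)).const_mul r
    simpa [div_eq_mul_inv] using this
  have hlim : Tendsto (fun n => ∫ x, F n x) atTop (𝓝 0) := by
    have := tendsto_integral_of_dominated_convergence (μ := volume) (F := F) (f := fun _ => 0) D (fun n => (hFm n).aestronglyMeasurable) hDi
      (fun n => Eventually.of_forall (hFD n)) (Eventually.of_forall fun x => ?_)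
    · simpa using this
    by_cases hx : w x = 0
    · simp [hF, hx]
    · have hxy : 0 < ‖x - y‖ := norm_pos_iff.2 (sub_ne_zero.2 fun h => hx (by rw [h, hwy]))
      have h1 : Tendsto (fun n : ℕ => (r / ((n:ℝ) + 1)) ^ (N:ℝ) * (‖x - y‖ ^ 2 + (r / ((n:ℝ) + 1)) ^ 2) ^ (-(N:ℝ) / 2)) atTop (𝓝 0) := by
        have h2 : Tendsto (fun n : ℕ => (r / ((n:ℝ) + 1) / ‖x - y‖) ^ (N:ℝ)) atTop (𝓝 0) := by
          have := (hst.div_const ‖x - y‖).rpow_const (p := (N:ℝ)) (Or.inr hNp.le)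
          rwa [zero_div, Real.zero_rpow hNp.ne'] at this
        exact squeeze_zero (fun n => (uu_fac (hs n)).2.2.le) (fun n => (uu_fac (hs n)).2.1 hxy) h2
      have := (h1.const_mul (inner ℝ ν (x - y))).const_mul (w x * V x)
      simp only [mul_zero] at this
      exact this
  set vB := (volume : Measure (ES N)).real (ball 0 1) with hvB
  have hvB0 : 0 < vB := by
    refine ENNReal.toReal_pos (measure_ball_pos _ _ one_pos).ne' measure_ball_lt_top.ne
  set c1 := c * κ * 2⁻¹ ^ N * vB with hc1
  have hc1p : 0 < c1 := by positivity
  obtain ⟨n, hn⟩ := (hlim.eventually (gt_mem_nhds hc1p)).exists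
  set s := r / ((n:ℝ) + 1) with hsd
  have hs0 : 0 < s := hs n
  have hsr : s ≤ r := div_le_self hr.le (by linarith [(Nat.cast_nonneg n : (0:ℝ) ≤ n)])
  set B := closedBall (y + s • ν) (s / 2) with hB
  have hBn : ∀ x ∈ B, ‖x - (y + s • ν)‖ ≤ s / 2 := fun x hx => by rwa [hB, mem_closedBall, dist_eq_norm] at hx
  have hBw : ∀ x ∈ B, c * s ^ (1 - (N:ℝ)) ≤ w x := fun x hx => hwc s x hs0 hsr (hBn x hx)
  have hBw0 : ∀ x ∈ B, w x ≠ 0 := fun x hx => (lt_of_lt_of_le (by positivity) (hBw x hx)).ne'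
  have hBΩ : B ⊆ Ω := fun x hx => (hwC x (hBw0 x hx)).1
  have hBc : IsCompact B := isCompact_closedBall _ _
  set g : ES N → ℝ := B.indicator fun _ => κ * s⁻¹ with hg
  have hg0 : ∀ x, 0 ≤ g x := fun x => indicator_nonneg (fun _ _ => by positivity) x
  have hgB : Bc Ω g := by
    refine ⟨measurable_const.indicator measurableSet_closedBall, B, hBc, hBΩ, κ * s⁻¹, fun x => ?_, fun x hx => indicator_of_notMem hx _⟩
    rw [abs_of_nonneg (hg0 x)]
    exact indicator_le_self' (fun _ _ => by positivity) x
  have hwgi : Integrable fun x => w x * g x := by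
    refine (hgB.mul hwm fun S hS hSΩ => ?_).int HK.bdd
    obtain ⟨M, hM⟩ := HK.bdd_on S hS hSΩ
    exact ⟨M, hM.1, fun x hx => by rw [abs_of_nonneg (hw0 x)]; exact (hwK x).trans ((le_abs_self _).trans (hM.2 x hx))⟩
  have hwg : c1 ≤ ∫ x, w x * g x := by
    have e1 : ∫ x, w x * g x = ∫ x in B, w x * (κ * s⁻¹) := by
      rw [← integral_indicator measurableSet_closedBall]
      congr 1
      funext x
      by_cases hx : x ∈ B
      · rw [indicator_of_mem hx, hg, indicator_of_mem hx]
      · rw [indicator_of_notMem hx, hg, indicator_of_notMem hx, mul_zero]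
    have hcon : ContinuousOn w B := fun x hx => ((hw2 x fun h => HK.yn (h ▸ hBΩ hx)).1.continuousAt).continuousWithinAt
    have := setIntegral_ge_of_const_le (μ := volume) (s := B) (f := fun x => w x * (κ * s⁻¹)) (c := c * s ^ (1 - (N:ℝ)) * (κ * s⁻¹))
      measurableSet_closedBall hBc.measure_lt_top.ne (fun x hx => mul_le_mul_of_nonneg_right (hBw x hx) (by positivity))
      ((hcon.mul continuousOn_const).integrableOn_compact hBc)
    rw [e1]
    refine le_trans (le_of_eq ?_) this
    rw [hB, Measure.addHaar_real_closedBall _ _ (by positivity), finrank_euclideanSpace_fin, smul_eq_mul, ← hvB, hc1,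
      show 1 - (N:ℝ) = -(N:ℝ) + 1 by ring, Real.rpow_add hs0, Real.rpow_one, Real.rpow_neg hs0.le, Real.rpow_natCast]
    rw [div_pow, inv_pow]
    field_simp
  have hFi : Integrable (F n) := hDi.mono' (hFm n).aestronglyMeasurable (Eventually.of_forall (hFD n))
  refine ⟨g, (∫ x, w x * g x) - ∫ x, F n x, by linarith, hgB, fun φ hφ => ?_⟩
  refine key_ineq HK V0 ca Va hφ hw0 hwK hw2 (UU_contDiff ν y hs0) hg0 (fun x hx => ⟨?_, ?_⟩) hwgi hFi ?_
  · exact mul_pos (hwC x hx).2.1 (uu_fac hs0).2.2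
  · by_cases hxB : x ∈ B
    · have : g x = κ * s⁻¹ := indicator_of_mem hxB _
      rw [this]
      exact (UU_ball hν hs0 (hBn x hxB)).2
    · have : g x = 0 := indicator_of_notMem hxB _
      rw [this, (UU_J ν y hs0 x).2, neg_neg]
      have : 0 < inner ℝ ν (x - y) := (hwC x hx).2.1
      positivity
  · have h1 := (Bc.basic HK Vm V0 ca Va hφ).add (hgB.mul HK.meas HK.bdd_on)
    refine (h1.int HK.bdd).congr (Eventually.of_forall fun x => ?_)
    simp only; ring

/-- A Hahn–Banach argument. -/
lemma hb_density {X : Type*} [MeasurableSpace X] {μ : Measure X} [IsFiniteMeasure μ] (S : Submodule ℝ (Lp ℝ 2 μ))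
    (e : Lp ℝ 2 μ) {c0 : ℝ} (hc : 0 < c0) (h : ∀ s ∈ S, c0 ≤ ∫ x, max (s x + e x) 0 ∂μ) :
    ∃ u : Lp ℝ 2 μ, (∀ᵐ x ∂μ, 0 ≤ u x ∧ u x ≤ 1) ∧ (∀ s ∈ S, ∫ x, u x * s x ∂μ = 0) ∧ 0 < ∫ x, u x * e x ∂μ := by
  set p : Lp ℝ 2 μ → ℝ := fun f => ∫ x, max (f x) 0 ∂μ with hp
  have hi : ∀ f : Lp ℝ 2 μ, Integrable f μ := fun f => (Lp.memLp f).integrable (by norm_num)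
  have hi' : ∀ f : Lp ℝ 2 μ, Integrable (fun x => max (f x) 0) μ := fun f => (hi f).sup (integrable_zero _ _ _)
  have hp0 : ∀ f, 0 ≤ p f := fun f => integral_nonneg fun x => le_max_right _ _
  have hhom : ∀ c : ℝ, 0 < c → ∀ f, p (c • f) = c * p f := fun c hc f => by
    simp only [hp]
    rw [← integral_const_mul]
    refine integral_congr_ae ?_
    filter_upwards [Lp.coeFn_smul c f] with x hx
    rw [hx, Pi.smul_apply, smul_eq_mul, mul_max_of_nonneg _ _ hc.le, mul_zero]
  have hadd : ∀ f g, p (f + g) ≤ p f + p g := fun f g => by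
    simp only [hp]
    rw [← integral_add (hi' f) (hi' g)]
    refine integral_mono_ae (hi' _) ((hi' f).add (hi' g)) ?_
    filter_upwards [Lp.coeFn_add f g] with x hx
    rw [hx, Pi.add_apply]
    exact max_le (add_le_add (le_max_left _ _) (le_max_left _ _)) (add_nonneg (le_max_right _ _) (le_max_right _ _))
  have hse : ∀ s ∈ S, c0 ≤ p (s + e) := fun s hs => by
    refine (h s hs).trans (le_of_eq (integral_congr_ae ?_))
    filter_upwards [Lp.coeFn_add s e] with x hx
    rw [hx, Pi.add_apply]
  have heS : e ∉ S := fun he => by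
    have := hse (-e) (S.neg_mem he)
    rw [neg_add_cancel] at this
    have h0 : p 0 = 0 := by
      simp only [hp]
      rw [← integral_zero X ℝ (μ := μ)]
      refine integral_congr_ae ?_
      filter_upwards [Lp.coeFn_zero ℝ 2 μ] with x hx
      rw [hx]; simp
    linarith
  set f0 : Lp ℝ 2 μ →ₗ.[ℝ] ℝ := LinearMap.toPMap 0 S with hf0
  have heD : e ∉ f0.domain := heS
  have hkey : ∀ s ∈ S, ∀ (k : ℝ) (hx : s + k • e ∈ (f0.supSpanSingleton e c0 heD).domain),
      f0.supSpanSingleton e c0 heD ⟨s + k • e, hx⟩ = k * c0 := fun s hs k hx =>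
    (LinearPMap.supSpanSingleton_apply_mk f0 e c0 heD s hs k).trans (by simp; rfl)
  obtain ⟨L, hL1, hL2⟩ := exists_extension_of_le_sublinear (f0.supSpanSingleton e c0 heD) p hhom hadd (by
    rintro ⟨x, hx⟩
    obtain ⟨s, hs, t, ht, rfl⟩ := Submodule.mem_sup.1 hx
    obtain ⟨k, rfl⟩ := Submodule.mem_span_singleton.1 ht
    rw [hkey s hs k hx]
    show k * c0 ≤ p (s + k • e)
    rcases le_or_gt k 0 with hk | hk
    · exact (mul_nonpos_of_nonpos_of_nonneg hk hc.le).trans (hp0 _)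
    · have e1 : s + k • e = k • (k⁻¹ • s + e) := by rw [smul_add, smul_smul, mul_inv_cancel₀ hk.ne', one_smul]
      rw [e1, hhom k hk]
      exact mul_le_mul_of_nonneg_left (hse _ (S.smul_mem _ hs)) hk.le)
  have hLS : ∀ s ∈ S, ∀ k : ℝ, L (s + k • e) = k * c0 := fun s hs k => by
    have hx : s + k • e ∈ (f0.supSpanSingleton e c0 heD).domain :=
      Submodule.mem_sup.2 ⟨s, hs, k • e, Submodule.mem_span_singleton.2 ⟨k, rfl⟩, rfl⟩
    exact (hL1 ⟨s + k • e, hx⟩).trans (hkey s hs k hx)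
  -- boundedness
  set one : Lp ℝ 2 μ := indicatorConstLp 2 MeasurableSet.univ (measure_ne_top μ _) (1:ℝ)
  have hpb : ∀ f, p f ≤ ‖one‖ * ‖f‖ := fun f => by
    have h1 : p f ≤ ∫ x, (|f| : Lp ℝ 2 μ) x ∂μ := by
      refine integral_mono_ae (hi' f) (hi _) ?_
      filter_upwards [Lp.coeFn_abs f] with x hx
      rw [hx]
      exact max_le (le_abs_self _) (abs_nonneg _)
    have h2 := L2.inner_indicatorConstLp_one (𝕜 := ℝ) MeasurableSet.univ (measure_ne_top μ _) (|f| : Lp ℝ 2 μ)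
    rw [setIntegral_univ] at h2
    rw [← h2] at h1
    refine h1.trans ((real_inner_le_norm _ _).trans ?_)
    rw [norm_abs_eq_norm]
  have hLb : ∀ f, ‖L f‖ ≤ ‖one‖ * ‖f‖ := fun f => by
    rw [Real.norm_eq_abs, abs_le]
    constructor
    · have := (hL2 (-f)).trans (hpb (-f))
      rw [map_neg, norm_neg] at this
      linarith
    · exact (hL2 f).trans (hpb f)
  set Lc : StrongDual ℝ (Lp ℝ 2 μ) := L.mkContinuous ‖one‖ hLb
  set u := (InnerProductSpace.toDual ℝ (Lp ℝ 2 μ)).symm Lc with hu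
  have huL : ∀ f, inner ℝ u f = L f := fun f => InnerProductSpace.toDual_symm_apply
  have huI : ∀ f : Lp ℝ 2 μ, ∫ x, u x * f x ∂μ = L f := fun f => by
    rw [← huL, L2.inner_def]
    refine integral_congr_ae (Eventually.of_forall fun x => ?_)
    simp [mul_comm]
  have huA : ∀ A, MeasurableSet A → 0 ≤ ∫ x in A, u x ∂μ ∧ ∫ x in A, u x ∂μ ≤ μ.real A := fun A hA => by
    have h2 := L2.inner_indicatorConstLp_one (𝕜 := ℝ) hA (measure_ne_top μ _) u
    rw [real_inner_comm, huL] at h2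
    rw [← h2]
    set iA : Lp ℝ 2 μ := indicatorConstLp 2 hA (measure_ne_top μ _) (1:ℝ)
    have hiA : iA =ᵐ[μ] A.indicator fun _ => (1:ℝ) := indicatorConstLp_coeFn
    constructor
    · have h3 : p (-iA) = 0 := by
        simp only [hp]
        refine integral_eq_zero_of_ae ?_
        filter_upwards [Lp.coeFn_neg iA, hiA] with x hx hx2
        rw [hx, Pi.neg_apply, hx2]
        exact max_eq_right (neg_nonpos.2 (indicator_nonneg (fun _ _ => zero_le_one) x))
      have := hL2 (-iA)
      rw [h3, map_neg] at this
      linarith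
    · refine (hL2 iA).trans (le_of_eq ?_)
      rw [← integral_indicator_one hA]
      refine integral_congr_ae ?_
      filter_upwards [hiA] with x hx2
      rw [hx2]
      exact max_eq_left (indicator_nonneg (fun _ _ => zero_le_one) x)
  refine ⟨u, ?_, fun s hs => ?_, ?_⟩
  · have h1 : 0 ≤ᵐ[μ] u := ae_nonneg_of_forall_setIntegral_nonneg (hi u) fun A hA _ => (huA A hA).1
    have h2 : 0 ≤ᵐ[μ] fun x => 1 - u x := ae_nonneg_of_forall_setIntegral_nonneg ((integrable_const _).sub (hi u)) fun A hA _ => by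
      rw [integral_sub (integrable_const _) (hi u).integrableOn]
      simp only [integral_const, smul_eq_mul, mul_one, measureReal_restrict_apply_univ]
      linarith [(huA A hA).2]
    filter_upwards [h1, h2] with x hx1 hx2
    exact ⟨hx1, by simpa using hx2⟩
  · rw [huI]; simpa using hLS s hs 0
  · rw [huI]
    have := hLS 0 S.zero_mem 1
    simp only [zero_add, one_smul, one_mul] at this
    rw [this]; exact hc
end

section
variable {N : ℕ} {Ω : Set (ES N)} {y : ES N} {α A ρ : ℝ} {d : ES N → ℝ} {G : ES N → ES N}

/-- Existence of a weak minorant. -/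
lemma Geo.weak_exists (H : Geo Ω y α A ρ d G) {K V : ES N → ℝ} {a : ℝ} (HK : Sol Ω y (fun _ => 0) K 0) (hpos : ∀ x ∈ Ω, 0 < K x)
    (Vm : Measurable V) (V0 : ∀ x, 0 ≤ V x) (ca : 0 ≤ a) (Va : ∀ x ∈ Ω, V x * dista Ω x ^ 2 ≤ a)
    (hInt : ∫⁻ x in Ω, ENNReal.ofReal (dista Ω x ^ 2 / ‖x - y‖ ^ N * V x) < ⊤) :
    ∃ h g : ES N → ℝ, Measurable h ∧ (∀ x, 0 ≤ h x ∧ h x ≤ K x) ∧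
      (∀ φ, IsTestFun Ω φ → ∫ x, h x * lap φ x = ∫ x, V x * h x * φ x) ∧ Bc Ω g ∧ 0 < ∫ x, h x * g x := by
  obtain ⟨g, c0, hc0, hg, hd⟩ := H.detect HK hpos Vm V0 ca Va hInt
  have hfin : IsFiniteMeasure (volume.restrict Ω) := isFiniteMeasure_restrict.2 HK.bdd.measure_lt_top.ne
  set μ := volume.restrict Ω with hμ
  have hB := fun {φ : ES N → ℝ} (hφ : IsTestFun Ω φ) => Bc.basic HK Vm V0 ca Va hφ
  let S : Submodule ℝ (Lp ℝ 2 μ) :=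
    { carrier := {f | ∃ φ, IsTestFun Ω φ ∧ f =ᵐ[μ] fun x => K x * (lap φ x - V x * φ x)}
      add_mem' := by
        rintro f1 f2 ⟨φ1, h1, e1⟩ ⟨φ2, h2, e2⟩
        refine ⟨fun x => φ1 x + φ2 x, ⟨h1.1.add h2.1, HasCompactSupport.add h1.2.1 h2.2.1,
          (tsupport_add φ1 φ2).trans (union_subset h1.2.2 h2.2.2)⟩, ?_⟩
        filter_upwards [e1, e2, Lp.coeFn_add f1 f2] with x e1 e2 e3
        rw [e3, Pi.add_apply, e1, e2, ((exists_J (h1.1.of_le two_le_top).contDiffAt).add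
          (exists_J (h2.1.of_le two_le_top).contDiffAt)).2.2]
        ring
      zero_mem' := by
        refine ⟨fun _ => 0, ⟨contDiff_const, by simp [tsupport], by simp [tsupport]⟩, ?_⟩
        filter_upwards [Lp.coeFn_zero ℝ 2 μ] with x e
        rw [e, (J_const 0 x).2.2]; simp
      smul_mem' := by
        rintro c f ⟨φ, h, e⟩
        have hsub : tsupport (fun x => c * φ x) ⊆ tsupport φ := closure_mono fun x hx => right_ne_zero_of_mul hx
        refine ⟨fun x => c * φ x, ⟨contDiff_const.mul h.1, HasCompactSupport.mul_left h.2.1, hsub.trans h.2.2⟩, ?_⟩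
        filter_upwards [e, Lp.coeFn_smul c f] with x e e3
        rw [e3, Pi.smul_apply, e, ((exists_J (h.1.of_le two_le_top).contDiffAt).cmul c).2.2, smul_eq_mul]
        ring }
  have hgK : Bc Ω (fun x => K x * g x) := hg.mul HK.meas HK.bdd_on
  set e := (hgK.memLp HK.bdd 2).toLp with he
  have he' := (hgK.memLp HK.bdd 2).coeFn_toLp
  obtain ⟨u, hu01, huS, hue⟩ := hb_density S e hc0 (by
    rintro s ⟨φ, hφ, es⟩
    refine (hd φ hφ).trans_eq ?_
    rw [← setIntegral_eq_integral_of_forall_compl_eq_zero (s := Ω) fun x hx => by rw [HK.h0 x hx]; simp]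
    refine integral_congr_ae ?_
    filter_upwards [es, he'] with x e1 e2
    rw [e1, e2]; congr 1; ring)
  set w : ES N → ℝ := fun x => max 0 (min 1 (u x)) with hw
  have hwm : Measurable w := measurable_const.max (measurable_const.min (Lp.stronglyMeasurable u).measurable)
  have hwu : ∀ᵐ x ∂μ, w x = u x := by
    filter_upwards [hu01] with x hx
    simp only [hw]; rw [min_eq_right hx.2, max_eq_right hx.1]
  have hK0 := HK.nn
  have key : ∀ k f : ES N → ℝ, (∀ x, x ∉ Ω → f x = 0) → (∀ᵐ x ∂μ, k x = f x) → ∫ x, w x * f x = ∫ x, u x * k x ∂μ := by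
    intro k f h0 hk
    rw [← setIntegral_eq_integral_of_forall_compl_eq_zero (s := Ω) fun x hx => by rw [h0 x hx]; simp]
    refine integral_congr_ae ?_
    filter_upwards [hwu, hk] with x h1 h2
    rw [h1, h2]
  refine ⟨fun x => w x * K x, g, hwm.mul HK.meas, fun x => ⟨mul_nonneg (le_max_left _ _) (hK0 x), ?_⟩, fun φ hφ => ?_, hg, ?_⟩
  · exact mul_le_of_le_one_left (hK0 x) (max_le zero_le_one (min_le_left _ _))
  · have h1 := huS _ (show (hB hφ |>.memLp HK.bdd 2).toLp ∈ S from ⟨φ, hφ, MemLp.coeFn_toLp _⟩)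
    rw [← key _ _ (fun x hx => (hB hφ).zero hx) (MemLp.coeFn_toLp _)] at h1
    have hb1 : ∀ S, IsCompact S → S ⊆ Ω → ∃ M, 0 ≤ M ∧ ∀ x ∈ S, |w x * K x| ≤ M := fun S hS h => by
      obtain ⟨M, hM, hb⟩ := HK.bdd_on S hS h
      refine ⟨M, hM, fun x hx => ?_⟩
      rw [abs_mul]
      refine (mul_le_of_le_one_left (abs_nonneg _) ?_).trans (hb x hx)
      rw [abs_of_nonneg (le_max_left _ _)]
      exact max_le zero_le_one (min_le_left _ _)
    have i1 : Integrable (fun x => w x * K x * lap φ x) := Bc.int (Bc.mul (Bc.of_cont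
      (lap_continuous (hφ.1.of_le two_le_top)) (hcs_lap hφ.2.1) ((tsupport_lap_subset φ).trans hφ.2.2))
      (hwm.mul HK.meas) hb1) HK.bdd
    have i2 : Integrable (fun x => w x * K x * (V x * φ x)) := Bc.int (Bc.mul (Bc.mul (Bc.of_cont
      hφ.1.continuous hφ.2.1 hφ.2.2) Vm fun S hS h => by
        obtain ⟨M, hM, hb⟩ := V_bdd HK.op HK.yn ca Va hS h
        exact ⟨M, hM, fun x hx => by rw [abs_of_nonneg (V0 x)]; exact hb x hx⟩)
      (hwm.mul HK.meas) hb1) HK.bdd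
    have h2 := integral_sub i1 i2
    have e1 : ∀ x, w x * K x * lap φ x - w x * K x * (V x * φ x) = w x * (K x * (lap φ x - V x * φ x)) := fun x => by ring
    have e2 : ∀ x, V x * (w x * K x) * φ x = w x * K x * (V x * φ x) := fun x => by ring
    simp only [e1, e2] at h2 ⊢
    linarith
  · rw [← key _ _ (fun x hx => hgK.zero hx) he'] at hue
    simpa only [mul_assoc] using hue
end

section
variable {N : ℕ} {Ω : Set (ES N)} {y : ES N} {α A ρ : ℝ} {d : ES N → ℝ} {G : ES N → ES N}

lemma mm_ae {f : ES N → ℝ} (hf : LocallyIntegrable f) : ∀ᵐ x, Tendsto (mm f x) (𝓝[>] 0) (𝓝 (f x)) := by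
  obtain ⟨C1, hC1, hp1⟩ := exists_psi_le N
  filter_upwards [IsUnifLocDoublingMeasure.ae_tendsto_average_norm_sub volume hf 1] with x hx
  have h1 := hx (l := 𝓝[>] (0:ℝ)) (fun _ => x) id tendsto_id
    (by filter_upwards [self_mem_nhdsWithin] with j hj using mem_closedBall_self (by simpa using (mem_Ioi.1 hj).le))
  have h2 := h1.const_mul (C1 * volume.real (closedBall (0 : ES N) 1))
  rw [mul_zero] at h2
  rw [tendsto_iff_norm_sub_tendsto_zero]
  refine squeeze_zero' (Eventually.of_forall fun s => norm_nonneg _) ?_ h2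
  filter_upwards [self_mem_nhdsWithin] with s hs
  have hs : 0 < s := hs
  have hi : IntegrableOn f (closedBall x s) := hf.integrableOn_isCompact (isCompact_closedBall x s)
  have hc : IntegrableOn (fun _ => f x) (closedBall x s) := integrableOn_const (isCompact_closedBall x s).measure_lt_top.ne
  have hv : volume.real (closedBall x s) = s ^ N * volume.real (closedBall (0 : ES N) 1) := by
    rw [Measure.addHaar_real_closedBall' _ _ hs.le]; simp
  have hv0 : 0 < volume.real (closedBall (0 : ES N) 1) :=
    ENNReal.toReal_pos (measure_closedBall_pos _ _ one_pos).ne' measure_closedBall_lt_top.ne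
  have e1 : mm f x s - f x = ∫ z, psi s x z * (f z - f x) := by
    conv_lhs => rw [← mm_const (f x) x hs]
    unfold mm
    rw [← integral_sub (psi_mul_integrable hs hi) (psi_mul_integrable hs hc)]
    congr 1; ext z; ring
  have e2 : C1 * volume.real (closedBall (0 : ES N) 1) * ⨍ z in closedBall x (id s), ‖f z - f x‖
      = ∫ z in closedBall x s, C1 * (s ^ N)⁻¹ * ‖f z - f x‖ := by
    rw [integral_const_mul, setAverage_eq, id, hv, smul_eq_mul]
    field_simp
  rw [e2, e1, ← setIntegral_eq_integral_of_forall_compl_eq_zero (s := closedBall x s) fun z hz => by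
    rw [mem_closedBall, not_le] at hz
    rw [psi_zero hs hz.le, zero_mul]]
  refine norm_integral_le_of_norm_le ((hi.sub hc).norm.const_mul _) (Eventually.of_forall fun z => ?_)
  rw [norm_mul, Real.norm_of_nonneg (psi_nonneg hs x z)]
  exact mul_le_mul_of_nonneg_right (hp1 s hs x z) (norm_nonneg _)

lemma mm_weak {V h : ES N → ℝ} (hm : Measurable fun x => V x * h x)
    (hw : ∀ φ, IsTestFun Ω φ → ∫ x, h x * lap φ x = ∫ x, V x * h x * φ x) {x : ES N} {s0 M : ℝ}
    (hb : closedBall x s0 ⊆ Ω) (hi : IntegrableOn h (closedBall x s0))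
    (hM : ∀ z ∈ closedBall x s0, 0 ≤ V z * h z ∧ V z * h z ≤ M) (h0 : ∀ z, 0 ≤ h z) (hs0 : 0 < s0) :
    ∃ l, Tendsto (mm h x) (𝓝[>] 0) (𝓝 l) ∧ ∀ s ∈ Ioo 0 s0, |l - mm h x s| ≤ M * s ^ 2 / 4 := by
  have hd : ∀ s ∈ Ioo 0 s0, HasDerivAt (mm h x) (s * ∫ z, V z * h z * qs s x z) s := fun s hs => by
    have := mm_hasDerivAt hs.1 hs.2 hi
    rw [← hw (qs s x) ⟨qs_contDiff s x, qs_hcs hs.1 x, (qs_tsupport hs.1 x).trans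
      ((closedBall_subset_closedBall hs.2.le).trans hb)⟩]
    simpa only [mul_comm] using this
  have hM0 : 0 ≤ M := (hM x (mem_closedBall_self hs0.le)).1.trans (hM x (mem_closedBall_self hs0.le)).2
  have hI : ∀ s ∈ Ioo 0 s0, 0 ≤ (∫ z, V z * h z * qs s x z) ∧ (∫ z, V z * h z * qs s x z) ≤ M / 2 := fun s hs => by
    have hp : ∀ z, 0 ≤ V z * h z * qs s x z ∧ V z * h z * qs s x z ≤ M / 2 * psi s x z := fun z => by
      by_cases hz : z ∈ closedBall x s
      · obtain ⟨h1, h2⟩ := hM z (closedBall_subset_closedBall hs.2.le hz)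
        have h3 := qs_nonneg hs.1 x z
        have h4 := qs_le hs.1 x z
        refine ⟨mul_nonneg h1 h3, ?_⟩
        calc _ ≤ M * (psi s x z / 2) := mul_le_mul h2 h4 h3 hM0
          _ = _ := by ring
      · rw [mem_closedBall, not_le] at hz
        simp [qs_zero hs.1 hz.le, psi_zero hs.1 hz.le]
    refine ⟨integral_nonneg fun z => (hp z).1, ?_⟩
    have hpi := (psi_integrable (x := x) hs.1).const_mul (M / 2)
    calc _ ≤ ∫ z, M / 2 * psi s x z := by
          refine integral_mono (hpi.mono' (hm.mul (qs_contDiff s x).continuous.measurable).aestronglyMeasurable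
            (Eventually.of_forall fun z => ?_)) hpi fun z => (hp z).2
          rw [Real.norm_of_nonneg (hp z).1]; exact (hp z).2
      _ = M / 2 := by rw [integral_const_mul, psi_integral hs.1, mul_one]
  have m1 : MonotoneOn (mm h x) (Ioo 0 s0) := by
    refine monotoneOn_of_deriv_nonneg (convex_Ioo _ _) (fun s hs => (hd s hs).continuousAt.continuousWithinAt)
      (fun s hs => ?_) fun s hs => ?_ <;> rw [interior_Ioo] at hs
    · exact (hd s hs).differentiableAt.differentiableWithinAt
    · rw [(hd s hs).deriv]; exact mul_nonneg hs.1.le (hI s hs).1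
  have hd2 : ∀ s ∈ Ioo 0 s0, HasDerivAt (fun s => M * s ^ 2 / 4 - mm h x s) (M * (2 * s) / 4 - s * ∫ z, V z * h z * qs s x z) s :=
    fun s hs => by
      have := (((hasDerivAt_pow 2 s).const_mul M).div_const 4).sub (hd s hs)
      simp only [Nat.cast_ofNat, Nat.add_one_sub_one, pow_one] at this
      exact this
  have m2 : MonotoneOn (fun s => M * s ^ 2 / 4 - mm h x s) (Ioo 0 s0) := by
    refine monotoneOn_of_deriv_nonneg (convex_Ioo _ _) (fun s hs => (hd2 s hs).continuousAt.continuousWithinAt)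
      (fun s hs => ?_) fun s hs => ?_ <;> rw [interior_Ioo] at hs
    · exact (hd2 s hs).differentiableAt.differentiableWithinAt
    · rw [(hd2 s hs).deriv]; nlinarith [mul_le_mul_of_nonneg_left (hI s hs).2 hs.1.le]
  have ht := m1.tendsto_nhdsWithin_Ioo_right (nonempty_Ioo.2 hs0) ⟨0, by
    rintro _ ⟨s, hs, rfl⟩; exact mm_nonneg hs.1 x h0⟩
  refine ⟨_, ht, fun s hs => ?_⟩
  have h1 := tend_of_monotoneOn m1 ht hs
  have h2 := tend_of_monotoneOn m2 (l := M * 0 ^ 2 / 4 - _) ((Tendsto.mono_left (Continuous.tendsto (by fun_prop) 0) nhdsWithin_le_nhds).sub ht) hs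
  rw [abs_le]; constructor <;> linarith
end

section
variable {N : ℕ} {Ω : Set (ES N)} {y : ES N} {α A ρ : ℝ} {d : ES N → ℝ} {G : ES N → ES N}

/-- A weak minorant has a continuous representative. -/
lemma Sol.rep {K V h0 : ES N → ℝ} {a : ℝ} (HK : Sol Ω y (fun _ => 0) K 0)
    (Vm : Measurable V) (V0 : ∀ x, 0 ≤ V x) (ca : 0 ≤ a) (Va : ∀ x ∈ Ω, V x * dista Ω x ^ 2 ≤ a)
    (hm : Measurable h0) (hb : ∀ x, 0 ≤ h0 x ∧ h0 x ≤ K x)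
    (hw : ∀ φ, IsTestFun Ω φ → ∫ x, h0 x * lap φ x = ∫ x, V x * h0 x * φ x) :
    ∃ h, Sol Ω y V h a ∧ (∀ x, h x ≤ K x) ∧ h =ᵐ[volume] h0 := by
  have hInt : ∀ S, IsCompact S → S ⊆ Ω → IntegrableOn h0 S := fun S hS h =>
    (HK.intOn hS fun hy => HK.yn (h hy)).mono' hm.aestronglyMeasurable
      (Eventually.of_forall fun x => by rw [Real.norm_of_nonneg (hb x).1]; exact (hb x).2)
  have hloc : ∀ p ∈ Ω, ∃ r > 0, closedBall p (2 * r) ⊆ Ω ∧ ∃ M, 0 ≤ M ∧ ∀ x ∈ ball p r, ∃ l,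
      Tendsto (mm h0 x) (𝓝[>] 0) (𝓝 l) ∧ ∀ s ∈ Ioo 0 r, |l - mm h0 x s| ≤ M * s ^ 2 / 4 := fun p hp => by
    obtain ⟨r, hr, hsub⟩ := Metric.nhds_basis_closedBall.mem_iff.1 (HK.op.mem_nhds hp)
    have hsub : closedBall p (2 * (r / 2)) ⊆ Ω := by rwa [mul_div_cancel₀ _ two_ne_zero]
    obtain ⟨M1, hM1, hb1⟩ := V_bdd HK.op HK.yn ca Va (isCompact_closedBall p _) hsub
    obtain ⟨M2, hM2, hb2⟩ := HK.bdd_on _ (isCompact_closedBall p _) hsub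
    refine ⟨r / 2, by positivity, hsub, M1 * M2, mul_nonneg hM1 hM2, fun x hx => ?_⟩
    have hxs : closedBall x (r / 2) ⊆ closedBall p (2 * (r / 2)) :=
      closedBall_subset_closedBall' (by linarith [mem_ball.1 hx])
    refine mm_weak (Vm.mul hm) hw (hxs.trans hsub) (hInt _ (isCompact_closedBall x _) (hxs.trans hsub))
      (fun z hz => ⟨mul_nonneg (V0 z) (hb z).1, ?_⟩) (fun z => (hb z).1) (by positivity)
    exact mul_le_mul (hb1 z (hxs hz)) ((hb z).2.trans ((le_abs_self _).trans (hb2 z (hxs hz)))) (hb z).1 hM1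
  have hex : ∀ x, ∃ l, (x ∈ Ω → Tendsto (mm h0 x) (𝓝[>] 0) (𝓝 l)) ∧ (x ∉ Ω → l = 0) := fun x => by
    by_cases hx : x ∈ Ω
    · obtain ⟨r, hr, -, M, -, hl⟩ := hloc x hx
      obtain ⟨l, hl, -⟩ := hl x (mem_ball_self hr)
      exact ⟨l, fun _ => hl, fun h => absurd hx h⟩
    · exact ⟨0, fun h => absurd h hx, fun _ => rfl⟩
  choose h hl h0Ω using hex
  have hcut : ∀ (p x : ES N) (r s : ℝ), x ∈ ball p r → s ∈ Ioo 0 r →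
      mm h0 x s = mm ((closedBall p (2 * r)).indicator h0) x s := fun p x r s hx hs => by
    unfold mm; congr 1; ext z
    by_cases hz : dist z x ≤ s
    · rw [indicator_of_mem]
      have := dist_triangle z x p; have := mem_ball.1 hx; have := hs.2
      rw [mem_closedBall]; linarith
    · rw [psi_zero hs.1 (not_le.1 hz).le]; simp
  have hci : ∀ (p : ES N) (r : ℝ), closedBall p (2 * r) ⊆ Ω → LocallyIntegrable ((closedBall p (2 * r)).indicator h0) :=
    fun p r hs => ((integrable_indicator_iff measurableSet_closedBall).2 (hInt _ (isCompact_closedBall p _) hs)).locallyIntegrable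
  have hae : h =ᵐ[volume] h0 := by
    refine measure_null_of_locally_null _ fun p hp => ?_
    have hpΩ : p ∈ Ω := by
      by_contra hc
      exact hp ((h0Ω p hc).trans (le_antisymm (hb p).1 ((hb p).2.trans (HK.h0 p hc).le)))
    obtain ⟨r, hr, hsub, -⟩ := hloc p hpΩ
    refine ⟨_, inter_mem_nhdsWithin _ (ball_mem_nhds p hr), measure_mono_null (fun x hx => ?_) (mm_ae (hci p r hsub))⟩
    intro hc
    rw [mem_ofPred_eq] at hc
    refine hx.1 (tendsto_nhds_unique (hl x ((ball_subset_closedBall.trans (closedBall_subset_closedBall (by linarith))).trans hsub hx.2)) ?_)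
    rw [indicator_of_mem (closedBall_subset_closedBall (by linarith) (ball_subset_closedBall hx.2))] at hc
    refine hc.congr' ?_
    filter_upwards [Ioo_mem_nhdsGT hr] with s hs using (hcut p x r s hx.2 hs).symm
  have hnn : ∀ x, 0 ≤ h x := fun x => by
    by_cases hx : x ∈ Ω
    · refine ge_of_tendsto (hl x hx) ?_
      filter_upwards [self_mem_nhdsWithin] with s hs using mm_nonneg hs x fun z => (hb z).1
    · rw [h0Ω x hx]
  have hle : ∀ x, h x ≤ K x := fun x => by
    by_cases hx : x ∈ Ω
    · obtain ⟨r, hr, hsub⟩ := Metric.nhds_basis_closedBall.mem_iff.1 (HK.op.mem_nhds hx)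
      have hy : y ∉ closedBall x r := fun hy => HK.yn (hsub hy)
      refine le_of_tendsto_of_tendsto (hl x hx) (mm_tendsto hr (HK.intOn (isCompact_closedBall x r) hy)
        (HK.contAt (by rintro rfl; exact HK.yn hx))) ?_
      filter_upwards [Ioo_mem_nhdsGT hr] with s hs
      have hs' := closedBall_subset_closedBall (x := x) hs.2.le
      exact mm_mono hs.1 (hInt _ (isCompact_closedBall x s) (hs'.trans hsub))
        (HK.intOn (isCompact_closedBall x s) fun hh => hy (hs' hh)) fun z _ => (hb z).2
    · rw [h0Ω x hx]; exact HK.nn x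
  refine ⟨h, ⟨HK.op, HK.bdd, HK.yn, ca, fun x hx => ContinuousAt.continuousWithinAt ?_, h0Ω, hnn, Vm, V0, Va, fun φ hφ => ?_⟩, hle, hae⟩
  · by_cases hxΩ : x ∈ Ω
    · obtain ⟨r, hr, hsub, M, hM, hlx⟩ := hloc x hxΩ
      refine continuousAt_of_locally_uniform_approx_of_continuousAt fun u hu => ?_
      obtain ⟨ε, hε, hu⟩ := Metric.mem_uniformity_dist.1 hu
      have h1 : ∀ᶠ s in 𝓝[>] (0:ℝ), M * s ^ 2 / 4 < ε :=
        (Tendsto.mono_left (Continuous.tendsto (by fun_prop) 0) nhdsWithin_le_nhds).eventually (gt_mem_nhds (by simpa using hε))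
      obtain ⟨s, hs1, hs2⟩ := (h1.and (Ioo_mem_nhdsGT hr)).exists
      refine ⟨ball x r, ball_mem_nhds x hr, _, (mm_contDiff (hci x r hsub) hs2.1).continuous.continuousAt, fun z hz => hu ?_⟩
      obtain ⟨l, hl1, hl2⟩ := hlx z hz
      have hzΩ : z ∈ Ω := hsub (closedBall_subset_closedBall (by linarith) (ball_subset_closedBall hz))
      rw [← hcut x z r s hz hs2, tendsto_nhds_unique (hl z hzΩ) hl1]
      exact (hl2 s hs2).trans_lt hs1
    · have hK := HK.contAt hx
      unfold ContinuousAt at hK ⊢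
      rw [HK.h0 x hxΩ] at hK
      rw [h0Ω x hxΩ]
      exact squeeze_zero hnn hle hK
  · rw [integral_congr_ae (g := fun x => h0 x * lap φ x) (by filter_upwards [hae] with x e; rw [e]), hw φ hφ]
    refine integral_congr_ae ?_
    filter_upwards [hae] with x e
    rw [e]

lemma Sol.pos {V h : ES N → ℝ} {a : ℝ} (HS : Sol Ω y V h a) (hc : IsPreconnected Ω) {x1 : ES N} (hx1 : h x1 ≠ 0) :
    ∀ x ∈ Ω, 0 < h x := by
  obtain ⟨C, hC1, hH⟩ := exists_harnack N a HS.ca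
  have hx1Ω : x1 ∈ Ω := by
    by_contra hn; exact hx1 (HS.h0 _ hn)
  by_contra! hcon
  obtain ⟨x2, hx2, hle⟩ := hcon
  have hcont : ContinuousOn h Ω := HS.hc.mono fun x hx => by rintro rfl; exact HS.yn hx
  have hU1 : IsOpen (Ω ∩ {x | h x ≠ 0}) := hcont.isOpen_inter_preimage HS.op isOpen_ne
  have hU2 : IsOpen (Ω ∩ {x | h x = 0}) := by
    rw [isOpen_iff_mem_nhds]
    rintro z ⟨hz, hz0⟩
    obtain ⟨r, hr, hsub⟩ := Metric.isOpen_iff.1 HS.op z hz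
    filter_upwards [ball_mem_nhds z (show 0 < r / 8 by positivity)] with x hx
    refine ⟨hsub (ball_subset_ball (by linarith) hx), le_antisymm ?_ (HS.nn x)⟩
    have := hH Ω y V h HS x z (r / 8) (by positivity) (mem_ball.1 hx).le (by rwa [mul_div_cancel₀ _ (by norm_num)])
    rw [mem_ofPred_eq] at hz0
    rwa [hz0, mul_zero] at this
  obtain ⟨z, hz, h1, h2⟩ := hc _ _ hU1 hU2 (fun x hx => by
    by_cases hh : h x = 0
    · exact Or.inr ⟨hx, hh⟩
    · exact Or.inl ⟨hx, hh⟩) ⟨x1, hx1Ω, hx1Ω, hx1⟩ ⟨x2, hx2, hx2, le_antisymm hle (HS.nn _)⟩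
  exact h1.2 h2.2
end

section
variable {N : ℕ} {Ω : Set (ES N)} {y : ES N} {α A ρ : ℝ} {d : ES N → ℝ} {G : ES N → ES N}

lemma Sol.of_LV {V V' h : ES N → ℝ} {a : ℝ} (op : IsOpen Ω) (bdd : Bornology.IsBounded Ω) (yn : y ∉ Ω) (ca : 0 ≤ a)
    (Vm : Measurable V') (V0 : ∀ x, 0 ≤ V' x) (Va : ∀ x ∈ Ω, V' x * dista Ω x ^ 2 ≤ a) (hVV : ∀ x ∈ Ω, V' x = V x)
    (hh : LVHarmonic Ω V h) (nn : ∀ x ∈ Ω, 0 ≤ h x)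
    (hbd : ∀ z ∈ frontier Ω, z ≠ y → Tendsto h (𝓝[Ω] z) (𝓝 0)) : Sol Ω y V' (Ω.indicator h) a := by
  refine ⟨op, bdd, yn, ca, fun x hx => ContinuousAt.continuousWithinAt ?_, fun x hx => indicator_of_notMem hx _,
    fun x => indicator_nonneg nn x, Vm, V0, Va, fun φ hφ => ?_⟩
  · by_cases hxΩ : x ∈ Ω
    · refine (hh.1.continuousAt (op.mem_nhds hxΩ)).congr ?_
      filter_upwards [op.mem_nhds hxΩ] with z hz using (indicator_of_mem hz h).symm
    · have h1 : Tendsto h (𝓝[Ω] x) (𝓝 0) := by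
        by_cases hc : x ∈ closure Ω
        · exact hbd x (by rw [op.frontier_eq]; exact ⟨hc, hxΩ⟩) hx
        · rw [notMem_closure_iff_nhdsWithin_eq_bot.1 hc]; exact tendsto_bot
      unfold ContinuousAt
      rw [indicator_of_notMem hxΩ, ← nhdsWithin_univ x, ← union_compl_self Ω, nhdsWithin_union]
      refine Tendsto.sup (h1.congr' ?_) (tendsto_const_nhds.congr' ?_)
      · filter_upwards [self_mem_nhdsWithin] with z hz using (indicator_of_mem hz h).symm
      · filter_upwards [self_mem_nhdsWithin] with z hz using (indicator_of_notMem hz h).symm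
  · have h1 := hh.2.2.2 φ hφ
    rw [← setIntegral_eq_integral_of_forall_compl_eq_zero (s := Ω) fun x hx => by rw [indicator_of_notMem hx]; simp,
      ← setIntegral_eq_integral_of_forall_compl_eq_zero (s := Ω) (f := fun x => V' x * Ω.indicator h x * φ x) fun x hx => by rw [indicator_of_notMem hx]; simp]
    rw [setIntegral_congr_fun op.measurableSet (g := fun x => h x * lap φ x) fun x hx => by
      simp only [indicator_of_mem hx], h1]
    exact setIntegral_congr_fun op.measurableSet fun x hx => by simp only [indicator_of_mem hx, hVV x hx]

lemma Sol.to_LV {V V' h : ES N → ℝ} {a : ℝ} (HS : Sol Ω y V' h a) (hVV : ∀ x ∈ Ω, V' x = V x) : LVHarmonic Ω V h := by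
  have hcont : ContinuousOn h Ω := HS.hc.mono fun x hx => by rintro rfl; exact HS.yn hx
  refine ⟨hcont, hcont.locallyIntegrableOn HS.op.measurableSet, ?_, fun φ hφ => ?_⟩
  · rw [locallyIntegrableOn_iff HS.op.isLocallyClosed]
    intro k hk hkc
    have h1 : IntegrableOn (fun x => V' x * h x) k := by
      obtain ⟨M1, hM1, hb1⟩ := V_bdd HS.op HS.yn HS.ca HS.Va hkc hk
      obtain ⟨M2, hM2, hb2⟩ := HS.bdd_on _ hkc hk
      refine Measure.integrableOn_of_bounded (M := M1 * M2) hkc.measure_lt_top.ne (HS.Vm.mul HS.meas).aestronglyMeasurable ?_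
      filter_upwards [ae_restrict_mem hkc.measurableSet] with x hx
      rw [norm_mul]
      refine mul_le_mul ?_ (hb2 x hx) (norm_nonneg _) hM1
      rw [Real.norm_of_nonneg (HS.V0 x)]; exact hb1 x hx
    exact h1.congr_fun (fun x hx => by simp only [hVV x (hk hx)]) hkc.measurableSet
  · have h1 := HS.weak φ hφ
    rw [← setIntegral_eq_integral_of_forall_compl_eq_zero (s := Ω) fun x hx => by rw [HS.h0 x hx]; simp,
      ← setIntegral_eq_integral_of_forall_compl_eq_zero (s := Ω) (f := fun x => V' x * h x * φ x) fun x hx => by rw [HS.h0 x hx]; simp] at h1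
    rw [h1]
    exact setIntegral_congr_fun HS.op.measurableSet fun x hx => by simp only [hVV x hx]
end

/-- If `Ω` is `C^{1,α}`-smooth near `y ∈ ∂Ω`, then `y` is finely
regular with respect to `V` iff `∫_Ω δ_Ω(x)²/|x-y|^N · V(x) dx < ∞`. -/
theorem statement1 {N : ℕ} (hN : 2 ≤ N) (Ω : Set (ES N))
    (hΩ : IsLipschitzDomain Ω) (hbd : Bornology.IsBounded Ω)
    (x₀ : ES N) (hx₀ : x₀ ∈ Ω) (a : ℝ) (ha : 0 < a)
    (V : ES N → ℝ) (hV : VClass Ω a V)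
    (y : ES N) (hy : y ∈ frontier Ω)
    (α : ℝ) (hα : 0 < α) (hα1 : α ≤ 1) (hsm : IsC1AlphaNear Ω α y)
    (K : ES N → ℝ) (hK : IsMartinKernel Ω (fun _ => 0) x₀ y K) :
    FinelyRegular Ω V K ↔
      ∫⁻ x in Ω, ENNReal.ofReal (dista Ω x ^ 2 / ‖x - y‖ ^ N * V x) < ⊤ := by
  obtain ⟨A, ρ, d, G, H⟩ := exists_geo hN hα hα1 hΩ.1 hy hsm
  have op := hΩ.1
  have yn : y ∉ Ω := by rw [op.frontier_eq] at hy; exact hy.2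
  have hVV : ∀ x ∈ Ω, Ω.indicator V x = V x := fun x hx => indicator_of_mem hx V
  have Vm : Measurable (Ω.indicator V) := hV.1.indicator op.measurableSet
  have V0 : ∀ x, 0 ≤ Ω.indicator V x := indicator_nonneg fun x hx => (hV.2 x hx).1
  have Va : ∀ x ∈ Ω, Ω.indicator V x * dista Ω x ^ 2 ≤ a := fun x hx => by rw [hVV x hx]; exact (hV.2 x hx).2
  have HK : Sol Ω y (fun _ => 0) (Ω.indicator K) 0 := Sol.of_LV op hbd yn le_rfl measurable_const (fun _ => le_rfl)
    (fun x _ => by simp) (fun x _ => rfl) hK.1 (fun x hx => (hK.2.1 x hx).le) hK.2.2.2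
  have hKp : ∀ x ∈ Ω, 0 < Ω.indicator K x := fun x hx => by rw [indicator_of_mem hx]; exact hK.2.1 x hx
  have hI : ∫⁻ x in Ω, ENNReal.ofReal (dista Ω x ^ 2 / ‖x - y‖ ^ N * V x) =
      ∫⁻ x in Ω, ENNReal.ofReal (dista Ω x ^ 2 / ‖x - y‖ ^ N * Ω.indicator V x) :=
    setLIntegral_congr_fun op.measurableSet fun x hx => by simp only [hVV x hx]
  rw [hI]
  constructor
  · rintro ⟨h, hh, hp, hle⟩
    have HS : Sol Ω y (Ω.indicator V) (Ω.indicator h) a := Sol.of_LV op hbd yn ha.le Vm V0 Va hVV hh (fun x hx => (hp x hx).le)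
      fun z hz hzy => by
        refine squeeze_zero' ?_ ?_ (hK.2.2.2 z hz hzy)
        · filter_upwards [self_mem_nhdsWithin] with x hx using (hp x hx).le
        · filter_upwards [self_mem_nhdsWithin] with x hx using hle x hx
    refine H.fwd HK HS (fun x => ?_) fun x hx => by rw [indicator_of_mem hx]; exact hp x hx
    by_cases hx : x ∈ Ω
    · rw [indicator_of_mem hx, indicator_of_mem hx]; exact hle x hx
    · rw [indicator_of_notMem hx, indicator_of_notMem hx]
  · intro hInt
    obtain ⟨h0, g, hm, hb, hw, -, hg⟩ := H.weak_exists HK hKp Vm V0 ha.le Va hInt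
    obtain ⟨h, HS, hle, hae⟩ := HK.rep Vm V0 ha.le Va hm hb hw
    have hne : ∃ x1, h x1 ≠ 0 := by
      by_contra! hcon
      have : ∫ x, h0 x * g x = 0 := by
        rw [integral_congr_ae (g := fun _ => 0) (by filter_upwards [hae] with x e; rw [← e, hcon]; simp), integral_zero]
      linarith
    obtain ⟨x1, hx1⟩ := hne
    exact ⟨h, HS.to_LV hVV, HS.pos hΩ.2.1.isPreconnected hx1, fun x hx => (hle x).trans_eq (indicator_of_mem hx K)⟩
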